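/- There exists α > 0 such that for every quad Q there exists a constant c = c(Q) > 0 with the following property: for every integer n ≥ 1 and every t ≥ n^{−α}, the covariance Cov(1_{f(0,·) ∈ Cross_0(nQ)}, 1_{f(t,·) ∈ Cross_0(nQ)}) is at most c·n^{−α}, where f is a dynamical Bargmann–Fock field. -/

import Mathlib

open MeasureTheory Set
open scoped Pointwise ENNReal NNReal

noncomputable section

/-- The plane `ℝ²` with its Euclidean structure. -/
abbrev Plane := EuclideanSpace ℝ (Fin 2)

/-- A quad: a compact subset of the plane whose boundary is a piecewise-`C¹` simple closed
curve, together with two disjoint distinguished closed arcs of the boundary. -/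
structure Quad where
  carrier : Set Plane
  eta : Set Plane
  eta' : Set Plane
  compact : IsCompact carrier
  eta_closed : IsClosed eta
  eta'_closed : IsClosed eta'
  disjoint : Disjoint eta eta'
  boundary : ∃ γ : ℝ → Plane,
    Continuous γ ∧
    (∀ s : ℝ, γ (s + 1) = γ s) ∧
    Set.InjOn γ (Set.Ico 0 1) ∧
    γ '' Set.Icc 0 1 = frontier carrier ∧
    (∃ (k : ℕ) (τ : ℕ → ℝ), 0 < k ∧ τ 0 = 0 ∧ τ k = 1 ∧
      (∀ i < k, τ i < τ (i + 1)) ∧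
      (∀ i < k, ContDiffOn ℝ 1 γ (Set.Icc (τ i) (τ (i + 1))))) ∧
    (∃ a b : ℝ, a ≤ b ∧ eta = γ '' Set.Icc a b) ∧
    (∃ a b : ℝ, a ≤ b ∧ eta' = γ '' Set.Icc a b)

/-- The crossing event `Cross_ℓ(sQ)`: the continuous function `u` admits a continuous path in
`sQ ∩ {u > -ℓ}` joining the two (rescaled) distinguished arcs. -/
def CrossedScaled (Q : Quad) (s ℓ : ℝ) (u : Plane → ℝ) : Prop :=
  ∃ γ : ℝ → Plane, ContinuousOn γ (Set.Icc 0 1) ∧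
    γ 0 ∈ s • Q.eta ∧ γ 1 ∈ s • Q.eta' ∧
    ∀ r ∈ Set.Icc (0 : ℝ) 1, γ r ∈ s • Q.carrier ∧ -ℓ < u (γ r)

/-- Covariance of the indicator functions of two events. -/
def covIndicator {Ω : Type*} [MeasurableSpace Ω] (P : Measure Ω) (A B : Set Ω) : ℝ :=
  (P (A ∩ B)).toReal - (P A).toReal * (P B).toReal

/-- A dynamical Bargmann–Fock field: a jointly measurable, almost surely continuous map
which is a centered Gaussian family with covariance
`E[f(t,x) f(s,y)] = e^{-|t-s|} exp(-|x-y|²/2)`. -/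
structure IsDynBargmannFock {Ω : Type*} [MeasurableSpace Ω] (P : Measure Ω)
    (f : Ω → ℝ → Plane → ℝ) : Prop where
  measurable : Measurable fun p : Ω × (ℝ × Plane) => f p.1 p.2.1 p.2.2
  continuous : ∀ᵐ ω ∂P,
    ContinuousOn (fun p : ℝ × Plane => f ω p.1 p.2) (Set.Ici 0 ×ˢ Set.univ)
  gaussian : ∀ (n : ℕ) (c : Fin n → ℝ) (ts : Fin n → ℝ) (xs : Fin n → Plane),
    (∀ i, 0 ≤ ts i) → ∃ v : ℝ≥0,
      P.map (fun ω => ∑ i, c i * f ω (ts i) (xs i)) = ProbabilityTheory.gaussianReal 0 v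
  covariance : ∀ (s t : ℝ), 0 ≤ s → 0 ≤ t → ∀ x y : Plane,
    ∫ ω, f ω t x * f ω s y ∂P = Real.exp (-|t - s|) * Real.exp (-‖x - y‖ ^ 2 / 2)

namespace BF

set_option linter.unusedSectionVars false

/-- Nearest-neighbour adjacency on `ℤ²`. -/
def Adj4 (p q : ℤ × ℤ) : Prop :=
  (p.1 = q.1 ∧ (q.2 = p.2 + 1 ∨ p.2 = q.2 + 1)) ∨ (p.2 = q.2 ∧ (q.1 = p.1 + 1 ∨ p.1 = q.1 + 1))

/-- `*`-adjacency (or equality) on `ℤ²`. -/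
def Adj8 (p q : ℤ × ℤ) : Prop :=
  (p.1 ≤ q.1 + 1 ∧ q.1 ≤ p.1 + 1) ∧ (p.2 ≤ q.2 + 1 ∧ q.2 ≤ p.2 + 1)

lemma Adj4.adj8 {p q : ℤ × ℤ} (h : Adj4 p q) : Adj8 p q := by
  unfold Adj4 at h; unfold Adj8; omega

lemma Adj4.symm {p q : ℤ × ℤ} (h : Adj4 p q) : Adj4 q p := by
  unfold Adj4 at *; omega

lemma Adj8.symm {p q : ℤ × ℤ} (h : Adj8 p q) : Adj8 q p := by
  unfold Adj8 at *; omega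

/-- Parity of the edges of the path `v 0, …, v M` crossing the column gap `x | x + 1`
strictly above height `y`. -/
def gapParity (v : ℕ → ℤ × ℤ) (M : ℕ) (x y : ℤ) : ZMod 2 :=
  ∑ i ∈ Finset.range M,
    if (((v i).1 = x ∧ (v (i + 1)).1 = x + 1) ∨ ((v i).1 = x + 1 ∧ (v (i + 1)).1 = x)) ∧ y < (v i).2
    then 1 else 0

lemma zmod2_add_self (a : ZMod 2) : a + a = 0 := CharTwo.add_self_eq_zero a

lemma sum_add_succ_zmod2 (r : ℕ → ZMod 2) (M : ℕ) :
    ∑ i ∈ Finset.range M, (r i + r (i + 1)) = r 0 + r M := by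
  induction M with
  | zero => simp [zmod2_add_self]
  | succ k ih =>
    rw [Finset.sum_range_succ, ih]
    have := zmod2_add_self (r k)
    linear_combination this

lemma gapParity_step_right {v : ℕ → ℤ × ℤ} {M : ℕ} (hv : ∀ i < M, Adj4 (v i) (v (i + 1)))
    {x y : ℤ} (hp : ∀ i ≤ M, v i ≠ (x + 1, y)) (h0 : (v 0).1 ≠ x + 1) (hM : (v M).1 ≠ x + 1) :
    gapParity v M x y = gapParity v M (x + 1) y := by
  have key := sum_add_succ_zmod2
    (fun i => if (v i).1 = x + 1 ∧ y < (v i).2 then (1 : ZMod 2) else 0) M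
  simp only [h0, hM, false_and, if_false, add_zero] at key
  have h2 : gapParity v M x y + gapParity v M (x + 1) y = 0 := by
    rw [← key, gapParity, gapParity, ← Finset.sum_add_distrib]
    refine Finset.sum_congr rfl fun i hi => ?_
    have hi' := Finset.mem_range.1 hi
    have ha := hv i hi'
    have h1 := hp i hi'.le
    have h2 := hp (i + 1) hi'
    rw [Ne, Prod.ext_iff] at h1 h2
    unfold Adj4 at ha
    simp only at h1 h2
    split_ifs <;> first | rfl | (exfalso; omega)
  calc gapParity v M x y = gapParity v M x y + (gapParity v M (x + 1) y + gapParity v M (x + 1) y) := by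
        rw [zmod2_add_self, add_zero]
    _ = _ := by rw [← add_assoc, h2, zero_add]

lemma gapParity_step_up {v : ℕ → ℤ × ℤ} {M : ℕ} (hv : ∀ i < M, Adj4 (v i) (v (i + 1)))
    {x y : ℤ} (hp : (∀ i ≤ M, v i ≠ (x, y + 1)) ∨ (∀ i ≤ M, v i ≠ (x + 1, y + 1))) :
    gapParity v M x y = gapParity v M x (y + 1) := by
  refine Finset.sum_congr rfl fun i hi => ?_
  have hi' := Finset.mem_range.1 hi
  have ha := hv i hi'
  unfold Adj4 at ha
  have h1 : ((v i).1 ≠ x ∨ (v i).2 ≠ y + 1) ∧ ((v (i+1)).1 ≠ x ∨ (v (i+1)).2 ≠ y + 1) ∨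
      ((v i).1 ≠ x + 1 ∨ (v i).2 ≠ y + 1) ∧ ((v (i+1)).1 ≠ x + 1 ∨ (v (i+1)).2 ≠ y + 1) := by
    rcases hp with hp | hp
    · left; have := hp i hi'.le; have := hp (i + 1) hi'
      simp only [Ne, Prod.ext_iff] at *; omega
    · right; have := hp i hi'.le; have := hp (i + 1) hi'
      simp only [Ne, Prod.ext_iff] at *; omega
  split_ifs <;> first | rfl | (exfalso; omega)

lemma gapParity_total {v : ℕ → ℤ × ℤ} {M : ℕ} (hv : ∀ i < M, Adj4 (v i) (v (i + 1)))
    {x y : ℤ} (hy : ∀ i ≤ M, y ≤ (v i).2) (hp : ∀ i ≤ M, v i ≠ (x, y))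
    (h0 : (v 0).1 ≤ x) (hM : x < (v M).1) : gapParity v M x y = 1 := by
  have key := sum_add_succ_zmod2
    (fun i => if (v i).1 ≤ x then (1 : ZMod 2) else 0) M
  simp only [h0, not_le.2 hM, if_true, if_false, add_zero] at key
  rw [← key]
  refine Finset.sum_congr rfl fun i hi => ?_
  have hi' := Finset.mem_range.1 hi
  have ha := hv i hi'
  unfold Adj4 at ha
  have h1 := hp i hi'.le
  have h2 := hp (i + 1) hi'
  have h3 := hy i hi'.le
  have h4 := hy (i + 1) hi'
  rw [Ne, Prod.ext_iff] at h1 h2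
  simp only at h1 h2
  split_ifs <;> first | rfl | (exfalso; omega)

lemma gapParity_top {v : ℕ → ℤ × ℤ} {M : ℕ} {x y : ℤ} (hy : ∀ i ≤ M, (v i).2 ≤ y) :
    gapParity v M x y = 0 := by
  refine Finset.sum_eq_zero fun i hi => ?_
  have hi' := Finset.mem_range.1 hi
  have h3 := hy i hi'.le
  rw [if_neg]; omega

lemma gapParity_adj8 {v : ℕ → ℤ × ℤ} {M : ℕ} (hv : ∀ i < M, Adj4 (v i) (v (i + 1)))
    {p q : ℤ × ℤ} (hpq : Adj8 p q) (hp : ∀ i ≤ M, v i ≠ p) (hq : ∀ i ≤ M, v i ≠ q)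
    (h0p : (v 0).1 ≤ p.1) (h0q : (v 0).1 ≤ q.1) (hMp : p.1 < (v M).1) (hMq : q.1 < (v M).1) :
    gapParity v M p.1 p.2 = gapParity v M q.1 q.2 := by
  have right : ∀ p q : ℤ × ℤ, Adj8 p q → q.1 = p.1 + 1 → (∀ i ≤ M, v i ≠ p) → (∀ i ≤ M, v i ≠ q) →
      (v 0).1 ≤ p.1 → q.1 < (v M).1 → gapParity v M p.1 p.2 = gapParity v M q.1 q.2 := by
    rintro ⟨px, py⟩ ⟨qx, qy⟩ h hx hp hq h0 hM
    simp only at hx h0 hM ⊢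
    subst hx
    unfold Adj8 at h
    simp only at h
    have hy : qy = py ∨ qy = py + 1 ∨ py = qy + 1 := by omega
    rcases hy with rfl | rfl | rfl
    · exact gapParity_step_right hv hq (by omega) (by omega)
    · rw [gapParity_step_up hv (Or.inr hq)]
      exact gapParity_step_right hv hq (by omega) (by omega)
    · rw [← gapParity_step_right hv hq (by omega) (by omega)]
      exact (gapParity_step_up hv (Or.inl hp)).symm
  have hx : q.1 = p.1 + 1 ∨ p.1 = q.1 + 1 ∨ p.1 = q.1 := by unfold Adj8 at hpq; omega
  rcases hx with hx | hx | hx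
  · exact right p q hpq hx hp hq h0p hMq
  · exact (right q p hpq.symm hx hq hp h0q hMp).symm
  · obtain ⟨px, py⟩ := p
    obtain ⟨qx, qy⟩ := q
    simp only at hx ⊢
    subst hx
    unfold Adj8 at hpq
    simp only at hpq
    have hy : qy = py ∨ qy = py + 1 ∨ py = qy + 1 := by omega
    rcases hy with rfl | rfl | rfl
    · rfl
    · exact gapParity_step_up hv (Or.inl hq)
    · exact (gapParity_step_up hv (Or.inl hp)).symm

/-- A nearest-neighbour left-right crossing and a `*`-connected bottom-top crossing of a
rectangle have a common vertex. -/
theorem crossing_paths_meet {x0 x1 y0 y1 : ℤ} {v w : ℕ → ℤ × ℤ} {m k : ℕ}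
    (hv : ∀ i < m, Adj4 (v i) (v (i + 1))) (hw : ∀ j < k, Adj8 (w j) (w (j + 1)))
    (hvy : ∀ i ≤ m, y0 ≤ (v i).2 ∧ (v i).2 ≤ y1)
    (hwx : ∀ j ≤ k, x0 ≤ (w j).1 ∧ (w j).1 ≤ x1)
    (hv0 : (v 0).1 ≤ x0) (hvm : x1 ≤ (v m).1) (hw0 : (w 0).2 ≤ y0) (hwk : y1 ≤ (w k).2) :
    ∃ i ≤ m, ∃ j ≤ k, v i = w j := by
  by_contra! hne
  -- extend the path by one step to the right
  set u : ℕ → ℤ × ℤ := fun i => if i ≤ m then v i else ((v m).1 + 1, (v m).2) with hu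
  have hum : ∀ i ≤ m, u i = v i := fun i hi => by simp [hu, hi]
  have hulast : u (m + 1) = ((v m).1 + 1, (v m).2) := by simp [hu]
  have hadj : ∀ i < m + 1, Adj4 (u i) (u (i + 1)) := by
    intro i hi
    rcases Nat.lt_succ_iff_lt_or_eq.1 hi with h | rfl
    · rw [hum i h.le, hum (i + 1) h]; exact hv i h
    · rw [hum i le_rfl, hulast]; unfold Adj4; simp
  have hne' : ∀ j ≤ k, ∀ i ≤ m + 1, u i ≠ w j := by
    intro j hj i hi
    rcases Nat.le_succ_iff.1 hi with h | rfl
    · rw [hum i h]; exact hne i h j hj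
    · rw [hulast]; intro h
      have := (hwx j hj).2
      rw [← h] at this; simp only at this; omega
  have huy : ∀ i ≤ m + 1, y0 ≤ (u i).2 ∧ (u i).2 ≤ y1 := by
    intro i hi
    rcases Nat.le_succ_iff.1 hi with h | rfl
    · rw [hum i h]; exact hvy i h
    · rw [hulast]; exact hvy m le_rfl
  have hu0 : (u 0).1 ≤ x0 := by rw [hum 0 (Nat.zero_le _)]; exact hv0
  have hulast' : x1 < (u (m + 1)).1 := by rw [hulast]; simp only; omega
  have hconst : ∀ j ≤ k, gapParity u (m + 1) (w j).1 (w j).2 = gapParity u (m + 1) (w 0).1 (w 0).2 := by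
    intro j
    induction j with
    | zero => intro _; rfl
    | succ j ih =>
      intro hj
      rw [← ih (by omega)]
      have h1 := hwx j (by omega)
      have h2 := hwx (j + 1) hj
      exact (gapParity_adj8 hadj (hw j (by omega)) (hne' j (by omega)) (hne' (j + 1) hj)
        (by omega) (by omega) (by omega) (by omega)).symm
  have hb : gapParity u (m + 1) (w 0).1 (w 0).2 = 1 := by
    have h1 := hwx 0 (Nat.zero_le _)
    exact gapParity_total hadj (fun i hi => le_trans hw0 (huy i hi).1) (hne' 0 (Nat.zero_le _))
      (by omega) (by omega)
  have ht : gapParity u (m + 1) (w k).1 (w k).2 = 0 :=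
    gapParity_top fun i hi => le_trans (huy i hi).2 hwk
  rw [hconst k le_rfl, hb] at ht
  exact one_ne_zero ht

/-- `a` and `b` are joined by an `r`-path inside `S`. -/
def Conn {V : Type*} (r : V → V → Prop) (S : Set V) (a b : V) : Prop :=
  a ∈ S ∧ Relation.ReflTransGen (fun x y => r x y ∧ y ∈ S) a b

namespace Conn
variable {V W : Type*} {r : V → V → Prop} {S T : Set V} {a b c : V}

lemma refl (h : a ∈ S) : Conn r S a a := ⟨h, .refl⟩

lemma left_mem (h : Conn r S a b) : a ∈ S := h.1

lemma right_mem (h : Conn r S a b) : b ∈ S := by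
  rcases h with ⟨ha, h⟩
  induction h with
  | refl => exact ha
  | tail _ h _ => exact h.2

lemma step (h : Conn r S a b) (hr : r b c) (hc : c ∈ S) : Conn r S a c :=
  ⟨h.1, h.2.tail ⟨hr, hc⟩⟩

lemma edge (ha : a ∈ S) (hr : r a b) (hb : b ∈ S) : Conn r S a b := (refl ha).step hr hb

lemma trans (h : Conn r S a b) (h' : Conn r S b c) : Conn r S a c := ⟨h.1, h.2.trans h'.2⟩

lemma mono (hST : S ⊆ T) (h : Conn r S a b) : Conn r T a b :=
  ⟨hST h.1, Relation.ReflTransGen.mono (fun _ _ h => ⟨h.1, hST h.2⟩) _ _ h.2⟩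

lemma rel_mono {r' : V → V → Prop} (hr : ∀ x y, r x y → r' x y) (h : Conn r S a b) :
    Conn r' S a b :=
  ⟨h.1, Relation.ReflTransGen.mono (fun _ _ h => ⟨hr _ _ h.1, h.2⟩) _ _ h.2⟩

lemma symm (hr : ∀ x y, r x y → r y x) (h : Conn r S a b) : Conn r S b a := by
  rcases h with ⟨ha, h⟩
  induction h with
  | refl => exact refl ha
  | tail hab h ih =>
    have hb : Conn r S a _ := ⟨ha, hab⟩
    exact (edge h.2 (hr _ _ h.1) hb.right_mem).trans ih

lemma map {r' : W → W → Prop} {S' : Set W} (g : V → W) (hr : ∀ x y, r x y → r' (g x) (g y))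
    (hS : ∀ x ∈ S, g x ∈ S') (h : Conn r S a b) : Conn r' S' (g a) (g b) :=
  ⟨hS _ h.1, Relation.ReflTransGen.lift g (fun _ _ h => ⟨hr _ _ h.1, hS _ h.2⟩) _ _ h.2⟩

lemma exists_seq (h : Conn r S a b) : ∃ (n : ℕ) (w : ℕ → V), w 0 = a ∧ w n = b ∧
    (∀ i < n, r (w i) (w (i + 1))) ∧ ∀ i ≤ n, w i ∈ S := by
  rcases h with ⟨ha, h⟩
  induction h with
  | refl => exact ⟨0, fun _ => a, rfl, rfl, by simp, by simpa using ha⟩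
  | @tail b c _ h ih =>
    obtain ⟨n, w, h0, hn, hr, hS⟩ := ih
    refine ⟨n + 1, fun i => if i ≤ n then w i else c, by simp [h0], by simp, ?_, ?_⟩
    · intro i hi
      rcases Nat.lt_succ_iff_lt_or_eq.1 hi with hi' | rfl
      · simpa [hi'.le, Nat.succ_le_of_lt hi'] using hr i hi'
      · simpa [hn] using h.1
    · intro i hi
      by_cases hi' : i ≤ n
      · simpa [hi'] using hS i hi'
      · simpa [hi'] using h.2

lemma of_seq {w : ℕ → V} {i j : ℕ} (hij : i ≤ j) (hr : ∀ k, i ≤ k → k < j → r (w k) (w (k + 1)))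
    (hS : ∀ k, i ≤ k → k ≤ j → w k ∈ S) : Conn r S (w i) (w j) := by
  induction j, hij using Nat.le_induction with
  | base => exact refl (hS i le_rfl le_rfl)
  | succ j hij ih =>
    exact (ih (fun k h1 h2 => hr k h1 (by omega)) (fun k h1 h2 => hS k h1 (by omega))).step
      (hr j hij (by omega)) (hS _ (by omega) le_rfl)

/-- A path is contained in the cluster of its starting point. -/
lemma cluster (h : Conn r S a b) : Conn r {z | Conn r S a z} a b := by
  obtain ⟨ha, h⟩ := h
  induction h with
  | refl => exact refl (refl ha)
  | tail hab h ih => exact ih.step h.1 (step ⟨ha, hab⟩ h.1 h.2)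

/-- A path from a point with `g ≤ m` to a point with `m' ≤ g`, where `g` changes by at most one at
each step, has a subpath on which `g` stays in `[m, m']` and goes from `m` to `m'`. -/
lemma subpath {g : V → ℤ} {m m' : ℤ} (hmm : m ≤ m')
    (hr : ∀ x y, r x y → g y ≤ g x + 1)
    (h : Conn r S a b) (ha : g a ≤ m) (hb : m' ≤ g b) :
    ∃ a' b', g a' = m ∧ g b' = m' ∧ Conn r (S ∩ {z | m ≤ g z ∧ g z ≤ m'}) a' b' ∧
      Conn r S a a' := by
  obtain ⟨n, w, rfl, rfl, hw, hS⟩ := h.exists_seq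
  classical
  have ex : ∃ j, j ≤ n ∧ m' ≤ g (w j) := ⟨n, le_rfl, hb⟩
  obtain ⟨hjn, hj⟩ := Nat.find_spec ex
  set j := Nat.find ex with hjdef
  have hjmin : ∀ i < j, g (w i) < m' := fun i hi => by
    have := Nat.find_min ex hi
    push Not at this
    exact this (by omega)
  set p : ℕ → Prop := fun i => g (w i) ≤ m
  have hp0 : p 0 := ha
  set i := Nat.findGreatest p j with hidef
  have hij : i ≤ j := Nat.findGreatest_le j
  have hi : g (w i) ≤ m := Nat.findGreatest_spec (P := p) (Nat.zero_le j) hp0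
  have hgr : ∀ k, i < k → k ≤ j → m < g (w k) := fun k h1 h2 =>
    not_le.1 (Nat.findGreatest_is_greatest (P := p) h1 h2)
  have hjm : g (w j) = m' := by
    rcases Nat.eq_zero_or_pos j with h0 | h0
    · rw [h0] at hj ⊢; omega
    · have h1 := hjmin (j - 1) (by omega)
      have h2 := hr _ _ (hw (j - 1) (by omega))
      rw [Nat.sub_add_cancel h0] at h2
      omega
  have him : g (w i) = m := by
    rcases hij.eq_or_lt with h0 | h0
    · rw [h0] at hi ⊢; omega
    · have h1 := hgr (i + 1) (by omega) h0
      have h2 := hr _ _ (hw i (by omega))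
      omega
  refine ⟨w i, w j, him, hjm, of_seq hij (fun k _ h => hw k (by omega)) fun k h1 h2 => ?_,
    of_seq (Nat.zero_le _) (fun k _ h => hw k (by omega)) fun k _ h => hS k (by omega)⟩
  refine ⟨hS k (by omega), ?_, ?_⟩
  · rcases h1.eq_or_lt with rfl | h1
    · exact him.ge
    · exact (hgr k h1 h2).le
  · rcases h2.eq_or_lt with rfl | h2
    · exact hjm.le
    · exact (hjmin k h2).le

end Conn

/-- The integer rectangle `[a, b] × [c, d]`. -/
def rect (a b c d : ℤ) : Set (ℤ × ℤ) := {p | (a ≤ p.1 ∧ p.1 ≤ b) ∧ c ≤ p.2 ∧ p.2 ≤ d}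

/-- A horizontal `4`-path in a horizontal strip and a vertical `*`-path in a vertical strip meet. -/
lemma Conn.meet {S T : Set (ℤ × ℤ)} {a b c d : ℤ × ℤ} {x0 x1 y0 y1 : ℤ}
    (h : Conn Adj4 S a b) (h' : Conn Adj8 T c d)
    (hS : ∀ p ∈ S, y0 ≤ p.2 ∧ p.2 ≤ y1) (hT : ∀ p ∈ T, x0 ≤ p.1 ∧ p.1 ≤ x1)
    (ha : a.1 ≤ x0) (hb : x1 ≤ b.1) (hc : c.2 ≤ y0) (hd : y1 ≤ d.2) : (S ∩ T).Nonempty := by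
  obtain ⟨m, v, rfl, rfl, hv, hvS⟩ := h.exists_seq
  obtain ⟨k, w, rfl, rfl, hw, hwT⟩ := h'.exists_seq
  obtain ⟨i, hi, j, hj, hij⟩ := crossing_paths_meet hv hw (fun i hi => hS _ (hvS i hi))
    (fun j hj => hT _ (hwT j hj)) ha hb hc hd
  exact ⟨v i, hvS i hi, hij ▸ hwT j hj⟩

lemma square_edges_even (c1 c2 c3 c4 b1 b2 b3 b4 k1 k2 k3 k4 : Prop)
    (e12 : c1 → ¬ c2 → k2) (e21 : c2 → ¬ c1 → k1) (e23 : c2 → ¬ c3 → k3) (e32 : c3 → ¬ c2 → k2)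
    (e34 : c3 → ¬ c4 → k4) (e43 : c4 → ¬ c3 → k3) (e41 : c4 → ¬ c1 → k1) (e14 : c1 → ¬ c4 → k4)
    (f12 : k1 → k2 → (b1 ↔ b2)) (f13 : k1 → k3 → (b1 ↔ b3)) (f14 : k1 → k4 → (b1 ↔ b4))
    (f23 : k2 → k3 → (b2 ↔ b3)) (f24 : k2 → k4 → (b2 ↔ b4)) (f34 : k3 → k4 → (b3 ↔ b4))
    [Decidable ((c1 ∧ ¬ c2 ∧ b2) ∨ (c2 ∧ ¬ c1 ∧ b1))] [Decidable ((c2 ∧ ¬ c3 ∧ b3) ∨ (c3 ∧ ¬ c2 ∧ b2))]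
    [Decidable ((c4 ∧ ¬ c3 ∧ b3) ∨ (c3 ∧ ¬ c4 ∧ b4))] [Decidable ((c1 ∧ ¬ c4 ∧ b4) ∨ (c4 ∧ ¬ c1 ∧ b1))] :
    (if (c1 ∧ ¬ c2 ∧ b2) ∨ (c2 ∧ ¬ c1 ∧ b1) then (1 : ZMod 2) else 0)
      + (if (c4 ∧ ¬ c3 ∧ b3) ∨ (c3 ∧ ¬ c4 ∧ b4) then 1 else 0)
      = (if (c1 ∧ ¬ c4 ∧ b4) ∨ (c4 ∧ ¬ c1 ∧ b1) then 1 else 0)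
      + (if (c2 ∧ ¬ c3 ∧ b3) ∨ (c3 ∧ ¬ c2 ∧ b2) then 1 else 0) := by
  have h2 : (1 : ZMod 2) + 1 = 0 := zmod2_add_self 1
  by_cases c1 <;> by_cases c2 <;> by_cases c3 <;> by_cases c4 <;> simp_all <;>
    (try split_ifs) <;> simp_all

/-- If no open `4`-path crosses a rectangle from left to right, some closed `*`-path crosses it
from bottom to top. -/
theorem exists_dual_crossing {x0 x1 y0 y1 : ℤ} (hx : x0 ≤ x1) (hy : y0 ≤ y1) (O : Set (ℤ × ℤ))
    (hno : ¬ ∃ a b, a.1 = x0 ∧ b.1 = x1 ∧ Conn Adj4 (O ∩ rect x0 x1 y0 y1) a b) :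
    ∃ a b, a.2 = y0 ∧ b.2 = y1 ∧ Conn Adj8 (Oᶜ ∩ rect x0 x1 y0 y1) a b := by
  classical
  set R := rect x0 x1 y0 y1 with hR
  by_contra hcon
  set K : ℤ × ℤ → Prop := fun p => p ∈ Oᶜ ∩ R with hK
  set B : ℤ × ℤ → Prop := fun p => ∃ a, a.2 = y0 ∧ Conn Adj8 (Oᶜ ∩ R) a p with hB
  set C : ℤ × ℤ → Prop := fun p => p.1 = x0 - 1 ∨ ∃ a, a.1 = x0 ∧ Conn Adj4 (O ∩ R) a p with hC
  have hBK : ∀ p q, Adj8 p q → K p → K q → (B p ↔ B q) := by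
    intro p q h hp hq
    constructor
    · rintro ⟨a, ha, hc⟩; exact ⟨a, ha, hc.step h hq⟩
    · rintro ⟨a, ha, hc⟩; exact ⟨a, ha, hc.step h.symm hp⟩
  have hCK : ∀ p q, Adj4 p q → (x0 ≤ q.1 ∧ q.1 ≤ x1) → (y0 ≤ q.2 ∧ q.2 ≤ y1) → C p → ¬ C q → K q := by
    intro p q h hq1 hq2 hp hq
    have hqR : q ∈ R := ⟨hq1, hq2⟩
    refine ⟨fun hqO => hq ?_, hqR⟩
    rcases hp with hp | ⟨a, ha, hc⟩
    · right
      refine ⟨q, ?_, Conn.refl ⟨hqO, hqR⟩⟩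
      unfold Adj4 at h; omega
    · exact Or.inr ⟨a, ha, hc.step h ⟨hqO, hqR⟩⟩
  have hCx0 : ∀ y, C (x0 - 1, y) := fun y => Or.inl rfl
  have hCx1 : ∀ y, ¬ C (x1, y) := by
    rintro y (h | ⟨a, ha, hc⟩)
    · simp only at h; omega
    · exact hno ⟨a, _, ha, rfl, hc⟩
  have hBtop : ∀ x, ¬ B (x, y1) := fun x ⟨a, ha, hc⟩ => hcon ⟨a, _, ha, rfl, hc⟩
  have hBbot : ∀ x, K (x, y0) → B (x, y0) := fun x hx => ⟨_, rfl, Conn.refl hx⟩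
  have hCK' : ∀ p q, Adj4 p q → (x0 - 1 ≤ q.1 ∧ q.1 ≤ x1) → (y0 ≤ q.2 ∧ q.2 ≤ y1) →
      C p → ¬ C q → K q := by
    intro p q h hq1 hq2 hp hq
    have : q.1 ≠ x0 - 1 := fun h => hq (Or.inl h)
    exact hCK p q h (by omega) hq2 hp hq
  clear_value B C K
  clear hno hcon hC hB hK hCK
  set e : ℤ × ℤ → ℤ × ℤ → ZMod 2 :=
    fun p q => if (C p ∧ ¬ C q ∧ B q) ∨ (C q ∧ ¬ C p ∧ B p) then 1 else 0 with he
  set n : ℕ := (x1 - x0 + 1).toNat with hn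
  have hnx : (n : ℤ) = x1 - x0 + 1 := by omega
  set X : ℕ → ℤ := fun i => x0 - 1 + i with hX
  set N : ℤ → ZMod 2 := fun y => ∑ i ∈ Finset.range n, e (X i, y) (X (i + 1), y) with hN
  have hXs : ∀ i, X (i + 1) = X i + 1 := fun i => by simp [hX]; ring
  have hXn : X n = x1 := by simp [hX, hnx]
  have step : ∀ y, y0 ≤ y → y + 1 ≤ y1 → N y = N (y + 1) := by
    intro y h0 h1
    have hsq : ∀ i ∈ Finset.range n, e (X i, y) (X (i + 1), y) + e (X i, y + 1) (X (i + 1), y + 1)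
        = e (X i, y) (X i, y + 1) + e (X (i + 1), y) (X (i + 1), y + 1) := by
      intro i hi
      have hi := Finset.mem_range.1 hi
      have hXi : x0 - 1 ≤ X i ∧ X i + 1 ≤ x1 := by
        rw [← hXn, ← hXs]; simp [hX]; omega
      rw [hXs]
      apply square_edges_even (C (X i, y)) (C (X i + 1, y)) (C (X i + 1, y + 1)) (C (X i, y + 1))
        (B (X i, y)) (B (X i + 1, y)) (B (X i + 1, y + 1)) (B (X i, y + 1))
        (K (X i, y)) (K (X i + 1, y)) (K (X i + 1, y + 1)) (K (X i, y + 1))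
      all_goals first
        | (apply hCK'
           · simp [Adj4]
           · simp only; omega
           · simp only; omega)
        | (apply hBK; simp only [Adj8]; omega)
    have hsum := Finset.sum_congr rfl hsq
    rw [Finset.sum_add_distrib] at hsum
    have htel := sum_add_succ_zmod2 (fun i => e (X i, y) (X i, y + 1)) n
    rw [htel, hXn] at hsum
    have z0 : e (X 0, y) (X 0, y + 1) = 0 := by
      have h1 := hCx0 y
      have h2 := hCx0 (y + 1)
      simp only [he, hX, Nat.cast_zero, add_zero]
      rw [if_neg]; exact fun h => h.elim (fun h => h.2.1 h2) (fun h => h.2.1 h1)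
    have z1 : e (x1, y) (x1, y + 1) = 0 := by
      have h1 := hCx1 y
      have h2 := hCx1 (y + 1)
      simp only [he]
      rw [if_neg]; exact fun h => h.elim (fun h => h1 h.1) (fun h => h2 h.1)
    rw [z0, z1, add_zero] at hsum
    calc N y = N y + (N (y + 1) + N (y + 1)) := by rw [zmod2_add_self, add_zero]
      _ = N (y + 1) := by rw [← add_assoc]; simp only [hN]; rw [hsum, zero_add]
  have hconst : ∀ k : ℕ, y0 + k ≤ y1 → N y0 = N (y0 + k) := by
    intro k
    induction k with
    | zero => simp
    | succ k ih =>
      intro hk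
      push_cast at hk ⊢
      rw [ih (by omega), step (y0 + k) (by omega) (by omega)]
      congr 1; ring
  have hN1 : N y1 = 0 := by
    refine Finset.sum_eq_zero fun i _ => ?_
    have h1 := hBtop (X i)
    have h2 := hBtop (X (i + 1))
    simp only [he]
    rw [if_neg]; exact fun h => h.elim (fun h => h2 h.2.2) (fun h => h1 h.2.2)
  have hN0 : N y0 = 1 := by
    have key := sum_add_succ_zmod2 (fun i => if C (X i, y0) then (1 : ZMod 2) else 0) n
    have h0 : C (X 0, y0) := by simpa [hX] using hCx0 y0
    have h1 : ¬ C (X n, y0) := by rw [hXn]; exact hCx1 y0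
    simp only [h0, h1, if_true, if_false, add_zero] at key
    rw [← key]
    refine Finset.sum_congr rfl fun i hi => ?_
    have hi := Finset.mem_range.1 hi
    have hXi : x0 - 1 ≤ X i ∧ X i + 1 ≤ x1 := by
      rw [← hXn, ← hXs]; simp [hX]; omega
    have h1 : C (X i, y0) → ¬ C (X (i + 1), y0) → B (X (i + 1), y0) := fun hc hc' => by
      apply hBbot
      refine hCK' _ _ ?_ ?_ ?_ hc hc'
      · simp [Adj4, hXs]
      · simp only [hXs]; omega
      · simp only; omega
    have h2 : C (X (i + 1), y0) → ¬ C (X i, y0) → B (X i, y0) := fun hc hc' => by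
      apply hBbot
      refine hCK' _ _ ?_ ?_ ?_ hc hc'
      · simp [Adj4, hXs]
      · simp only; omega
      · simp only; omega
    have h3 := zmod2_add_self 1
    by_cases ha : C (X i, y0) <;> by_cases hb : C (X (i + 1), y0) <;> simp [he, ha, hb, h1, h2, h3]
  have := hconst (y1 - y0).toNat (by omega)
  rw [show y0 + ((y1 - y0).toNat : ℤ) = y1 by omega, hN0, hN1] at this
  exact one_ne_zero this

/-- The event `E` only depends on the sites in `S`. -/
def OnlyOn (E : Set (ℤ × ℤ) → Prop) (S : Set (ℤ × ℤ)) : Prop :=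
  ∀ O O' : Set (ℤ × ℤ), O ∩ S = O' ∩ S → E O → E O'

/-- The event `E` only depends on finitely many sites. -/
def Local (E : Set (ℤ × ℤ) → Prop) : Prop := ∃ S : Set (ℤ × ℤ), S.Finite ∧ OnlyOn E S

lemma OnlyOn.mono {E : Set (ℤ × ℤ) → Prop} {S T : Set (ℤ × ℤ)} (h : OnlyOn E S) (hST : S ⊆ T) :
    OnlyOn E T := fun O O' hO => h O O' (by
      rw [← inter_eq_self_of_subset_right hST, ← inter_assoc, hO, inter_assoc])

lemma OnlyOn.and {E E' : Set (ℤ × ℤ) → Prop} {S : Set (ℤ × ℤ)} (h : OnlyOn E S) (h' : OnlyOn E' S) :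
    OnlyOn (fun O => E O ∧ E' O) S := fun O O' hO h1 => ⟨h O O' hO h1.1, h' O O' hO h1.2⟩

lemma OnlyOn.not {E : Set (ℤ × ℤ) → Prop} {S : Set (ℤ × ℤ)} (h : OnlyOn E S) :
    OnlyOn (fun O => ¬ E O) S := fun O O' hO h1 h2 => h1 (h O' O hO.symm h2)

lemma OnlyOn.compl {E : Set (ℤ × ℤ) → Prop} {S : Set (ℤ × ℤ)} (h : OnlyOn E S) :
    OnlyOn (fun O => E Oᶜ) S := fun O O' hO h1 => h _ _ (by
      ext x
      have := Set.ext_iff.1 hO x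
      simp only [mem_inter_iff, mem_compl_iff] at *; tauto) h1

lemma OnlyOn.preimage {E : Set (ℤ × ℤ) → Prop} {S : Set (ℤ × ℤ)} (h : OnlyOn E S)
    (g : ℤ × ℤ → ℤ × ℤ) : OnlyOn (fun O => E (g ⁻¹' O)) (g '' S) := fun O O' hO h1 => h _ _ (by
      ext x
      have := Set.ext_iff.1 hO (g x)
      simp only [mem_inter_iff, mem_preimage] at *
      constructor
      · rintro ⟨h1, h2⟩; exact ⟨(this.1 ⟨h1, mem_image_of_mem g h2⟩).1, h2⟩
      · rintro ⟨h1, h2⟩; exact ⟨(this.2 ⟨h1, mem_image_of_mem g h2⟩).1, h2⟩) h1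

/-- Increasing local events. -/
structure Good (E : Set (ℤ × ℤ) → Prop) : Prop where
  mono : ∀ O O', O ⊆ O' → E O → E O'
  loc : Local E

lemma Good.and {E E' : Set (ℤ × ℤ) → Prop} (h : Good E) (h' : Good E') :
    Good (fun O => E O ∧ E' O) where
  mono _ _ hO hE := ⟨h.mono _ _ hO hE.1, h'.mono _ _ hO hE.2⟩
  loc := by
    obtain ⟨S, hS, hES⟩ := h.loc
    obtain ⟨T, hT, hET⟩ := h'.loc
    exact ⟨S ∪ T, hS.union hT, (hES.mono subset_union_left).and (hET.mono subset_union_right)⟩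

lemma Local.preimage {E : Set (ℤ × ℤ) → Prop} (h : Local E) (g : ℤ × ℤ → ℤ × ℤ) :
    Local (fun O => E (g ⁻¹' O)) := by
  obtain ⟨S, hS, hES⟩ := h
  exact ⟨g '' S, hS.image g, hES.preimage g⟩

lemma Good.preimage {E : Set (ℤ × ℤ) → Prop} (h : Good E) (g : ℤ × ℤ → ℤ × ℤ) :
    Good (fun O => E (g ⁻¹' O)) where
  mono _ _ hO hE := h.mono _ _ (preimage_mono hO) hE
  loc := h.loc.preimage g

def shift (v : ℤ × ℤ) (p : ℤ × ℤ) : ℤ × ℤ := (p.1 + v.1, p.2 + v.2)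
def reflX (p : ℤ × ℤ) : ℤ × ℤ := (-p.1, p.2)
def reflY (p : ℤ × ℤ) : ℤ × ℤ := (p.1, -p.2)

lemma adj4_shift (v : ℤ × ℤ) (p q : ℤ × ℤ) (h : Adj4 p q) : Adj4 (shift v p) (shift v q) := by
  unfold Adj4 shift at *; simp only; omega
lemma adj4_reflY (p q : ℤ × ℤ) (h : Adj4 p q) : Adj4 (reflY p) (reflY q) := by
  unfold Adj4 reflY at *; simp only; omega
lemma adj4_swap (p q : ℤ × ℤ) (h : Adj4 p q) : Adj4 p.swap q.swap := by
  unfold Adj4 at *; simp only [Prod.fst_swap, Prod.snd_swap]; omega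

/-- Horizontal crossing of a rectangle. -/
def HCross (a b c d : ℤ) (O : Set (ℤ × ℤ)) : Prop :=
  ∃ p q : ℤ × ℤ, p.1 = a ∧ q.1 = b ∧ Conn Adj4 (O ∩ rect a b c d) p q

/-- Vertical crossing of a rectangle. -/
def VCross (a b c d : ℤ) (O : Set (ℤ × ℤ)) : Prop :=
  ∃ p q : ℤ × ℤ, p.2 = c ∧ q.2 = d ∧ Conn Adj4 (O ∩ rect a b c d) p q

/-- A planar percolation model which is invariant, positively associated, self-dual,
with squares crossed with probability at least `1/4` up to scale `D`, and with an approximate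
independence property at distance `d0`. -/
structure Perc (D d0 s0 : ℤ) (err : ℝ) where
  pr : (Set (ℤ × ℤ) → Prop) → ℝ
  nonneg : ∀ E, 0 ≤ pr E
  mono : ∀ E E', (∀ O, E O → E' O) → pr E ≤ pr E'
  union : ∀ E E', pr (fun O => E O ∨ E' O) ≤ pr E + pr E'
  not_eq : ∀ E, Local E → pr (fun O => ¬ E O) = 1 - pr E
  compl_eq : ∀ E, Local E → pr (fun O => E Oᶜ) = pr E
  shift_eq : ∀ E, Local E → ∀ v, pr (fun O => E (shift v ⁻¹' O)) = pr E
  swap_eq : ∀ E, Local E → pr (fun O => E (Prod.swap ⁻¹' O)) = pr E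
  reflX_eq : ∀ E, Local E → pr (fun O => E (reflX ⁻¹' O)) = pr E
  reflY_eq : ∀ E, Local E → pr (fun O => E (reflY ⁻¹' O)) = pr E
  fkg : ∀ E E', Good E → Good E' → pr E * pr E' ≤ pr (fun O => E O ∧ E' O)
  square : ∀ L, 0 ≤ L → L ≤ D → 1 / 4 ≤ pr (HCross 0 L 0 L)
  base : 1 / 4 ≤ pr (fun O => rect (-s0) s0 (-s0) s0 ⊆ O)
  mix : ∀ E E' S S', OnlyOn E S → OnlyOn E' S' → S ⊆ rect (-D) D (-D) D → S' ⊆ rect (-D) D (-D) D →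
    (∀ p ∈ S, ∀ q ∈ S', d0 ≤ |p.1 - q.1| ∨ d0 ≤ |p.2 - q.2|) →
    pr (fun O => E O ∧ E' O) ≤ pr E * pr E' + err

lemma rect_finite (a b c d : ℤ) : (rect a b c d).Finite := by
  refine ((finite_Icc a b).prod (finite_Icc c d)).subset ?_
  rintro ⟨x, y⟩ ⟨h1, h2⟩
  exact ⟨h1, h2⟩

lemma conn_inter_congr {r : ℤ × ℤ → ℤ × ℤ → Prop} {O O' R : Set (ℤ × ℤ)} (h : O ∩ R = O' ∩ R)
    {a b : ℤ × ℤ} (hc : Conn r (O ∩ R) a b) : Conn r (O' ∩ R) a b := h ▸ hc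

lemma good_conn {R : Set (ℤ × ℤ)} (hR : R.Finite) (A : ℤ × ℤ → ℤ × ℤ → Prop) :
    Good (fun O => ∃ p q, A p q ∧ Conn Adj4 (O ∩ R) p q) where
  mono := by
    rintro O O' hO ⟨p, q, h, hc⟩
    exact ⟨p, q, h, hc.mono (inter_subset_inter_left _ hO)⟩
  loc := ⟨R, hR, by
    rintro O O' hO ⟨p, q, h, hc⟩
    exact ⟨p, q, h, conn_inter_congr hO hc⟩⟩

lemma good_hcross (a b c d : ℤ) : Good (HCross a b c d) := by
  have := good_conn (rect_finite a b c d) fun p q => p.1 = a ∧ q.1 = b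
  simp only [and_assoc] at this; exact this

lemma good_vcross (a b c d : ℤ) : Good (VCross a b c d) := by
  have := good_conn (rect_finite a b c d) fun p q => p.2 = c ∧ q.2 = d
  simp only [and_assoc] at this; exact this

/-- A horizontal path and a vertical path are joined. -/
lemma conn_of_cross {S T U : Set (ℤ × ℤ)} {a b c d : ℤ × ℤ} {x0 x1 y0 y1 : ℤ}
    (h : Conn Adj4 S a b) (h' : Conn Adj4 T c d)
    (hS : ∀ p ∈ S, y0 ≤ p.2 ∧ p.2 ≤ y1) (hT : ∀ p ∈ T, x0 ≤ p.1 ∧ p.1 ≤ x1)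
    (ha : a.1 ≤ x0) (hb : x1 ≤ b.1) (hc : c.2 ≤ y0) (hd : y1 ≤ d.2) (hSU : S ⊆ U) (hTU : T ⊆ U) :
    Conn Adj4 U a c := by
  obtain ⟨z, hz, hz'⟩ := h.cluster.meet (h'.cluster.rel_mono fun _ _ h => h.adj8)
    (fun p hp => hS p (Conn.right_mem hp)) (fun p hp => hT p (Conn.right_mem hp)) ha hb hc hd
  exact (Conn.mono hSU hz).trans ((Conn.mono hTU hz').symm fun _ _ h => h.symm)

namespace Perc
variable {D d0 s0 : ℤ} {err : ℝ} (M : Perc D d0 s0 err)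

lemma le_one (E : Set (ℤ × ℤ) → Prop) : M.pr E ≤ 1 := by
  have h : Local (fun _ => True) := ⟨∅, finite_empty, fun _ _ _ _ => trivial⟩
  have h1 := M.not_eq _ h
  have h2 := M.nonneg (fun _ => ¬ True)
  have h3 := M.mono E (fun _ => True) fun _ _ => trivial
  linarith

lemma fkg_le {E E' : Set (ℤ × ℤ) → Prop} (h : Good E) (h' : Good E') {x y : ℝ}
    (hx : x ≤ M.pr E) (hy : y ≤ M.pr E') (hy0 : 0 ≤ y) : x * y ≤ M.pr (fun O => E O ∧ E' O) :=
  (mul_le_mul hx hy hy0 (M.nonneg _)).trans (M.fkg _ _ h h')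

/-- Probability of crossing a `w × h` rectangle horizontally. -/
def G (w h : ℤ) : ℝ := M.pr (HCross 0 w 0 h)

lemma pr_hcross (a b c d : ℤ) : M.pr (HCross a b c d) = M.G (b - a) (d - c) := by
  rw [G, ← M.shift_eq _ (good_hcross 0 (b - a) 0 (d - c)).loc (a, c)]
  refine le_antisymm (M.mono _ _ ?_) (M.mono _ _ ?_)
  · rintro O ⟨p, q, hp, hq, h⟩
    refine ⟨shift (-a, -c) p, shift (-a, -c) q, by simp [shift, hp], by simp [shift, hq]; ring,
      h.map _ (adj4_shift _) ?_⟩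
    rintro x ⟨hx, hx'⟩
    refine ⟨by simpa [shift] using hx, ?_⟩
    simp only [rect, mem_ofPred_eq, shift] at *; omega
  · rintro O ⟨p, q, hp, hq, h⟩
    refine ⟨shift (a, c) p, shift (a, c) q, by simp [shift, hp], by simp [shift, hq],
      h.map _ (adj4_shift _) ?_⟩
    rintro x ⟨hx, hx'⟩
    refine ⟨hx, ?_⟩
    simp only [rect, mem_ofPred_eq, shift] at *; omega

lemma pr_vcross (a b c d : ℤ) : M.pr (VCross a b c d) = M.G (d - c) (b - a) := by
  rw [← pr_hcross, ← M.swap_eq _ (good_hcross c d a b).loc]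
  refine le_antisymm (M.mono _ _ ?_) (M.mono _ _ ?_)
  · rintro O ⟨p, q, hp, hq, h⟩
    refine ⟨p.swap, q.swap, hp, hq, h.map _ adj4_swap ?_⟩
    rintro x ⟨hx, hx'⟩
    refine ⟨by simpa using hx, ?_⟩
    simp only [rect, mem_ofPred_eq, Prod.fst_swap, Prod.snd_swap] at *; omega
  · rintro O ⟨p, q, hp, hq, h⟩
    refine ⟨p.swap, q.swap, hp, hq, h.map _ adj4_swap ?_⟩
    rintro x ⟨hx, hx'⟩
    refine ⟨hx, ?_⟩
    simp only [rect, mem_ofPred_eq, Prod.fst_swap, Prod.snd_swap] at *; omega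

lemma G_nonneg (w h : ℤ) : 0 ≤ M.G w h := M.nonneg _

lemma adj4_fst {x y : ℤ × ℤ} (h : Adj4 x y) : y.1 ≤ x.1 + 1 := by unfold Adj4 at h; omega
lemma adj4_snd {x y : ℤ × ℤ} (h : Adj4 x y) : y.2 ≤ x.2 + 1 := by unfold Adj4 at h; omega

lemma G_mono {w w' h h' : ℤ} (hw0 : 0 ≤ w') (hw : w' ≤ w) (hh : h ≤ h') : M.G w h ≤ M.G w' h' := by
  refine M.mono _ _ ?_
  rintro O ⟨p, q, hp, hq, hc⟩
  obtain ⟨a, b, ha, hb, h1, -⟩ := hc.subpath (g := Prod.fst) hw0 (fun x y => adj4_fst) hp.le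
    (by omega : w' ≤ q.1)
  refine ⟨a, b, ha, hb, h1.mono ?_⟩
  rintro x ⟨⟨hx, hx'⟩, hx''⟩
  refine ⟨hx, ?_⟩
  simp only [rect, mem_ofPred_eq] at *; omega

lemma square_le {L : ℤ} (h0 : 0 ≤ L) (hL : L ≤ D) : 1 / 4 ≤ M.G L L := M.square L h0 hL

lemma G_glue {w1 w2 h : ℤ} (h0 : 0 ≤ h) (h1 : h ≤ w1) (h2 : h ≤ w2) (hD : h ≤ D) :
    M.G w1 h * M.G w2 h * (1 / 4) ≤ M.G (w1 + w2 - h) h := by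
  have e1 : M.G w1 h ≤ M.pr (HCross 0 w1 0 h) := le_rfl
  have e2 : M.G w2 h ≤ M.pr (HCross (w1 - h) (w1 + w2 - h) 0 h) := by
    rw [pr_hcross]; apply le_of_eq; congr 1 <;> ring
  have e3 : 1 / 4 ≤ M.pr (VCross (w1 - h) w1 0 h) := by
    rw [pr_vcross]; refine (M.square_le h0 hD).trans (le_of_eq ?_); congr 1 <;> ring
  refine (M.fkg_le ((good_hcross _ _ _ _).and (good_hcross _ _ _ _)) (good_vcross _ _ _ _)
    (M.fkg_le (good_hcross _ _ _ _) (good_hcross _ _ _ _) e1 e2 (M.G_nonneg _ _)) e3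
    (by norm_num)).trans (M.mono _ _ ?_)
  rintro O ⟨⟨⟨p, q, hp, hq, hc⟩, p', q', hp', hq', hc'⟩, p'', q'', hp'', hq'', hc''⟩
  have sub : ∀ {a b c d : ℤ}, 0 ≤ a → b ≤ w1 + w2 - h → 0 ≤ c → d ≤ h →
      O ∩ rect a b c d ⊆ O ∩ rect 0 (w1 + w2 - h) 0 h := by
    rintro a b c d h1 h2 h3 h4 x ⟨hx, hx'⟩
    refine ⟨hx, ?_⟩
    simp only [rect, mem_ofPred_eq] at *; omega
  have c1 := conn_of_cross hc hc'' (y0 := 0) (y1 := h) (x0 := w1 - h) (x1 := w1)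
    (fun p hp => hp.2.2) (fun p hp => hp.2.1) (by omega) (by omega) (by omega) (by omega)
    (U := O ∩ rect 0 (w1 + w2 - h) 0 h) (sub (by omega) (by omega) le_rfl le_rfl)
    (sub (by omega) (by omega) le_rfl le_rfl)
  have c2 := conn_of_cross hc' hc'' (y0 := 0) (y1 := h) (x0 := w1 - h) (x1 := w1)
    (fun p hp => hp.2.2) (fun p hp => hp.2.1) (by omega) (by omega) (by omega) (by omega)
    (U := O ∩ rect 0 (w1 + w2 - h) 0 h) (sub (by omega) (by omega) le_rfl le_rfl)
    (sub (by omega) (by omega) le_rfl le_rfl)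
  have c3 := hc'.mono (T := O ∩ rect 0 (w1 + w2 - h) 0 h) (sub (by omega) (by omega) le_rfl le_rfl)
  exact ⟨p, q', hp, hq', (c1.trans (c2.symm fun _ _ h => h.symm)).trans c3⟩

lemma G_iterate {h e : ℤ} (h0 : 0 ≤ h) (he : 0 ≤ e) (hD : h ≤ D) (k : ℕ) :
    (M.G (h + e) h * (1 / 4)) ^ k * (1 / 4) ≤ M.G (h + k * e) h := by
  induction k with
  | zero => simpa using M.square_le h0 hD
  | succ k ih =>
    have := M.G_glue (w1 := h + k * e) (w2 := h + e) h0 (by nlinarith [Int.natCast_nonneg k])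
      (by omega) hD
    have e1 : h + k * e + (h + e) - h = h + (k + 1 : ℕ) * e := by push_cast; ring
    rw [e1] at this
    refine le_trans ?_ this
    rw [pow_succ]
    nlinarith [M.G_nonneg (h + e) h]

end Perc

/-- Some open cluster of `R` meets every path from the box of radius `s` to the outside of the box
of radius `3s`. -/
def Hub (R : Set (ℤ × ℤ)) (s : ℤ) (O : Set (ℤ × ℤ)) : Prop :=
  ∃ z, ∀ (S : Set (ℤ × ℤ)) (a b : ℤ × ℤ), Conn Adj4 S a b → max |a.1| |a.2| ≤ s →
    3 * s ≤ max |b.1| |b.2| → ∃ y ∈ S, Conn Adj4 (O ∩ R) z y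

lemma onlyOn_hub (R : Set (ℤ × ℤ)) (s : ℤ) : OnlyOn (Hub R s) R := by
  rintro O O' hO ⟨z, hz⟩
  refine ⟨z, fun S a b h1 h2 h3 => ?_⟩
  obtain ⟨y, hy, hc⟩ := hz S a b h1 h2 h3
  exact ⟨y, hy, conn_inter_congr hO hc⟩

lemma good_hub {R : Set (ℤ × ℤ)} (hR : R.Finite) (s : ℤ) : Good (Hub R s) where
  mono := by
    rintro O O' hO ⟨z, hz⟩
    refine ⟨z, fun S a b h1 h2 h3 => ?_⟩
    obtain ⟨y, hy, hc⟩ := hz S a b h1 h2 h3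
    exact ⟨y, hy, hc.mono (inter_subset_inter_left _ hO)⟩
  loc := ⟨R, hR, onlyOn_hub R s⟩

/-- The annulus of radii `s` and `3s`. -/
def annulus (s : ℤ) : Set (ℤ × ℤ) := {p | s ≤ max |p.1| |p.2| ∧ max |p.1| |p.2| ≤ 3 * s}

lemma annulus_subset (s : ℤ) : annulus s ⊆ rect (-(3 * s)) (3 * s) (-(3 * s)) (3 * s) := by
  rintro p ⟨-, hp⟩
  have h1 := abs_le.1 ((le_max_left _ _).trans hp)
  have h2 := abs_le.1 ((le_max_right _ _).trans hp)
  exact ⟨h1, h2⟩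

lemma annulus_finite (s : ℤ) : (annulus s).Finite := (rect_finite _ _ _ _).subset (annulus_subset s)

lemma rect_subset_annulus {s a b c d : ℤ} (h1 : -(3 * s) ≤ a) (h2 : b ≤ 3 * s)
    (h3 : -(3 * s) ≤ c) (h4 : d ≤ 3 * s) (h : s ≤ a ∨ b ≤ -s ∨ s ≤ c ∨ d ≤ -s) :
    rect a b c d ⊆ annulus s := by
  rintro p ⟨hp1, hp2⟩
  refine ⟨?_, max_le (abs_le.2 (by omega)) (abs_le.2 (by omega))⟩
  have e1 := le_abs_self p.1
  have e2 := neg_le_abs p.1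
  have e3 := le_abs_self p.2
  have e4 := neg_le_abs p.2
  rw [le_max_iff]; omega

lemma hub_of_crossings {s : ℤ} (hs : 0 ≤ s) {O : Set (ℤ × ℤ)}
    (hr : VCross s (3 * s) (-(3 * s)) (3 * s) O) (hl : VCross (-(3 * s)) (-s) (-(3 * s)) (3 * s) O)
    (ht : HCross (-(3 * s)) (3 * s) s (3 * s) O) (hb : HCross (-(3 * s)) (3 * s) (-(3 * s)) (-s) O) :
    Hub (annulus s) s O := by
  obtain ⟨r, r', er, er', cr⟩ := hr
  obtain ⟨l, l', el, el', cl⟩ := hl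
  obtain ⟨t, t', et, et', ct⟩ := ht
  obtain ⟨b, b', eb, eb', cb⟩ := hb
  have hsymm : ∀ x y, Adj4 x y → Adj4 y x := fun _ _ h => h.symm
  have sr : O ∩ rect s (3 * s) (-(3 * s)) (3 * s) ⊆ O ∩ annulus s :=
    inter_subset_inter_right _ (rect_subset_annulus (by omega) (by omega) (by omega) (by omega)
      (by omega))
  have sl : O ∩ rect (-(3 * s)) (-s) (-(3 * s)) (3 * s) ⊆ O ∩ annulus s :=
    inter_subset_inter_right _ (rect_subset_annulus (by omega) (by omega) (by omega) (by omega)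
      (by omega))
  have st : O ∩ rect (-(3 * s)) (3 * s) s (3 * s) ⊆ O ∩ annulus s :=
    inter_subset_inter_right _ (rect_subset_annulus (by omega) (by omega) (by omega) (by omega)
      (by omega))
  have sb : O ∩ rect (-(3 * s)) (3 * s) (-(3 * s)) (-s) ⊆ O ∩ annulus s :=
    inter_subset_inter_right _ (rect_subset_annulus (by omega) (by omega) (by omega) (by omega)
      (by omega))
  have tr : Conn Adj4 (O ∩ annulus s) t r := conn_of_cross ct cr (fun p hp => hp.2.2)
    (fun p hp => hp.2.1) (by omega) (by omega) (by omega) (by omega) st sr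
  have tl : Conn Adj4 (O ∩ annulus s) t l := conn_of_cross ct cl (fun p hp => hp.2.2)
    (fun p hp => hp.2.1) (by omega) (by omega) (by omega) (by omega) st sl
  have br : Conn Adj4 (O ∩ annulus s) b r := conn_of_cross cb cr (fun p hp => hp.2.2)
    (fun p hp => hp.2.1) (by omega) (by omega) (by omega) (by omega) sb sr
  refine ⟨t, fun S x y hxy hx hy => ?_⟩
  obtain ⟨x', y', hx', hy', hc, -⟩ := hxy.subpath (g := fun p => max |p.1| |p.2|)
    (by omega : s ≤ 3 * s) (by
      intro p q h
      have h := h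
      simp only [max_le_iff, abs_le]
      have e1 := le_max_left |p.1| |p.2|
      have e2 := le_max_right |p.1| |p.2|
      have := le_abs_self p.1; have := neg_abs_le p.1
      have := le_abs_self p.2; have := neg_abs_le p.2
      unfold Adj4 at h; omega) hx hy
  have hx1 := abs_le.1 ((le_max_left _ _).trans hx'.le)
  have hx2 := abs_le.1 ((le_max_right _ _).trans hx'.le)
  have hstrip : ∀ p ∈ S ∩ {z | s ≤ max |z.1| |z.2| ∧ max |z.1| |z.2| ≤ 3 * s},
      (-(3 * s) ≤ p.1 ∧ p.1 ≤ 3 * s) ∧ (-(3 * s) ≤ p.2 ∧ p.2 ≤ 3 * s) := fun p hp =>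
    ⟨abs_le.1 ((le_max_left _ _).trans hp.2.2), abs_le.1 ((le_max_right _ _).trans hp.2.2)⟩
  have hcase : y'.1 = 3 * s ∨ y'.1 = -(3 * s) ∨ y'.2 = 3 * s ∨ y'.2 = -(3 * s) := by
    rcases max_choice |y'.1| |y'.2| with h | h <;> rw [h] at hy' <;>
      rcases abs_choice y'.1 with h1 | h1 <;> rcases abs_choice y'.2 with h2 | h2 <;> omega
  have h8 : ∀ x y, Adj4 x y → Adj8 x y := fun _ _ h => h.adj8
  rcases hcase with h | h | h | h
  · obtain ⟨a1, b1, ha1, hb1, hc1, -⟩ := hc.subpath (g := Prod.fst) (by omega : s ≤ 3 * s)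
      (fun _ _ => Perc.adj4_fst) hx1.2 h.ge
    obtain ⟨z, hz, hz'⟩ := hc1.meet (cr.cluster.rel_mono h8) (y0 := -(3 * s)) (y1 := 3 * s) (x0 := s)
      (x1 := 3 * s) (fun p hp => (hstrip p hp.1).2) (fun p hp => (Conn.right_mem hp).2.1)
      (by omega) (by omega) (by omega) (by omega)
    exact ⟨z, hz.1.1, tr.trans (hz'.mono sr)⟩
  · obtain ⟨a1, b1, ha1, hb1, hc1, -⟩ := hc.subpath (g := fun p => -p.1) (by omega : s ≤ 3 * s)
      (fun p q h => by have := Perc.adj4_fst (hsymm _ _ h); omega) (by omega)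
      (by omega)
    obtain ⟨z, hz, hz'⟩ := (hc1.symm hsymm).meet (cl.cluster.rel_mono h8) (y0 := -(3 * s))
      (y1 := 3 * s) (x0 := -(3 * s))
      (x1 := -s) (fun p hp => (hstrip p hp.1).2) (fun p hp => (Conn.right_mem hp).2.1)
      (by omega) (by omega) (by omega) (by omega)
    exact ⟨z, hz.1.1, tl.trans (hz'.mono sl)⟩
  · obtain ⟨a1, b1, ha1, hb1, hc1, -⟩ := hc.subpath (g := Prod.snd) (by omega : s ≤ 3 * s)
      (fun _ _ => Perc.adj4_snd) hx2.2 h.ge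
    obtain ⟨z, hz', hz⟩ := ct.cluster.meet (hc1.rel_mono h8) (y0 := s) (y1 := 3 * s) (x0 := -(3 * s))
      (x1 := 3 * s) (fun p hp => (Conn.right_mem hp).2.2) (fun p hp => (hstrip p hp.1).1)
      (by omega) (by omega) (by omega) (by omega)
    exact ⟨z, hz.1.1, hz'.mono st⟩
  · obtain ⟨a1, b1, ha1, hb1, hc1, -⟩ := hc.subpath (g := fun p => -p.2) (by omega : s ≤ 3 * s)
      (fun p q h => by have := Perc.adj4_snd (hsymm _ _ h); omega) (by omega)
      (by omega)
    obtain ⟨z, hz', hz⟩ := cb.cluster.meet ((hc1.symm hsymm).rel_mono h8) (y0 := -(3 * s)) (y1 := -s)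
      (x0 := -(3 * s))
      (x1 := 3 * s) (fun p hp => (Conn.right_mem hp).2.2) (fun p hp => (hstrip p hp.1).1)
      (by omega) (by omega) (by omega) (by omega)
    exact ⟨z, hz.1.1, (tr.trans (br.symm hsymm)).trans (hz'.mono sb)⟩

/-- A path of the box of radius `m` centred at `(-m, 0)` from the left side to the part `[a, b]`
of the right side. -/
def TEv (m a b : ℤ) (O : Set (ℤ × ℤ)) : Prop :=
  ∃ p q : ℤ × ℤ, p.1 = -(2 * m) ∧ q.1 = 0 ∧ a ≤ q.2 ∧ q.2 ≤ b ∧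
    Conn Adj4 (O ∩ rect (-(2 * m)) 0 (-m) m) p q

lemma good_tEv (m a b : ℤ) : Good (TEv m a b) := by
  have := good_conn (rect_finite (-(2 * m)) 0 (-m) m) fun p q => p.1 = -(2 * m) ∧ q.1 = 0 ∧ a ≤ q.2 ∧ q.2 ≤ b
  simp only [and_assoc] at this; exact this

/-- A path ending on the column `x = 0` from the left meets a path whose endpoints lie above and
below on this column. -/
lemma hook_meet {S T : Set (ℤ × ℤ)} {a : ℤ × ℤ} {x0 y0 y1 y yb yt : ℤ}
    (h : Conn Adj4 S a (0, y)) (h' : Conn Adj4 T (0, yb) (0, yt))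
    (hS : ∀ p ∈ S, p.1 ≤ 0 ∧ y0 ≤ p.2 ∧ p.2 ≤ y1) (hT : ∀ p ∈ T, x0 ≤ p.1 ∧ p.1 ≤ 0)
    (ha : a.1 ≤ x0) (hb : yb ≤ y) (ht : y ≤ yt) : (S ∩ T).Nonempty := by
  rcases hb.eq_or_lt with rfl | hb
  · exact ⟨_, h.right_mem, h'.left_mem⟩
  rcases ht.eq_or_lt with rfl | ht
  · exact ⟨_, h.right_mem, h'.right_mem⟩
  have hx0 := (hT _ h'.left_mem)
  simp only at hx0
  set T' : Set (ℤ × ℤ) := T ∪ {p | p.1 = 1 ∧ (p.2 ≤ yb ∨ yt ≤ p.2)} with hT'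
  have hS' : Conn Adj4 (S ∪ {((1 : ℤ), y)}) a (1, y) :=
    (h.mono subset_union_left).step (by simp [Adj4]) (by simp)
  have col : ∀ (c : ℤ) (k : ℕ), (c + k ≤ yb ∨ yt ≤ c) → Conn Adj4 T' (1, c) (1, c + k) := by
    intro c k hc
    have := Conn.of_seq (r := Adj4) (S := T') (w := fun i : ℕ => ((1 : ℤ), c + i)) (Nat.zero_le k)
      (fun i _ _ => by simp [Adj4]; left; ring)
      (fun i _ hi => Or.inr ⟨rfl, by simp only; omega⟩)
    simpa using this
  have c1 := col (min y0 yb) (yb - min y0 yb).toNat (by left; omega)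
  have c2 := col yt (max y1 yt - yt).toNat (by right; omega)
  rw [show min y0 yb + ((yb - min y0 yb).toNat : ℤ) = yb by omega] at c1
  rw [show yt + ((max y1 yt - yt).toNat : ℤ) = max y1 yt by omega] at c2
  have c3 : Conn Adj4 T' (0, yb) (0, yt) := h'.mono subset_union_left
  have c4 : Conn Adj4 T' (1, yb) (0, yb) :=
    Conn.edge c1.right_mem (by simp [Adj4]) (Or.inl h'.left_mem)
  have c5 : Conn Adj4 T' (0, yt) (1, yt) :=
    Conn.edge c3.right_mem (by simp [Adj4]) c2.left_mem
  have c := (((c1.trans c4).trans c3).trans c5).trans c2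
  obtain ⟨z, hz, hz'⟩ := hS'.meet (c.rel_mono fun _ _ h => h.adj8) (x0 := x0) (x1 := 1) (y0 := y0)
    (y1 := y1) (by
      rintro p (hp | rfl)
      · exact (hS p hp).2
      · exact (hS _ h.right_mem).2) (by
      rintro p (hp | hp)
      · have := hT p hp; omega
      · have := hp.1; omega) ha le_rfl (min_le_left _ _) (le_max_left _ _)
  rcases hz with hz | rfl
  · rcases hz' with hz' | hz'
    · exact ⟨z, hz, hz'⟩
    · have := (hS z hz).1; have := hz'.1; omega
  · rcases hz' with hz' | hz'
    · have := (hT _ hz').2; simp only at this; omega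
    · have := hz'.2; simp only at this; omega

lemma hook_conn {S T U : Set (ℤ × ℤ)} {a q qb qt : ℤ × ℤ} {x0 y0 y1 : ℤ}
    (h : Conn Adj4 S a q) (h' : Conn Adj4 T qb qt) (hq : q.1 = 0) (hqb : qb.1 = 0) (hqt : qt.1 = 0)
    (hS : ∀ p ∈ S, p.1 ≤ 0 ∧ y0 ≤ p.2 ∧ p.2 ≤ y1) (hT : ∀ p ∈ T, x0 ≤ p.1 ∧ p.1 ≤ 0)
    (ha : a.1 ≤ x0) (hb : qb.2 ≤ q.2) (ht : q.2 ≤ qt.2) (hSU : S ⊆ U) (hTU : T ⊆ U) :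
    Conn Adj4 U a qb := by
  obtain ⟨q1, q2⟩ := q
  obtain ⟨b1, b2⟩ := qb
  obtain ⟨t1, t2⟩ := qt
  simp only at hq hqb hqt hb ht
  subst hq hqb hqt
  obtain ⟨z, hz, hz'⟩ := hook_meet h.cluster h'.cluster
    (fun p hp => hS p (Conn.right_mem hp)) (fun p hp => hT p (Conn.right_mem hp)) ha hb ht
  exact (Conn.mono hSU hz).trans ((Conn.mono hTU hz').symm fun _ _ h => h.symm)

/-- The four corner arcs of the box of radius `t` centred at `(-t, 0)` are joined. -/
def XEv (t α : ℤ) (O : Set (ℤ × ℤ)) : Prop :=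
  ∃ q1 q2 q3 q4 : ℤ × ℤ, (q1.1 = 0 ∧ α ≤ q1.2) ∧ (q2.1 = 0 ∧ q2.2 ≤ -α) ∧
    (q3.1 = -(2 * t) ∧ α ≤ q3.2) ∧ (q4.1 = -(2 * t) ∧ q4.2 ≤ -α) ∧
    Conn Adj4 (O ∩ rect (-(2 * t)) 0 (-t) t) q2 q1 ∧ Conn Adj4 (O ∩ rect (-(2 * t)) 0 (-t) t) q2 q3 ∧
    Conn Adj4 (O ∩ rect (-(2 * t)) 0 (-t) t) q4 q3

lemma good_xEv (t α : ℤ) : Good (XEv t α) where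
  mono := by
    rintro O O' hO ⟨q1, q2, q3, q4, h1, h2, h3, h4, c1, c2, c3⟩
    exact ⟨q1, q2, q3, q4, h1, h2, h3, h4, c1.mono (inter_subset_inter_left _ hO),
      c2.mono (inter_subset_inter_left _ hO), c3.mono (inter_subset_inter_left _ hO)⟩
  loc := ⟨_, rect_finite (-(2 * t)) 0 (-t) t, by
    rintro O O' hO ⟨q1, q2, q3, q4, h1, h2, h3, h4, c1, c2, c3⟩
    exact ⟨q1, q2, q3, q4, h1, h2, h3, h4, conn_inter_congr hO c1, conn_inter_congr hO c2,
      conn_inter_congr hO c3⟩⟩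

/-- The reflection in the line `x = -t`. -/
def mirror (t : ℤ) (p : ℤ × ℤ) : ℤ × ℤ := (-p.1 - 2 * t, p.2)

lemma mirror_mirror (t : ℤ) (p : ℤ × ℤ) : mirror t (mirror t p) = p := by
  ext <;> simp [mirror]
lemma adj4_mirror (t : ℤ) (p q : ℤ × ℤ) (h : Adj4 p q) : Adj4 (mirror t p) (mirror t q) := by
  unfold Adj4 mirror at *; simp only; omega

lemma conn_mirror {t a b c d a' b' : ℤ} {O : Set (ℤ × ℤ)} {p q : ℤ × ℤ}
    (h : Conn Adj4 (mirror t ⁻¹' O ∩ rect a b c d) p q) (ha : a' ≤ -b - 2 * t)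
    (hb : -a - 2 * t ≤ b') : Conn Adj4 (O ∩ rect a' b' c d) (mirror t p) (mirror t q) := by
  refine h.map _ (adj4_mirror t) ?_
  rintro x ⟨hx, hx'⟩
  refine ⟨hx, ?_⟩
  simp only [rect, mem_ofPred_eq, mirror] at *; omega

lemma conn_mirror' {t a b c d a' b' : ℤ} {O : Set (ℤ × ℤ)} {p q : ℤ × ℤ}
    (h : Conn Adj4 (O ∩ rect a b c d) p q) (ha : a' ≤ -b - 2 * t)
    (hb : -a - 2 * t ≤ b') : Conn Adj4 (mirror t ⁻¹' O ∩ rect a' b' c d) (mirror t p) (mirror t q) := by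
  refine h.map _ (adj4_mirror t) ?_
  rintro x ⟨hx, hx'⟩
  refine ⟨by rw [mem_preimage, mirror_mirror]; exact hx, ?_⟩
  simp only [rect, mem_ofPred_eq, mirror] at *; omega

lemma conn_reflY {a b c : ℤ} {O : Set (ℤ × ℤ)} {p q : ℤ × ℤ}
    (h : Conn Adj4 (reflY ⁻¹' O ∩ rect a b (-c) c) p q) :
    Conn Adj4 (O ∩ rect a b (-c) c) (reflY p) (reflY q) := by
  refine h.map _ adj4_reflY ?_
  rintro x ⟨hx, hx'⟩
  refine ⟨hx, ?_⟩
  simp only [rect, mem_ofPred_eq, reflY] at *; omega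

namespace Perc
variable {D d0 s0 : ℤ} {err : ℝ} (M : Perc D d0 s0 err)

lemma mirror_eq {E : Set (ℤ × ℤ) → Prop} (hE : Local E) (t : ℤ) :
    M.pr (fun O => E (mirror t ⁻¹' O)) = M.pr E := by
  rw [← M.reflX_eq E hE, ← M.shift_eq _ (hE.preimage reflX) (-(2 * t), 0)]
  congr 1; ext O
  have : mirror t ⁻¹' O = reflX ⁻¹' (shift (-(2 * t), 0) ⁻¹' O) := by
    ext p; simp [mirror, reflX, shift, sub_eq_add_neg]
  rw [this]

lemma hub_annulus {s : ℤ} (hs : 0 ≤ s) : M.G (6 * s) (2 * s) ^ 4 ≤ M.pr (Hub (annulus s) s) := by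
  have e1 : M.G (6 * s) (2 * s) ≤ M.pr (VCross s (3 * s) (-(3 * s)) (3 * s)) := by
    rw [pr_vcross]; apply le_of_eq; congr 1 <;> ring
  have e2 : M.G (6 * s) (2 * s) ≤ M.pr (VCross (-(3 * s)) (-s) (-(3 * s)) (3 * s)) := by
    rw [pr_vcross]; apply le_of_eq; congr 1 <;> ring
  have e3 : M.G (6 * s) (2 * s) ≤ M.pr (HCross (-(3 * s)) (3 * s) s (3 * s)) := by
    rw [pr_hcross]; apply le_of_eq; congr 1 <;> ring
  have e4 : M.G (6 * s) (2 * s) ≤ M.pr (HCross (-(3 * s)) (3 * s) (-(3 * s)) (-s)) := by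
    rw [pr_hcross]; apply le_of_eq; congr 1 <;> ring
  have h0 := M.G_nonneg (6 * s) (2 * s)
  have := M.fkg_le ((good_vcross _ _ _ _).and (good_vcross _ _ _ _))
    ((good_hcross _ _ _ _).and (good_hcross _ _ _ _))
    (M.fkg_le (good_vcross _ _ _ _) (good_vcross _ _ _ _) e1 e2 h0)
    (M.fkg_le (good_hcross _ _ _ _) (good_hcross _ _ _ _) e3 e4 h0) (by positivity)
  refine (le_of_eq (by ring)).trans (this.trans (M.mono _ _ ?_))
  rintro O ⟨⟨h1, h2⟩, h3, h4⟩
  exact hub_of_crossings hs h1 h2 h3 h4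

lemma exists_alpha {m : ℤ} (hm : 0 ≤ m) (hD : 2 * m ≤ D) :
    ∃ α β : ℤ, 0 ≤ α ∧ α ≤ m ∧ 0 ≤ β ∧ β ≤ m ∧ β ≤ α + 1 ∧ 1 / 16 ≤ M.pr (TEv m α m) ∧
      1 / 16 ≤ M.pr (TEv m 0 β) := by
  have hsq : 1 / 4 ≤ M.pr (HCross (-(2 * m)) 0 (-m) m) := by
    rw [pr_hcross]; refine (M.square_le (by omega) hD).trans (le_of_eq ?_); congr 1 <;> ring
  have h8 : 1 / 8 ≤ M.pr (TEv m 0 m) := by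
    have h1 : M.pr (HCross (-(2 * m)) 0 (-m) m) ≤
        M.pr (TEv m 0 m) + M.pr (fun O => TEv m 0 m (reflY ⁻¹' O)) := by
      refine (M.mono _ _ ?_).trans (M.union _ _)
      rintro O ⟨p, q, hp, hq, h⟩
      rcases le_total 0 q.2 with h0 | h0
      · exact Or.inl ⟨p, q, hp, hq, h0, h.right_mem.2.2.2, h⟩
      · refine Or.inr ⟨reflY p, reflY q, hp, hq, by simp [reflY, h0], ?_, ?_⟩
        · have := h.right_mem.2.2.1; simp only [reflY]; omega
        · apply conn_reflY
          have : reflY ⁻¹' (reflY ⁻¹' O) = O := by ext p; simp [reflY]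
          rwa [this]
    rw [M.reflY_eq _ (good_tEv _ _ _).loc] at h1
    linarith
  by_cases htop : 1 / 16 ≤ M.pr (TEv m m m)
  · exact ⟨m, m, hm, le_rfl, hm, le_rfl, by omega, htop, by linarith⟩
  · obtain ⟨k, hk⟩ : ∃ k : ℕ, (k : ℤ) = m := ⟨m.toNat, by omega⟩
    have key : ∀ j : ℕ, j ≤ k → ¬ (1 / 16 ≤ M.pr (TEv m j m)) →
        ∃ i : ℕ, i < k ∧ 1 / 16 ≤ M.pr (TEv m i m) ∧ ¬ (1 / 16 ≤ M.pr (TEv m (i + 1 : ℕ) m)) := by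
      intro j
      induction j with
      | zero => intro _ h; exact absurd (by push_cast; linarith) h
      | succ j ih =>
        intro hj h
        by_cases h' : 1 / 16 ≤ M.pr (TEv m j m)
        · exact ⟨j, by omega, h', h⟩
        · exact ih (by omega) h'
    obtain ⟨i, hi, h1, h2⟩ := key k le_rfl (by rw [hk]; exact htop)
    refine ⟨i, i + 1, by omega, by omega, by omega, by omega, le_rfl, h1, ?_⟩
    have : M.pr (TEv m 0 m) ≤ M.pr (TEv m 0 (i + 1)) + M.pr (TEv m (i + 1 : ℕ) m) := by
      refine (M.mono _ _ ?_).trans (M.union _ _)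
      rintro O ⟨p, q, hp, hq, h0, h1, h⟩
      rcases le_total q.2 (i + 1) with h2 | h2
      · exact Or.inl ⟨p, q, hp, hq, h0, h2, h⟩
      · exact Or.inr ⟨p, q, hp, hq, by push_cast; exact h2, h1, h⟩
    push Not at h2
    linarith

lemma wide_of_hub {m s β : ℤ} {R : Set (ℤ × ℤ)} {q : ℝ} (hs : 0 ≤ s) (hsm : 3 * s ≤ m)
    (hβ : β ≤ s) (hR : R ⊆ rect (-(3 * s)) (3 * s) (-(3 * s)) (3 * s)) (hq0 : 0 ≤ q)
    (hq : q ≤ M.pr (Hub R s)) (hT : 1 / 16 ≤ M.pr (TEv m 0 β)) :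
    (1 / 16) ^ 2 * q ≤ M.G (4 * m) (2 * m) := by
  have hT' : 1 / 16 ≤ M.pr (fun O => TEv m 0 β (mirror 0 ⁻¹' O)) := by
    rw [M.mirror_eq (good_tEv _ _ _).loc]; exact hT
  have h1 := M.fkg_le ((good_tEv m 0 β).and ((good_tEv m 0 β).preimage (mirror 0)))
    (good_hub ((rect_finite _ _ _ _).subset hR) s)
    (M.fkg_le (good_tEv m 0 β) ((good_tEv m 0 β).preimage (mirror 0)) hT hT' (by norm_num)) hq hq0
  have h2 : M.G (4 * m) (2 * m) = M.pr (HCross (-(2 * m)) (2 * m) (-m) m) := by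
    rw [pr_hcross]; congr 1 <;> ring
  rw [h2]
  refine (le_of_eq (by ring)).trans (h1.trans (M.mono _ _ ?_))
  rintro O ⟨⟨⟨p, q, hp, hq, hq0, hqβ, hc⟩, p', q', hp', hq', hq0', hqβ', hc'⟩, z, hz⟩
  have hc' := conn_mirror (a' := 0) (b' := 2 * m) hc' (by omega) (by omega)
  have hsymm : ∀ x y, Adj4 x y → Adj4 y x := fun _ _ h => h.symm
  obtain ⟨y, hy, hzy⟩ := hz _ q p (hc.cluster.symm hsymm)
    (max_le (abs_le.2 (by omega)) (abs_le.2 (by omega)))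
    (le_trans (le_trans (by omega : 3 * s ≤ -p.1) (neg_le_abs p.1)) (le_max_left _ _))
  obtain ⟨y', hy', hzy'⟩ := hz _ (mirror 0 q') (mirror 0 p') (hc'.cluster.symm hsymm)
    (max_le (abs_le.2 (by simp only [mirror]; omega)) (abs_le.2 (by simp only [mirror]; omega)))
    (le_trans ((by simp only [mirror]; omega : 3 * s ≤ (mirror 0 p').1).trans (le_abs_self _)) (le_max_left _ _))
  have sub : ∀ {a b c d : ℤ}, -(2 * m) ≤ a → b ≤ 2 * m → -m ≤ c → d ≤ m →
      O ∩ rect a b c d ⊆ O ∩ rect (-(2 * m)) (2 * m) (-m) m := by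
    rintro a b c d h1 h2 h3 h4 x ⟨hx, hx'⟩
    refine ⟨hx, ?_⟩
    simp only [rect, mem_ofPred_eq] at *; omega
  have sR : O ∩ R ⊆ O ∩ rect (-(2 * m)) (2 * m) (-m) m :=
    (inter_subset_inter_right _ hR).trans (sub (by omega) (by omega) (by omega) (by omega))
  have k1 := Conn.mono (sub (by omega) (by omega) (by omega) (by omega)) hy
  have k2 := Conn.mono (sub (by omega) (by omega) (by omega) (by omega)) hy'
  refine ⟨p, mirror 0 p', hp, by simp [mirror, hp'], ?_⟩
  exact (((k1.trans ((hzy.mono sR).symm hsymm))).trans (hzy'.mono sR)).trans (k2.symm hsymm)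

lemma pr_xEv {t α : ℤ} (ht : 0 ≤ t) (hD : 2 * t ≤ D) (hT : 1 / 16 ≤ M.pr (TEv t α t)) :
    (1 / 16) ^ 4 * (1 / 4) ≤ M.pr (XEv t α) := by
  have g1 := good_tEv t α t
  have g2 := g1.preimage reflY
  have g3 := g1.preimage (mirror t)
  have g4 := g2.preimage (mirror t)
  have gV := good_vcross (-(2 * t)) 0 (-t) t
  have h2 : 1 / 16 ≤ M.pr (fun O => TEv t α t (reflY ⁻¹' O)) := by
    rw [M.reflY_eq _ g1.loc]; exact hT
  have h3 : 1 / 16 ≤ M.pr (fun O => TEv t α t (mirror t ⁻¹' O)) := by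
    rw [M.mirror_eq g1.loc]; exact hT
  have h4 : 1 / 16 ≤ M.pr (fun O => TEv t α t (reflY ⁻¹' (mirror t ⁻¹' O))) := by
    rw [M.mirror_eq g2.loc]; exact h2
  have hV : 1 / 4 ≤ M.pr (VCross (-(2 * t)) 0 (-t) t) := by
    rw [pr_vcross]; refine (M.square_le (by omega) hD).trans (le_of_eq ?_); congr 1 <;> ring
  have := M.fkg_le ((g1.and g2).and (g3.and g4)) gV
    (M.fkg_le (g1.and g2) (g3.and g4) (M.fkg_le g1 g2 hT h2 (by norm_num))
      (M.fkg_le g3 g4 h3 h4 (by norm_num)) (by norm_num)) hV (by norm_num)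
  refine (le_of_eq (by ring)).trans (this.trans (M.mono _ _ ?_))
  rintro O ⟨⟨⟨⟨p1, q1, hp1, hq1, ha1, -, c1⟩, p2, q2, hp2, hq2, ha2, -, c2⟩,
    ⟨p3, q3, hp3, hq3, ha3, -, c3⟩, p4, q4, hp4, hq4, ha4, -, c4⟩, a, b, ha, hb, hc⟩
  have hsymm : ∀ x y, Adj4 x y → Adj4 y x := fun _ _ h => h.symm
  have c2 := conn_reflY c2
  have c3 := (conn_mirror (a' := -(2 * t)) (b' := 0) c3 (by omega) (by omega)).symm hsymm
  have c4 := (conn_mirror (a' := -(2 * t)) (b' := 0) (conn_reflY c4) (by omega) (by omega)).symm hsymm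
  have key : ∀ {p q : ℤ × ℤ}, p.1 = -(2 * t) → q.1 = 0 →
      Conn Adj4 (O ∩ rect (-(2 * t)) 0 (-t) t) p q → Conn Adj4 (O ∩ rect (-(2 * t)) 0 (-t) t) p a := by
    intro p q hp hq h
    exact conn_of_cross h hc (fun p hp => hp.2.2) (fun p hp => hp.2.1) (by omega) (by omega)
      (by omega) (by omega) Subset.rfl Subset.rfl
  have k1 := (c1.symm hsymm).trans (key hp1 hq1 c1)
  have k2 := (c2.symm hsymm).trans (key (by simpa [reflY] using hp2) (by simpa [reflY] using hq2) c2)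
  have k3 := key (by simp [mirror, hq3]) (by simp [mirror, hp3]) c3
  have k4 := key (by simp [mirror, reflY, hq4]) (by simp [mirror, reflY, hp4]) c4
  refine ⟨q1, reflY q2, mirror t q3, mirror t (reflY q4), ⟨hq1, ha1⟩, ⟨hq2, ?_⟩, ⟨?_, ha3⟩,
    ⟨?_, ?_⟩, k2.trans (k1.symm hsymm), k2.trans (k3.symm hsymm), k4.trans (k3.symm hsymm)⟩
  · simp only [reflY]; omega
  · simp [mirror, hq3]
  · simp [mirror, reflY, hq4]
  · simp only [mirror, reflY]; omega

lemma wide_of_good {m t α β : ℤ} (ht : 0 ≤ t) (htm : t ≤ m) (hmt : m ≤ 2 * t)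
    (hD : 2 * t ≤ D) (hα : α ≤ t) (hβ : β ≤ 2 * α)
    (hT : 1 / 16 ≤ M.pr (TEv t α t)) (hT' : 1 / 16 ≤ M.pr (TEv m 0 β)) :
    (1 / 16) ^ 6 * (1 / 4) ≤ M.G (4 * m - 2 * t) (m + 2 * t) := by
  have g1 := good_tEv m 0 β
  have g2 := g1.preimage (mirror t)
  have g3 := (good_xEv t α).preimage (shift (0, α))
  have h2 : 1 / 16 ≤ M.pr (fun O => TEv m 0 β (mirror t ⁻¹' O)) := by
    rw [M.mirror_eq g1.loc]; exact hT'
  have h3 : (1 / 16) ^ 4 * (1 / 4) ≤ M.pr (fun O => XEv t α (shift (0, α) ⁻¹' O)) := by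
    rw [M.shift_eq _ (good_xEv t α).loc]; exact M.pr_xEv ht hD hT
  have := M.fkg_le (g1.and g2) g3 (M.fkg_le g1 g2 hT' h2 (by norm_num)) h3 (by norm_num)
  have h4 : M.G (4 * m - 2 * t) (m + 2 * t) = M.pr (HCross (-(2 * m)) (2 * m - 2 * t) (-m) (2 * t)) := by
    rw [pr_hcross]; congr 1 <;> ring
  rw [h4]
  refine (le_of_eq (by ring)).trans (this.trans (M.mono _ _ ?_))
  rintro O ⟨⟨⟨p, q, hp, hq, hq0, hqβ, hc⟩, p', q', hp', hq', hq0', hqβ', hc'⟩,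
    q1, q2, q3, q4, ⟨h1, h1'⟩, ⟨h2, h2'⟩, ⟨h3, h3'⟩, ⟨h4, h4'⟩, c1, c2, c3⟩
  have hsymm : ∀ x y, Adj4 x y → Adj4 y x := fun _ _ h => h.symm
  have mv : ∀ {a b : ℤ × ℤ}, Conn Adj4 (shift (0, α) ⁻¹' O ∩ rect (-(2 * t)) 0 (-t) t) a b →
      Conn Adj4 (O ∩ rect (-(2 * t)) 0 (-m) (2 * t)) (shift (0, α) a) (shift (0, α) b) := by
    intro a b h
    refine h.map _ (adj4_shift _) ?_
    rintro x ⟨hx, hx'⟩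
    refine ⟨hx, ?_⟩
    simp only [rect, mem_ofPred_eq, shift] at *; omega
  have c1 := mv c1
  have c2 := mv c2
  have c3 := mv c3
  set U := rect (-(2 * m)) (2 * m - 2 * t) (-m) (2 * t) with hU
  have sub : ∀ {a b c d : ℤ}, -(2 * m) ≤ a → b ≤ 2 * m - 2 * t → -m ≤ c → d ≤ 2 * t →
      O ∩ rect a b c d ⊆ O ∩ U := by
    rintro a b c d h1 h2 h3 h4 x ⟨hx, hx'⟩
    refine ⟨hx, ?_⟩
    simp only [hU, rect, mem_ofPred_eq] at *; omega
  have k1 : Conn Adj4 (O ∩ U) p (shift (0, α) q2) := by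
    refine hook_conn hc c1 hq (by simpa [shift] using h2) (by simpa [shift] using h1)
      (x0 := -(2 * t)) (y0 := -m) (y1 := m) (fun p hp => ⟨hp.2.1.2, hp.2.2⟩)
      (fun p hp => hp.2.1) (by omega) ?_ ?_ (sub (by omega) (by omega) (by omega) (by omega))
      (sub (by omega) (by omega) (by omega) (by omega))
    · simp only [shift]; omega
    · simp only [shift]; omega
  have c3' := conn_mirror' (t := t) (a' := -(2 * t)) (b' := 0) c3 (by omega) (by omega)
  have k2 : Conn Adj4 (mirror t ⁻¹' O ∩ rect (-(2 * m)) 0 (-m) (2 * t)) p' (mirror t (shift (0, α) q4)) := by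
    refine hook_conn hc' c3' hq' (by simp [mirror, shift, h4]) (by simp [mirror, shift, h3])
      (x0 := -(2 * t)) (y0 := -m) (y1 := m) (fun p hp => ⟨hp.2.1.2, hp.2.2⟩)
      (fun p hp => hp.2.1) (by omega) ?_ ?_ ?_ ?_
    · simp only [mirror, shift]; omega
    · simp only [mirror, shift]; omega
    · rintro x ⟨hx, hx'⟩
      refine ⟨hx, ?_⟩
      simp only [rect, mem_ofPred_eq] at *; omega
    · rintro x ⟨hx, hx'⟩
      refine ⟨hx, ?_⟩
      simp only [rect, mem_ofPred_eq] at *; omega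
  have k3 := conn_mirror (a' := -(2 * t)) (b' := 2 * m - 2 * t) k2 (by omega) (by omega)
  rw [mirror_mirror] at k3
  have k3 := k3.mono (sub (by omega) (by omega) (by omega) (by omega))
  have k4 := c2.mono (sub (by omega) (by omega) (by omega) (by omega))
  have k5 := c3.mono (sub (by omega) (by omega) (by omega) (by omega))
  refine ⟨p, mirror t p', hp, by simp only [mirror]; omega, ?_⟩
  exact (((k1.trans k4).trans (k5.symm hsymm)).trans (k3.symm hsymm))

end Perc

/-- The universal lower bound for the probability of a hub at a good scale. -/
def hubConst : ℝ := (((1 / 16) ^ 6 * (1 / 4) * (1 / 4)) ^ 24 * (1 / 4)) ^ 4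

/-- The lower bound for the probability of a hub deduced from a hub of smaller radius. -/
def hubStep (q : ℝ) : ℝ := (((1 / 16) ^ 2 * q * (1 / 4)) ^ 2 * (1 / 4)) ^ 4

lemma hubConst_pos : 0 < hubConst := by unfold hubConst; positivity

lemma hubConst_le : hubConst ≤ hubStep (1 / 4) := by unfold hubConst hubStep; norm_num

lemma hubConst_lt_one : hubConst < 1 := by unfold hubConst; norm_num

lemma hubStep_pos {q : ℝ} (hq : 0 < q) : 0 < hubStep q := by unfold hubStep; positivity

/-- An open path from the box of radius `r` to the outside of the box of radius `R`. -/
def Arm (r R : ℤ) (O : Set (ℤ × ℤ)) : Prop :=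
  ∃ a b : ℤ × ℤ, max |a.1| |a.2| ≤ r ∧ R ≤ max |b.1| |b.2| ∧ Conn Adj4 O a b

namespace Perc
variable {D d0 s0 : ℤ} {err : ℝ} (M : Perc D d0 s0 err)

lemma hub_of_good {t α β : ℤ} (ht : 1 ≤ t) (hD : 4 * t ≤ D) (hα : α ≤ t) (hβ : β ≤ 2 * α)
    (hT : 1 / 16 ≤ M.pr (TEv t α t)) (hT' : 1 / 16 ≤ M.pr (TEv ((3 * t + 1) / 2) 0 β)) :
    hubConst ≤ M.pr (Hub (annulus (2 * t)) (2 * t)) := by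
  set m := (3 * t + 1) / 2 with hm
  have h1 := M.wide_of_good (m := m) (by omega) (by omega) (by omega) (by omega) hα hβ hT hT'
  have h2 := M.G_iterate (h := m + 2 * t) (e := 3 * m - 4 * t) (by omega) (by omega) (by omega) 24
  have h3 : M.G (m + 2 * t + (24 : ℕ) * (3 * m - 4 * t)) (m + 2 * t) ≤ M.G (6 * (2 * t)) (2 * (2 * t)) :=
    M.G_mono (by omega) (by push_cast; omega) (by omega)
  rw [show m + 2 * t + (3 * m - 4 * t) = 4 * m - 2 * t by ring] at h2
  refine le_trans ?_ (M.hub_annulus (by omega))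
  unfold hubConst
  refine pow_le_pow_left₀ (by positivity) (le_trans ?_ (h2.trans h3)) 4
  gcongr

lemma hub_of_hub {m s β : ℤ} {R : Set (ℤ × ℤ)} {q : ℝ} (hs : 0 ≤ s) (hsm : 3 * s ≤ m)
    (hD : 2 * m ≤ D)
    (hβ : β ≤ s) (hR : R ⊆ rect (-(3 * s)) (3 * s) (-(3 * s)) (3 * s)) (hq0 : 0 ≤ q)
    (hq : q ≤ M.pr (Hub R s)) (hT : 1 / 16 ≤ M.pr (TEv m 0 β)) :
    hubStep q ≤ M.pr (Hub (annulus m) m) := by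
  have h1 := M.wide_of_hub hs hsm hβ hR hq0 hq hT
  have h2 := M.G_iterate (h := 2 * m) (e := 2 * m) (by omega) (by omega) (by omega) 2
  rw [show 2 * m + 2 * m = 4 * m by ring, show 2 * m + (2 : ℕ) * (2 * m) = 6 * m by push_cast; ring] at h2
  refine le_trans ?_ (M.hub_annulus (by omega))
  unfold hubStep
  refine pow_le_pow_left₀ (by positivity) (le_trans ?_ h2) 4
  gcongr

/-- The scales `u, 3u/2, 9u/4, …`. -/
def chain (u : ℤ) : ℕ → ℤ
  | 0 => u
  | i + 1 => (3 * chain u i + 1) / 2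

lemma chain_bounds {u : ℤ} (hu : 1 ≤ u) (i : ℕ) : u ≤ chain u i ∧ chain u i ≤ 2 ^ i * u ∧
    (chain u i + 1) * 2 ^ i ≤ (u + 1) * 3 ^ i := by
  induction i with
  | zero => simp [chain]
  | succ i ih =>
    obtain ⟨h1, h2, h3⟩ := ih
    have e : 2 * chain u (i + 1) ≤ 3 * chain u i + 1 := by simp only [chain]; omega
    refine ⟨by simp only [chain]; omega, ?_, ?_⟩
    · rw [pow_succ]; nlinarith
    · rw [pow_succ, pow_succ]
      have : (0 : ℤ) < 2 ^ i := by positivity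
      nlinarith

lemma exists_hub_of_chain {α β : ℤ → ℤ} {u a : ℤ} {I : ℕ}
    (H : ∀ m, 0 ≤ m → 2 * m ≤ D → 0 ≤ α m ∧ α m ≤ m ∧ 0 ≤ β m ∧ β m ≤ m ∧ β m ≤ α m + 1 ∧
      1 / 16 ≤ M.pr (TEv m (α m) m) ∧ 1 / 16 ≤ M.pr (TEv m 0 (β m)))
    (hu : 1 ≤ u) (ha : a ≤ α u) (hI : (u + 1) * 3 ^ I ≤ a * 4 ^ I)
    (hD : 4 * (2 ^ I * u) ≤ D) :
    ∃ v, u ≤ v ∧ v ≤ 2 ^ I * u ∧ hubConst ≤ M.pr (Hub (annulus (2 * v)) (2 * v)) := by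
  by_contra! hcon
  have hle : ∀ i ≤ I, chain u i ≤ 2 ^ I * u := fun i hi =>
    (chain_bounds hu i).2.1.trans (by gcongr; norm_num)
  have key : ∀ i ≤ I, a * 2 ^ i ≤ α (chain u i) := by
    intro i
    induction i with
    | zero => intro _; simpa [chain] using ha
    | succ i ih =>
      intro hi
      have ih := ih (by omega)
      have b := chain_bounds hu i
      have l1 := hle i (by omega)
      have l2 := hle (i + 1) hi
      have b' := chain_bounds hu (i + 1)
      have h1 := H (chain u i) (by omega) (by omega)
      have h2 := H (chain u (i + 1)) (by omega) (by omega)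
      by_cases hβ : β (chain u (i + 1)) ≤ 2 * α (chain u i)
      · exact absurd (M.hub_of_good (by omega) (by omega) h1.2.1 hβ h1.2.2.2.2.2.1 h2.2.2.2.2.2.2)
          (not_le.2 (hcon _ b.1 l1))
      · have e : a * 2 ^ (i + 1) = 2 * (a * 2 ^ i) := by ring
        omega
  have h := key I le_rfl
  have b := chain_bounds hu I
  have h2 := (H (chain u I) (by omega) (by have := hle I le_rfl; omega)).2.1
  have e : (4 : ℤ) ^ I = 2 ^ I * 2 ^ I := by rw [← mul_pow]; norm_num
  have : (0 : ℤ) < 2 ^ I := by positivity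
  rw [e] at hI
  nlinarith

/-- Disjoint closed hubs at well separated scales are almost independent. -/
lemma pr_no_hub {σ : ℕ → ℤ} {q : ℝ} (hq1 : q ≤ 1) (herr : 0 ≤ err) (n : ℕ) (h0 : 0 < σ 0)
    (hd : d0 ≤ σ 0)
    (hσ : ∀ i, i + 1 < n → 8 * σ i ≤ σ (i + 1)) (hD : ∀ i < n, 3 * σ i ≤ D)
    (hq : ∀ i < n, q ≤ M.pr (Hub (annulus (σ i)) (σ i))) :
    M.pr (fun O => ∀ i < n, ¬ Hub (annulus (σ i)) (σ i) Oᶜ) ≤ (1 - q) ^ n + n * err := by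
  have hmono : ∀ j, j < n → σ 0 ≤ σ j ∧ ∀ i ≤ j, σ i ≤ σ j := by
    intro j
    induction j with
    | zero => intro _; exact ⟨le_rfl, fun i hi => by rw [Nat.le_zero.1 hi]⟩
    | succ j ih =>
      intro hj
      obtain ⟨h1, h2⟩ := ih (by omega)
      have := hσ j hj
      refine ⟨by omega, fun i hi => ?_⟩
      rcases hi.lt_or_eq with hi | rfl
      · have := h2 i (by omega); omega
      · rfl
  have key : ∀ k ≤ n, M.pr (fun O => ∀ i < k, ¬ Hub (annulus (σ i)) (σ i) Oᶜ)
      ≤ (1 - q) ^ k + k * err := by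
    intro k
    induction k with
    | zero => intro _; simpa using M.le_one _
    | succ k ih =>
      intro hk
      have ih := ih (by omega)
      have o1 : ∀ i, OnlyOn (fun O => ¬ Hub (annulus (σ i)) (σ i) Oᶜ) (annulus (σ i)) := fun i =>
        ((onlyOn_hub (annulus (σ i)) (σ i)).compl).not
      have o2 : OnlyOn (fun O => ∀ i < k, ¬ Hub (annulus (σ i)) (σ i) Oᶜ)
          (⋃ i ∈ {i | i < k}, annulus (σ i)) := by
        intro O O' h hO i hi
        exact ((o1 i).mono (subset_biUnion_of_mem (u := fun i => annulus (σ i)) hi)) O O' h (hO i hi)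
      have m1 := M.mix _ _ _ _ o2 (o1 k) (by
        refine iUnion₂_subset fun i hi => ?_
        have h1 := hD i (by have : i < k := hi; omega)
        refine (annulus_subset (σ i)).trans ?_
        rintro p hp
        simp only [rect, mem_ofPred_eq] at *; omega) (by
        have h1 := hD k (by omega)
        refine (annulus_subset (σ k)).trans ?_
        rintro p hp
        simp only [rect, mem_ofPred_eq] at *; omega) (by
        intro p hpU p' hp'
        obtain ⟨i, hi, hp⟩ : ∃ i, i < k ∧ p ∈ annulus (σ i) := by simpa using hpU
        obtain ⟨l, rfl⟩ : ∃ l, k = l + 1 := ⟨k - 1, by omega⟩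
        have h1 := (hmono l (by omega)).2 i (by omega)
        have h1' := (hmono l (by omega)).1
        have h2 := hσ l (by omega)
        have a1 := abs_le.1 ((le_max_left _ _).trans hp.2)
        have a2 := abs_le.1 ((le_max_right _ _).trans hp.2)
        have a3 := hp'.1
        have b1 := le_abs_self (p.1 - p'.1)
        have b2 := neg_le_abs (p.1 - p'.1)
        have b3 := le_abs_self (p.2 - p'.2)
        have b4 := neg_le_abs (p.2 - p'.2)
        rcases le_max_iff.1 a3 with a3 | a3
        · left; rcases le_abs.1 a3 with a3 | a3 <;> omega
        · right; rcases le_abs.1 a3 with a3 | a3 <;> omega)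
      have hloc : Local (Hub (annulus (σ k)) (σ k)) := (good_hub (annulus_finite _) _).loc
      have m2 : M.pr (fun O => ¬ Hub (annulus (σ k)) (σ k) Oᶜ) ≤ 1 - q := by
        rw [M.not_eq (fun O => Hub (annulus (σ k)) (σ k) Oᶜ) ⟨_, annulus_finite (σ k),
          (onlyOn_hub (annulus (σ k)) (σ k)).compl⟩, M.compl_eq _ hloc]
        linarith [hq k (by omega)]
      have m3 : M.pr (fun O => ∀ i < k + 1, ¬ Hub (annulus (σ i)) (σ i) Oᶜ) ≤
          M.pr (fun O => (∀ i < k, ¬ Hub (annulus (σ i)) (σ i) Oᶜ) ∧ ¬ Hub (annulus (σ k)) (σ k) Oᶜ) :=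
        M.mono _ _ fun O h => ⟨fun i hi => h i (by omega), h k (by omega)⟩
      have n1 := M.nonneg (fun O => ¬ Hub (annulus (σ k)) (σ k) Oᶜ)
      have n2 := M.le_one (fun O => ¬ Hub (annulus (σ k)) (σ k) Oᶜ)
      have p0 : 0 ≤ (1 - q) ^ k := pow_nonneg (by linarith) k
      have : 0 ≤ (k : ℝ) * err := by positivity
      calc _ ≤ _ := m3
        _ ≤ _ := m1
        _ ≤ ((1 - q) ^ k + k * err) * M.pr (fun O => ¬ Hub (annulus (σ k)) (σ k) Oᶜ) + err := by
            gcongr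
        _ ≤ (1 - q) ^ k * (1 - q) + (k * err) * 1 + err := by
            rw [add_mul]; gcongr
        _ = _ := by push_cast; ring
  exact key n le_rfl

lemma no_hub_of_path {O S : Set (ℤ × ℤ)} {a b : ℤ × ℤ} {r R s : ℤ} (hc : Conn Adj4 S a b)
    (hS : S ⊆ O) (ha : max |a.1| |a.2| ≤ r) (hb : R ≤ max |b.1| |b.2|) (hr : r ≤ s)
    (hR : 3 * s ≤ R) : ¬ Hub (annulus s) s Oᶜ := by
  rintro ⟨z, hz⟩
  obtain ⟨y, hy, hzy⟩ := hz S a b hc (ha.trans hr) (hR.trans hb)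
  exact hzy.right_mem.1 (hS hy)

/-- From one good scale to the next one. -/
lemma next_hub {s : ℤ} {K I : ℕ} (hs : 1 ≤ s) (hd : d0 ≤ s) (herr0 : 0 ≤ err)
    (hK : (1 - hubStep hubConst) ^ K + K * err < 1 / 16)
    (hI : 2 * 8 ^ (K + 1) * 3 ^ I ≤ (4 : ℤ) ^ I) (hD : 4 * (2 ^ I * (8 ^ (K + 1) * s)) ≤ D)
    (hq : hubConst ≤ M.pr (Hub (annulus s) s)) :
    ∃ s', 8 * s ≤ s' ∧ s' ≤ 2 * (2 ^ I * (8 ^ (K + 1) * s)) ∧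
      hubConst ≤ M.pr (Hub (annulus s') s') := by
  have H := fun m => M.exists_alpha (m := m)
  choose! α β H using H
  have p2 : (1 : ℤ) ≤ 2 ^ I := one_le_pow₀ (by norm_num)
  have h8 : ∀ j ≤ K + 1, (8 : ℤ) ^ j * s ≤ 8 ^ (K + 1) * s := fun j hj => by gcongr; norm_num
  have h8' : ∀ j, s ≤ (8 : ℤ) ^ j * s := fun j => by
    have : (1 : ℤ) ≤ 8 ^ j := one_le_pow₀ (by norm_num)
    nlinarith
  have h8D : ∀ j ≤ K + 1, 4 * ((8 : ℤ) ^ j * s) ≤ D := fun j hj => by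
    have := h8 j hj; have := h8' j; nlinarith
  by_cases hall : ∀ j ≤ K, β (8 ^ (j + 1) * s) ≤ s
  · exfalso
    have hβK := hall K le_rfl
    have hTK := (H (8 ^ (K + 1) * s) (by have := h8' (K + 1); omega)
      (by have := h8D (K + 1) le_rfl; have := h8' (K + 1); omega)).2.2.2.2.2.2
    have hhub : ∀ j < K, hubStep hubConst ≤ M.pr (Hub (annulus (8 ^ (j + 1) * s)) (8 ^ (j + 1) * s)) := by
      intro j hj
      have := h8D (j + 1) (by omega)
      have := h8' (j + 1)
      refine M.hub_of_hub (by omega) ?_ (by omega) (hall j hj.le) (annulus_subset s) hubConst_pos.le hq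
        (H _ (by omega) (by omega)).2.2.2.2.2.2
      have := h8' j
      rw [pow_succ]; linarith
    have hq1 : hubStep hubConst ≤ 1 := by
      rcases Nat.eq_zero_or_pos K with rfl | h
      · norm_num at hK
      · exact (hhub 0 h).trans (M.le_one _)
    have hpr := M.pr_no_hub (σ := fun j => 8 ^ (j + 1) * s) hq1 herr0 K (by have := h8' 1; simpa using by omega)
      (by have := h8' 1; simpa using by omega) (fun i _ => by rw [pow_succ 8 (i + 1)]; linarith)
      (fun i hi => by have := h8D (i + 1) (by omega); have := h8' (i + 1); omega) hhub
    have hle : M.pr (TEv (8 ^ (K + 1) * s) 0 (β (8 ^ (K + 1) * s))) ≤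
        M.pr (fun O => ∀ i < K, ¬ Hub (annulus (8 ^ (i + 1) * s)) (8 ^ (i + 1) * s) Oᶜ) := by
      refine M.mono _ _ ?_
      rintro O ⟨p, q, hp, hq, hq0, hqβ, hc⟩ i hi
      refine no_hub_of_path (hc.symm fun _ _ h => h.symm) inter_subset_left
        (max_le (abs_le.2 (by omega)) (abs_le.2 (by omega)) : _ ≤ s)
        ((by omega : 2 * (8 ^ (K + 1) * s) ≤ -p.1).trans ((neg_le_abs _).trans (le_max_left _ _)))
        (h8' _) ?_
      have e := h8 (i + 2) (by omega)
      have e' := h8' (i + 1)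
      rw [show (8 : ℤ) ^ (i + 2) = 8 ^ (i + 1) * 8 by rw [← pow_succ]] at e
      linarith
    linarith
  · push Not at hall
    obtain ⟨j, hj, hβ⟩ := hall
    have hh := h8D (j + 1) (by omega)
    have hh' := h8' (j + 1)
    have hα := (H (8 ^ (j + 1) * s) (by omega) (by omega)).2.2.2.2.1
    obtain ⟨v, hv1, hv2, hv⟩ := M.exists_hub_of_chain (u := 8 ^ (j + 1) * s) (a := s) (I := I) H
      (by omega) (by omega) (by
        have := h8 (j + 1) (by omega)
        have e : (0 : ℤ) < 3 ^ I := by positivity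
        calc (8 ^ (j + 1) * s + 1) * 3 ^ I ≤ (2 * (8 ^ (K + 1) * s)) * 3 ^ I := by gcongr; omega
          _ = s * (2 * 8 ^ (K + 1) * 3 ^ I) := by ring
          _ ≤ _ := by gcongr) (by
        have := h8 (j + 1) (by omega)
        have : 2 ^ I * (8 ^ (j + 1) * s) ≤ 2 ^ I * (8 ^ (K + 1) * s) := by gcongr
        linarith)
    refine ⟨2 * v, ?_, ?_, hv⟩
    · have := h8' j
      rw [pow_succ] at hv1; linarith
    · have := h8 (j + 1) (by omega)
      have : 2 ^ I * (8 ^ (j + 1) * s) ≤ 2 ^ I * (8 ^ (K + 1) * s) := by gcongr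
      linarith

lemma first_hub {t : ℤ} {I : ℕ} (hs0 : 1 ≤ s0) (ht : 3 * s0 ≤ t) (hI : (t + 1) * 3 ^ I ≤ s0 * 4 ^ I)
    (hD : 4 * (2 ^ I * t) ≤ D) :
    ∃ s, t ≤ s ∧ s ≤ 2 * (2 ^ I * t) ∧ hubConst ≤ M.pr (Hub (annulus s) s) := by
  have H := fun m => M.exists_alpha (m := m)
  choose! α β H using H
  have p2 : (1 : ℤ) ≤ 2 ^ I := one_le_pow₀ (by norm_num)
  have hDt : 4 * t ≤ D := by nlinarith
  have Ht := H t (by omega) (by omega)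
  by_cases hβ : β t ≤ s0
  · refine ⟨t, le_rfl, by nlinarith, hubConst_le.trans ?_⟩
    refine M.hub_of_hub (s := s0) (R := rect (-s0) s0 (-s0) s0) (by omega) ht (by omega) hβ ?_
      (by norm_num) ?_ Ht.2.2.2.2.2.2
    · rintro p hp
      simp only [rect, mem_ofPred_eq] at *; omega
    · refine M.base.trans (M.mono _ _ ?_)
      intro O hO
      have hrow : ∀ (x y : ℤ), |x| ≤ s0 → |y| ≤ s0 → Conn Adj4 (O ∩ rect (-s0) s0 (-s0) s0) (-s0, -s0) (x, y) := by
        intro x y hx hy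
        rw [abs_le] at hx hy
        have c1 := Conn.of_seq (r := Adj4) (S := O ∩ rect (-s0) s0 (-s0) s0)
          (w := fun i : ℕ => (-s0 + i, -s0)) (Nat.zero_le (x + s0).toNat)
          (fun i _ _ => by simp [Adj4]; left; ring)
          (fun i _ hi => ⟨hO ⟨⟨by simp, by simp only; omega⟩, by simp only; omega⟩, ⟨by simp, by simp only; omega⟩,
            by simp only; omega⟩)
        have c2 := Conn.of_seq (r := Adj4) (S := O ∩ rect (-s0) s0 (-s0) s0)
          (w := fun i : ℕ => (x, -s0 + i)) (Nat.zero_le (y + s0).toNat)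
          (fun i _ _ => by simp [Adj4]; left; ring)
          (fun i _ hi => ⟨hO ⟨hx, by simp only; omega⟩, hx, by simp only; omega⟩)
        simp only [Int.ofNat_toNat] at c1 c2
        have e1 : -s0 + max (x + s0) 0 = x := by omega
        have e2 : -s0 + max (y + s0) 0 = y := by omega
        rw [e1] at c1
        rw [e2] at c2
        simpa using c1.trans (by simpa using c2)
      refine ⟨(-s0, -s0), fun S a b hc ha _ => ⟨a, hc.left_mem, ?_⟩⟩
      exact hrow a.1 a.2 ((le_max_left _ _).trans ha) ((le_max_right _ _).trans ha)
  · obtain ⟨v, h1, h2, h3⟩ := M.exists_hub_of_chain (u := t) (a := s0) (I := I) H (by omega) (by omega)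
      hI hD
    exact ⟨2 * v, by omega, by omega, h3⟩

end Perc

/-- Polynomial decay of the arm probability, with universal constants. -/
theorem exists_arm_bound : ∃ (C : ℤ) (κ q : ℝ), 8 ≤ C ∧ 0 < κ ∧ 0 < q ∧ q < 1 ∧
    ∀ {D d0 s0 : ℤ} {err : ℝ} (M : Perc D d0 s0 err) (t : ℤ) (I N : ℕ), 0 ≤ err → err ≤ κ → 1 ≤ s0 →
      d0 ≤ t → 3 * s0 ≤ t → (t + 1) * 3 ^ I ≤ s0 * 4 ^ I → C ^ (N + 1) * (2 ^ I * t) ≤ D →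
      M.pr (Arm t (C ^ (N + 1) * (2 ^ I * t))) ≤ (1 - q) ^ N + N * err := by
  have hp := hubStep_pos hubConst_pos
  have hp1 : hubStep hubConst < 1 := by unfold hubStep hubConst; norm_num
  obtain ⟨K, hK⟩ := exists_pow_lt_of_lt_one (by norm_num : (0 : ℝ) < 1 / 32)
    (by linarith : 1 - hubStep hubConst < 1)
  obtain ⟨I0, hI0⟩ := pow_unbounded_of_one_lt (2 * 8 ^ (K + 1) : ℝ) (by norm_num : (1 : ℝ) < 4 / 3)
  have hI0' : 2 * 8 ^ (K + 1) * 3 ^ I0 ≤ (4 : ℤ) ^ I0 := by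
    rw [div_pow, lt_div_iff₀ (by positivity)] at hI0
    exact_mod_cast hI0.le
  set B : ℤ := 2 ^ I0 * 8 ^ (K + 1) with hB
  have hB8 : 8 ≤ B := by
    have h1 : (1 : ℤ) ≤ 2 ^ I0 := one_le_pow₀ (by norm_num)
    have h2 : (1 : ℤ) ≤ 8 ^ K := one_le_pow₀ (by norm_num)
    rw [hB, pow_succ]; nlinarith
  refine ⟨8 * B, 1 / (32 * (K + 1)), hubConst, by omega, by positivity, hubConst_pos, hubConst_lt_one, ?_⟩
  intro D d0 s0 err M t I N he0 he hs0 hd ht hI hD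
  have hKe : (1 - hubStep hubConst) ^ K + K * err < 1 / 16 := by
    have : K * err ≤ 1 / 32 := by
      calc K * err ≤ (K + 1) * (1 / (32 * (K + 1))) := by gcongr; linarith
        _ = 1 / 32 := by field_simp
    linarith
  have pI : (1 : ℤ) ≤ 2 ^ I := one_le_pow₀ (by norm_num)
  have hT : 0 < 2 ^ I * t := by have : 0 < t := by omega
                                positivity
  clear_value B
  have hC1 : ∀ j, (1 : ℤ) ≤ (8 * B) ^ j := fun j => one_le_pow₀ (by omega)
  have hCT : ∀ j, 2 ^ I * t ≤ (8 * B) ^ j * (2 ^ I * t) := fun j => by nlinarith [hC1 j]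
  obtain ⟨s, hs1, hs2, hs⟩ := M.first_hub hs0 ht hI (by
    have := hCT N; rw [pow_succ] at hD; nlinarith)
  have hseq : ∀ n ≤ N, ∃ σ : ℕ → ℤ, σ 0 = s ∧ (∀ i, i + 1 < n + 1 → 8 * σ i ≤ σ (i + 1)) ∧
      (∀ i < n + 1, t ≤ σ i ∧ σ i ≤ 2 * ((8 * B) ^ i * (2 ^ I * t))) ∧
      ∀ i < n + 1, hubConst ≤ M.pr (Hub (annulus (σ i)) (σ i)) := by
    intro n
    induction n with
    | zero =>
      intro _
      refine ⟨fun _ => s, rfl, by simp, ?_, ?_⟩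
      · intro i hi; obtain rfl : i = 0 := by omega
        exact ⟨hs1, by simpa using hs2⟩
      · intro i _; exact hs
    | succ n ih =>
      intro hn
      obtain ⟨σ, h0, h1, h2, h3⟩ := ih (by omega)
      have hn' := h2 n (by omega)
      have hBs : B * σ n ≤ B * (2 * ((8 * B) ^ n * (2 ^ I * t))) := by gcongr; exact hn'.2
      have hmon : (8 * B) ^ (n + 1) * (2 ^ I * t) ≤ (8 * B) ^ (N + 1) * (2 ^ I * t) := by
        gcongr ?_ * _; exact pow_le_pow_right₀ (by omega) (by omega)
      have e1 : (8 * B) ^ (n + 1) * (2 ^ I * t) = 8 * (B * ((8 * B) ^ n * (2 ^ I * t))) := by ring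
      have e2 : 2 ^ I0 * (8 ^ (K + 1) * σ n) = B * σ n := by rw [hB]; ring
      obtain ⟨s', k1, k2, k3⟩ := M.next_hub (s := σ n) (K := K) (I := I0) (by omega) (by omega) he0 hKe hI0'
        (by rw [e2]; linarith) (h3 n (by omega))
      rw [e2] at k2
      refine ⟨Function.update σ (n + 1) s', by simp [h0], ?_, ?_, ?_⟩
      · intro i hi
        rcases Nat.lt_or_ge i n with h | h
        · rw [Function.update_of_ne (by omega), Function.update_of_ne (by omega)]
          exact h1 i (by omega)
        · obtain rfl : i = n := by omega
          simpa using k1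
      · intro i hi
        rcases Nat.lt_or_ge i (n + 1) with h | h
        · rw [Function.update_of_ne (by omega)]; exact h2 i h
        · obtain rfl : i = n + 1 := by omega
          rw [Function.update_self]
          have : 0 < B * ((8 * B) ^ n * (2 ^ I * t)) := by
            have := hCT n; have : 0 < (8 * B) ^ n * (2 ^ I * t) := by omega
            have : 0 < B := by omega
            positivity
          exact ⟨by omega, by linarith⟩
      · intro i hi
        rcases Nat.lt_or_ge i (n + 1) with h | h
        · rw [Function.update_of_ne (by omega)]; exact h3 i h
        · obtain rfl : i = n + 1 := by omega
          rw [Function.update_self]; exact k3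
  obtain ⟨σ, h0, h1, h2, h3⟩ := hseq N le_rfl
  have hσD : ∀ i < N, 3 * σ i ≤ (8 * B) ^ (N + 1) * (2 ^ I * t) := by
    intro i hi
    have hi' := (h2 i (by omega)).2
    have e1 : (8 * B) ^ (i + 1) * (2 ^ I * t) ≤ (8 * B) ^ (N + 1) * (2 ^ I * t) := by
      gcongr ?_ * _; exact pow_le_pow_right₀ (by omega) (by omega)
    have e2 : (8 * B) ^ (i + 1) * (2 ^ I * t) = 8 * (B * ((8 * B) ^ i * (2 ^ I * t))) := by ring
    have := hCT i
    nlinarith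
  refine (M.mono _ _ ?_).trans (M.pr_no_hub hubConst_lt_one.le he0 N (by omega) (by omega)
    (fun i hi => h1 i (by omega)) (fun i hi => (hσD i hi).trans hD) (fun i hi => h3 i (by omega)))
  rintro O ⟨a, b, ha, hb, hc⟩ i hi
  exact Perc.no_hub_of_path hc Subset.rfl ha hb (h2 i (by omega)).1 (hσD i hi)

/-- Bounded measurable functions. -/
structure BM {X : Type*} [MeasurableSpace X] (g : X → ℝ) : Prop where
  meas : Measurable g
  bdd : ∃ C, ∀ x, |g x| ≤ C

namespace BM
variable {X Y : Type*} [MeasurableSpace X] [MeasurableSpace Y] {g h : X → ℝ}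

lemma integrable (hg : BM g) (μ : Measure X) [IsFiniteMeasure μ] : Integrable g μ := by
  obtain ⟨C, hC⟩ := hg.bdd
  exact .of_bound hg.meas.aestronglyMeasurable C (.of_forall hC)

lemma add (hg : BM g) (hh : BM h) : BM fun x => g x + h x := by
  obtain ⟨C, hC⟩ := hg.bdd
  obtain ⟨C', hC'⟩ := hh.bdd
  exact ⟨hg.meas.add hh.meas, C + C', fun x => (abs_add_le _ _).trans (add_le_add (hC x) (hC' x))⟩

lemma mul (hg : BM g) (hh : BM h) : BM fun x => g x * h x := by
  obtain ⟨C, hC⟩ := hg.bdd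
  obtain ⟨C', hC'⟩ := hh.bdd
  refine ⟨hg.meas.mul hh.meas, C * C', fun x => ?_⟩
  rw [abs_mul]
  exact mul_le_mul (hC x) (hC' x) (abs_nonneg _) ((abs_nonneg _).trans (hC x))

lemma const (c : ℝ) : BM fun _ : X => c := ⟨measurable_const, |c|, fun _ => le_rfl⟩

lemma sum {ι : Type*} {s : Finset ι} {G : ι → X → ℝ} (hG : ∀ i ∈ s, BM (G i)) :
    BM fun x => ∑ i ∈ s, G i x := by
  classical
  induction s using Finset.induction_on with
  | empty => simpa using const 0
  | insert a s ha ih =>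
    simp only [Finset.sum_insert ha]
    exact (hG a (by simp)).add (ih fun i hi => hG i (by simp [hi]))

lemma comp {φ : Y → X} (hg : BM g) (hφ : Measurable φ) : BM fun y => g (φ y) :=
  ⟨hg.meas.comp hφ, hg.bdd.imp fun _ hC y => hC (φ y)⟩

lemma indicator {s : Set X} (hs : MeasurableSet s) : BM (s.indicator fun _ => (1 : ℝ)) :=
  ⟨measurable_const.indicator hs, 1, fun x => by by_cases h : x ∈ s <;> simp [h]⟩

end BM

section Proj
variable {ι : Type*} [Fintype ι] [DecidableEq ι] (ν : Measure ℝ) [IsProbabilityMeasure ν]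

/-- Average over the coordinates outside `W`. -/
def proj (W : Finset ι) (g : (ι → ℝ) → ℝ) (x : ι → ℝ) : ℝ :=
  ∫ y, g (W.piecewise x y) ∂(Measure.pi fun _ => ν)

/-- The function only depends on the coordinates in `W`. -/
def DepOn (W : Finset ι) (g : (ι → ℝ) → ℝ) : Prop := ∀ x y, (∀ i ∈ W, x i = y i) → g x = g y

lemma DepOn.mono {W W' : Finset ι} {g : (ι → ℝ) → ℝ} (h : DepOn W g) (hW : W ⊆ W') : DepOn W' g :=
  fun x y hxy => h x y fun i hi => hxy i (hW hi)

lemma DepOn.mul {W : Finset ι} {g h : (ι → ℝ) → ℝ} (hg : DepOn W g) (hh : DepOn W h) :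
    DepOn W fun x => g x * h x := fun x y hxy => by simp only [hg x y hxy, hh x y hxy]

lemma measurable_piecewise (W : Finset ι) :
    Measurable fun p : (ι → ℝ) × (ι → ℝ) => W.piecewise p.1 p.2 := by
  refine measurable_pi_lambda _ fun i => ?_
  by_cases h : i ∈ W
  · simp only [Finset.piecewise, h, if_true]; fun_prop
  · simp only [Finset.piecewise, h, if_false]; fun_prop

lemma measurePreserving_piecewise (W : Finset ι) :
    MeasurePreserving (fun p : (ι → ℝ) × (ι → ℝ) => W.piecewise p.1 p.2)
      ((Measure.pi fun _ => ν).prod (Measure.pi fun _ => ν)) (Measure.pi fun _ => ν) := by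
  refine ⟨measurable_piecewise W, ?_⟩
  symm
  refine Measure.pi_eq fun s hs => ?_
  rw [Measure.map_apply (measurable_piecewise W) (.univ_pi hs)]
  have : (fun p : (ι → ℝ) × (ι → ℝ) => W.piecewise p.1 p.2) ⁻¹' (univ.pi s) =
      (univ.pi fun i => if i ∈ W then s i else univ) ×ˢ (univ.pi fun i => if i ∈ W then univ else s i) := by
    ext p
    simp only [mem_preimage, mem_univ_pi, mem_prod, ← forall_and]
    refine forall_congr' fun i => ?_
    by_cases h : i ∈ W <;> simp [h]
  rw [this, Measure.prod_prod, Measure.pi_pi, Measure.pi_pi, ← Finset.prod_mul_distrib]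
  refine Finset.prod_congr rfl fun i _ => ?_
  by_cases h : i ∈ W <;> simp [h]

variable {ν} {g h : (ι → ℝ) → ℝ}

lemma BM.proj (hg : BM g) (W : Finset ι) : BM (proj ν W g) := by
  obtain ⟨C, hC⟩ := hg.bdd
  refine ⟨?_, C, fun x => ?_⟩
  · have : StronglyMeasurable fun p : (ι → ℝ) × (ι → ℝ) => g (W.piecewise p.1 p.2) :=
      (hg.meas.comp (measurable_piecewise W)).stronglyMeasurable
    exact this.integral_prod_right.measurable
  · have := norm_integral_le_of_norm_le_const (μ := Measure.pi fun _ : ι => ν)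
      (f := fun y => g (W.piecewise x y)) (C := C) (.of_forall fun y => hC _)
    simpa [BF.proj] using this

lemma depOn_proj (W : Finset ι) (g : (ι → ℝ) → ℝ) : DepOn W (proj ν W g) := by
  intro x y hxy
  simp only [proj]
  congr 1; ext z; congr 1; ext i
  by_cases h : i ∈ W <;> simp [h, hxy]

lemma proj_of_depOn {W : Finset ι} (hg : DepOn W g) : proj ν W g = g := by
  ext x
  have : ∀ y, g (W.piecewise x y) = g x := fun y => hg _ _ fun i hi => by simp [hi]
  simp [proj, this]

lemma proj_univ : proj ν Finset.univ g = g := proj_of_depOn fun x y h => by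
  congr 1; ext i; exact h i (Finset.mem_univ i)

lemma integral_proj (hg : BM g) (W : Finset ι) :
    ∫ x, proj ν W g x ∂(Measure.pi fun _ => ν) = ∫ x, g x ∂(Measure.pi fun _ => ν) := by
  have mp := measurePreserving_piecewise ν W
  simp only [proj]
  rw [← integral_prod (fun p : (ι → ℝ) × (ι → ℝ) => g (W.piecewise p.1 p.2))
    ((hg.comp mp.measurable).integrable _), ← mp.map_eq, integral_map mp.measurable.aemeasurable
    (by rw [mp.map_eq]; exact hg.meas.aestronglyMeasurable), mp.map_eq]

lemma proj_proj (hg : BM g) (W W' : Finset ι) : proj ν W (proj ν W' g) = proj ν (W ∩ W') g := by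
  ext x
  have mp := measurePreserving_piecewise ν W'
  have e : ∀ y y', W'.piecewise (W.piecewise x y) y' = (W ∩ W').piecewise x (W'.piecewise y y') := by
    intro y y'; ext i
    by_cases h : i ∈ W <;> by_cases h' : i ∈ W' <;> simp [h, h']
  have hG : BM fun z => g ((W ∩ W').piecewise x z) :=
    hg.comp ((measurable_piecewise (W ∩ W')).comp (measurable_const.prodMk measurable_id))
  have := integral_proj (ν := ν) hG W'
  simp only [proj, e] at *
  exact this

lemma proj_mul {W : Finset ι} (hg : DepOn W g) : proj ν W (fun x => g x * h x) =
    fun x => g x * proj ν W h x := by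
  ext x
  have : ∀ y, g (W.piecewise x y) = g x := fun y => hg _ _ fun i hi => by simp [hi]
  simp [proj, this, integral_const_mul]

lemma integral_mul_proj (hg : BM g) (hh : BM h) {W : Finset ι} (hgW : DepOn W g) :
    ∫ x, g x * proj ν W h x ∂(Measure.pi fun _ => ν) = ∫ x, g x * h x ∂(Measure.pi fun _ => ν) := by
  rw [← integral_proj (hg.mul hh) W, proj_mul hgW]

lemma proj_sum {κ : Type*} {s : Finset κ} {G : κ → (ι → ℝ) → ℝ} (hG : ∀ i ∈ s, BM (G i))
    (W : Finset ι) : proj ν W (fun x => ∑ i ∈ s, G i x) = fun x => ∑ i ∈ s, proj ν W (G i) x := by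
  ext x
  simp only [proj]
  rw [integral_finsetSum]
  exact fun i hi => ((hG i hi).comp
    ((measurable_piecewise W).comp (measurable_const.prodMk measurable_id))).integrable _

lemma proj_const_mul (c : ℝ) (W : Finset ι) : proj ν W (fun x => c * g x) =
    fun x => c * proj ν W g x := by
  ext x; simp [proj, integral_const_mul]

lemma proj_of_depOn_disjoint {W S : Finset ι} (hg : DepOn W g) (h : Disjoint S W) (x : ι → ℝ) :
    proj ν S g x = ∫ y, g y ∂(Measure.pi fun _ => ν) := by
  simp only [proj]
  congr 1; ext y
  refine hg _ _ fun i hi => ?_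
  have : i ∉ S := fun h' => Finset.disjoint_left.1 h h' hi
  simp [this]

variable (ν)

/-- The Efron–Stein component of `g` with index `V`. -/
def comp (g : (ι → ℝ) → ℝ) (V : Finset ι) (x : ι → ℝ) : ℝ :=
  ∑ U ∈ V.powerset, (-1) ^ (V \ U).card * proj ν U g x

variable {ν}

lemma BM.efron (hg : BM g) (V : Finset ι) : BM (BF.comp ν g V) :=
  BM.sum fun U _ => (BM.const _).mul (hg.proj U)

lemma depOn_comp (V : Finset ι) (g : (ι → ℝ) → ℝ) : DepOn V (BF.comp ν g V) := by
  intro x y hxy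
  simp only [BF.comp]
  refine Finset.sum_congr rfl fun U hU => ?_
  rw [(depOn_proj U g).mono (Finset.mem_powerset.1 hU) x y hxy]

lemma proj_comp_of_not_mem (hg : BM g) {V W : Finset ι} {i : ι} (hi : i ∈ V) (hiW : i ∉ W) :
    proj ν W (BF.comp ν g V) = 0 := by
  have e : proj ν W (BF.comp ν g V) =
      fun x => ∑ U ∈ V.powerset, (-1) ^ (V \ U).card * proj ν (W ∩ U) g x := by
    unfold BF.comp
    rw [proj_sum fun U _ => (BM.const _).mul (hg.proj U)]
    ext x
    refine Finset.sum_congr rfl fun U _ => ?_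
    rw [proj_const_mul, proj_proj hg]
  rw [e]; ext x
  obtain ⟨V', hV', rfl⟩ : ∃ V', i ∉ V' ∧ V = insert i V' :=
    ⟨V.erase i, by simp, (Finset.insert_erase hi).symm⟩
  rw [Finset.sum_powerset_insert hV', ← Finset.sum_add_distrib, Pi.zero_apply]
  refine Finset.sum_eq_zero fun U hU => ?_
  have hU := Finset.mem_powerset.1 hU
  have hiU : i ∉ U := fun h => hV' (hU h)
  rw [Finset.insert_sdiff_insert, Finset.inter_insert_of_notMem hiW, Finset.insert_sdiff_of_notMem _ hiU,
    Finset.card_insert_of_notMem (by simp [hV']), Finset.sdiff_insert_of_notMem hV', pow_succ]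
  ring

lemma proj_comp_of_subset {V W : Finset ι} (h : V ⊆ W) : proj ν W (BF.comp ν g V) = BF.comp ν g V :=
  proj_of_depOn ((depOn_comp V g).mono h)

lemma integral_comp_eq_zero (hg : BM g) {V : Finset ι} (hV : V.Nonempty) :
    ∫ x, BF.comp ν g V x ∂(Measure.pi fun _ => ν) = 0 := by
  obtain ⟨i, hi⟩ := hV
  rw [← integral_proj (hg.efron V) ∅, proj_comp_of_not_mem hg hi (by simp)]
  simp

lemma integral_comp_mul_comp (hg : BM g) {V V' : Finset ι} (h : V ≠ V') :
    ∫ x, BF.comp ν g V x * BF.comp ν g V' x ∂(Measure.pi fun _ => ν) = 0 := by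
  have key : ∀ {V V' : Finset ι}, ¬ V ⊆ V' →
      ∫ x, BF.comp ν g V x * BF.comp ν g V' x ∂(Measure.pi fun _ => ν) = 0 := by
    intro V V' hn
    obtain ⟨i, hi, hi'⟩ := Finset.not_subset.1 hn
    have := integral_mul_proj (ν := ν) (BM.efron (ν := ν) hg V') (BM.efron (ν := ν) hg V) (depOn_comp V' g)
    rw [proj_comp_of_not_mem hg hi hi'] at this
    simp only [mul_comm (BF.comp ν g V _)]
    simpa using this.symm
  by_cases hn : V ⊆ V'
  · simp only [mul_comm (BF.comp ν g V _)]
    exact key fun h' => h (hn.antisymm h')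
  · exact key hn

lemma sum_comp (g : (ι → ℝ) → ℝ) (x : ι → ℝ) : ∑ V, BF.comp ν g V x = g x := by
  simp only [BF.comp]
  have e : ∀ V : Finset ι, ∑ U ∈ V.powerset, (-1 : ℝ) ^ (V \ U).card * proj ν U g x =
      ∑ U, if U ⊆ V then (-1 : ℝ) ^ (V \ U).card * proj ν U g x else 0 := by
    intro V
    rw [← Finset.sum_filter]
    exact Finset.sum_congr (by ext; simp) fun _ _ => rfl
  simp only [e]
  rw [Finset.sum_comm]
  have e2 : ∀ U : Finset ι, (∑ V, if U ⊆ V then (-1 : ℝ) ^ (V \ U).card * proj ν U g x else 0) =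
      if Uᶜ = ∅ then proj ν U g x else 0 := by
    intro U
    rw [← Finset.sum_filter]
    have : ∑ V with U ⊆ V, (-1 : ℝ) ^ (V \ U).card * proj ν U g x =
        ∑ T ∈ (Uᶜ).powerset, (-1 : ℝ) ^ T.card * proj ν U g x := by
      refine Finset.sum_bij' (fun V _ => V \ U) (fun T _ => U ∪ T) ?_ ?_ ?_ ?_ ?_
      · intro V _; simp only [Finset.mem_powerset]; intro i; simp
      · intro T _; simp
      · intro V hV
        simp only [Finset.mem_filter] at hV
        exact Finset.union_sdiff_of_subset hV.2
      · intro T hT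
        have hd : Disjoint T U := by
          rw [Finset.disjoint_left]; intro i hi hi'
          have := Finset.mem_powerset.1 hT hi; simp [hi'] at this
        rw [Finset.union_sdiff_left, Finset.sdiff_eq_self_of_disjoint hd]
      · intro V _; rfl
    rw [this, ← Finset.sum_mul]
    have h1 := Finset.sum_powerset_neg_one_pow_card (x := Uᶜ)
    have h2 : (∑ T ∈ (Uᶜ).powerset, (-1 : ℝ) ^ T.card) = if Uᶜ = ∅ then 1 else 0 := by
      exact_mod_cast congrArg (Int.cast : ℤ → ℝ) h1
    rw [h2]; split_ifs <;> simp
  simp only [e2, Finset.compl_eq_empty_iff]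
  simp [proj_univ]

end Proj

section Level
variable {ι : Type*} [Fintype ι] [DecidableEq ι] {ν : Measure ℝ} [IsProbabilityMeasure ν]
  {g : (ι → ℝ) → ℝ}

variable (ν) in
/-- The squared norm of an Efron–Stein component. -/
def weight (g : (ι → ℝ) → ℝ) (V : Finset ι) : ℝ :=
  ∫ x, BF.comp ν g V x * BF.comp ν g V x ∂(Measure.pi fun _ => ν)

variable (ν) in
/-- The homogeneous part of degree `k`. -/
def level (g : (ι → ℝ) → ℝ) (k : ℕ) (x : ι → ℝ) : ℝ :=
  ∑ V : Finset ι with V.card = k, BF.comp ν g V x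

lemma weight_nonneg (g : (ι → ℝ) → ℝ) (V : Finset ι) : 0 ≤ weight ν g V :=
  integral_nonneg fun _ => mul_self_nonneg _

lemma BM.level (hg : BM g) (k : ℕ) : BM (level ν g k) := BM.sum fun V _ => hg.efron V

lemma integral_comp_sum (hg : BM g) (s : Finset (Finset ι)) (V : Finset ι) :
    ∫ x, BF.comp ν g V x * ∑ T ∈ s, BF.comp ν g T x ∂(Measure.pi fun _ => ν) =
      if V ∈ s then weight ν g V else 0 := by
  simp only [Finset.mul_sum]
  rw [integral_finsetSum _ fun T _ => ((hg.efron V).mul (hg.efron T)).integrable _]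
  rw [← Finset.sum_ite_eq' s V fun T => weight ν g T]
  refine Finset.sum_congr rfl fun T _ => ?_
  split_ifs with h
  · rw [h]; rfl
  · exact integral_comp_mul_comp hg (Ne.symm h)

lemma integral_sum_sum (hg : BM g) (s t : Finset (Finset ι)) :
    ∫ x, (∑ V ∈ s, BF.comp ν g V x) * (∑ T ∈ t, BF.comp ν g T x) ∂(Measure.pi fun _ => ν) =
      ∑ V ∈ s with V ∈ t, weight ν g V := by
  simp only [Finset.sum_mul]
  rw [integral_finsetSum _ fun V _ => ((hg.efron V).mul (BM.sum fun T _ => hg.efron T)).integrable _]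
  simp only [integral_comp_sum hg, Finset.sum_filter]

lemma integral_mul_level (hg : BM g) (k : ℕ) :
    ∫ x, g x * level ν g k x ∂(Measure.pi fun _ => ν) =
      ∑ V : Finset ι with V.card = k, weight ν g V := by
  have := integral_sum_sum (ν := ν) hg Finset.univ {V : Finset ι | V.card = k}
  simp only [sum_comp] at this
  unfold level
  rw [this]; congr 1; ext; simp

/-- A pair of components of the same degree, one of which avoids `S`. -/
lemma proj_comp_mul_comp (hg : BM g) {S V T : Finset ι} (hc : V.card = T.card) (hT : Disjoint S T)
    (x : ι → ℝ) : proj ν S (fun y => BF.comp ν g V y * BF.comp ν g T y) x =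
      if V = T then weight ν g T else 0 := by
  split_ifs with h
  · subst h
    exact proj_of_depOn_disjoint ((depOn_comp V g).mul (depOn_comp V g)) hT x
  · obtain ⟨i, hi, hi'⟩ : ∃ i ∈ T, i ∉ V := by
      by_contra! hcon
      exact h (Finset.eq_of_subset_of_card_le hcon hc.le).symm
    have h0 : proj ν (Finset.univ.erase i) (fun y => BF.comp ν g V y * BF.comp ν g T y) = 0 := by
      rw [proj_mul ((depOn_comp V g).mono fun j hj => by
        simp only [Finset.mem_erase, Finset.mem_univ, and_true]; rintro rfl; exact hi' hj),
        proj_comp_of_not_mem hg hi (by simp)]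
      ext; simp
    have hS : S ∩ Finset.univ.erase i = S := by
      ext j; simp only [Finset.mem_inter, Finset.mem_erase, Finset.mem_univ, and_true]
      exact ⟨fun h => h.1, fun h => ⟨h, by rintro rfl; exact Finset.disjoint_left.1 hT h hi⟩⟩
    rw [← hS, ← proj_proj ((BM.efron (ν := ν) hg V).mul (BM.efron (ν := ν) hg T)), h0]
    simp [proj]

lemma integral_proj_level_le (hg : BM g) {k : ℕ} (hk : 1 ≤ k) {S : Finset ι} {φ : (ι → ℝ) → ℝ}
    (hφ : BM φ) (hφS : DepOn S φ) (hφ0 : ∀ x, 0 ≤ φ x) :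
    ∫ x, φ x * (proj ν S (level ν g k) x * proj ν S (level ν g k) x) ∂(Measure.pi fun _ => ν) ≤
      ∫ x, φ x * (level ν g k x * level ν g k x) ∂(Measure.pi fun _ => ν) -
      (∫ x, φ x ∂(Measure.pi fun _ => ν)) *
        ∑ V : Finset ι with V.card = k ∧ Disjoint S V, weight ν g V := by
  set h := level ν g k with hh
  set u := proj ν S h with hu
  set s : Finset (Finset ι) := {V : Finset ι | V.card = k ∧ Disjoint S V} with hs
  set v : (ι → ℝ) → ℝ := fun x => ∑ V ∈ s, BF.comp ν g V x with hv
  set μ : Measure (ι → ℝ) := Measure.pi fun _ => ν with hμ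
  have bh : BM h := hg.level k
  have bu : BM u := bh.proj S
  have bv : BM v := BM.sum fun V _ => hg.efron V
  have us : DepOn S u := depOn_proj S h
  have hvdep : DepOn Sᶜ v := by
    intro x y hxy
    refine Finset.sum_congr rfl fun V hV => depOn_comp V g x y fun i hi => hxy i ?_
    simp only [hs, Finset.mem_filter] at hV
    rw [Finset.mem_compl]
    exact fun h' => Finset.disjoint_left.1 hV.2.2 h' hi
  have hdisj : Disjoint S Sᶜ := disjoint_compl_right
  have iv : ∫ x, v x ∂μ = 0 := by
    simp only [hv]
    rw [integral_finsetSum _ fun V _ => (hg.efron V).integrable _]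
    refine Finset.sum_eq_zero fun V hV => integral_comp_eq_zero hg ?_
    simp only [hs, Finset.mem_filter] at hV
    rw [← Finset.card_pos]; omega
  have ivv : ∫ x, v x * v x ∂μ = ∑ V ∈ s, weight ν g V := by
    have := integral_sum_sum (ν := ν) hg s s
    rw [Finset.filter_true_of_mem fun _ h => h] at this
    exact this
  have e1 : ∫ x, φ x * (h x * u x) ∂μ = ∫ x, φ x * (u x * u x) ∂μ := by
    have := integral_mul_proj (ν := ν) (hφ.mul bu) bh (hφS.mul us)
    rw [← hu] at this
    calc _ = ∫ x, φ x * u x * h x ∂μ := by congr 1; ext x; ring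
      _ = _ := this.symm
      _ = _ := by congr 1; ext x; ring
  have e2 : ∫ x, φ x * (u x * v x) ∂μ = 0 := by
    have := integral_mul_proj (ν := ν) (hφ.mul bu) bv (hφS.mul us)
    calc _ = ∫ x, φ x * u x * v x ∂μ := by congr 1; ext x; ring
      _ = _ := this.symm
      _ = 0 := by
        have : ∀ x, proj ν S v x = 0 := fun x => (proj_of_depOn_disjoint hvdep hdisj x).trans iv
        simp [this]
  have e3 : ∫ x, φ x * (v x * v x) ∂μ = (∫ x, φ x ∂μ) * ∑ V ∈ s, weight ν g V := by
    have := integral_mul_proj (ν := ν) hφ (bv.mul bv) hφS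
    rw [← this, ← ivv]
    have : ∀ x, proj ν S (fun x => v x * v x) x = ∫ x, v x * v x ∂μ := fun x =>
      proj_of_depOn_disjoint (hvdep.mul hvdep) hdisj x
    simp only [this]
    rw [integral_mul_const]
  have e4 : ∫ x, φ x * (h x * v x) ∂μ = (∫ x, φ x ∂μ) * ∑ V ∈ s, weight ν g V := by
    have h1 := integral_mul_proj (ν := ν) hφ (bh.mul bv) hφS
    rw [← h1]
    have : ∀ x, proj ν S (fun x => h x * v x) x = ∑ V ∈ s, weight ν g V := by
      intro x
      have e : (fun x => h x * v x) = fun x => ∑ p ∈ (Finset.univ.filter fun V : Finset ι => V.card = k) ×ˢ s,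
          BF.comp ν g p.1 x * BF.comp ν g p.2 x := by
        ext x
        rw [Finset.sum_product, hh, hv]
        simp only [level, Finset.sum_mul_sum]
      rw [e, proj_sum fun p _ => (BM.efron (ν := ν) hg _).mul (BM.efron (ν := ν) hg _)]
      simp only []
      rw [Finset.sum_product_right]
      refine Finset.sum_congr rfl fun T hT => ?_
      have hT' := (Finset.mem_filter.1 hT).2
      have : ∀ V ∈ (Finset.univ.filter fun V : Finset ι => V.card = k),
          proj ν S (fun y => BF.comp ν g V y * BF.comp ν g T y) x = if V = T then weight ν g T else 0 :=
        fun V hV => proj_comp_mul_comp hg (by rw [(Finset.mem_filter.1 hV).2, hT'.1]) hT'.2 x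
      rw [Finset.sum_congr rfl this, Finset.sum_ite_eq', if_pos]
      simp [hT'.1]
    simp only [this]
    rw [integral_mul_const]
  have pos : 0 ≤ ∫ x, φ x * ((h x - v x - u x) * (h x - v x - u x)) ∂μ :=
    integral_nonneg fun x => mul_nonneg (hφ0 x) (mul_self_nonneg _)
  have b : ∀ {a b : (ι → ℝ) → ℝ}, BM a → BM b → Integrable (fun x => φ x * (a x * b x)) μ :=
    fun ha hb => (hφ.mul (ha.mul hb)).integrable μ
  have expand : ∫ x, φ x * ((h x - v x - u x) * (h x - v x - u x)) ∂μ =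
      ∫ x, φ x * (h x * h x) ∂μ + ∫ x, φ x * (v x * v x) ∂μ + ∫ x, φ x * (u x * u x) ∂μ
      - 2 * ∫ x, φ x * (h x * v x) ∂μ - 2 * ∫ x, φ x * (h x * u x) ∂μ
      + 2 * ∫ x, φ x * (u x * v x) ∂μ := by
    have i1 : Integrable (fun x => φ x * (h x * h x) + φ x * (v x * v x)) μ := (b bh bh).add (b bv bv)
    have i2 : Integrable (fun x => φ x * (h x * h x) + φ x * (v x * v x) + φ x * (u x * u x)) μ :=
      i1.add (b bu bu)
    have i3 : Integrable (fun x => φ x * (h x * h x) + φ x * (v x * v x) + φ x * (u x * u x)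
      - 2 * (φ x * (h x * v x))) μ := i2.sub ((b bh bv).const_mul 2)
    have i4 : Integrable (fun x => φ x * (h x * h x) + φ x * (v x * v x) + φ x * (u x * u x)
      - 2 * (φ x * (h x * v x)) - 2 * (φ x * (h x * u x))) μ := i3.sub ((b bh bu).const_mul 2)
    rw [← integral_const_mul, ← integral_const_mul, ← integral_const_mul,
      ← integral_add (b bh bh) (b bv bv), ← integral_add i1 (b bu bu),
      ← integral_sub i2 ((b bh bv).const_mul 2), ← integral_sub i3 ((b bh bu).const_mul 2),
      ← integral_add i4 ((b bu bv).const_mul 2)]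
    congr 1; ext x; ring
  rw [expand, e1, e2, e3, e4] at pos
  linarith

/-- `J` is the set of coordinates revealed by an algorithm which determines `g`. -/
structure StopSet (g : (ι → ℝ) → ℝ) (J : (ι → ℝ) → Finset ι) : Prop where
  meas : ∀ S, MeasurableSet {x | J x = S}
  stable : ∀ x y, (∀ i ∈ J x, x i = y i) → J y = J x ∧ g y = g x

lemma StopSet.measurableSet {J : (ι → ℝ) → Finset ι} (hJ : StopSet g J) (p : Finset ι → Prop) :
    MeasurableSet {x | p (J x)} := by
  have : {x | p (J x)} = ⋃ S ∈ {S : Finset ι | p S}, {x | J x = S} := by ext; simp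
  rw [this]
  exact MeasurableSet.biUnion (to_countable _) fun S _ => hJ.meas S

/-- The revealment bound for one algorithm. -/
lemma level_sq_le {J : (ι → ℝ) → Finset ι} (hJ : StopSet g J) (hg : BM g) (hg1 : ∀ x, |g x| ≤ 1)
    {k : ℕ} (hk : 1 ≤ k) :
    (∑ V : Finset ι with V.card = k, weight ν g V) ^ 2 ≤
      ∑ V : Finset ι with V.card = k, weight ν g V *
        (Measure.pi fun _ => ν).real {x | ¬ Disjoint (J x) V} := by
  set μ : Measure (ι → ℝ) := Measure.pi fun _ => ν with hμ
  set c := ∑ V : Finset ι with V.card = k, weight ν g V with hc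
  set h := level ν g k with hh
  have bh : BM h := hg.level k
  set φ : Finset ι → (ι → ℝ) → ℝ := fun S => {x | J x = S}.indicator fun _ => 1 with hφ
  have bφ : ∀ S, BM (φ S) := fun S => BM.indicator (hJ.meas S)
  have dφ : ∀ S, DepOn S (φ S) := by
    intro S x y hxy
    have : J x = S ↔ J y = S := by
      constructor
      · intro hx; rw [(hJ.stable x y fun i hi => hxy i (hx ▸ hi)).1, hx]
      · intro hy; rw [(hJ.stable y x fun i hi => (hxy i (hy ▸ hi)).symm).1, hy]
    by_cases hy : J y = S
    · simp [hφ, hy, this.2 hy]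
    · simp [hφ, hy, mt this.1 hy]
  have dgφ : ∀ S, DepOn S fun x => g x * φ S x := by
    intro S x y hxy
    simp only [dφ S x y hxy]
    by_cases hy : J y = S
    · rw [(hJ.stable y x fun i hi => (hxy i (hy ▸ hi)).symm).2]
    · simp [hφ, hy]
  have φsum : ∀ (F : Finset ι → (ι → ℝ) → ℝ) x, ∑ S, φ S x * F S x = F (J x) x := by
    intro F x
    rw [Finset.sum_eq_single (J x)]
    · simp [hφ]
    · intro S _ hS; simp [hφ, Ne.symm hS]
    · simp
  have cS : c = ∑ S, ∫ x, g x * φ S x * proj ν S h x ∂μ := by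
    rw [hc, ← integral_mul_level hg]
    have : ∀ S, ∫ x, g x * φ S x * proj ν S h x ∂μ = ∫ x, g x * φ S x * h x ∂μ := fun S =>
      integral_mul_proj (hg.mul (bφ S)) bh (dgφ S)
    simp only [this]
    rw [← integral_finsetSum _ fun S _ => ((hg.mul (bφ S)).mul bh).integrable _]
    congr 1; ext x
    calc g x * h x = ∑ S, φ S x * (g x * h x) := (φsum (fun _ x => g x * h x) x).symm
      _ = _ := Finset.sum_congr rfl fun S _ => by ring
  have hw : c ^ 2 ≤ ∑ S, ∫ x, φ S x * (proj ν S h x * proj ν S h x) ∂μ := by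
    have h1 : 2 * c * c ≤ c ^ 2 + ∑ S, ∫ x, φ S x * (proj ν S h x * proj ν S h x) ∂μ := by
      conv_lhs => rw [cS]
      rw [Finset.mul_sum]
      have i1 : ∀ S, Integrable (fun x => g x * φ S x * proj ν S h x) μ := fun S =>
        ((hg.mul (bφ S)).mul (bh.proj S)).integrable _
      have i2 : ∀ S, Integrable (fun x => φ S x * (proj ν S h x * proj ν S h x)) μ := fun S =>
        ((bφ S).mul ((bh.proj S).mul (bh.proj S))).integrable _
      rw [← cS, ← Finset.mul_sum, ← integral_finsetSum _ fun S _ => i1 S, ← integral_finsetSum _ fun S _ => i2 S,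
        ← integral_const_mul]
      have e : c ^ 2 = ∫ _, c ^ 2 ∂μ := by simp
      rw [e, ← integral_add (integrable_const _) (integrable_finsetSum _ fun S _ => i2 S)]
      refine integral_mono ((integrable_finsetSum _ fun S _ => i1 S).const_mul _)
        ((integrable_const _).add (integrable_finsetSum _ fun S _ => i2 S)) fun x => ?_
      have e1 := φsum (fun S x => g x * proj ν S h x) x
      have e2 := φsum (fun S x => proj ν S h x * proj ν S h x) x
      have e3 : ∑ S, g x * φ S x * proj ν S h x = ∑ S, φ S x * (g x * proj ν S h x) :=
        Finset.sum_congr rfl fun S _ => by ring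
      simp only
      rw [e3, e1, e2]
      have hgx := abs_le.1 (hg1 x)
      nlinarith [sq_nonneg (c * g x - proj ν (J x) h x), sq_nonneg c,
        mul_nonneg (sq_nonneg c) (by nlinarith : 0 ≤ 1 - g x ^ 2)]
    nlinarith
  refine hw.trans ?_
  have h2 := Finset.sum_le_sum fun S (_ : S ∈ Finset.univ) =>
    integral_proj_level_le (ν := ν) hg hk (bφ S) (dφ S) (fun x => indicator_nonneg (fun _ _ => zero_le_one) x)
  refine h2.trans ?_
  rw [Finset.sum_sub_distrib]
  have e1 : ∑ S, ∫ x, φ S x * (h x * h x) ∂μ = c := by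
    rw [← integral_finsetSum _ fun S _ => ((bφ S).mul (bh.mul bh)).integrable _]
    simp only [φsum (fun _ x => h x * h x)]
    have := integral_sum_sum (ν := ν) hg {V : Finset ι | V.card = k} {V : Finset ι | V.card = k}
    rw [Finset.filter_true_of_mem fun _ h => h] at this
    exact this
  have e2 : ∀ S, ∫ x, φ S x ∂μ = μ.real {x | J x = S} := fun S => by
    simp [hφ, integral_indicator_const, hJ.meas S]
  rw [e1]
  have e3 : ∑ S, (∫ x, φ S x ∂μ) * ∑ V : Finset ι with V.card = k ∧ Disjoint S V, weight ν g V =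
      ∑ V : Finset ι with V.card = k, weight ν g V * μ.real {x | Disjoint (J x) V} := by
    simp only [Finset.mul_sum]
    have : ∀ S, ∑ V : Finset ι with V.card = k ∧ Disjoint S V, (∫ x, φ S x ∂μ) * weight ν g V =
        ∑ V : Finset ι with V.card = k, if Disjoint S V then μ.real {x | J x = S} * weight ν g V else 0 := by
      intro S
      rw [← Finset.sum_filter, Finset.filter_filter, e2]
    simp only [this]
    rw [Finset.sum_comm]
    refine Finset.sum_congr rfl fun V _ => ?_
    have hU : {x | Disjoint (J x) V} = ⋃ S ∈ (Finset.univ.filter fun S => Disjoint S V), {x | J x = S} := by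
      ext x; simp
    rw [hU, measureReal_biUnion_finset, Finset.sum_filter, Finset.mul_sum]
    · refine Finset.sum_congr rfl fun S _ => ?_
      split_ifs <;> ring
    · intro S _ T _ hST
      exact Set.disjoint_left.2 fun x hx hx' => hST (hx.symm.trans hx')
    · exact fun S _ => hJ.meas S
  rw [e3, hc, ← Finset.sum_sub_distrib]
  refine le_of_eq (Finset.sum_congr rfl fun V _ => ?_)
  have hcompl : {x | ¬ Disjoint (J x) V} = {x | Disjoint (J x) V}ᶜ := rfl
  rw [hcompl, probReal_compl_eq_one_sub (hJ.measurableSet fun S => Disjoint S V)]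
  ring

/-- The revealment bound for a family of algorithms, averaged uniformly. -/
lemma level_le {U : Type*} {s : Finset U} (hs : s.Nonempty) {J : U → (ι → ℝ) → Finset ι}
    (hJ : ∀ u ∈ s, StopSet g (J u)) (hg : BM g) (hg1 : ∀ x, |g x| ≤ 1) {δ : ℝ} (hδ0 : 0 ≤ δ)
    (hδ : ∀ i, ∑ u ∈ s, (Measure.pi fun _ => ν).real {x | i ∈ J u x} ≤ s.card * δ)
    {k : ℕ} (hk : 1 ≤ k) : ∑ V : Finset ι with V.card = k, weight ν g V ≤ k * δ := by
  set c := ∑ V : Finset ι with V.card = k, weight ν g V with hc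
  have hc0 : 0 ≤ c := Finset.sum_nonneg fun V _ => weight_nonneg g V
  have hn : (0 : ℝ) < s.card := by exact_mod_cast hs.card_pos
  have h1 : s.card * c ^ 2 ≤ s.card * (k * δ * c) := by
    calc s.card * c ^ 2 = ∑ _u ∈ s, c ^ 2 := by simp
      _ ≤ ∑ u ∈ s, ∑ V : Finset ι with V.card = k, weight ν g V *
        (Measure.pi fun _ => ν).real {x | ¬ Disjoint (J u x) V} :=
          Finset.sum_le_sum fun u hu => level_sq_le (hJ u hu) hg hg1 hk
      _ = ∑ V : Finset ι with V.card = k, weight ν g V *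
        ∑ u ∈ s, (Measure.pi fun _ => ν).real {x | ¬ Disjoint (J u x) V} := by
          rw [Finset.sum_comm]; simp only [Finset.mul_sum]
      _ ≤ ∑ V : Finset ι with V.card = k, weight ν g V * (k * (s.card * δ)) := by
          refine Finset.sum_le_sum fun V hV => mul_le_mul_of_nonneg_left ?_ (weight_nonneg g V)
          calc _ ≤ ∑ u ∈ s, ∑ i ∈ V, (Measure.pi fun _ => ν).real {x | i ∈ J u x} := by
                refine Finset.sum_le_sum fun u _ => ?_
                refine le_trans (measureReal_mono ?_ (measure_ne_top _ _)) (measureReal_biUnion_finset_le V _)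
                intro x hx
                obtain ⟨i, hi, hi'⟩ := Finset.not_disjoint_iff.1 hx
                exact mem_iUnion₂.2 ⟨i, hi', hi⟩
            _ = ∑ i ∈ V, ∑ u ∈ s, (Measure.pi fun _ => ν).real {x | i ∈ J u x} := Finset.sum_comm
            _ ≤ ∑ i ∈ V, s.card * δ := Finset.sum_le_sum fun i _ => hδ i
            _ = _ := by rw [Finset.sum_const, (Finset.mem_filter.1 hV).2, nsmul_eq_mul]
      _ = _ := by rw [← Finset.sum_mul, ← hc]; ring
  have h2 := le_of_mul_le_mul_left h1 hn
  rcases hc0.eq_or_lt with h0 | h0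
  · rw [← h0]; positivity
  · nlinarith
end Level

section GaussVec
open Filter Topology
variable {A : Type*} [Fintype A] {Ω : Type*} [MeasurableSpace Ω] {Ω' : Type*} [MeasurableSpace Ω']

/-- `X` is a centered Gaussian vector with covariance `K`, expressed by characteristic functions. -/
structure GV (P : Measure Ω) (X : A → Ω → ℝ) (K : A → A → ℝ) : Prop where
  prob : IsProbabilityMeasure P
  meas : ∀ a, Measurable (X a)
  char : ∀ c : A → ℝ, ∫ ω, Complex.exp ((∑ a, c a * X a ω : ℝ) * Complex.I) ∂P =
    Complex.exp ((-(∑ a, ∑ b, c a * c b * K a b) / 2 : ℝ))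

/-- The joint law, on Euclidean space. -/
def GV.law (P : Measure Ω) (X : A → Ω → ℝ) : Measure (EuclideanSpace ℝ A) :=
  P.map fun ω => WithLp.toLp 2 fun a => X a ω

variable {P : Measure Ω} {X : A → Ω → ℝ} {K : A → A → ℝ} {P' : Measure Ω'} {X' : A → Ω' → ℝ}

lemma GV.measurable_toLp (h : GV P X K) : Measurable fun ω => WithLp.toLp 2 fun a => X a ω :=
  (WithLp.measurable_toLp 2 _).comp (measurable_pi_lambda _ h.meas)

lemma GV.isProb (h : GV P X K) : IsProbabilityMeasure (GV.law P X) :=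
  haveI := h.prob
  Measure.isProbabilityMeasure_map h.measurable_toLp.aemeasurable

lemma GV.charFun_law (h : GV P X K) (c : EuclideanSpace ℝ A) :
    charFun (GV.law P X) c = Complex.exp ((-(∑ a, ∑ b, c a * c b * K a b) / 2 : ℝ)) := by
  rw [← h.char, charFun_apply, GV.law, integral_map h.measurable_toLp.aemeasurable (by fun_prop)]
  simp [PiLp.inner_apply]

lemma GV.law_eq (h : GV P X K) (h' : GV P' X' K) : GV.law P X = GV.law P' X' := by
  have := h.isProb
  have := h'.isProb
  refine Measure.ext_of_charFun (funext fun c => ?_)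
  rw [h.charFun_law, h'.charFun_law]

/-- The event that the pattern of threshold exceedances satisfies `p`. -/
def patt (p : (A → Prop) → Prop) (θ : A → ℝ) : Set (EuclideanSpace ℝ A) :=
  {x | p fun a => θ a < x a}

lemma measurableSet_patt (p : (A → Prop) → Prop) (θ : A → ℝ) : MeasurableSet (patt p θ) := by
  have : patt p θ = (fun x : EuclideanSpace ℝ A => fun a => θ a < x a) ⁻¹' {q | p q} := rfl
  rw [this]
  refine measurableSet_preimage (measurable_pi_lambda _ fun a => ?_) (Set.toFinite _).measurableSet
  exact measurableSet_setOfPred.1 (measurableSet_lt measurable_const (by fun_prop))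

lemma frontier_patt (p : (A → Prop) → Prop) (θ : A → ℝ) :
    frontier (patt p θ) ⊆ ⋃ a, {x | x a = θ a} := by
  intro x hx
  by_contra hcon
  simp only [mem_iUnion, mem_ofPred_eq, not_exists] at hcon
  have hev : ∀ᶠ y in 𝓝 x, ∀ a, (θ a < y a ↔ θ a < x a) := by
    rw [eventually_all]
    intro a
    have hc : ContinuousAt (fun y : EuclideanSpace ℝ A => y a) x := by fun_prop
    rcases lt_or_gt_of_ne (hcon a) with h | h
    · filter_upwards [hc.eventually (gt_mem_nhds h)] with y hy
      exact iff_of_false hy.le.not_gt h.le.not_gt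
    · filter_upwards [hc.eventually (lt_mem_nhds h)] with y hy
      exact iff_of_true hy h
  have hev' : ∀ᶠ y in 𝓝 x, (y ∈ patt p θ ↔ x ∈ patt p θ) := by
    filter_upwards [hev] with y hy
    simp only [patt, mem_ofPred_eq, hy]
  rw [frontier_eq_closure_inter_closure] at hx
  by_cases hm : x ∈ patt p θ
  · have := mem_closure_iff_frequently.1 hx.2
    obtain ⟨y, hy, hy'⟩ := (this.and_eventually hev').exists
    exact hy (hy'.2 hm)
  · have := mem_closure_iff_frequently.1 hx.1
    obtain ⟨y, hy, hy'⟩ := (this.and_eventually hev').exists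
    exact hm (hy'.1 hy)

lemma GV.real_patt (h : GV P X K) (p : (A → Prop) → Prop) (θ : A → ℝ) :
    P.real {ω | p fun a => θ a < X a ω} = (GV.law P X).real (patt p θ) := by
  rw [GV.law, map_measureReal_apply h.measurable_toLp (measurableSet_patt p θ)]
  rfl

/-- Threshold pattern probabilities depend only on the covariance. -/
lemma GV.patt_eq (h : GV P X K) (h' : GV P' X' K) (p : (A → Prop) → Prop) (θ : A → ℝ) :
    P.real {ω | p fun a => θ a < X a ω} = P'.real {ω | p fun a => θ a < X' a ω} := by
  rw [h.real_patt, h'.real_patt, h.law_eq h']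

lemma GV.map_eval [DecidableEq A] (h : GV P X K) (a : A) (hK : 0 ≤ K a a) :
    P.map (X a) = ProbabilityTheory.gaussianReal 0 (K a a).toNNReal := by
  have := h.prob
  have := Measure.isProbabilityMeasure_map (μ := P) (h.meas a).aemeasurable
  refine Measure.ext_of_charFun (funext fun t => ?_)
  have hc := h.char (Pi.single a t)
  rw [charFun_apply_real, integral_map (h.meas a).aemeasurable (by fun_prop),
    ProbabilityTheory.charFun_gaussianReal]
  simp only [Pi.single_apply, ite_mul, zero_mul, Finset.sum_ite_eq', Finset.mem_univ, if_true,
    mul_ite, mul_zero] at hc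
  push_cast at hc ⊢
  convert hc using 2
  simp [Real.coe_toNNReal _ hK]; ring

/-- Threshold pattern probabilities are continuous in the covariance. -/
lemma GV.tendsto_patt {Ωs : ℕ → Type*} [∀ n, MeasurableSpace (Ωs n)] {Ps : ∀ n, Measure (Ωs n)}
    {Xs : ∀ n, A → Ωs n → ℝ} {Ks : ℕ → A → A → ℝ} (hs : ∀ n, GV (Ps n) (Xs n) (Ks n))
    (h : GV P X K) (hK : ∀ a b, Tendsto (fun n => Ks n a b) atTop (𝓝 (K a b)))
    (hpos : ∀ a, 0 < K a a) (p : (A → Prop) → Prop) (θ : A → ℝ) :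
    Tendsto (fun n => (Ps n).real {ω | p fun a => θ a < Xs n a ω}) atTop
      (𝓝 (P.real {ω | p fun a => θ a < X a ω})) := by
  classical
  have hprob := h.prob
  let L : ProbabilityMeasure (EuclideanSpace ℝ A) := ⟨GV.law P X, h.isProb⟩
  let Ls : ℕ → ProbabilityMeasure (EuclideanSpace ℝ A) := fun n => ⟨GV.law (Ps n) (Xs n), (hs n).isProb⟩
  have hL : Tendsto Ls atTop (𝓝 L) := by
    refine ProbabilityMeasure.tendsto_of_tendsto_charFun fun c => ?_
    have e : ∀ n, charFun (Ls n : Measure (EuclideanSpace ℝ A)) c = _ := fun n => (hs n).charFun_law c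
    have e' : charFun (L : Measure (EuclideanSpace ℝ A)) c = _ := h.charFun_law c
    simp only [e, e']
    refine (Complex.continuous_exp.tendsto _).comp ((Complex.continuous_ofReal.tendsto _).comp ?_)
    refine ((tendsto_finsetSum _ fun a _ => tendsto_finsetSum _ fun b _ => ?_).neg).div_const 2
    exact (hK a b).const_mul _
  have hnull : (L : Measure (EuclideanSpace ℝ A)) (frontier (patt p θ)) = 0 := by
    refine measure_mono_null (frontier_patt p θ) (measure_iUnion_null fun a => ?_)
    have hev := h.map_eval a (hpos a).le
    have h0 : (P.map (X a)) {θ a} = 0 := by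
      rw [hev]
      have : (K a a).toNNReal ≠ 0 := by simpa using hpos a
      have := ProbabilityTheory.nullSingletonClass_gaussianReal (μ := 0) this
      exact measure_singleton _
    rw [Measure.map_apply (h.meas a) (measurableSet_singleton _)] at h0
    show (GV.law P X) _ = 0
    rw [GV.law, Measure.map_apply h.measurable_toLp]
    · exact h0
    · exact measurableSet_eq_fun (by fun_prop) measurable_const
  have := ProbabilityMeasure.tendsto_measure_of_null_frontier_of_tendsto' hL hnull
  simp only [h.real_patt, fun n => (hs n).real_patt]
  exact (ENNReal.tendsto_toReal (measure_ne_top (L : Measure (EuclideanSpace ℝ A)) _)).comp this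

/-- Linear images of independent standard Gaussian variables. -/
lemma GV.linear {ι : Type*} [Fintype ι] (T : A → ι → ℝ) :
    GV (Measure.pi fun _ : ι => ProbabilityTheory.gaussianReal 0 1) (fun a x => ∑ i, T a i * x i)
      fun a b => ∑ i, T a i * T b i where
  prob := inferInstance
  meas a := by fun_prop
  char c := by
    have e1 : ∀ x : ι → ℝ, Complex.exp ((∑ a, c a * ∑ i, T a i * x i : ℝ) * Complex.I) =
        ∏ i, Complex.exp (((∑ a, c a * T a i : ℝ) : ℂ) * (x i : ℂ) * Complex.I) := by
      intro x
      rw [← Complex.exp_sum, ← Finset.sum_mul]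
      congr 2
      push_cast
      simp only [Finset.mul_sum, Finset.sum_mul]
      rw [Finset.sum_comm]
      simp only [mul_assoc]
    simp only [e1]
    rw [integral_fintype_prod_eq_prod
      (f := fun i (y : ℝ) => Complex.exp (((∑ a, c a * T a i : ℝ) : ℂ) * (y : ℂ) * Complex.I))]
    simp only [← charFun_apply_real, ProbabilityTheory.charFun_gaussianReal]
    rw [← Complex.exp_sum]
    congr 1
    push_cast
    simp only [mul_zero, zero_mul, zero_sub, one_mul]
    rw [Finset.sum_neg_distrib, ← Finset.sum_div, neg_div]
    congr 2
    simp only [sq, Finset.sum_mul_sum]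
    simp only [Finset.mul_sum]
    rw [Finset.sum_comm]
    refine Finset.sum_congr rfl fun a _ => ?_
    rw [Finset.sum_comm]
    exact Finset.sum_congr rfl fun b _ => Finset.sum_congr rfl fun i _ => by ring

/-- A vector all of whose linear combinations are Gaussian. -/
lemma GV.of_gaussian [IsProbabilityMeasure P] (hm : ∀ a, Measurable (X a))
    (hg : ∀ c : A → ℝ, ∃ v : ℝ≥0,
      P.map (fun ω => ∑ a, c a * X a ω) = ProbabilityTheory.gaussianReal 0 v) :
    GV P X fun a b => ∫ ω, X a ω * X b ω ∂P where
  prob := inferInstance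
  meas := hm
  char c := by
    classical
    obtain ⟨v, hv⟩ := hg c
    have hmS : Measurable fun ω => ∑ a, c a * X a ω := by fun_prop
    have hL2 : ∀ a, MemLp (X a) 2 P := by
      intro a
      obtain ⟨w, hw⟩ := hg (Pi.single a 1)
      simp only [Pi.single_apply, ite_mul, zero_mul, one_mul, Finset.sum_ite_eq', Finset.mem_univ, if_true] at hw
      have := ProbabilityTheory.memLp_id_gaussianReal' (μ := 0) (v := w) 2 (by simp)
      rw [← hw, memLp_map_measure_iff (by fun_prop) (hm a).aemeasurable] at this
      exact this
    have hvar : ∫ ω, (∑ a, c a * X a ω) ^ 2 ∂P = v := by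
      have h1 : ∫ y, y ^ 2 ∂(ProbabilityTheory.gaussianReal 0 v) = v := by
        have := ProbabilityTheory.variance_fun_id_gaussianReal (μ := 0) (v := v)
        rw [ProbabilityTheory.variance_eq_integral (by fun_prop)] at this
        simpa using this
      rw [← h1, ← hv, integral_map hmS.aemeasurable (by fun_prop)]
    have hcov : ∫ ω, (∑ a, c a * X a ω) ^ 2 ∂P = ∑ a, ∑ b, c a * c b * ∫ ω, X a ω * X b ω ∂P := by
      have hi : ∀ a b, Integrable (fun ω => X a ω * X b ω) P := fun a b => (hL2 a).integrable_mul (hL2 b)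
      have : ∀ ω, (∑ a, c a * X a ω) ^ 2 = ∑ a, ∑ b, c a * c b * (X a ω * X b ω) := by
        intro ω
        rw [sq, Finset.sum_mul_sum]
        exact Finset.sum_congr rfl fun a _ => Finset.sum_congr rfl fun b _ => by ring
      simp only [this]
      rw [integral_finsetSum _ fun a _ => integrable_finsetSum _ fun b _ => (hi a b).const_mul _]
      refine Finset.sum_congr rfl fun a _ => ?_
      rw [integral_finsetSum _ fun b _ => (hi a b).const_mul _]
      exact Finset.sum_congr rfl fun b _ => integral_const_mul _ _
    have hch := ProbabilityTheory.charFun_gaussianReal (μ := 0) (v := v) 1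
    rw [← hv, charFun_apply_real, integral_map hmS.aemeasurable (by fun_prop)] at hch
    rw [← hcov, hvar]
    simp only [Complex.ofReal_one, one_mul] at hch
    rw [hch]
    congr 1
    push_cast
    ring
end GaussVec

section Resample
variable {ι : Type*} [Fintype ι] [DecidableEq ι] {ν : Measure ℝ} [IsProbabilityMeasure ν]
  {g : (ι → ℝ) → ℝ}

lemma proj_eq_sum (hg : BM g) (W : Finset ι) :
    proj ν W g = fun x => ∑ V : Finset ι with V ⊆ W, BF.comp ν g V x := by
  have e : g = fun x => ∑ V : Finset ι, BF.comp ν g V x := funext fun x => (sum_comp g x).symm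
  conv_lhs => rw [e]
  rw [proj_sum fun V _ => hg.efron V]
  ext x
  rw [Finset.sum_filter]
  refine Finset.sum_congr rfl fun V _ => ?_
  by_cases hW : V ⊆ W
  · simp [hW, proj_comp_of_subset]
  · obtain ⟨i, hi, hi'⟩ := Finset.not_subset.1 hW
    simp [hW, proj_comp_of_not_mem hg hi hi']

lemma integral_self_mul_proj (hg : BM g) (W : Finset ι) :
    ∫ x, g x * proj ν W g x ∂(Measure.pi fun _ => ν) = ∑ V : Finset ι with V ⊆ W, weight ν g V := by
  have := integral_sum_sum (ν := ν) hg Finset.univ {V : Finset ι | V ⊆ W}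
  simp only [sum_comp] at this
  rw [proj_eq_sum hg, this]
  congr 1; ext; simp

lemma weight_empty (g : (ι → ℝ) → ℝ) :
    weight ν g ∅ = (∫ x, g x ∂(Measure.pi fun _ => ν)) ^ 2 := by
  simp [weight, BF.comp, proj, sq]

/-- Averaged noise stability over resampling sets that rarely contain a given set. -/
lemma exists_resample_le {κ : Type*} {s : Finset κ} (hs : s.Nonempty) (W : κ → Finset ι) {r δ : ℝ}
    (hr0 : 0 ≤ r) (hr1 : r < 1) (hδ : 0 ≤ δ)
    (hW : ∀ V : Finset ι, ((s.filter fun k => V ⊆ W k).card : ℝ) ≤ s.card * r ^ V.card) (hg : BM g)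
    (hlev : ∀ k : ℕ, 1 ≤ k → ∑ V : Finset ι with V.card = k, weight ν g V ≤ k * δ) :
    ∃ k ∈ s, ∫ x, g x * proj ν (W k) g x ∂(Measure.pi fun _ => ν) ≤
      (∫ x, g x ∂(Measure.pi fun _ => ν)) ^ 2 + δ * (1 / (1 - r) ^ 2) := by
  by_contra! hcon
  have h1 := Finset.sum_lt_sum_of_nonempty hs hcon
  refine absurd h1 (not_lt.2 ?_)
  rw [Finset.sum_const, nsmul_eq_mul]
  simp only [integral_self_mul_proj hg, Finset.sum_filter]
  rw [Finset.sum_comm]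
  have h2 : ∀ V : Finset ι, ∑ k ∈ s, (if V ⊆ W k then weight ν g V else 0) ≤
      s.card * (weight ν g V * r ^ V.card) := by
    intro V
    rw [← Finset.sum_filter, Finset.sum_const, nsmul_eq_mul]
    calc _ ≤ s.card * r ^ V.card * weight ν g V :=
          mul_le_mul_of_nonneg_right (hW V) (weight_nonneg g V)
      _ = _ := by ring
  refine (Finset.sum_le_sum fun V _ => h2 V).trans ?_
  rw [← Finset.mul_sum]
  refine mul_le_mul_of_nonneg_left ?_ (Nat.cast_nonneg _)
  have hmaps : ∀ V ∈ (Finset.univ : Finset (Finset ι)), V.card ∈ Finset.range (Fintype.card ι + 1) :=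
    fun V _ => Finset.mem_range.2 (Nat.lt_succ_of_le (Finset.card_le_univ V))
  rw [← Finset.sum_fiberwise_of_maps_to hmaps, Finset.sum_range_succ']
  have h0 : ∑ V : Finset ι with V.card = 0, weight ν g V * r ^ V.card =
      (∫ x, g x ∂(Measure.pi fun _ => ν)) ^ 2 := by
    simp only [Finset.card_eq_zero, Finset.filter_eq', Finset.mem_univ, if_true]
    simp [weight_empty]
  rw [h0, add_comm]
  refine add_le_add_right ?_ _
  have h3 : ∀ k, ∑ V : Finset ι with V.card = k + 1, weight ν g V * r ^ V.card ≤
      δ * (((k + 1 : ℕ) : ℝ) * r ^ (k + 1)) := by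
    intro k
    have : ∑ V : Finset ι with V.card = k + 1, weight ν g V * r ^ V.card =
        (∑ V : Finset ι with V.card = k + 1, weight ν g V) * r ^ (k + 1) := by
      rw [Finset.sum_mul]
      exact Finset.sum_congr rfl fun V hV => by rw [(Finset.mem_filter.1 hV).2]
    rw [this]
    calc _ ≤ ((k + 1 : ℕ) : ℝ) * δ * r ^ (k + 1) :=
          mul_le_mul_of_nonneg_right (hlev _ (by omega)) (pow_nonneg hr0 _)
      _ = _ := by ring
  refine (Finset.sum_le_sum fun k _ => h3 k).trans ?_
  rw [← Finset.mul_sum]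
  refine mul_le_mul_of_nonneg_left ?_ hδ
  have hsum := hasSum_coe_mul_geometric_of_norm_lt_one (𝕜 := ℝ) (r := r) (by rwa [Real.norm_of_nonneg hr0])
  have h4 := hsum.summable.sum_le_tsum (Finset.range (Fintype.card ι + 1))
    (fun k _ => mul_nonneg (Nat.cast_nonneg _) (pow_nonneg hr0 _))
  rw [hsum.tsum_eq, Finset.sum_range_succ'] at h4
  simp only [Nat.cast_zero, zero_mul, add_zero] at h4
  refine h4.trans ?_
  have : 0 < 1 - r := by linarith
  gcongr

end Resample

section Noise
variable {ι : Type*} [Fintype ι] [DecidableEq ι]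

/-- The standard Gaussian product measure. -/
abbrev gam (ι : Type*) [Fintype ι] : Measure (ι → ℝ) :=
  Measure.pi fun _ : ι => ProbabilityTheory.gaussianReal 0 1

/-- Coordinates kept by a resampling. -/
def keep (m : ℕ) (κ : ι → Fin m) : Finset (ι × Option (Fin m)) :=
  {p | p.2 ≠ none ∧ p.2 ≠ some (κ p.1)}

lemma card_keep_le {m : ℕ} (hm : 1 ≤ m) (V : Finset (ι × Option (Fin m))) :
    (((Finset.univ : Finset (ι → Fin m)).filter fun κ => V ⊆ keep m κ).card : ℝ) ≤
      (Finset.univ : Finset (ι → Fin m)).card * (1 - 1 / m : ℝ) ^ V.card := by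
  have hm' : (1 : ℝ) ≤ m := by exact_mod_cast hm
  set F : ι → Finset (Option (Fin m)) := fun i => {o | (i, o) ∈ V} with hF
  have e1 : ((Finset.univ : Finset (ι → Fin m)).filter fun κ => V ⊆ keep m κ) =
      Fintype.piFinset fun i => {k : Fin m | none ∉ F i ∧ some k ∉ F i} := by
    ext κ
    simp only [Finset.mem_filter, Finset.mem_univ, true_and, Fintype.mem_piFinset, hF, keep,
      Finset.subset_iff, Prod.forall]
    constructor
    · intro h i
      exact ⟨fun h' => (h i none h').1 rfl, fun h' => (h i _ h').2 rfl⟩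
    · intro h i o ho
      exact ⟨by rintro rfl; exact (h i).1 ho, by rintro rfl; exact (h i).2 ho⟩
  have e2 : V.card = ∑ i, (F i).card := by
    rw [Finset.card_eq_sum_card_fiberwise (f := Prod.fst) (t := Finset.univ) (fun _ _ => by simp)]
    refine Finset.sum_congr rfl fun i _ => ?_
    refine Finset.card_bij (fun p _ => p.2) ?_ ?_ ?_
    · rintro ⟨j, o⟩ h
      simp only [Finset.mem_filter] at h
      obtain ⟨h, rfl⟩ := h
      simpa [hF] using h
    · rintro ⟨j, o⟩ h ⟨j', o'⟩ h' h''
      simp only [Finset.mem_filter] at h h'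
      simp only at h''
      rw [h''] ; rw [h.2, h'.2]
    · intro o ho
      exact ⟨(i, o), by simpa [hF] using ho, rfl⟩
  rw [e1, Fintype.card_piFinset, e2, ← Finset.prod_pow_eq_pow_sum, Finset.card_univ, Fintype.card_pi]
  push_cast
  rw [← Finset.prod_mul_distrib]
  refine Finset.prod_le_prod (fun i _ => Nat.cast_nonneg _) fun i _ => ?_
  rw [Fintype.card_fin]
  have hpos : 0 ≤ (1 - 1 / m : ℝ) := by
    rw [sub_nonneg, div_le_one (by linarith)]; exact hm'
  by_cases hn : none ∈ F i
  · simp only [hn, not_true_eq_false, false_and, Finset.filter_false, Finset.card_empty, Nat.cast_zero]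
    positivity
  · have hb := one_add_mul_le_pow (a := -(1 / m : ℝ)) (by
      have : (1 / m : ℝ) ≤ 1 := by linarith
      linarith) (F i).card
    have hc : ({k : Fin m | none ∉ F i ∧ some k ∉ F i} : Finset (Fin m)).card + (F i).card ≤ m := by
      have hFi : (F i).card ≤ ({k : Fin m | some k ∈ F i} : Finset (Fin m)).card := by
        refine (Finset.card_le_card fun o ho => ?_).trans_eq
          (Finset.card_map (s := ({k : Fin m | some k ∈ F i} : Finset (Fin m))) Function.Embedding.some)
        cases o with
        | none => exact absurd ho hn
        | some k => simpa using ho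
      have := Finset.card_filter_add_card_filter_not (s := (Finset.univ : Finset (Fin m))) (fun k => some k ∈ F i)
      simp only [hn, not_false_eq_true, true_and]
      rw [Finset.card_univ, Fintype.card_fin] at this
      omega
    have hc' : (({k : Fin m | none ∉ F i ∧ some k ∉ F i} : Finset (Fin m)).card : ℝ) + (F i).card ≤ m := by
      exact_mod_cast hc
    calc _ ≤ (m : ℝ) - (F i).card := by linarith
      _ = m * (1 + (F i).card * (-(1 / m : ℝ))) := by field_simp; ring
      _ ≤ _ := by rw [sub_eq_add_neg]; exact mul_le_mul_of_nonneg_left hb (by linarith)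

variable {β : Type*} [Fintype β]

/-- The linear map with matrix `T`. -/
def lin (T : ι → β → ℝ) (x : β → ℝ) (i : ι) : ℝ := ∑ p, T i p * x p

lemma measurable_lin (T : ι → β → ℝ) : Measurable (lin T) := by
  unfold lin; fun_prop

lemma GV.map_eq {Ω Ω' A : Type*} [MeasurableSpace Ω] [MeasurableSpace Ω'] [Fintype A]
    {P : Measure Ω} {P' : Measure Ω'} {X : A → Ω → ℝ} {X' : A → Ω' → ℝ} {K : A → A → ℝ}
    (h : GV P X K) (h' : GV P' X' K) :
    P.map (fun ω a => X a ω) = P'.map (fun ω a => X' a ω) := by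
  have := congrArg (Measure.map (WithLp.ofLp : EuclideanSpace ℝ A → A → ℝ)) (h.law_eq h')
  have hm : Measurable (WithLp.ofLp : EuclideanSpace ℝ A → A → ℝ) := by fun_prop
  rwa [GV.law, GV.law, Measure.map_map hm h.measurable_toLp, Measure.map_map hm h'.measurable_toLp] at this

lemma measurePreserving_lin [DecidableEq β] (T : ι → β → ℝ)
    (hT : ∀ i j, ∑ p, T i p * T j p = if i = j then 1 else 0) :
    MeasurePreserving (lin T) (gam β) (gam ι) := by
  refine ⟨measurable_lin T, ?_⟩
  have h1 := GV.linear T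
  have h2 := GV.linear (fun i j : ι => if i = j then (1 : ℝ) else 0)
  have e : (fun a b : ι => ∑ i, T a i * T b i) = fun a b => ∑ i,
      (if a = i then (1 : ℝ) else 0) * (if b = i then (1 : ℝ) else 0) := by
    ext a b
    rw [hT]
    simp [eq_comm (a := b)]
  rw [e] at h1
  have := h1.map_eq h2
  simp only [ite_mul, one_mul, zero_mul, Finset.sum_ite_eq, Finset.mem_univ, if_true] at this
  have e2 : (fun (x : ι → ℝ) i => x i) = id := rfl
  rw [e2, Measure.map_id] at this
  exact this

lemma integral_lin_lin_eq {β' : Type*} [Fintype β'] [DecidableEq β] [DecidableEq β']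
    {g : (ι → ℝ) → ℝ} (hg : BM g)
    (U V : ι → β → ℝ) (U' V' : ι → β' → ℝ)
    (hUU : ∀ i j, ∑ p, U i p * U j p = ∑ p, U' i p * U' j p)
    (hVV : ∀ i j, ∑ p, V i p * V j p = ∑ p, V' i p * V' j p)
    (hUV : ∀ i j, ∑ p, U i p * V j p = ∑ p, U' i p * V' j p) :
    ∫ x, g (lin U x) * g (lin V x) ∂(gam β) = ∫ x, g (lin U' x) * g (lin V' x) ∂(gam β') := by
  have h1 := GV.linear (Sum.elim U V)
  have h2 := GV.linear (Sum.elim U' V')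
  have e : (fun a b : ι ⊕ ι => ∑ i, Sum.elim U V a i * Sum.elim U V b i) = fun a b => ∑ i,
      Sum.elim U' V' a i * Sum.elim U' V' b i := by
    ext a b
    rcases a with a | a <;> rcases b with b | b
    · exact hUU a b
    · exact hUV a b
    · simpa only [Sum.elim_inl, Sum.elim_inr, mul_comm] using hUV b a
    · exact hVV a b
  rw [e] at h1
  have h3 := h1.map_eq h2
  have hG : BM fun y : ι ⊕ ι → ℝ => g (fun i => y (.inl i)) * g (fun i => y (.inr i)) :=
    (hg.comp (by fun_prop)).mul (hg.comp (by fun_prop))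
  have h3' : (gam β).map (lin (Sum.elim U V)) = (gam β').map (lin (Sum.elim U' V')) := h3
  have h4 := congrArg (fun μ => ∫ y, g (fun i => y (.inl i)) * g (fun i => y (.inr i)) ∂μ) h3'
  beta_reduce at h4
  rw [integral_map (measurable_lin (Sum.elim U V)).aemeasurable hG.meas.aestronglyMeasurable,
    integral_map (measurable_lin (Sum.elim U' V')).aemeasurable hG.meas.aestronglyMeasurable] at h4
  exact h4

/-- Coefficients of the splitting of a standard Gaussian variable into independent pieces. -/
def splitCoef (m : ℕ) (ρ : ℝ) : Option (Fin m) → ℝ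
  | none => √(1 - m * ρ / (m - 1))
  | some _ => √(ρ / (m - 1))

/-- The matrix of the splitting. -/
def splitMat (m : ℕ) (ρ : ℝ) (i : ι) (p : ι × Option (Fin m)) : ℝ :=
  if p.1 = i then splitCoef m ρ p.2 else 0

lemma sum_splitMat {m : ℕ} {ρ : ℝ} (w : ι × Option (Fin m) → ℝ) (i j : ι) :
    ∑ p, w p * (splitMat m ρ i p * splitMat m ρ j p) =
      if i = j then ∑ o, w (i, o) * splitCoef m ρ o ^ 2 else 0 := by
  rw [Fintype.sum_prod_type]
  split_ifs with h
  · subst h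
    rw [Finset.sum_eq_single i]
    · simp [splitMat, sq]
    · intro k _ hk; simp [splitMat, hk]
    · simp
  · refine Finset.sum_eq_zero fun k _ => Finset.sum_eq_zero fun o _ => ?_
    by_cases hk : k = i
    · subst hk; simp [splitMat, h]
    · simp [splitMat, hk]

theorem noise_sens [DecidableEq β] {U : Type*} {s : Finset U} (hs : s.Nonempty) {g : (ι → ℝ) → ℝ}
    {J : U → (ι → ℝ) → Finset ι} (hJ : ∀ u ∈ s, StopSet g (J u)) (hg : BM g) (hg1 : ∀ x, |g x| ≤ 1)
    {δ : ℝ} (hδ0 : 0 ≤ δ)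
    (hδ : ∀ i, ∑ u ∈ s, (gam ι).real {x | i ∈ J u x} ≤ s.card * δ)
    {m : ℕ} (hm : 2 ≤ m) {ρ : ℝ} (hρ0 : 0 ≤ ρ) (hρ1 : ρ ≤ 1 - 1 / m) (S T : ι → β → ℝ)
    (hSS : ∀ i j, ∑ p, S i p * S j p = if i = j then 1 else 0)
    (hTT : ∀ i j, ∑ p, T i p * T j p = if i = j then 1 else 0)
    (hST : ∀ i j, ∑ p, S i p * T j p = if i = j then ρ else 0) :
    ∫ x, g (lin S x) * g (lin T x) ∂(gam β) ≤ (∫ x, g x ∂(gam ι)) ^ 2 + δ * m ^ 2 := by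
  classical
  have hm2 : (2 : ℝ) ≤ m := by exact_mod_cast hm
  have hb : 0 ≤ ρ / (m - 1) := div_nonneg hρ0 (by linarith)
  have ha : 0 ≤ 1 - m * ρ / (m - 1) := by
    rw [sub_nonneg, div_le_one (by linarith)]
    have := mul_le_mul_of_nonneg_left hρ1 (by linarith : (0:ℝ) ≤ m)
    have e : (m : ℝ) * (1 - 1 / m) = m - 1 := by field_simp
    linarith
  have hcn : splitCoef m ρ none ^ 2 = 1 - m * ρ / (m - 1) := Real.sq_sqrt ha
  have hcs : ∀ k, splitCoef m ρ (some k) ^ 2 = ρ / (m - 1) := fun k => Real.sq_sqrt hb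
  set L : ι → ι × Option (Fin m) → ℝ := splitMat m ρ with hL
  have hLL : ∀ i j, ∑ p, L i p * L j p = if i = j then 1 else 0 := by
    intro i j
    have := sum_splitMat (ρ := ρ) (fun _ : ι × Option (Fin m) => (1 : ℝ)) i j
    simp only [one_mul] at this
    rw [this]
    congr 1
    rw [Fintype.sum_option, hcn]
    simp only [hcs, Finset.sum_const, Finset.card_univ, Fintype.card_fin, nsmul_eq_mul]
    ring
  have hLp := measurePreserving_lin L hLL
  have hgL : BM (g ∘ lin L) := hg.comp (measurable_lin L)
  have hStop : ∀ u ∈ s, StopSet (g ∘ lin L) fun z => J u (lin L z) ×ˢ Finset.univ := by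
    intro u hu
    have key : ∀ x y : ι × Option (Fin m) → ℝ,
        (∀ i ∈ J u (lin L x) ×ˢ Finset.univ, x i = y i) →
        ∀ i ∈ J u (lin L x), lin L x i = lin L y i := by
      intro x y h i hi
      refine Finset.sum_congr rfl fun p _ => ?_
      by_cases hp : p.1 = i
      · rw [h p (by simp [hp, hi])]
      · simp [hL, splitMat, hp]
    refine ⟨fun S' => ?_, fun x y h => ?_⟩
    · exact measurable_lin L ((hJ u hu).measurableSet fun V => V ×ˢ Finset.univ = S')
    · obtain ⟨h1, h2⟩ := (hJ u hu).stable _ _ (key x y h)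
      exact ⟨by simp only [h1], h2⟩
  have hrev : ∀ p : ι × Option (Fin m), ∑ u ∈ s, (gam (ι × Option (Fin m))).real
      {z | p ∈ J u (lin L z) ×ˢ (Finset.univ : Finset (Option (Fin m)))} ≤ s.card * δ := by
    intro p
    refine le_trans (Finset.sum_le_sum fun u hu => ?_) (hδ p.1)
    have e : {z | p ∈ J u (lin L z) ×ˢ (Finset.univ : Finset (Option (Fin m)))} =
        lin L ⁻¹' {x | p.1 ∈ J u x} := by ext; simp
    rw [e, hLp.measureReal_preimage ((hJ u hu).measurableSet fun V => p.1 ∈ V).nullMeasurableSet]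
  have hlev := fun k hk => level_le hs hStop hgL (fun x => hg1 _) hδ0 hrev (k := k) hk
  have hr1 : (1 / m : ℝ) ≤ 1 := by rw [div_le_one (by linarith)]; linarith
  have : NeZero m := ⟨by omega⟩
  obtain ⟨κ, -, hκ⟩ := exists_resample_le (s := (Finset.univ : Finset (ι → Fin m)))
    ⟨fun _ => 0, Finset.mem_univ _⟩ (fun κ => keep m κ) (r := 1 - 1 / m) (by linarith)
    (by have : (0:ℝ) < 1 / m := by positivity
        linarith) hδ0 (fun V => card_keep_le (by omega) V) hgL hlev
  have e1 : ∫ x, (g ∘ lin L) x ∂(gam (ι × Option (Fin m))) = ∫ x, g x ∂(gam ι) := by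
    rw [← hLp.map_eq, integral_map (measurable_lin L).aemeasurable hg.meas.aestronglyMeasurable]
    rfl
  have e2 : δ * (1 / (1 - (1 - 1 / m : ℝ)) ^ 2) = δ * m ^ 2 := by
    field_simp
    ring
  rw [e1, e2] at hκ
  refine le_trans (le_of_eq ?_) hκ
  obtain ⟨K, hK⟩ : ∃ K, K = keep m κ := ⟨_, rfl⟩
  rw [← hK]
  have e3 : ∫ x, (g ∘ lin L) x * proj (ProbabilityTheory.gaussianReal 0 1) K (g ∘ lin L) x ∂(gam (ι × Option (Fin m))) =
      ∫ z, g (lin (fun i => Sum.elim (L i) fun _ => 0) z) *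
        g (lin (fun i => Sum.elim (fun p => if p ∈ K then L i p else 0)
          (fun p => if p ∈ K then 0 else L i p)) z) ∂(gam ((ι × Option (Fin m)) ⊕ (ι × Option (Fin m)))) := by
    have hmp := measurePreserving_sumPiEquivProdPi
      (fun _ : (ι × Option (Fin m)) ⊕ (ι × Option (Fin m)) => ProbabilityTheory.gaussianReal 0 1)
    have hG : BM fun q : ((ι × Option (Fin m)) → ℝ) × ((ι × Option (Fin m)) → ℝ) => (g ∘ lin L) q.1 * (g ∘ lin L) (K.piecewise q.1 q.2) :=
      (hgL.comp measurable_fst).mul (hgL.comp (measurable_piecewise K))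
    have h5 : ∫ x, (g ∘ lin L) x * proj (ProbabilityTheory.gaussianReal 0 1) K (g ∘ lin L) x ∂(gam (ι × Option (Fin m))) =
        ∫ q, (g ∘ lin L) q.1 * (g ∘ lin L) (K.piecewise q.1 q.2) ∂((gam (ι × Option (Fin m))).prod (gam (ι × Option (Fin m)))) := by
      rw [integral_prod _ (hG.integrable _)]
      simp only [integral_const_mul, proj]
    rw [h5, ← hmp.integral_comp (MeasurableEquiv.measurableEmbedding _)]
    congr 1
    ext z
    simp only [Function.comp]
    congr 2 <;> ext i <;> simp only [lin, Fintype.sum_sum_type, Sum.elim_inl, Sum.elim_inr]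
    · simp [MeasurableEquiv.sumPiEquivProdPi, Equiv.sumPiEquivProdPi]
    · rw [← Finset.sum_add_distrib]
      refine Finset.sum_congr rfl fun p _ => ?_
      by_cases hp : p ∈ K <;>
        simp [hp, Finset.piecewise, MeasurableEquiv.sumPiEquivProdPi, Equiv.sumPiEquivProdPi]
  rw [e3]
  refine integral_lin_lin_eq hg _ _ _ _ ?_ ?_ ?_ <;> intro i j <;> rw [Fintype.sum_sum_type] <;>
    simp only [Sum.elim_inl, Sum.elim_inr]
  · rw [hSS, hLL]; simp
  · rw [hTT, ← Finset.sum_add_distrib, ← hLL]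
    refine Finset.sum_congr rfl fun p _ => ?_
    by_cases hp : p ∈ K <;> simp [hp]
  · rw [hST]
    have := sum_splitMat (ρ := ρ) (fun p : ι × Option (Fin m) => if p ∈ K then (1 : ℝ) else 0) i j
    have e4 : ∑ p, L i p * (if p ∈ K then L j p else 0) =
        ∑ p, (if p ∈ K then (1 : ℝ) else 0) * (splitMat m ρ i p * splitMat m ρ j p) := by
      refine Finset.sum_congr rfl fun p _ => ?_
      by_cases hp : p ∈ K <;> simp [hp, hL]
    simp only [zero_mul, Finset.sum_const_zero, add_zero]
    rw [e4, this]
    congr 1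
    rw [Fintype.sum_option]
    simp only [hcs, hK, keep, Finset.mem_filter, Finset.mem_univ, true_and, ne_eq, not_true_eq_false,
      false_and, if_false, zero_mul, reduceCtorEq, not_false_eq_true, Option.some.injEq, ite_mul, one_mul]
    rw [← Finset.sum_filter, Finset.sum_const, Finset.filter_ne' , Finset.card_erase_of_mem (Finset.mem_univ _),
      Finset.card_univ, Fintype.card_fin, nsmul_eq_mul, zero_add, Nat.cast_sub (by omega), Nat.cast_one]
    have : (m : ℝ) - 1 ≠ 0 := by linarith
    field_simp

end Noise

section Harris

/-- Chebyshev's association inequality. -/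
lemma integral_mul_integral_le {X : Type*} [MeasurableSpace X] (μ : Measure X) [IsProbabilityMeasure μ]
    {G H : X → ℝ} (hG : BM G) (hH : BM H) (h : ∀ x y, 0 ≤ (G x - G y) * (H x - H y)) :
    (∫ x, G x ∂μ) * (∫ x, H x ∂μ) ≤ ∫ x, G x * H x ∂μ := by
  have iG := hG.integrable μ
  have iH := hH.integrable μ
  have iGH := (hG.mul hH).integrable μ
  have h1 : ∀ x, ∫ y, (G x - G y) * (H x - H y) ∂μ =
      G x * H x - G x * (∫ y, H y ∂μ) - H x * (∫ y, G y ∂μ) + ∫ y, G y * H y ∂μ := by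
    intro x
    have e : ∀ y, (G x - G y) * (H x - H y) = G x * H x - G x * H y - H x * G y + G y * H y :=
      fun y => by ring
    simp only [e]
    have i1 : Integrable (fun y => G x * H x - G x * H y) μ := (integrable_const _).sub (iH.const_mul _)
    have i2 : Integrable (fun y => G x * H x - G x * H y - H x * G y) μ := i1.sub (iG.const_mul _)
    rw [integral_add i2 iGH, integral_sub i1 (iG.const_mul _), integral_sub (integrable_const _) (iH.const_mul _), integral_const_mul, integral_const_mul,
      integral_const]
    simp [integral_const_mul]
  have h2 : 0 ≤ ∫ x, ∫ y, (G x - G y) * (H x - H y) ∂μ ∂μ :=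
    integral_nonneg fun x => integral_nonneg fun y => h x y
  simp only [h1] at h2
  have i1 : Integrable (fun x => G x * H x - G x * (∫ y, H y ∂μ)) μ := iGH.sub (iG.mul_const _)
  have i2 : Integrable (fun x => G x * H x - G x * (∫ y, H y ∂μ) - H x * (∫ y, G y ∂μ)) μ :=
    i1.sub (iH.mul_const _)
  rw [integral_add i2 (integrable_const _), integral_sub i1 (iH.mul_const _), integral_sub iGH (iG.mul_const _), integral_mul_const, integral_mul_const] at h2
  simp only [integral_const, probReal_univ, one_smul] at h2
  linarith [mul_comm (∫ x, G x ∂μ) (∫ x, H x ∂μ)]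

variable {ι : Type*} [Fintype ι] [DecidableEq ι] {ν : Measure ℝ} [IsProbabilityMeasure ν]
  {g h : (ι → ℝ) → ℝ}

lemma monotone_proj (hg : BM g) (hm : Monotone g) (W : Finset ι) : Monotone (proj ν W g) := by
  intro x y hxy
  refine integral_mono ((hg.comp ((measurable_piecewise W).comp measurable_prodMk_left)).integrable _)
    ((hg.comp ((measurable_piecewise W).comp measurable_prodMk_left)).integrable _) fun z => hm fun i => ?_
  by_cases hi : i ∈ W <;> simp [Finset.piecewise, hi, hxy i]

lemma piecewise_erase (x y : ι → ℝ) (i : ι) :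
    (Finset.univ.erase i).piecewise x y = Function.update x i (y i) := by
  ext j
  by_cases hj : j = i
  · subst hj; simp
  · simp [hj]

lemma integral_proj_erase_mul_le (hg : BM g) (hh : BM h) (mg : Monotone g) (mh : Monotone h) (i : ι) :
    ∫ x, proj ν (Finset.univ.erase i) g x * proj ν (Finset.univ.erase i) h x ∂(Measure.pi fun _ => ν) ≤
      ∫ x, g x * h x ∂(Measure.pi fun _ => ν) := by
  rw [← integral_proj (hg.mul hh) (Finset.univ.erase i)]
  refine integral_mono (((hg.proj _).mul (hh.proj _)).integrable _) (((hg.mul hh).proj _).integrable _)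
    fun x => ?_
  have hmeas : Measurable fun y : ι → ℝ => (Finset.univ.erase i).piecewise x y :=
    (measurable_piecewise _).comp measurable_prodMk_left
  refine integral_mul_integral_le _ (hg.comp hmeas) (hh.comp hmeas) fun y z => ?_
  simp only [piecewise_erase]
  have key : ∀ a b : ℝ, a ≤ b → Function.update x i a ≤ Function.update x i b := fun a b hab =>
    update_le_update_iff.2 ⟨hab, fun _ _ => le_rfl⟩
  rcases le_total (y i) (z i) with hyz | hyz
  · exact mul_nonneg_of_nonpos_of_nonpos (sub_nonpos.2 (mg (key _ _ hyz))) (sub_nonpos.2 (mh (key _ _ hyz)))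
  · exact mul_nonneg (sub_nonneg.2 (mg (key _ _ hyz))) (sub_nonneg.2 (mh (key _ _ hyz)))

/-- Harris' inequality. -/
lemma harris (hg : BM g) (hh : BM h) (mg : Monotone g) (mh : Monotone h) :
    (∫ x, g x ∂(Measure.pi fun _ => ν)) * (∫ x, h x ∂(Measure.pi fun _ => ν)) ≤
      ∫ x, g x * h x ∂(Measure.pi fun _ => ν) := by
  have key : ∀ S : Finset ι, ∫ x, proj ν Sᶜ g x * proj ν Sᶜ h x ∂(Measure.pi fun _ => ν) ≤
      ∫ x, g x * h x ∂(Measure.pi fun _ => ν) := by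
    intro S
    induction S using Finset.induction_on with
    | empty => simp [proj_univ]
    | insert i S hi ih =>
      refine le_trans ?_ ih
      have e : (insert i S)ᶜ = Finset.univ.erase i ∩ Sᶜ := by
        ext j; simp
      rw [e, ← proj_proj hg, ← proj_proj hh]
      exact integral_proj_erase_mul_le (hg.proj _) (hh.proj _) (monotone_proj hg mg _)
        (monotone_proj hh mh _) i
  have := key Finset.univ
  rw [Finset.compl_univ] at this
  simpa [proj] using this

/-- Positive association of increasing events. -/
lemma harris_set {A B : Set (ι → ℝ)} (hA : MeasurableSet A) (hB : MeasurableSet B)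
    (mA : IsUpperSet A) (mB : IsUpperSet B) :
    (Measure.pi fun _ => ν).real A * (Measure.pi fun _ => ν).real B ≤
      (Measure.pi fun _ => ν).real (A ∩ B) := by
  have mono : ∀ {A : Set (ι → ℝ)}, IsUpperSet A → Monotone (A.indicator fun _ => (1 : ℝ)) := by
    intro A mA x y hxy
    by_cases hx : x ∈ A
    · simp [hx, mA hxy hx]
    · simp [hx, indicator_nonneg]
  have := harris (ν := ν) (BM.indicator hA) (BM.indicator hB) (mono mA) (mono mB)
  have e : ∀ x, A.indicator (fun _ => (1 : ℝ)) x * B.indicator (fun _ => (1 : ℝ)) x =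
      (A ∩ B).indicator (fun _ => (1 : ℝ)) x := fun x => by
    by_cases h1 : x ∈ A <;> by_cases h2 : x ∈ B <;> simp [h1, h2]
  simp only [e] at this
  rwa [integral_indicator_const _ hA, integral_indicator_const _ hB,
    integral_indicator_const _ (hA.inter hB), smul_eq_mul, smul_eq_mul, smul_eq_mul, mul_one, mul_one,
    mul_one] at this

end Harris

section Shift

lemma gaussian_le_volume (s : Set ℝ) : ProbabilityTheory.gaussianReal 0 1 s ≤ volume s := by
  rw [ProbabilityTheory.gaussianReal_apply 0 one_ne_zero]
  refine (lintegral_mono (g := fun _ => 1) fun x => ?_).trans_eq (by simp)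
  rw [ProbabilityTheory.gaussianPDF, ← ENNReal.ofReal_one]
  refine ENNReal.ofReal_le_ofReal ?_
  rw [ProbabilityTheory.gaussianPDFReal]
  refine mul_le_one₀ (inv_le_one_of_one_le₀ ?_) (Real.exp_nonneg _) ?_
  · rw [Real.one_le_sqrt]
    have := Real.pi_gt_three
    push_cast; linarith
  · rw [Real.exp_le_one_iff]
    have : 0 ≤ (x - 0) ^ 2 / (2 * ((1 : ℝ≥0) : ℝ)) := by positivity
    rw [neg_div]; linarith

lemma gaussian_shift_le {U : Set ℝ} (hU : IsUpperSet U) {a : ℝ} (ha : 0 ≤ a) :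
    (ProbabilityTheory.gaussianReal 0 1).real {y | y + a ∈ U} ≤
      (ProbabilityTheory.gaussianReal 0 1).real U + a := by
  have h1 : {y | y + a ∈ U} ⊆ U ∪ {y | y + a ∈ U ∧ y ∉ U} := fun y hy => by
    by_cases h : y ∈ U
    · exact .inl h
    · exact .inr ⟨hy, h⟩
  refine (measureReal_mono h1).trans ((measureReal_union_le _ _).trans (add_le_add_right ?_ _))
  refine ENNReal.toReal_le_of_le_ofReal ha ((gaussian_le_volume _).trans ((Real.volume_le_diam _).trans ?_))
  refine Metric.ediam_le fun x hx y hy => ?_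
  rw [edist_dist]
  refine ENNReal.ofReal_le_ofReal ?_
  rw [Real.dist_eq, abs_le]
  constructor
  · by_contra! h
    exact hy.2 (hU (by linarith) hx.1)
  · by_contra! h
    exact hx.2 (hU (by linarith) hy.1)

variable {ι : Type*} [Fintype ι] [DecidableEq ι]

lemma gam_shift_one_le {A : Set (ι → ℝ)} (hA : MeasurableSet A) (mA : IsUpperSet A) (i : ι) {a : ℝ}
    (ha : 0 ≤ a) : (gam ι).real {x | Function.update x i (x i + a) ∈ A} ≤ (gam ι).real A + a := by
  have hup : ∀ x : ι → ℝ, Measurable fun s : ℝ => Function.update x i s := fun x => measurable_update x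
  have hA' : MeasurableSet {x | Function.update x i (x i + a) ∈ A} := by
    have : Measurable fun x : ι → ℝ => Function.update x i (x i + a) := by
      refine measurable_pi_lambda _ fun j => ?_
      by_cases hj : j = i
      · subst hj; simp; fun_prop
      · simp [hj]; fun_prop
    exact this hA
  have e : ∀ {B : Set (ι → ℝ)}, MeasurableSet B → (gam ι).real B =
      ∫ x, (ProbabilityTheory.gaussianReal 0 1).real {s | Function.update x i s ∈ B} ∂(gam ι) := by
    intro B hB
    have h1 := integral_proj (ν := ProbabilityTheory.gaussianReal 0 1) (BM.indicator hB) (Finset.univ.erase i)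
    rw [integral_indicator_const _ hB, smul_eq_mul, mul_one] at h1
    rw [← h1]
    refine integral_congr_ae (.of_forall fun x => ?_)
    beta_reduce
    have hpre : MeasurableSet {s | Function.update x i s ∈ B} := hup x hB
    rw [← (measurePreserving_eval (fun _ : ι => ProbabilityTheory.gaussianReal 0 1) i).measureReal_preimage
      hpre.nullMeasurableSet, ← mul_one (Measure.real _ _), ← smul_eq_mul,
      ← integral_indicator_const _ ((measurable_pi_apply i) hpre), proj]
    refine integral_congr_ae (.of_forall fun y => ?_)
    beta_reduce
    rw [piecewise_erase]
    rfl
  have im : ∀ {B : Set (ι → ℝ)}, MeasurableSet B → Integrable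
      (fun x => (ProbabilityTheory.gaussianReal 0 1).real {s | Function.update x i s ∈ B}) (gam ι) := by
    intro B hB
    refine BM.integrable ⟨?_, 1, fun x => ?_⟩ _
    · have hm : MeasurableSet {q : (ι → ℝ) × ℝ | Function.update q.1 i q.2 ∈ B} := by
        have : Measurable fun q : (ι → ℝ) × ℝ => Function.update q.1 i q.2 := by
          refine measurable_pi_lambda _ fun j => ?_
          by_cases hj : j = i
          · subst hj; simp; fun_prop
          · simp [hj]; fun_prop
        exact this hB
      exact (measurable_measure_prodMk_left hm).ennreal_toReal
    · rw [abs_of_nonneg measureReal_nonneg]; exact measureReal_le_one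
  rw [e hA', e hA]
  have e2 : (∫ x, (ProbabilityTheory.gaussianReal 0 1).real {s | Function.update x i s ∈ A} ∂(gam ι)) + a =
      ∫ x, ((ProbabilityTheory.gaussianReal 0 1).real {s | Function.update x i s ∈ A} + a) ∂(gam ι) := by
    rw [integral_add (im hA) (integrable_const _)]; simp
  rw [e2]
  refine integral_mono (im hA') ((im hA).add (integrable_const _)) fun x => ?_
  have := gaussian_shift_le (U := {s | Function.update x i s ∈ A})
    (fun s t hst hs => mA (update_le_update_iff.2 ⟨hst, fun _ _ => le_rfl⟩) hs) ha
  simpa using this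

/-- Effect on increasing events of a shift of some of the coordinates. -/
lemma gam_shift_le {A : Set (ι → ℝ)} (hA : MeasurableSet A) (mA : IsUpperSet A) (S : Finset ι) {a : ℝ}
    (ha : 0 ≤ a) : (gam ι).real {x | (fun i => x i + if i ∈ S then a else 0) ∈ A} ≤
      (gam ι).real A + S.card * a := by
  induction S using Finset.induction_on generalizing A with
  | empty => simp only [Finset.notMem_empty, if_false, add_zero, Finset.card_empty, Nat.cast_zero, zero_mul]; rfl
  | insert j S hj ih =>
    have hA' : MeasurableSet {x | Function.update x j (x j + a) ∈ A} := by
      have : Measurable fun x : ι → ℝ => Function.update x j (x j + a) := by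
        refine measurable_pi_lambda _ fun k => ?_
        by_cases hk : k = j
        · subst hk; simp; fun_prop
        · simp [hk]; fun_prop
      exact this hA
    have mA' : IsUpperSet {x | Function.update x j (x j + a) ∈ A} := fun x y hxy hx =>
      mA (update_le_update_iff.2 ⟨by linarith [hxy j], fun k _ => hxy k⟩) hx
    have h1 := ih hA' mA'
    have h2 := gam_shift_one_le hA mA j ha
    have e : {x : ι → ℝ | (fun i => x i + if i ∈ insert j S then a else 0) ∈ A} =
        {x | (fun i => x i + if i ∈ S then a else 0) ∈ {x | Function.update x j (x j + a) ∈ A}} := by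
      ext x
      simp only [mem_ofPred_eq]
      refine iff_of_eq (congrArg (· ∈ A) (funext fun i => ?_))
      by_cases hi : i = j
      · subst hi; simp [hj]
      · simp [hi]
    rw [e, Finset.card_insert_of_notMem hj]
    push_cast
    linarith

end Shift

/-- Weights of the one-dimensional Bargmann–Fock expansion. -/
def phi (k : ℕ) (x : ℝ) : ℝ := Real.exp (-x ^ 2 / 2) * x ^ k / √(k.factorial : ℝ)

lemma phi_nonneg (k : ℕ) {x : ℝ} (hx : 0 ≤ x) : 0 ≤ phi k x := by
  unfold phi; positivity

lemma phi_mul_phi (k : ℕ) (x y : ℝ) : phi k x * phi k y =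
    Real.exp (-(x ^ 2 + y ^ 2) / 2) * ((x * y) ^ k / k.factorial) := by
  have h1 : (0 : ℝ) < k.factorial := by exact_mod_cast k.factorial_pos
  have e : Real.exp (-(x ^ 2 + y ^ 2) / 2) = Real.exp (-x ^ 2 / 2) * Real.exp (-y ^ 2 / 2) := by
    rw [← Real.exp_add]; congr 1; ring
  unfold phi
  rw [e, div_mul_div_comm, Real.mul_self_sqrt h1.le]
  ring

lemma hasSum_phi_mul (x y : ℝ) :
    HasSum (fun k => phi k x * phi k y) (Real.exp (-(x - y) ^ 2 / 2)) := by
  simp only [phi_mul_phi]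
  have h := (NormedSpace.expSeries_div_hasSum_exp (x * y)).mul_left (Real.exp (-(x ^ 2 + y ^ 2) / 2))
  rw [← Real.exp_eq_exp_ℝ, ← Real.exp_add] at h
  have e : -(x - y) ^ 2 / 2 = -(x ^ 2 + y ^ 2) / 2 + x * y := by ring
  rwa [e]

lemma phi_zero_zero : phi 0 0 = 1 := by simp [phi]

lemma phi_zero_right {k : ℕ} (hk : k ≠ 0) : phi k 0 = 0 := by simp [phi, hk]

lemma phi_le_gauss (k : ℕ) {x : ℝ} (hx : 0 ≤ x) : phi k x ≤ Real.exp (-(x - √k) ^ 2 / 2) := by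
  rcases Nat.eq_zero_or_pos k with rfl | hk
  · simp [phi]
  have hk' : (0 : ℝ) < k := by exact_mod_cast hk
  have h1 : (0 : ℝ) < k.factorial := by exact_mod_cast k.factorial_pos
  set y := √(k : ℝ) with hy
  have hy0 : 0 < y := Real.sqrt_pos.2 hk'
  have hyk : y ^ 2 = k := Real.sq_sqrt hk'.le
  have h2 : x ^ k ≤ y ^ k * Real.exp (x * y - k) := by
    have h3 : x / y ≤ Real.exp (x / y - 1) := by
      have := Real.add_one_le_exp (x / y - 1); linarith
    have h4 := pow_le_pow_left₀ (by positivity) h3 k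
    rw [← Real.exp_nat_mul, div_pow, div_le_iff₀ (by positivity)] at h4
    have e : (k : ℝ) * (x / y - 1) = x * y - k := by
      rw [← hyk]; field_simp
    rw [e] at h4
    linarith
  have h5 : y ^ k / √(k.factorial : ℝ) ≤ Real.exp (k / 2) := by
    rw [div_le_iff₀ (Real.sqrt_pos.2 h1)]
    refine le_of_sq_le_sq ?_ (by positivity)
    rw [mul_pow, Real.sq_sqrt h1.le, ← Real.exp_nat_mul, ← pow_mul, mul_comm k 2, pow_mul, hyk]
    have := Real.pow_div_factorial_le_exp (k : ℝ) hk'.le k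
    rw [div_le_iff₀ h1] at this
    convert this using 3
    push_cast; ring
  have e2 : Real.exp (-(x - y) ^ 2 / 2) =
      Real.exp (-x ^ 2 / 2) * Real.exp (x * y - k) * Real.exp (k / 2) := by
    rw [← Real.exp_add, ← Real.exp_add]; congr 1; rw [← hyk]; ring
  rw [e2]
  calc phi k x ≤ Real.exp (-x ^ 2 / 2) * (y ^ k * Real.exp (x * y - k)) / √(k.factorial : ℝ) := by
        unfold phi; gcongr
    _ = Real.exp (-x ^ 2 / 2) * Real.exp (x * y - k) * (y ^ k / √(k.factorial : ℝ)) := by ring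
    _ ≤ _ := by gcongr

/-- Constant controlling the weights on `[0, X]`. -/
def Kc (X : ℝ) : ℝ := 48 ^ 6 * (1 + X ^ 2) ^ 6

lemma one_le_Kc (X : ℝ) : 1 ≤ Kc X := by
  unfold Kc
  have : 1 ≤ (1 + X ^ 2) ^ 6 := one_le_pow₀ (by nlinarith [sq_nonneg X])
  nlinarith

lemma gauss_decay {x y X : ℝ} (hx : 0 ≤ x) (hX : x ≤ X) :
    Real.exp (-(x - y) ^ 2 / 4) * (1 + y ^ 2) ^ 6 ≤ Kc X := by
  set u := (x - y) ^ 2 with hu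
  have hu0 : 0 ≤ u := sq_nonneg _
  have h1 : 1 + y ^ 2 ≤ 2 * (1 + X ^ 2) * (1 + u) := by
    have : x ^ 2 ≤ X ^ 2 := pow_le_pow_left₀ hx hX 2
    have h' : 1 + y ^ 2 ≤ 2 * (1 + x ^ 2) * (1 + u) := by
      rw [hu]; nlinarith [sq_nonneg (2 * x - y), sq_nonneg (x * (x - y))]
    refine h'.trans ?_
    gcongr
  have h2 : 1 + u ≤ 24 * Real.exp (u / 24) := by
    have := Real.add_one_le_exp (u / 24); linarith
  calc Real.exp (-u / 4) * (1 + y ^ 2) ^ 6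
      ≤ Real.exp (-u / 4) * (2 * (1 + X ^ 2) * (24 * Real.exp (u / 24))) ^ 6 := by
        gcongr
        exact h1.trans (by gcongr)
    _ = Kc X * (Real.exp (-u / 4) * Real.exp (u / 24) ^ 6) := by unfold Kc; ring
    _ = Kc X := by
        rw [← Real.exp_nat_mul, ← Real.exp_add]
        have : -u / 4 + ((6 : ℕ) : ℝ) * (u / 24) = 0 := by push_cast; ring
        rw [this, Real.exp_zero, mul_one]

lemma phi_le_of_far (k : ℕ) {x X R : ℝ} (hx : 0 ≤ x) (hX : x ≤ X) (hR0 : 0 ≤ R) (hR : R ≤ |√k - x|) :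
    phi k x ≤ Real.exp (-R ^ 2 / 4) * (Kc X / (1 + k) ^ 6) := by
  refine (phi_le_gauss k hx).trans ?_
  have hk : √(k : ℝ) ^ 2 = k := Real.sq_sqrt (Nat.cast_nonneg k)
  have h1 := gauss_decay (y := √k) hx hX
  rw [hk] at h1
  have hR2 : R ^ 2 ≤ (x - √k) ^ 2 := by
    rw [← sq_abs (x - √k), abs_sub_comm]
    exact pow_le_pow_left₀ hR0 hR 2
  have e : Real.exp (-(x - √k) ^ 2 / 2) = Real.exp (-(x - √k) ^ 2 / 4) * Real.exp (-(x - √k) ^ 2 / 4) := by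
    rw [← Real.exp_add]; congr 1; ring
  rw [e]
  have hpos : (0 : ℝ) < (1 + k) ^ 6 := by positivity
  refine mul_le_mul (Real.exp_le_exp.2 (by linarith)) ?_ (Real.exp_nonneg _) (Real.exp_nonneg _)
  rw [le_div_iff₀ hpos]
  exact h1

lemma phi_le (k : ℕ) {x X : ℝ} (hx : 0 ≤ x) (hX : x ≤ X) : phi k x ≤ Kc X / (1 + k) ^ 6 := by
  have := phi_le_of_far k hx hX le_rfl (abs_nonneg _)
  simpa using this

lemma phi_le_one (k : ℕ) {x : ℝ} (hx : 0 ≤ x) : phi k x ≤ 1 := by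
  refine (phi_le_gauss k hx).trans (Real.exp_le_one_iff.2 ?_)
  nlinarith [sq_nonneg (x - √k)]

lemma phi_sub_le (k : ℕ) (x y : ℝ) : |phi k x - phi k y| ≤ |x - y| := by
  have h := ((hasSum_phi_mul x x).add (hasSum_phi_mul y y)).sub ((hasSum_phi_mul x y).mul_left 2)
  have e : (fun k => phi k x * phi k x + phi k y * phi k y - 2 * (phi k x * phi k y)) =
      fun k => (phi k x - phi k y) ^ 2 := by ext k; ring
  rw [e] at h
  have h1 := le_hasSum h k fun j _ => sq_nonneg _
  have h2 := Real.add_one_le_exp (-(x - y) ^ 2 / 2)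
  refine sq_le_sq.1 (h1.trans ?_)
  simp only [sub_self]
  norm_num
  linarith

lemma phi_sub_le' (k : ℕ) {x y X : ℝ} (hx : 0 ≤ x) (hX : x ≤ X) (hy : 0 ≤ y) (hY : y ≤ X) :
    |phi k x - phi k y| ≤ √|x - y| * (Kc X / (1 + k) ^ 3) := by
  have hK := one_le_Kc X
  have h1 : |phi k x - phi k y| ≤ Kc X / (1 + k) ^ 6 := by
    rw [abs_le]
    have := phi_le k hx hX
    have := phi_le k hy hY
    have := phi_nonneg k hx
    have := phi_nonneg k hy
    constructor <;> linarith
  have h2 : |phi k x - phi k y| ^ 2 ≤ |x - y| * (Kc X / (1 + k) ^ 6) := by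
    rw [sq]
    exact mul_le_mul (phi_sub_le k x y) h1 (abs_nonneg _) (abs_nonneg _)
  refine le_of_sq_le_sq (h2.trans ?_) (by positivity)
  rw [mul_pow, Real.sq_sqrt (abs_nonneg _), div_pow, ← pow_mul]
  gcongr
  nlinarith

lemma hasSum_nat_mul_phi (x : ℝ) : HasSum (fun k : ℕ => (k : ℝ) * (phi k x * phi k x)) (x ^ 2) := by
  have h := (hasSum_phi_mul x x).mul_left (x ^ 2)
  have e : (fun k => x ^ 2 * (phi k x * phi k x)) =
      fun k : ℕ => ((k + 1 : ℕ) : ℝ) * (phi (k + 1) x * phi (k + 1) x) := by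
    ext k
    have h1 : (k.factorial : ℝ) ≠ 0 := by exact_mod_cast k.factorial_ne_zero
    simp only [phi_mul_phi, Nat.factorial_succ]
    push_cast
    field_simp
    ring
  rw [e, hasSum_nat_add_iff (f := fun k : ℕ => (k : ℝ) * (phi k x * phi k x)) 1] at h
  simpa using h

lemma sum_phi_ge {N0 : ℕ} {x X : ℝ} (hx : 0 ≤ x) (hX : x ≤ X) (hN0 : 0 < N0) (hN : 2 * X ^ 2 ≤ N0) :
    1 / 2 ≤ ∑ k ∈ Finset.range N0, phi k x := by
  have hN' : (0 : ℝ) < N0 := by exact_mod_cast hN0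
  have hxX : x ^ 2 ≤ X ^ 2 := pow_le_pow_left₀ hx hX 2
  have h1 := (hasSum_phi_mul x x).sub ((hasSum_nat_mul_phi x).div_const (N0 : ℝ))
  have h2 : HasSum (fun k => if k ∈ Finset.range N0 then phi k x else 0)
      (∑ k ∈ Finset.range N0, phi k x) := by
    have : HasSum (fun k => if k ∈ Finset.range N0 then phi k x else 0)
        (∑ k ∈ Finset.range N0, if k ∈ Finset.range N0 then phi k x else 0) :=
      hasSum_sum_of_ne_finset_zero (L := SummationFilter.unconditional ℕ)
        (fun k hk => by simp only [hk, if_false])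
    rwa [Finset.sum_congr rfl fun k hk => if_pos hk] at this
  have hle : ∀ k : ℕ, phi k x * phi k x - k * (phi k x * phi k x) / N0 ≤
      if k ∈ Finset.range N0 then phi k x else 0 := by
    intro k
    have h0 := phi_nonneg k hx
    have h4 := phi_le_one k hx
    have e : phi k x * phi k x - k * (phi k x * phi k x) / N0 =
        phi k x * phi k x * (1 - k / N0) := by ring
    rw [e]
    split_ifs with hk
    · have : 0 ≤ (k : ℝ) / N0 := by positivity
      nlinarith [mul_nonneg h0 h0]
    · have : (1 : ℝ) ≤ k / N0 := by
        rw [le_div_iff₀ hN', one_mul]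
        exact_mod_cast not_lt.1 fun h => hk (Finset.mem_range.2 h)
      exact mul_nonpos_of_nonneg_of_nonpos (mul_nonneg h0 h0) (by linarith)
  have h3 := hasSum_le hle h1 h2
  refine le_trans ?_ h3
  have : x ^ 2 / N0 ≤ 1 / 2 := by rw [div_le_iff₀ hN']; linarith
  simp only [sub_self]
  norm_num
  linarith

section Model
variable {N : ℕ}

/-- Index set of the truncated Bargmann–Fock expansion. -/
abbrev Blk (N : ℕ) := Fin N × Fin N

/-- Coefficients of the truncated Bargmann–Fock expansion. -/
def cf (N : ℕ) (z : ℝ × ℝ) (i : Blk N) : ℝ := phi i.1 z.1 * phi i.2 z.2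

open Classical in
/-- Coefficients of the localised expansion. -/
def cfl (R : ℝ) (N : ℕ) (z : ℝ × ℝ) (i : Blk N) : ℝ :=
  if |√(i.1 : ℕ) - z.1| ≤ R ∧ |√(i.2 : ℕ) - z.2| ≤ R then cf N z i else 0

/-- The square `[0, X]²`. -/
def box (X : ℝ) : Set (ℝ × ℝ) := {z | (0 ≤ z.1 ∧ z.1 ≤ X) ∧ 0 ≤ z.2 ∧ z.2 ≤ X}

lemma cf_nonneg {X : ℝ} {z : ℝ × ℝ} (hz : z ∈ box X) (i : Blk N) : 0 ≤ cf N z i :=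
  mul_nonneg (phi_nonneg _ hz.1.1) (phi_nonneg _ hz.2.1)

lemma sum_blk (a b : ℕ → ℝ) : ∑ i : Blk N, a i.1 * b i.2 =
    (∑ k ∈ Finset.range N, a k) * ∑ k ∈ Finset.range N, b k := by
  rw [← Fin.sum_univ_eq_sum_range, ← Fin.sum_univ_eq_sum_range, Finset.sum_mul_sum,
    Fintype.sum_prod_type]

lemma sum_inv_sq_le (N : ℕ) : ∑ k ∈ Finset.range N, 1 / (1 + (k : ℝ)) ^ 2 ≤ 2 := by
  have h : ∀ N : ℕ, ∑ k ∈ Finset.range (N + 1), 1 / (1 + (k : ℝ)) ^ 2 ≤ 2 - 1 / ((N : ℝ) + 1) := by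
    intro N
    induction N with
    | zero => norm_num
    | succ n ih =>
      rw [Finset.sum_range_succ]
      push_cast
      have e : 1 / (1 + ((n : ℝ) + 1)) ^ 2 ≤ 1 / ((n : ℝ) + 1) - 1 / (n + 1 + 1) := by
        rw [div_sub_div _ _ (by positivity) (by positivity), div_le_div_iff₀ (by positivity) (by positivity)]
        nlinarith [Nat.cast_nonneg (α := ℝ) n]
      linarith
  rcases N with _ | N
  · simp
  refine (h N).trans ?_
  have : (0 : ℝ) ≤ 1 / ((N : ℝ) + 1) := by positivity
  linarith

/-- Configurations with controlled growth. -/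
def Tame (N : ℕ) (B : ℝ) : Set (Blk N → ℝ) :=
  {ξ | ∀ i : Blk N, |ξ i| ≤ B * ((1 + (i.1 : ℕ)) * (1 + (i.2 : ℕ)))}

lemma abs_sum_le_of_tame {B A : ℝ} (hA : 0 ≤ A) (hB : 0 ≤ B) {ξ : Blk N → ℝ} (hξ : ξ ∈ Tame N B) {a : Blk N → ℝ}
    (ha : ∀ i : Blk N, |a i| ≤ A / ((1 + (i.1 : ℕ)) ^ 3 * (1 + (i.2 : ℕ)) ^ 3)) :
    |∑ i, a i * ξ i| ≤ 4 * B * A := by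
  have h1 := sum_blk (N := N) (fun k => 1 / (1 + (k : ℝ)) ^ 2) (fun k => 1 / (1 + (k : ℝ)) ^ 2)
  calc |∑ i, a i * ξ i| ≤ ∑ i, |a i * ξ i| := Finset.abs_sum_le_sum_abs _ _
    _ ≤ ∑ i : Blk N, A * B * (1 / (1 + ((i.1 : ℕ) : ℝ)) ^ 2 * (1 / (1 + ((i.2 : ℕ) : ℝ)) ^ 2)) := by
        refine Finset.sum_le_sum fun i _ => ?_
        rw [abs_mul]
        refine (mul_le_mul (ha i) (hξ i) (abs_nonneg _) (by positivity)).trans (le_of_eq ?_)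
        field_simp
    _ ≤ A * B * (2 * 2) := by
        rw [← Finset.mul_sum, h1]
        refine mul_le_mul_of_nonneg_left ?_ (by positivity)
        exact mul_le_mul (sum_inv_sq_le N) (sum_inv_sq_le N)
          (Finset.sum_nonneg fun _ _ => by positivity) (by norm_num)
    _ = _ := by ring

lemma div_pow_le_div_pow {K : ℝ} (hK : 0 ≤ K) (k : ℕ) : K / (1 + (k : ℝ)) ^ 6 ≤ K / (1 + (k : ℝ)) ^ 3 := by
  have : (1 : ℝ) ≤ 1 + k := by linarith [Nat.cast_nonneg (α := ℝ) k]
  exact div_le_div_of_nonneg_left hK (by positivity) (pow_le_pow_right₀ this (by norm_num))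

lemma abs_phi_le (k : ℕ) {x X : ℝ} (hx : 0 ≤ x) (hX : x ≤ X) : |phi k x| ≤ Kc X / (1 + k) ^ 3 := by
  rw [abs_of_nonneg (phi_nonneg k hx)]
  exact (phi_le k hx hX).trans (div_pow_le_div_pow (by linarith [one_le_Kc X]) k)

/-- Modulus of continuity on tame configurations. -/
lemma abs_sub_le_of_tame {B X d : ℝ} (hB : 0 ≤ B) {ξ : Blk N → ℝ} (hξ : ξ ∈ Tame N B) {z w : ℝ × ℝ}
    (hz : z ∈ box X) (hw : w ∈ box X) (h1 : |z.1 - w.1| ≤ d) (h2 : |z.2 - w.2| ≤ d) :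
    |∑ i, cf N z i * ξ i - ∑ i, cf N w i * ξ i| ≤ 8 * B * Kc X ^ 2 * √d := by
  have hK := one_le_Kc X
  rw [← Finset.sum_sub_distrib]
  simp only [← sub_mul]
  refine (abs_sum_le_of_tame (A := 2 * Kc X ^ 2 * √d) (by positivity) hB hξ fun i => ?_).trans
    (le_of_eq (by ring))
  have e : cf N z i - cf N w i = (phi i.1 z.1 - phi i.1 w.1) * phi i.2 z.2 +
      phi i.1 w.1 * (phi i.2 z.2 - phi i.2 w.2) := by unfold cf; ring
  rw [e]
  refine (abs_add_le _ _).trans ?_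
  rw [abs_mul, abs_mul]
  have a1 := phi_sub_le' i.1 hz.1.1 hz.1.2 hw.1.1 hw.1.2
  have a2 := phi_sub_le' i.2 hz.2.1 hz.2.2 hw.2.1 hw.2.2
  have a3 := abs_phi_le i.2 hz.2.1 hz.2.2
  have a4 := abs_phi_le i.1 hw.1.1 hw.1.2
  have s1 : √|z.1 - w.1| ≤ √d := Real.sqrt_le_sqrt h1
  have s2 : √|z.2 - w.2| ≤ √d := Real.sqrt_le_sqrt h2
  calc _ ≤ (√d * (Kc X / (1 + (i.1 : ℕ)) ^ 3)) * (Kc X / (1 + (i.2 : ℕ)) ^ 3) +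
        (Kc X / (1 + (i.1 : ℕ)) ^ 3) * (√d * (Kc X / (1 + (i.2 : ℕ)) ^ 3)) := by
        gcongr
        · exact a1.trans (by gcongr)
        · exact a2.trans (by gcongr)
    _ = _ := by field_simp; ring

/-- Localisation error on tame configurations. -/
lemma abs_cfl_sub_le_of_tame {B X R : ℝ} (hB : 0 ≤ B) (hR : 0 ≤ R) {ξ : Blk N → ℝ} (hξ : ξ ∈ Tame N B)
    {z : ℝ × ℝ} (hz : z ∈ box X) :
    |∑ i, cfl R N z i * ξ i - ∑ i, cf N z i * ξ i| ≤ 4 * B * Kc X ^ 2 * Real.exp (-R ^ 2 / 4) := by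
  have hK := one_le_Kc X
  rw [← Finset.sum_sub_distrib]
  simp only [← sub_mul]
  refine (abs_sum_le_of_tame (A := Kc X ^ 2 * Real.exp (-R ^ 2 / 4)) (by positivity) hB hξ fun i => ?_).trans
    (le_of_eq (by ring))
  have p1 := phi_nonneg i.1 hz.1.1
  have p2 := phi_nonneg i.2 hz.2.1
  have a1 := abs_phi_le i.1 hz.1.1 hz.1.2
  have a2 := abs_phi_le i.2 hz.2.1 hz.2.2
  rw [abs_of_nonneg p1] at a1
  rw [abs_of_nonneg p2] at a2
  unfold cfl
  split_ifs with h
  · rw [sub_self, abs_zero]; positivity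
  rw [zero_sub, abs_neg, abs_of_nonneg (cf_nonneg hz i)]
  unfold cf
  rw [not_and_or, not_le, not_le] at h
  rcases h with h | h
  · have := (phi_le_of_far i.1 hz.1.1 hz.1.2 hR h.le).trans
      (mul_le_mul_of_nonneg_left (div_pow_le_div_pow (by linarith) _) (Real.exp_nonneg _))
    exact (mul_le_mul this a2 p2 (by positivity)).trans (le_of_eq (by field_simp))
  · have := (phi_le_of_far i.2 hz.2.1 hz.2.2 hR h.le).trans
      (mul_le_mul_of_nonneg_left (div_pow_le_div_pow (by linarith) _) (Real.exp_nonneg _))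
    exact (mul_le_mul a1 this p2 (by positivity)).trans (le_of_eq (by field_simp))

lemma gam_coord_le {ι : Type*} [Fintype ι] (i : ι) {c : ℝ} (hc : 0 < c) :
    (gam ι).real {x | c < |x i|} ≤ 1 / c ^ 2 := by
  have h1 : (gam ι).real {x | c < |x i|} = (ProbabilityTheory.gaussianReal 0 1).real {x | c < |x|} := by
    have := (measurePreserving_eval (fun _ : ι => ProbabilityTheory.gaussianReal 0 1) i).measureReal_preimage
      (s := {x : ℝ | c < |x|}) (measurableSet_lt measurable_const (by fun_prop)).nullMeasurableSet
    exact this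
  rw [h1]
  have h2 := ProbabilityTheory.meas_ge_le_variance_div_sq (μ := ProbabilityTheory.gaussianReal 0 1)
    (X := id) (ProbabilityTheory.memLp_id_gaussianReal' 2 (by simp)) hc
  rw [ProbabilityTheory.variance_id_gaussianReal] at h2
  simp only [id_eq, ProbabilityTheory.integral_id_gaussianReal, sub_zero, NNReal.coe_one] at h2
  exact ENNReal.toReal_le_of_le_ofReal (by positivity)
    ((measure_mono fun x (hx : c < |x|) => hx.le).trans h2)

lemma gam_tame_compl_le {B : ℝ} (hB : 0 < B) : (gam (Blk N)).real (Tame N B)ᶜ ≤ 4 / B ^ 2 := by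
  have e : (Tame N B)ᶜ = ⋃ i : Blk N, {ξ | B * ((1 + ((i.1 : ℕ) : ℝ)) * (1 + (i.2 : ℕ))) < |ξ i|} := by
    ext ξ; simp [Tame]
  rw [e]
  refine (measureReal_iUnion_fintype_le _).trans ?_
  calc _ ≤ ∑ i : Blk N, 1 / B ^ 2 * (1 / (1 + ((i.1 : ℕ) : ℝ)) ^ 2 * (1 / (1 + ((i.2 : ℕ) : ℝ)) ^ 2)) := by
        refine Finset.sum_le_sum fun i _ => (gam_coord_le i (by positivity)).trans (le_of_eq ?_)
        field_simp
    _ ≤ 1 / B ^ 2 * (2 * 2) := by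
        rw [← Finset.mul_sum, sum_blk (N := N) (fun k => 1 / (1 + (k : ℝ)) ^ 2) (fun k => 1 / (1 + (k : ℝ)) ^ 2)]
        refine mul_le_mul_of_nonneg_left ?_ (by positivity)
        exact mul_le_mul (sum_inv_sq_le N) (sum_inv_sq_le N)
          (Finset.sum_nonneg fun _ _ => by positivity) (by norm_num)
    _ = _ := by ring

end Model

open Filter Topology

section Sens
variable {N : ℕ} {α : Type*} [Fintype α]

/-- Monotone predicates on finite patterns. -/
def MonoP (p : (α → Prop) → Prop) : Prop := ∀ U V : α → Prop, (∀ a, U a → V a) → p U → p V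

/-- Sensitivity constant on `[0, X]²`. -/
def Sc (X : ℝ) : ℝ := 4 * (2 * X ^ 2 + 2) ^ 2

lemma Sc_pos (X : ℝ) : 0 < Sc X := by unfold Sc; positivity

/-- Truncation level needed on `[0, X]²`. -/
def trunc (X : ℝ) : ℕ := ⌈2 * X ^ 2⌉₊ + 1

/-- The truncated field. -/
def fld (N : ℕ) (z : ℝ × ℝ) (ξ : Blk N → ℝ) : ℝ := ∑ i, cf N z i * ξ i

/-- The localised truncated field. -/
def fldl (R : ℝ) (N : ℕ) (z : ℝ × ℝ) (ξ : Blk N → ℝ) : ℝ := ∑ i, cfl R N z i * ξ i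

@[fun_prop] lemma measurable_fld (z : ℝ × ℝ) : Measurable (fld N z) := by unfold fld; fun_prop

@[fun_prop] lemma measurable_fldl (R : ℝ) (z : ℝ × ℝ) : Measurable (fldl R N z) := by
  unfold fldl; fun_prop

lemma measurableSet_pattern {Ω : Type*} [MeasurableSpace Ω] {X : α → Ω → ℝ} (hX : ∀ a, Measurable (X a))
    (p : (α → Prop) → Prop) (θ : α → ℝ) : MeasurableSet {ω | p fun a => θ a < X a ω} := by
  have : {ω | p fun a => θ a < X a ω} = (fun ω : Ω => fun a => θ a < X a ω) ⁻¹' {q | p q} := rfl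
  rw [this]
  refine measurableSet_preimage (measurable_pi_lambda _ fun a => ?_) (Set.toFinite _).measurableSet
  exact measurableSet_setOfPred.1 (measurableSet_lt measurable_const (hX a))

lemma isUpperSet_pattern {X : ℝ} {p : (α → Prop) → Prop} (hp : MonoP p) (θ : α → ℝ) {z : α → ℝ × ℝ}
    (hz : ∀ a, z a ∈ box X) : IsUpperSet {ξ : Blk N → ℝ | p fun a => θ a < fld N (z a) ξ} := by
  intro ξ ξ' h hξ
  refine hp _ _ (fun a ha => lt_of_lt_of_le ha ?_) hξ
  exact Finset.sum_le_sum fun i _ => mul_le_mul_of_nonneg_left (h i) (cf_nonneg (hz a) i)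

/-- Effect of a small change of threshold on increasing events. -/
lemma pattern_shift_le {X s : ℝ} (hs : 0 ≤ s) (hN : trunc X ≤ N) {p : (α → Prop) → Prop}
    (hp : MonoP p) (θ : α → ℝ) {z : α → ℝ × ℝ} (hz : ∀ a, z a ∈ box X) :
    (gam (Blk N)).real {ξ | p fun a => θ a - s < fld N (z a) ξ} ≤
      (gam (Blk N)).real {ξ | p fun a => θ a < fld N (z a) ξ} + Sc X * s := by
  classical
  set S : Finset (Blk N) := {i | (i.1 : ℕ) ∈ Finset.range (trunc X) ∧ (i.2 : ℕ) ∈ Finset.range (trunc X)} with hS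
  have h1 := gam_shift_le (measurableSet_pattern (fun a => measurable_fld (N := N) (z a)) p θ)
    (isUpperSet_pattern hp θ hz) S (a := 4 * s) (by linarith)
  have hT0 : 0 < trunc X := Nat.succ_pos _
  have hT1 : 2 * X ^ 2 ≤ trunc X := by
    unfold trunc; push_cast; linarith [Nat.le_ceil (2 * X ^ 2)]
  have hT2 : (trunc X : ℝ) ≤ 2 * X ^ 2 + 2 := by
    unfold trunc; push_cast; linarith [Nat.ceil_lt_add_one (by positivity : 0 ≤ 2 * X ^ 2)]
  have hsum : ∀ a : ℕ → ℝ, ∑ k ∈ Finset.range N, (if k ∈ Finset.range (trunc X) then a k else 0) =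
      ∑ k ∈ Finset.range (trunc X), a k := by
    intro a
    rw [← Finset.sum_filter]
    congr 1
    ext k; simp; omega
  have hcard : (S.card : ℝ) ≤ (2 * X ^ 2 + 2) ^ 2 := by
    have e : (S.card : ℝ) = (trunc X : ℝ) * trunc X := by
      have := sum_blk (N := N) (fun k => if k ∈ Finset.range (trunc X) then 1 else 0)
        (fun k => if k ∈ Finset.range (trunc X) then 1 else 0)
      rw [hsum, Finset.sum_const, Finset.card_range, nsmul_eq_mul, mul_one] at this
      rw [← this, hS, Finset.card_filter]
      push_cast
      refine Finset.sum_congr rfl fun i _ => ?_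
      split_ifs <;> simp_all
    rw [e, sq]; gcongr
  have h2 : {ξ : Blk N → ℝ | p fun a => θ a - s < fld N (z a) ξ} ⊆
      {x | (fun i => x i + if i ∈ S then 4 * s else 0) ∈ {ξ | p fun a => θ a < fld N (z a) ξ}} := by
    intro ξ hξ
    refine hp _ _ (fun a ha => ?_) hξ
    have e : fld N (z a) (fun i => ξ i + if i ∈ S then 4 * s else 0) = fld N (z a) ξ +
        4 * s * ((∑ k ∈ Finset.range (trunc X), phi k (z a).1) * ∑ k ∈ Finset.range (trunc X), phi k (z a).2) := by
      unfold fld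
      simp only [mul_add, Finset.sum_add_distrib]
      congr 1
      rw [← hsum (fun k => phi k (z a).1), ← hsum (fun k => phi k (z a).2), ← sum_blk, Finset.mul_sum]
      refine Finset.sum_congr rfl fun i _ => ?_
      simp only [hS, Finset.mem_filter, Finset.mem_univ, true_and, cf]
      (split_ifs <;> simp_all); ring
    change θ a < fld N (z a) _
    rw [e]
    have g1 := sum_phi_ge (hz a).1.1 (hz a).1.2 hT0 hT1
    have g2 := sum_phi_ge (hz a).2.1 (hz a).2.2 hT0 hT1
    have g3 : 1 / 4 ≤ (∑ k ∈ Finset.range (trunc X), phi k (z a).1) *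
        ∑ k ∈ Finset.range (trunc X), phi k (z a).2 := by nlinarith
    nlinarith
  refine (measureReal_mono h2).trans (h1.trans ?_)
  unfold Sc
  nlinarith

/-- Increasing events of a perturbation of the truncated field. -/
lemma pattern_perturb_le {X s B : ℝ} (hs : 0 ≤ s) (hB : 0 < B) (hN : trunc X ≤ N)
    {p : (α → Prop) → Prop} (hp : MonoP p) (θ : α → ℝ) {z : α → ℝ × ℝ} (hz : ∀ a, z a ∈ box X)
    {E : Set (Blk N → ℝ)} (hE : ∀ ξ ∈ E, ξ ∈ Tame N B → p fun a => θ a - s < fld N (z a) ξ) :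
    (gam (Blk N)).real E ≤
      (gam (Blk N)).real {ξ | p fun a => θ a < fld N (z a) ξ} + Sc X * s + 4 / B ^ 2 := by
  have h : E ⊆ {ξ | p fun a => θ a - s < fld N (z a) ξ} ∪ (Tame N B)ᶜ := by
    intro ξ hξ
    by_cases ht : ξ ∈ Tame N B
    exacts [Or.inl (hE ξ hξ ht), Or.inr ht]
  refine (measureReal_mono h).trans ((measureReal_union_le _ _).trans ?_)
  have := pattern_shift_le hs hN hp θ hz
  have := gam_tame_compl_le (N := N) hB
  linarith

/-- Increasing events are stable under perturbations of the truncated field. -/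
lemma pattern_symmDiff_le {X s B : ℝ} (hs : 0 ≤ s) (hB : 0 < B) (hN : trunc X ≤ N)
    {p : (α → Prop) → Prop} (hp : MonoP p) (θ : α → ℝ) {z : α → ℝ × ℝ} (hz : ∀ a, z a ∈ box X)
    {G : α → (Blk N → ℝ) → ℝ} (hG : ∀ ξ ∈ Tame N B, ∀ a, |G a ξ - fld N (z a) ξ| ≤ s) :
    (gam (Blk N)).real {ξ | ¬((p fun a => θ a < G a ξ) ↔ p fun a => θ a < fld N (z a) ξ)} ≤
      2 * Sc X * s + 4 / B ^ 2 := by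
  set A : ℝ → Set (Blk N → ℝ) := fun c => {ξ | p fun a => θ a + c < fld N (z a) ξ} with hA
  have hm : ∀ c, MeasurableSet (A c) := fun c => measurableSet_pattern (fun a => measurable_fld (N := N) (z a)) p _
  have h : {ξ | ¬((p fun a => θ a < G a ξ) ↔ p fun a => θ a < fld N (z a) ξ)} ⊆
      (A (-s) \ A s) ∪ (Tame N B)ᶜ := by
    intro ξ hξ
    by_cases ht : ξ ∈ Tame N B
    · left
      have hg := hG ξ ht
      have i1 : (p fun a => θ a < G a ξ) → ξ ∈ A (-s) := fun h => hp _ _ (fun a ha => by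
        have := abs_le.1 (hg a); linarith) h
      have i2 : ξ ∈ A s → (p fun a => θ a < G a ξ) := fun h => hp _ _ (fun a ha => by
        have := abs_le.1 (hg a); linarith) h
      have i3 : (p fun a => θ a < fld N (z a) ξ) → ξ ∈ A (-s) := fun h => hp _ _ (fun a ha => by
        linarith) h
      have i4 : ξ ∈ A s → (p fun a => θ a < fld N (z a) ξ) := fun h => hp _ _ (fun a ha => by
        linarith) h
      rw [mem_ofPred_eq] at hξ
      refine ⟨?_, ?_⟩ <;> tauto
    · exact Or.inr ht
  have hsub : A s ⊆ A (-s) := fun ξ h => hp _ _ (fun a ha => by linarith) h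
  refine (measureReal_mono h).trans ((measureReal_union_le _ _).trans ?_)
  rw [measureReal_sdiff hsub (hm s)]
  have h1 := pattern_shift_le (by linarith : 0 ≤ 2 * s) hN hp (fun a => θ a + s) hz
  have h2 := gam_tame_compl_le (N := N) hB
  have e : A (-s) = {ξ | p fun a => θ a + s - 2 * s < fld N (z a) ξ} := by
    rw [hA]; simp only; congr 1; ext ξ; refine iff_of_eq (congrArg p ?_); ext a; constructor <;> intro h <;> linarith
  rw [← e] at h1
  linarith

/-- Signs are stable under perturbations of the truncated field. -/
lemma sign_symmDiff_le {X s B : ℝ} (hs : 0 ≤ s) (hB : 0 < B) (hN : trunc X ≤ N)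
    (θ : α → ℝ) {z : α → ℝ × ℝ} (hz : ∀ a, z a ∈ box X)
    {G : α → (Blk N → ℝ) → ℝ} (hG : ∀ ξ ∈ Tame N B, ∀ a, |G a ξ - fld N (z a) ξ| ≤ s) :
    (gam (Blk N)).real {ξ | ∃ a, ¬((θ a < G a ξ) ↔ θ a < fld N (z a) ξ)} ≤
      Fintype.card α * (2 * Sc X * s + 4 / B ^ 2) := by
  have h : {ξ | ∃ a, ¬((θ a < G a ξ) ↔ θ a < fld N (z a) ξ)} =
      ⋃ a, {ξ | ¬((θ a < G a ξ) ↔ θ a < fld N (z a) ξ)} := by ext; simp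
  rw [h]
  refine (measureReal_iUnion_fintype_le _).trans ?_
  refine (Finset.sum_le_sum fun a _ => pattern_symmDiff_le (α := Unit) (p := fun q => q ()) hs hB hN
    (fun U V h => h ()) (fun _ => θ a) (z := fun _ => z a) (fun _ => hz a) (G := fun _ => G a)
    fun ξ hξ _ => hG ξ hξ a).trans ?_
  rw [Finset.sum_const, nsmul_eq_mul, Finset.card_univ]

/-- Positive association of increasing events. -/
lemma pattern_fkg {X : ℝ} {p q : (α → Prop) → Prop} (hp : MonoP p) (hq : MonoP q) (θ : α → ℝ)
    {z : α → ℝ × ℝ} (hz : ∀ a, z a ∈ box X) :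
    (gam (Blk N)).real {ξ | p fun a => θ a < fld N (z a) ξ} *
      (gam (Blk N)).real {ξ | q fun a => θ a < fld N (z a) ξ} ≤
      (gam (Blk N)).real {ξ | (p fun a => θ a < fld N (z a) ξ) ∧ q fun a => θ a < fld N (z a) ξ} :=
  harris_set (measurableSet_pattern (fun a => measurable_fld (z a)) p θ)
    (measurableSet_pattern (fun a => measurable_fld (z a)) q θ)
    (isUpperSet_pattern hp θ hz) (isUpperSet_pattern hq θ hz)

/-- The Bargmann–Fock covariance. -/
def Kbf (z w : ℝ × ℝ) : ℝ := Real.exp (-(z.1 - w.1) ^ 2 / 2) * Real.exp (-(z.2 - w.2) ^ 2 / 2)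

lemma tendsto_cov (z w : ℝ × ℝ) :
    Tendsto (fun N => ∑ i, cf N z i * cf N w i) atTop (𝓝 (Kbf z w)) := by
  have h1 := ((hasSum_phi_mul z.1 w.1).tendsto_sum_nat).mul ((hasSum_phi_mul z.2 w.2).tendsto_sum_nat)
  refine h1.congr fun N => ?_
  rw [← sum_blk (N := N) (fun k => phi k z.1 * phi k w.1) (fun k => phi k z.2 * phi k w.2)]
  exact Finset.sum_congr rfl fun i _ => by unfold cf; ring

end Sens

section Field
variable {Ω : Type*} [MeasurableSpace Ω] {P : Measure Ω} {X : ℝ × ℝ → Ω → ℝ}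

/-- Finite-dimensional laws of the Bargmann–Fock field. -/
def BFF (P : Measure Ω) (X : ℝ × ℝ → Ω → ℝ) : Prop :=
  ∀ (α : Type) [Fintype α] (z : α → ℝ × ℝ), GV P (fun a => X (z a)) fun a b => Kbf (z a) (z b)

lemma BFF.isProb (h : BFF P X) : IsProbabilityMeasure P := (h Unit fun _ => (0, 0)).prob

lemma BFF.meas (h : BFF P X) (z : ℝ × ℝ) : Measurable (X z) := (h Unit fun _ => z).meas ()

lemma Kbf_self (z : ℝ × ℝ) : Kbf z z = 1 := by simp [Kbf]

/-- The lattice pattern of positive sites. -/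
def pos (X : ℝ × ℝ → Ω → ℝ) (g : ℤ × ℤ → ℝ × ℝ) (ω : Ω) : Set (ℤ × ℤ) := {q | 0 < X (g q) ω}

/-- The finite pattern predicate of a local event. -/
def locP (E : Set (ℤ × ℤ) → Prop) (S : Finset (ℤ × ℤ)) (U : S → Prop) : Prop :=
  E {q | ∃ h : q ∈ S, U ⟨q, h⟩}

lemma locP_iff {E : Set (ℤ × ℤ) → Prop} {S : Finset (ℤ × ℤ)} (hE : OnlyOn E S) (X : ℝ × ℝ → Ω → ℝ)
    (g : ℤ × ℤ → ℝ × ℝ) (ω : Ω) : E (pos X g ω) ↔ locP E S fun a => 0 < X (g a) ω := by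
  have : pos X g ω ∩ S = {q | ∃ h : q ∈ S, 0 < X (g (⟨q, h⟩ : S)) ω} ∩ S := by
    ext q; simp only [pos, mem_inter_iff, mem_ofPred_eq, Finset.mem_coe]; tauto
  exact ⟨hE _ _ this, hE _ _ this.symm⟩

lemma monoP_locP {E : Set (ℤ × ℤ) → Prop} (hE : ∀ O O', O ⊆ O' → E O → E O') (S : Finset (ℤ × ℤ)) :
    MonoP (locP E S) := fun U V h hU => hE _ _ (by rintro q ⟨hq, hq'⟩; exact ⟨hq, h _ hq'⟩) hU

lemma Local.exists_finset {E : Set (ℤ × ℤ) → Prop} (hE : Local E) : ∃ S : Finset (ℤ × ℤ), OnlyOn E S := by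
  obtain ⟨S, hS, h⟩ := hE
  exact ⟨hS.toFinset, by simpa using h⟩

lemma BFF.real_eq {Ω' : Type*} [MeasurableSpace Ω'] {P' : Measure Ω'} {X' : ℝ × ℝ → Ω' → ℝ}
    (h : BFF P X) (h' : BFF P' X') {E : Set (ℤ × ℤ) → Prop} (hE : Local E) {g g' : ℤ × ℤ → ℝ × ℝ}
    (hg : ∀ q r, Kbf (g q) (g r) = Kbf (g' q) (g' r)) :
    P.real {ω | E (pos X g ω)} = P'.real {ω | E (pos X' g' ω)} := by
  obtain ⟨S, hS⟩ := hE.exists_finset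
  simp only [locP_iff hS]
  refine GV.patt_eq (h S fun a => g a) ?_ _ _
  have := h' S fun a => g' a
  simp only [← hg] at this
  exact this

lemma BFF.neg (h : BFF P X) : BFF P fun z ω => -X z ω := by
  intro α _ z
  have := h α z
  refine ⟨this.prob, fun a => (this.meas a).neg, fun c => ?_⟩
  have h1 := this.char fun a => -c a
  simp only [neg_mul, mul_neg, neg_neg] at h1 ⊢
  exact h1

lemma BFF.ne_zero (h : BFF P X) (z : ℝ × ℝ) : ∀ᵐ ω ∂P, X z ω ≠ 0 := by
  have h1 := (h Unit fun _ => z).map_eval () (by rw [Kbf_self]; norm_num)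
  have h2 : (P.map (X z)) {0} = 0 := by
    rw [h1, Kbf_self]
    have := ProbabilityTheory.nullSingletonClass_gaussianReal (μ := 0) (v := (1 : ℝ).toNNReal) (by simp)
    exact measure_singleton 0
  rw [Measure.map_apply (h.meas z) (measurableSet_singleton 0)] at h2
  rw [ae_iff]
  simp only [ne_eq, not_not]
  exact h2

lemma BFF.measurableSet (h : BFF P X) {E : Set (ℤ × ℤ) → Prop} (hE : Local E) (g : ℤ × ℤ → ℝ × ℝ) :
    MeasurableSet {ω | E (pos X g ω)} := by
  obtain ⟨S, hS⟩ := hE.exists_finset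
  simp only [locP_iff hS]
  exact measurableSet_pattern (fun a : S => h.meas (g a)) _ _

lemma BFF.compl_eq (h : BFF P X) {E : Set (ℤ × ℤ) → Prop} (hE : Local E) (g : ℤ × ℤ → ℝ × ℝ) :
    P.real {ω | E (pos X g ω)ᶜ} = P.real {ω | E (pos X g ω)} := by
  rw [h.real_eq h.neg hE (g := g) (g' := g) fun _ _ => rfl]
  obtain ⟨S, hS⟩ := hE.exists_finset
  refine measureReal_congr ?_
  have : ∀ᵐ ω ∂P, ∀ q : S, X (g q) ω ≠ 0 := ae_all_iff.2 fun q => h.ne_zero _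
  filter_upwards [this] with ω hω
  have e : (pos X g ω)ᶜ ∩ S = pos (fun z ω => -X z ω) g ω ∩ S := by
    ext q
    simp only [pos, mem_inter_iff, mem_compl_iff, mem_ofPred_eq, Finset.mem_coe, not_lt, and_congr_left_iff,
      Left.neg_pos_iff]
    intro hq
    exact ⟨fun h => lt_of_le_of_ne h (hω ⟨q, hq⟩), le_of_lt⟩
  exact propext ⟨hS _ _ e, hS _ _ e.symm⟩

/-- Convergence of pattern probabilities of the truncated fields. -/
lemma BFF.tendsto_patt (h : BFF P X) {α : Type} [Fintype α] {z z' : α → ℝ × ℝ}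
    (hz : ∀ a b, Kbf (z a) (z b) = Kbf (z' a) (z' b)) (p : (α → Prop) → Prop) (θ : α → ℝ) :
    Tendsto (fun N => (gam (Blk N)).real {ξ | p fun a => θ a < fld N (z' a) ξ}) atTop
      (𝓝 (P.real {ω | p fun a => θ a < X (z a) ω})) := by
  refine GV.tendsto_patt (fun N => GV.linear fun a => cf N (z' a)) (h α z) (fun a b => ?_)
    (fun a => by rw [Kbf_self]; norm_num) p θ
  rw [hz]
  exact tendsto_cov _ _

lemma BFF.tendsto_real (h : BFF P X) {E : Set (ℤ × ℤ) → Prop} (hE : Local E) {g g' : ℤ × ℤ → ℝ × ℝ}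
    (hg : ∀ q r, Kbf (g q) (g r) = Kbf (g' q) (g' r)) :
    Tendsto (fun N => (gam (Blk N)).real {ξ | E (pos (fld N) g' ξ)}) atTop
      (𝓝 (P.real {ω | E (pos X g ω)})) := by
  obtain ⟨S, hS⟩ := hE.exists_finset
  simp only [locP_iff hS]
  exact h.tendsto_patt (α := S) (fun a b => hg a b) _ _

/-- Lattice points of mesh `ε` with offset `c`. -/
def pt (ε c : ℝ) (q : ℤ × ℤ) : ℝ × ℝ := (c + ε * q.1, c + ε * q.2)

lemma Kbf_pt (ε c c' : ℝ) (q r : ℤ × ℤ) : Kbf (pt ε c q) (pt ε c r) = Kbf (pt ε c' q) (pt ε c' r) := by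
  unfold Kbf pt; simp only; ring_nf

lemma pt_mem_box {ε c : ℝ} (hε : 0 ≤ ε) {D : ℤ} (hc : ε * D ≤ c) {q : ℤ × ℤ} (hq : q ∈ rect (-D) D (-D) D) :
    pt ε c q ∈ box (2 * c) := by
  obtain ⟨⟨h1, h2⟩, h3, h4⟩ := hq
  have h1' : -(D : ℝ) ≤ q.1 := by exact_mod_cast h1
  have h2' : (q.1 : ℝ) ≤ D := by exact_mod_cast h2
  have h3' : -(D : ℝ) ≤ q.2 := by exact_mod_cast h3
  have h4' : (q.2 : ℝ) ≤ D := by exact_mod_cast h4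
  unfold pt box
  refine ⟨⟨?_, ?_⟩, ?_, ?_⟩ <;> simp only <;> nlinarith

lemma BFF.fkg (h : BFF P X) {E E' : Set (ℤ × ℤ) → Prop} (hE : Good E) (hE' : Good E') {ε c : ℝ} (hε : 0 ≤ ε) :
    P.real {ω | E (pos X (pt ε c) ω)} * P.real {ω | E' (pos X (pt ε c) ω)} ≤
      P.real {ω | E (pos X (pt ε c) ω) ∧ E' (pos X (pt ε c) ω)} := by
  classical
  obtain ⟨S, hS⟩ := hE.loc.exists_finset
  obtain ⟨S', hS'⟩ := hE'.loc.exists_finset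
  obtain ⟨D, hD⟩ : ∃ D : ℤ, ∀ q ∈ S ∪ S', q ∈ rect (-D) D (-D) D := by
    refine ⟨∑ q ∈ S ∪ S', (|q.1| + |q.2|), fun q hq => ?_⟩
    have := Finset.single_le_sum (f := fun q : ℤ × ℤ => |q.1| + |q.2|) (fun q _ => by positivity) hq
    have a1 := abs_nonneg q.1
    have a2 := abs_nonneg q.2
    have b1 : |q.1| ≤ ∑ q ∈ S ∪ S', (|q.1| + |q.2|) := by linarith
    have b2 : |q.2| ≤ ∑ q ∈ S ∪ S', (|q.1| + |q.2|) := by linarith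
    exact ⟨abs_le.1 b1, abs_le.1 b2⟩
  have k := Kbf_pt ε c (ε * D)
  refine le_of_tendsto_of_tendsto' ((h.tendsto_real hE.loc k).mul (h.tendsto_real hE'.loc k))
    (h.tendsto_real (hE.and hE').loc k) fun N => ?_
  have hS1 : OnlyOn E (S ∪ S' : Finset _) := hS.mono (by simp)
  have hS2 : OnlyOn E' (S ∪ S' : Finset _) := hS'.mono (by simp)
  simp only [locP_iff hS1, locP_iff hS2]
  exact pattern_fkg (monoP_locP hE.mono _) (monoP_locP hE'.mono _) _
    (fun a => pt_mem_box hε le_rfl (hD a a.2))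

end Field

lemma conn4_of_conn8 {O O' : Set (ℤ × ℤ)} {x0 x1 y0 y1 : ℤ} {a b : ℤ × ℤ}
    (hO : ∀ p ∈ O ∩ rect x0 x1 y0 y1, ∀ q ∈ rect x0 x1 y0 y1, Adj8 p q → q ∈ O')
    (h : Conn Adj8 (O ∩ rect x0 x1 y0 y1) a b) : Conn Adj4 (O' ∩ rect x0 x1 y0 y1) a b := by
  have hself : ∀ p ∈ O ∩ rect x0 x1 y0 y1, p ∈ O' ∩ rect x0 x1 y0 y1 := fun p hp =>
    ⟨hO p hp p hp.2 (by unfold Adj8; omega), hp.2⟩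
  obtain ⟨ha, hab⟩ := h
  induction hab with
  | refl => exact Conn.refl (hself a ha)
  | @tail p q hp hpq ih =>
    have hpm : p ∈ O ∩ rect x0 x1 y0 y1 := Conn.right_mem ⟨ha, hp⟩
    obtain ⟨h8, hq⟩ := hpq
    have hr : (q.1, p.2) ∈ O' ∩ rect x0 x1 y0 y1 := by
      have : (q.1, p.2) ∈ rect x0 x1 y0 y1 := ⟨hq.2.1, hpm.2.2⟩
      refine ⟨hO p hpm _ this ?_, this⟩
      unfold Adj8 at *; simp only; omega
    have s1 : Conn Adj4 (O' ∩ rect x0 x1 y0 y1) a (q.1, p.2) := by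
      by_cases hpe : p = (q.1, p.2)
      · rw [← hpe]; exact ih
      · refine ih.step ?_ hr
        have : p.1 ≠ q.1 := fun h => hpe (Prod.ext h rfl)
        unfold Adj8 at h8
        refine Or.inr ⟨rfl, ?_⟩
        simp only; omega
    by_cases hqe : q = (q.1, p.2)
    · rw [hqe]; exact s1
    · refine s1.step ?_ (hself q hq)
      have : q.2 ≠ p.2 := fun h => hqe (Prod.ext rfl h)
      unfold Adj8 at h8
      refine Or.inl ⟨rfl, ?_⟩
      simp only; omega

lemma gaussian_tail_ge : 3 / 8 ≤ (ProbabilityTheory.gaussianReal 0 1).real (Ioi (1 / 8)) := by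
  set μ := ProbabilityTheory.gaussianReal 0 1
  have h1 : μ.real (Iio (-(1 / 8))) = μ.real (Ioi (1 / 8)) := by
    have e : μ.map (fun x => -x) = μ := by
      have := ProbabilityTheory.gaussianReal_map_neg (μ := 0) (v := 1)
      simpa using this
    conv_lhs => rw [← e]
    rw [map_measureReal_apply measurable_neg measurableSet_Iio]
    congr 1; ext x; simp
  have h2 : μ.real (Icc (-(1 / 8)) (1 / 8)) ≤ 1 / 4 := by
    have := gaussian_le_volume (Icc (-(1 / 8)) (1 / 8))
    rw [Real.volume_Icc] at this
    exact ENNReal.toReal_le_of_le_ofReal (by norm_num) (this.trans (by norm_num))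
  have h3 : (univ : Set ℝ) ⊆ Iio (-(1 / 8)) ∪ Icc (-(1 / 8)) (1 / 8) ∪ Ioi (1 / 8) := by
    intro x _
    by_cases h : x < -(1 / 8)
    · exact Or.inl (Or.inl h)
    by_cases h' : x ≤ 1 / 8
    · exact Or.inl (Or.inr ⟨not_lt.1 h, h'⟩)
    · exact Or.inr (not_le.1 h')
  have h4 := measureReal_mono (μ := μ) h3
  have h5 := measureReal_union_le (μ := μ) (Iio (-(1 / 8)) ∪ Icc (-(1 / 8)) (1 / 8)) (Ioi (1 / 8))
  have h6 := measureReal_union_le (μ := μ) (Iio (-(1 / 8))) (Icc (-(1 / 8)) (1 / 8))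
  rw [probReal_univ] at h4
  linarith

lemma gam_indep {ι : Type*} [Fintype ι] [DecidableEq ι] {A B : Set (ι → ℝ)} (hA : MeasurableSet A)
    (hB : MeasurableSet B) {W W' : Finset ι} (hW : Disjoint W W')
    (dA : ∀ x y, (∀ i ∈ W, x i = y i) → x ∈ A → y ∈ A) (dB : ∀ x y, (∀ i ∈ W', x i = y i) → x ∈ B → y ∈ B) :
    (gam ι).real (A ∩ B) = (gam ι).real A * (gam ι).real B := by
  classical
  set g := A.indicator fun _ => (1 : ℝ)
  set g' := B.indicator fun _ => (1 : ℝ)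
  have hg : BM g := BM.indicator hA
  have hg' : BM g' := BM.indicator hB
  have d : DepOn W g := fun x y h => by
    simp only [g, indicator]
    exact if_congr ⟨dA x y h, dA y x fun i hi => (h i hi).symm⟩ rfl rfl
  have d' : DepOn W' g' := fun x y h => by
    simp only [g', indicator]
    exact if_congr ⟨dB x y h, dB y x fun i hi => (h i hi).symm⟩ rfl rfl
  have h := integral_mul_proj (ν := ProbabilityTheory.gaussianReal 0 1) hg hg' d
  have hp : proj (ProbabilityTheory.gaussianReal 0 1) W g' = fun _ => ∫ y, g' y ∂gam ι :=
    funext fun x => proj_of_depOn_disjoint d' hW x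
  rw [hp, integral_mul_const] at h
  have e : (fun x => g x * g' x) = (A ∩ B).indicator fun _ => (1 : ℝ) := by
    ext x; simp only [g, g', indicator, mem_inter_iff]; split_ifs <;> simp_all
  rw [e] at h
  simp only [g, g'] at h
  rw [integral_indicator_const _ hA, integral_indicator_const _ hB,
    integral_indicator_const _ (hA.inter hB)] at h
  simpa using h.symm

section Field
variable {Ω : Type*} [MeasurableSpace Ω] {P : Measure Ω} {X : ℝ × ℝ → Ω → ℝ}

lemma fld_zero {N : ℕ} (hN : 0 < N) (ξ : Blk N → ℝ) : fld N (0, 0) ξ = ξ (⟨0, hN⟩, ⟨0, hN⟩) := by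
  unfold fld
  rw [Finset.sum_eq_single (⟨0, hN⟩, ⟨0, hN⟩)]
  · simp [cf, phi_zero_zero]
  · rintro ⟨i, j⟩ _ hij
    have : (i : ℕ) ≠ 0 ∨ (j : ℕ) ≠ 0 := by
      by_contra! hcon
      exact hij (Prod.ext (Fin.ext hcon.1) (Fin.ext hcon.2))
    rcases this with h | h <;> simp [cf, phi_zero_right h]
  · simp

lemma box_mono {a b : ℝ} (h : a ≤ b) : box a ⊆ box b := fun _ hz =>
  ⟨⟨hz.1.1, hz.1.2.trans h⟩, hz.2.1, hz.2.2.trans h⟩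

lemma abs_pt_sub {ε c : ℝ} (hε : 0 ≤ ε) {p q : ℤ × ℤ} (h : Adj8 p q) :
    |(pt ε c p).1 - (pt ε c q).1| ≤ ε ∧ |(pt ε c p).2 - (pt ε c q).2| ≤ ε := by
  obtain ⟨⟨h1, h2⟩, h3, h4⟩ := h
  have h1' : (p.1 : ℝ) ≤ q.1 + 1 := by exact_mod_cast h1
  have h2' : (q.1 : ℝ) ≤ p.1 + 1 := by exact_mod_cast h2
  have h3' : (p.2 : ℝ) ≤ q.2 + 1 := by exact_mod_cast h3
  have h4' : (q.2 : ℝ) ≤ p.2 + 1 := by exact_mod_cast h4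
  unfold pt
  constructor <;> rw [abs_le] <;> constructor <;> simp only <;> nlinarith

lemma BFF.base (h : BFF P X) {ε c : ℝ} (hε : 0 ≤ ε) {s0 : ℤ} (hs0 : 0 ≤ s0) (h1 : 2 * (ε * s0) ≤ 1)
    (h2 : 48 * Kc 1 ^ 2 * √(2 * (ε * s0)) < 1 / 8) :
    1 / 4 ≤ P.real {ω | rect (-s0) s0 (-s0) s0 ⊆ pos X (pt ε c) ω} := by
  have loc : Local fun O => rect (-s0) s0 (-s0) s0 ⊆ O :=
    ⟨_, rect_finite (-s0) s0 (-s0) s0, fun O O' hO hE => by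
      change (rect (-s0) s0 (-s0) s0 : Set (ℤ × ℤ)) ⊆ O at hE
      rw [← inter_eq_right] at hE ⊢; rwa [← hO]⟩
  refine ge_of_tendsto (h.tendsto_real loc (Kbf_pt ε c (ε * s0))) (eventually_atTop.2 ⟨1, fun N hN => ?_⟩)
  set i0 : Blk N := (⟨0, hN⟩, ⟨0, hN⟩)
  have hsub : {ξ : Blk N → ℝ | 1 / 8 < ξ i0} ⊆
      {ξ | rect (-s0) s0 (-s0) s0 ⊆ pos (fld N) (pt ε (ε * s0)) ξ} ∪ (Tame N 6)ᶜ := by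
    intro ξ hξ
    by_cases ht : ξ ∈ Tame N 6
    swap
    · exact Or.inr ht
    left
    intro q hq
    have b1 := pt_mem_box hε (c := ε * s0) le_rfl hq
    have hs : (0 : ℝ) ≤ s0 := by exact_mod_cast hs0
    have b2 : ((0 : ℝ), (0 : ℝ)) ∈ box 1 := by unfold box; simp
    have h3 := abs_sub_le_of_tame (d := 2 * (ε * s0)) (by norm_num) ht (box_mono h1 b1) b2
      (by simp only [sub_zero]; rw [abs_of_nonneg b1.1.1]; exact b1.1.2)
      (by simp only [sub_zero]; rw [abs_of_nonneg b1.2.1]; exact b1.2.2)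
    have h4 := (abs_le.1 h3).1
    have h5 := fld_zero hN ξ
    unfold fld at h5
    rw [h5] at h4
    have hξ' : 1 / 8 < ξ i0 := hξ
    change 0 < fld N _ ξ
    unfold fld
    have e : 8 * 6 * Kc 1 ^ 2 * √(2 * (ε * s0)) = 48 * Kc 1 ^ 2 * √(2 * (ε * s0)) := by ring
    rw [e] at h4
    change _ ≤ _ - ξ i0 at h4
    linarith
  have h3 : 3 / 8 ≤ (gam (Blk N)).real {ξ : Blk N → ℝ | 1 / 8 < ξ i0} := by
    have := (measurePreserving_eval (fun _ : Blk N => ProbabilityTheory.gaussianReal 0 1) i0).measureReal_preimage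
      (s := Ioi (1 / 8)) measurableSet_Ioi.nullMeasurableSet
    exact gaussian_tail_ge.trans this.symm.le
  have h4 := (measureReal_mono (μ := gam (Blk N)) hsub).trans (measureReal_union_le _ _)
  have h5 := gam_tame_compl_le (N := N) (B := 6) (by norm_num)
  norm_num at h5
  linarith

lemma BFF.square (h : BFF P X) {ε c B : ℝ} (hε : 0 ≤ ε) (hB : 0 < B) {D L : ℤ} (hL : 0 ≤ L) (hLD : L ≤ D)
    (hD : Sc (2 * (ε * D)) * (8 * B * Kc (2 * (ε * D)) ^ 2 * √ε) + 4 / B ^ 2 ≤ 1 / 2) :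
    1 / 4 ≤ P.real {ω | HCross 0 L 0 L (pos X (pt ε c) ω)} := by
  have := h.isProb
  set V8 : Set (ℤ × ℤ) → Prop := fun O => ∃ a b : ℤ × ℤ, a.2 = 0 ∧ b.2 = L ∧
    Conn Adj8 (O ∩ rect 0 L 0 L) a b with hV8
  have l8 : Local V8 := ⟨_, rect_finite 0 L 0 L, by
    rintro O O' hO ⟨a, b, ha, hb, hc⟩
    exact ⟨a, b, ha, hb, conn_inter_congr hO hc⟩⟩
  have lH := (good_hcross 0 L 0 L).loc
  have lV := (good_vcross 0 L 0 L)
  set s := 8 * B * Kc (2 * (ε * D)) ^ 2 * √ε with hs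
  have e1 : P.real {ω | HCross 0 L 0 L (pos X (pt ε c) ω)} = P.real {ω | VCross 0 L 0 L (pos X (pt ε c) ω)} := by
    rw [h.real_eq h lH (g := pt ε c) (g' := fun q => pt ε c q.swap) fun q r => by
      simp only [Kbf, pt, Prod.fst_swap, Prod.snd_swap]; ring]
    congr 1; ext ω
    constructor
    · rintro ⟨p, q, hp, hq, hc⟩
      refine ⟨p.swap, q.swap, hp, hq, hc.map _ adj4_swap ?_⟩
      rintro r ⟨hr, hr1, hr2⟩
      exact ⟨hr, hr2, hr1⟩
    · rintro ⟨p, q, hp, hq, hc⟩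
      refine ⟨p.swap, q.swap, hp, hq, hc.map _ adj4_swap ?_⟩
      rintro r ⟨hr, hr1, hr2⟩
      exact ⟨by simpa [pos] using hr, hr2, hr1⟩
  have e2 : 1 - P.real {ω | HCross 0 L 0 L (pos X (pt ε c) ω)} ≤ P.real {ω | V8 (pos X (pt ε c) ω)} := by
    rw [← h.compl_eq l8, ← probReal_compl_eq_one_sub (h.measurableSet lH _)]
    exact measureReal_mono fun ω hω => exists_dual_crossing hL hL _ fun ⟨a, b, h⟩ => hω ⟨a, b, h⟩
  have e3 : P.real {ω | V8 (pos X (pt ε c) ω)} ≤ P.real {ω | VCross 0 L 0 L (pos X (pt ε c) ω)} + 1 / 2 := by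
    have k := Kbf_pt ε c (ε * D)
    refine le_of_tendsto_of_tendsto (h.tendsto_real l8 k) ((h.tendsto_real lV.loc k).add_const _)
      (eventually_atTop.2 ⟨trunc (2 * (ε * D)), fun N hN => ?_⟩)
    set S := (rect_finite 0 L 0 L).toFinset with hS
    have hSV : OnlyOn (VCross 0 L 0 L) S := by
      rw [hS, Finite.coe_toFinset]
      rintro O O' hO ⟨a, b, ha, hb, hc⟩
      exact ⟨a, b, ha, hb, conn_inter_congr hO hc⟩
    have hz : ∀ q ∈ rect 0 L 0 L, pt ε (ε * D) q ∈ box (2 * (ε * D)) := fun q hq =>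
      pt_mem_box hε le_rfl (by obtain ⟨⟨_, _⟩, _, _⟩ := hq; refine ⟨⟨?_, ?_⟩, ?_, ?_⟩ <;> omega)
    have := pattern_perturb_le (N := N) (p := locP (VCross 0 L 0 L) S) (s := s) (by positivity) hB hN
      (monoP_locP lV.mono S) (fun _ => 0) (z := fun q : S => pt ε (ε * D) q)
      (fun q => hz q ((Finite.mem_toFinset _).1 q.2)) (E := {ξ | V8 (pos (fld N) (pt ε (ε * D)) ξ)}) ?_
    · simp only [locP_iff hSV]
      linarith
    · rintro ξ ⟨a, b, ha, hb, hc⟩ ht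
      refine ⟨a, b, ha, hb, conn4_of_conn8 ?_ hc⟩
      intro p hp q hq hpq
      refine ⟨by simpa [hS] using hq, ?_⟩
      have h1 := abs_sub_le_of_tame hB.le ht (hz p hp.2) (hz q hq) (abs_pt_sub hε hpq).1 (abs_pt_sub hε hpq).2
      have h2 : 0 < fld N (pt ε (ε * D) p) ξ := hp.1
      have := (abs_le.1 h1).2
      change 0 - s < fld N (pt ε (ε * D) q) ξ
      unfold fld at *
      linarith
  linarith

end Field

section Field
variable {Ω : Type*} [MeasurableSpace Ω] {P : Measure Ω} {X : ℝ × ℝ → Ω → ℝ}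

/-- Blocks within distance `R` of a point. -/
def nearBlk (R : ℝ) (N : ℕ) (z : ℝ × ℝ) : Set (Blk N) := {i | |√(i.1 : ℕ) - z.1| ≤ R ∧ |√(i.2 : ℕ) - z.2| ≤ R}

lemma fldl_congr {R : ℝ} {N : ℕ} {z : ℝ × ℝ} {x y : Blk N → ℝ} (h : ∀ i ∈ nearBlk R N z, x i = y i) :
    fldl R N z x = fldl R N z y := by
  refine Finset.sum_congr rfl fun i _ => ?_
  unfold cfl
  split_ifs with hi
  · rw [h i hi]
  · simp

lemma nearBlk_disjoint {R : ℝ} {N : ℕ} {z w : ℝ × ℝ} (h : 2 * R < |z.1 - w.1| ∨ 2 * R < |z.2 - w.2|) :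
    Disjoint (nearBlk R N z) (nearBlk R N w) := by
  refine Set.disjoint_left.2 fun i ⟨h1, h2⟩ ⟨h3, h4⟩ => ?_
  rw [abs_le] at h1 h2 h3 h4
  rcases h with h | h <;> rw [lt_abs] at h <;> rcases h with h | h <;> linarith

lemma onlyOn_fldl {E : Set (ℤ × ℤ) → Prop} {S : Set (ℤ × ℤ)} (hE : OnlyOn E S) {R : ℝ} {N : ℕ}
    {g : ℤ × ℤ → ℝ × ℝ} {x y : Blk N → ℝ} (h : ∀ q ∈ S, ∀ i ∈ nearBlk R N (g q), x i = y i)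
    (hx : E (pos (fldl R N) g x)) : E (pos (fldl R N) g y) := by
  refine hE _ _ ?_ hx
  ext q
  simp only [pos, mem_inter_iff, mem_ofPred_eq, and_congr_left_iff]
  intro hq
  rw [fldl_congr (h q hq)]

lemma BFF.mix (h : BFF P X) {ε c B R : ℝ} (hε : 0 ≤ ε) (hB : 0 < B) (hR : 0 ≤ R) {D d0 : ℤ} {err : ℝ}
    (hd : 2 * R < ε * d0) (hD : 0 ≤ D)
    (herr : 3 * ((2 * D + 1) ^ 2 * (2 * Sc (2 * (ε * D)) * (4 * B * Kc (2 * (ε * D)) ^ 2 * Real.exp (-R ^ 2 / 4)) +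
      4 / B ^ 2)) ≤ err) {E E' : Set (ℤ × ℤ) → Prop} {S S' : Set (ℤ × ℤ)} (hE : OnlyOn E S) (hE' : OnlyOn E' S')
    (hS : S ⊆ rect (-D) D (-D) D) (hS' : S' ⊆ rect (-D) D (-D) D)
    (hSS : ∀ p ∈ S, ∀ q ∈ S', d0 ≤ |p.1 - q.1| ∨ d0 ≤ |p.2 - q.2|) :
    P.real {ω | E (pos X (pt ε c) ω) ∧ E' (pos X (pt ε c) ω)} ≤
      P.real {ω | E (pos X (pt ε c) ω)} * P.real {ω | E' (pos X (pt ε c) ω)} + err := by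
  classical
  have hf := rect_finite (-D) D (-D) D
  have lE : Local E := ⟨S, hf.subset hS, hE⟩
  have lE' : Local E' := ⟨S', hf.subset hS', hE'⟩
  have lEE : Local fun O => E O ∧ E' O := ⟨S ∪ S', hf.subset (union_subset hS hS'), fun O O' hO hEE =>
    ⟨hE.mono subset_union_left O O' hO hEE.1, hE'.mono subset_union_right O O' hO hEE.2⟩⟩
  have k := Kbf_pt ε c (ε * D)
  refine le_of_tendsto_of_tendsto (h.tendsto_real lEE k)
    (((h.tendsto_real lE k).mul (h.tendsto_real lE' k)).add_const _)
    (eventually_atTop.2 ⟨trunc (2 * (ε * D)), fun N hN => ?_⟩)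
  set X0 := 2 * (ε * D) with hX0
  set s := 4 * B * Kc X0 ^ 2 * Real.exp (-R ^ 2 / 4) with hs
  set g := pt ε (ε * D) with hg
  set μ := gam (Blk N)
  set T := hf.toFinset with hT
  have hz : ∀ q ∈ rect (-D) D (-D) D, g q ∈ box X0 := fun q hq => pt_mem_box hε le_rfl hq
  set Z : Set (Blk N → ℝ) := {ξ | ∃ a : T, ¬(0 < fldl R N (g a) ξ ↔ 0 < fld N (g a) ξ)} with hZ
  have hpz : μ.real Z ≤ (2 * D + 1) ^ 2 * (2 * Sc X0 * s + 4 / B ^ 2) := by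
    have h1 := sign_symmDiff_le (N := N) (s := s) (X := X0) (by positivity) hB hN (fun _ : T => 0)
      (z := fun a => g a) (fun a => hz a ((Finite.mem_toFinset _).1 a.2)) (G := fun a => fldl R N (g a))
      fun ξ hξ a => abs_cfl_sub_le_of_tame hB.le hR hξ (hz a ((Finite.mem_toFinset _).1 a.2))
    refine h1.trans (mul_le_mul_of_nonneg_right ?_ (by have := Sc_pos X0; positivity))
    have h2 : T ⊆ Finset.Icc (-D) D ×ˢ Finset.Icc (-D) D := by
      intro q hq
      have := (Finite.mem_toFinset _).1 hq
      simp only [Finset.mem_product, Finset.mem_Icc]; exact this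
    have h3 := Finset.card_le_card h2
    rw [Finset.card_product, Int.card_Icc] at h3
    rw [Fintype.card_coe]
    have h4 : ((D + 1 - -D).toNat : ℤ) = 2 * D + 1 := by omega
    have h5 : (T.card : ℤ) ≤ (2 * D + 1) * (2 * D + 1) := by rw [← h4]; exact_mod_cast h3
    have h6 : (T.card : ℝ) ≤ (2 * D + 1) * (2 * D + 1) := by exact_mod_cast h5
    rw [sq]; exact h6
  have hiff : ∀ {F : Set (ℤ × ℤ) → Prop} {V : Set (ℤ × ℤ)}, OnlyOn F V → V ⊆ rect (-D) D (-D) D → ∀ ξ ∉ Z,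
      (F (pos (fldl R N) g ξ) ↔ F (pos (fld N) g ξ)) := by
    intro F V hF hV ξ hξ
    have e : pos (fldl R N) g ξ ∩ V = pos (fld N) g ξ ∩ V := by
      ext q
      simp only [pos, mem_inter_iff, mem_ofPred_eq, and_congr_left_iff]
      intro hq
      by_contra hc
      exact hξ ⟨⟨q, (Finite.mem_toFinset _).2 (hV hq)⟩, hc⟩
    exact ⟨hF _ _ e, hF _ _ e.symm⟩
  set A := {ξ | E (pos (fld N) g ξ)}
  set A' := {ξ | E' (pos (fld N) g ξ)}
  set G := {ξ | E (pos (fldl R N) g ξ)}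
  set G' := {ξ | E' (pos (fldl R N) g ξ)}
  have m : ∀ {F : Set (ℤ × ℤ) → Prop}, Local F → MeasurableSet {ξ | F (pos (fldl R N) g ξ)} := by
    intro F hF
    obtain ⟨V, hV⟩ := hF.exists_finset
    simp only [locP_iff hV]
    exact measurableSet_pattern (fun a : V => measurable_fldl R (g a)) _ _
  have hind : μ.real (G ∩ G') = μ.real G * μ.real G' := by
    refine gam_indep (m lE) (m lE') (W := {i | ∃ q ∈ S, i ∈ nearBlk R N (g q)})
      (W' := {i | ∃ q ∈ S', i ∈ nearBlk R N (g q)}) ?_ ?_ ?_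
    · refine Finset.disjoint_left.2 fun i hi hi' => ?_
      simp only [Finset.mem_filter, Finset.mem_univ, true_and] at hi hi'
      obtain ⟨p, hp, hip⟩ := hi
      obtain ⟨q, hq, hiq⟩ := hi'
      refine Set.disjoint_left.1 (nearBlk_disjoint ?_) hip hiq
      have key : ∀ a b : ℤ, d0 ≤ |a - b| → 2 * R < |(ε * D + ε * a) - (ε * D + ε * b)| := by
        intro a b hab
        have h1 : (d0 : ℝ) ≤ |(a : ℝ) - b| := by exact_mod_cast hab
        have h2 : (ε * D + ε * a) - (ε * D + ε * b) = ε * (a - b) := by ring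
        rw [h2, abs_mul, abs_of_nonneg hε]
        exact hd.trans_le (mul_le_mul_of_nonneg_left h1 hε)
      exact (hSS p hp q hq).imp (key _ _) (key _ _)
    · exact fun x y hxy hx => onlyOn_fldl hE (fun q hq i hi => hxy i (Finset.mem_filter.2 ⟨Finset.mem_univ _, q, hq, hi⟩)) hx
    · exact fun x y hxy hx => onlyOn_fldl hE' (fun q hq i hi => hxy i (Finset.mem_filter.2 ⟨Finset.mem_univ _, q, hq, hi⟩)) hx
  have i1 : μ.real (A ∩ A') ≤ μ.real (G ∩ G') + μ.real Z := by
    refine (measureReal_mono (s₂ := (G ∩ G') ∪ Z) fun ξ hξ => ?_).trans (measureReal_union_le _ _)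
    by_cases hz : ξ ∈ Z
    · exact Or.inr hz
    · exact Or.inl ⟨(hiff hE hS ξ hz).2 hξ.1, (hiff hE' hS' ξ hz).2 hξ.2⟩
  have i2 : μ.real G ≤ μ.real A + μ.real Z := by
    refine (measureReal_mono (s₂ := A ∪ Z) fun ξ hξ => ?_).trans (measureReal_union_le _ _)
    by_cases hz : ξ ∈ Z
    · exact Or.inr hz
    · exact Or.inl ((hiff hE hS ξ hz).1 hξ)
  have i3 : μ.real G' ≤ μ.real A' + μ.real Z := by
    refine (measureReal_mono (s₂ := A' ∪ Z) fun ξ hξ => ?_).trans (measureReal_union_le _ _)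
    by_cases hz : ξ ∈ Z
    · exact Or.inr hz
    · exact Or.inl ((hiff hE' hS' ξ hz).1 hξ)
  have u1 : μ.real G ≤ 1 := measureReal_le_one
  have u2 : μ.real A' ≤ 1 := measureReal_le_one
  have n1 : 0 ≤ μ.real G := measureReal_nonneg
  have n2 : 0 ≤ μ.real A' := measureReal_nonneg
  have n3 : 0 ≤ μ.real Z := measureReal_nonneg
  change μ.real (A ∩ A') ≤ μ.real A * μ.real A' + err
  rw [hind] at i1
  nlinarith [mul_le_mul_of_nonneg_left i3 n1, mul_le_mul_of_nonneg_right i2 n2, mul_le_mul_of_nonneg_right u1 n3,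
    mul_le_mul_of_nonneg_left u2 n3]

/-- The percolation model of positive sites on the lattice of mesh `ε`. -/
def BFF.perc (h : BFF P X) {ε B B' R : ℝ} (hε : 0 ≤ ε) (hB : 0 < B) (hB' : 0 < B') (hR : 0 ≤ R) {D d0 s0 : ℤ} {err : ℝ}
    (hs0 : 0 ≤ s0) (hD : 0 ≤ D) (h1 : 2 * (ε * s0) ≤ 1) (h2 : 48 * Kc 1 ^ 2 * √(2 * (ε * s0)) < 1 / 8)
    (hsq : Sc (2 * (ε * D)) * (8 * B * Kc (2 * (ε * D)) ^ 2 * √ε) + 4 / B ^ 2 ≤ 1 / 2)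
    (hd : 2 * R < ε * d0)
    (herr : 3 * ((2 * D + 1) ^ 2 * (2 * Sc (2 * (ε * D)) * (4 * B' * Kc (2 * (ε * D)) ^ 2 * Real.exp (-R ^ 2 / 4)) +
      4 / B' ^ 2)) ≤ err) : Perc D d0 s0 err where
  pr E := P.real {ω | E (pos X (pt ε 0) ω)}
  nonneg _ := measureReal_nonneg
  mono E E' hE := by
    have := h.isProb
    exact measureReal_mono fun ω hω => hE _ hω
  union E E' := measureReal_union_le _ _
  not_eq E hE := by
    have := h.isProb
    exact probReal_compl_eq_one_sub (h.measurableSet hE _)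
  compl_eq E hE := h.compl_eq hE _
  shift_eq E hE v := h.real_eq h hE (g := fun q => pt ε 0 (shift v q)) (g' := pt ε 0) fun q r => by
    simp only [Kbf, pt, shift]; push_cast; ring_nf
  swap_eq E hE := h.real_eq h hE (g := fun q => pt ε 0 q.swap) (g' := pt ε 0) fun q r => by
    simp only [Kbf, pt, Prod.fst_swap, Prod.snd_swap]; ring
  reflX_eq E hE := h.real_eq h hE (g := fun q => pt ε 0 (reflX q)) (g' := pt ε 0) fun q r => by
    simp only [Kbf, pt, reflX]; push_cast; ring_nf
  reflY_eq E hE := h.real_eq h hE (g := fun q => pt ε 0 (reflY q)) (g' := pt ε 0) fun q r => by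
    simp only [Kbf, pt, reflY]; push_cast; ring_nf
  fkg E E' hE hE' := h.fkg hE hE' hε
  square L hL hLD := h.square hε hB hL hLD hsq
  base := h.base hε hs0 h1 h2
  mix E E' S S' hE hE' hS hS' hSS := h.mix hε hB' hR hd hD herr hE hE' hS hS' hSS

end Field

section Explore
variable {V : Type*} {near : V → V → Prop} {St U U' : Set V}

/-- Points revealed by exploring the open clusters met by the starting set `St`. -/
def Rev (near : V → V → Prop) (St U : Set V) : Set V :=
  {a | ∃ a0 ∈ St, Relation.ReflTransGen (fun b c => b ∈ U ∧ near b c) a0 a}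

lemma rev_subset (h : ∀ a ∈ Rev near St U, a ∈ U' → a ∈ U) : Rev near St U' ⊆ Rev near St U := by
  rintro a ⟨a0, h0, hr⟩
  induction hr with
  | refl => exact ⟨a0, h0, .refl⟩
  | tail _ hbc ih =>
    obtain ⟨a1, h1, hr1⟩ := ih
    exact ⟨a1, h1, hr1.tail ⟨h _ ⟨a1, h1, hr1⟩ hbc.1, hbc.2⟩⟩

lemma rev_congr (h : ∀ a ∈ Rev near St U, (a ∈ U ↔ a ∈ U')) : Rev near St U' = Rev near St U := by
  have h1 : Rev near St U' ⊆ Rev near St U := rev_subset fun a ha => (h a ha).2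
  refine h1.antisymm ?_
  rintro a ⟨a0, h0, hr⟩
  induction hr with
  | refl => exact ⟨a0, h0, .refl⟩
  | @tail b c hb hbc ih =>
    obtain ⟨a1, h1, hr1⟩ := ih
    exact ⟨a1, h1, hr1.tail ⟨(h _ ⟨a0, h0, hb⟩).1 hbc.1, hbc.2⟩⟩

lemma path_mem_rev (hs : ∀ a b, near a b → near b a) {w : ℕ → V} {M k : ℕ} (hw : ∀ i < M, near (w i) (w (i + 1)))
    (hU : ∀ i ≤ M, w i ∈ U) (hk : k ≤ M) (hSt : w k ∈ St) : ∀ i ≤ M, w i ∈ Rev near St U := by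
  have up : ∀ j, k + j ≤ M → w (k + j) ∈ Rev near St U := by
    intro j
    induction j with
    | zero => exact fun _ => ⟨w k, hSt, .refl⟩
    | succ j ih =>
      intro hj
      obtain ⟨a, ha, hr⟩ := ih (by omega)
      exact ⟨a, ha, hr.tail ⟨hU _ (by omega), hw _ (by omega)⟩⟩
  have down : ∀ j, j ≤ k → w (k - j) ∈ Rev near St U := by
    intro j
    induction j with
    | zero => exact fun _ => ⟨w k, hSt, .refl⟩
    | succ j ih =>
      intro hj
      obtain ⟨a, ha, hr⟩ := ih (by omega)
      refine ⟨a, ha, hr.tail ⟨hU _ (by omega), hs _ _ ?_⟩⟩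
      have := hw (k - (j + 1)) (by omega)
      rwa [show k - (j + 1) + 1 = k - j by omega] at this
  intro i hi
  rcases le_total k i with h | h
  · have := up (i - k) (by omega)
    rwa [show k + (i - k) = i by omega] at this
  · have := down (k - i) (by omega)
    rwa [show k - (k - i) = i by omega] at this

/-- Crossing by one of the paths. -/
def PathOpen {κ : Type*} (w : κ → ℕ → V) (M : ℕ) (U : V → Prop) : Prop := ∃ j, ∀ i ≤ M, U (w j i)

lemma monoP_pathOpen {κ : Type*} (w : κ → ℕ → V) (M : ℕ) : MonoP (PathOpen w M) := fun _ _ h ⟨j, hj⟩ =>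
  ⟨j, fun i hi => h _ (hj i hi)⟩

open Classical in
/-- Blocks revealed by the exploration. -/
def revBlk (R θ : ℝ) (N : ℕ) (z : V → ℝ × ℝ) (near : V → V → Prop) (St : Set V) (x : Blk N → ℝ) : Finset (Blk N) :=
  {i | ∃ a ∈ Rev near St {a | θ < fldl R N (z a) x}, i ∈ nearBlk R N (z a)}

lemma mem_revBlk {R θ : ℝ} {N : ℕ} {z : V → ℝ × ℝ} {x : Blk N → ℝ} {i : Blk N} :
    i ∈ revBlk R θ N z near St x ↔ ∃ a ∈ Rev near St {a | θ < fldl R N (z a) x}, i ∈ nearBlk R N (z a) := by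
  simp [revBlk]

/-- Indicator of the localised crossing event. -/
def crossInd {κ : Type*} (R θ : ℝ) (N : ℕ) (z : V → ℝ × ℝ) (w : κ → ℕ → V) (M : ℕ) : (Blk N → ℝ) → ℝ :=
  {x | PathOpen w M fun a => θ < fldl R N (z a) x}.indicator fun _ => (1 : ℝ)

lemma stopSet_revBlk [Fintype V] {κ : Type*} {R θ : ℝ} {N : ℕ} {z : V → ℝ × ℝ} (hs : ∀ a b, near a b → near b a)
    {w : κ → ℕ → V} {M : ℕ} (hw : ∀ j, ∀ i < M, near (w j i) (w j (i + 1))) (hc : ∀ j, ∃ k ≤ M, w j k ∈ St) :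
    StopSet (crossInd R θ N z w M) (revBlk R θ N z near St) where
  meas S := by
    set p : (V → Prop) → Prop := fun Q => ∀ i, i ∈ S ↔ ∃ a ∈ Rev near St {a | Q a}, i ∈ nearBlk R N (z a) with hp
    have : {x | revBlk R θ N z near St x = S} = {x | p fun a => θ < fldl R N (z a) x} := by
      ext x; simp only [mem_ofPred_eq, Finset.ext_iff, mem_revBlk, hp]; exact forall_congr' fun i => Iff.comm
    rw [this]
    exact measurableSet_pattern (fun a => measurable_fldl R (z a)) p fun _ => θ
  stable x y h := by
    have hxy : ∀ x y : Blk N → ℝ, (∀ i ∈ revBlk R θ N z near St x, x i = y i) →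
        ∀ a ∈ Rev near St {a | θ < fldl R N (z a) x}, fldl R N (z a) x = fldl R N (z a) y := by
      intro x y h a ha
      refine fldl_congr fun i hi => h i (mem_revBlk.2 ⟨a, ha, hi⟩)
    have e := rev_congr (near := near) (St := St) (U := {a | θ < fldl R N (z a) x}) (U' := {a | θ < fldl R N (z a) y}) fun a ha => by
      rw [mem_ofPred_eq, mem_ofPred_eq, hxy x y h a ha]
    have eJ : revBlk R θ N z near St y = revBlk R θ N z near St x := by unfold revBlk; rw [e]
    have imp : ∀ x y : Blk N → ℝ, (∀ i ∈ revBlk R θ N z near St x, x i = y i) →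
        PathOpen w M (fun a => θ < fldl R N (z a) x) → PathOpen w M (fun a => θ < fldl R N (z a) y) := by
      rintro x y h ⟨j, hj⟩
      refine ⟨j, fun i hi => ?_⟩
      obtain ⟨k, hk, hkS⟩ := hc j
      rw [← hxy x y h _ (path_mem_rev hs (hw j) hj hk hkS i hi)]
      exact hj i hi
    refine ⟨eJ, ?_⟩
    have hi : y ∈ {x | PathOpen w M fun a => θ < fldl R N (z a) x} ↔
        x ∈ {x | PathOpen w M fun a => θ < fldl R N (z a) x} :=
      ⟨imp y x (by rw [eJ]; exact fun i hi => (h i hi).symm), imp x y h⟩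
    unfold crossInd
    by_cases hx : x ∈ {x | PathOpen w M fun a => θ < fldl R N (z a) x}
    · rw [indicator_of_mem hx, indicator_of_mem (hi.2 hx)]
    · rw [indicator_of_notMem hx, indicator_of_notMem (mt hi.1 hx)]

end Explore

section Reveal

/-- Lattice points of mesh `ε` centred at `w`. -/
def ptw (ε : ℝ) (w : ℝ × ℝ) (q : ℤ × ℤ) : ℝ × ℝ := (w.1 + ε * q.1, w.2 + ε * q.2)

lemma finite_ptw_box {ε : ℝ} (hε : 0 < ε) (w : ℝ × ℝ) (X : ℝ) : {q | ptw ε w q ∈ box X}.Finite := by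
  have key : ∀ c : ℝ, ∀ k : ℤ, 0 ≤ c + ε * k → c + ε * k ≤ X → k ∈ Icc ⌈-c / ε⌉ ⌊(X - c) / ε⌋ := by
    intro c k h1 h2
    refine ⟨Int.ceil_le.2 ?_, Int.le_floor.2 ?_⟩
    · rw [div_le_iff₀ hε]; linarith
    · rw [le_div_iff₀ hε]; linarith
  refine ((finite_Icc ⌈-w.1 / ε⌉ ⌊(X - w.1) / ε⌋).prod (finite_Icc ⌈-w.2 / ε⌉ ⌊(X - w.2) / ε⌋)).subset
    fun q hq => ?_
  exact ⟨key w.1 _ hq.1.1 hq.1.2, key w.2 _ hq.2.1 hq.2.2⟩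

/-- Sup-norm closeness. -/
def Near (ε : ℝ) (y z : ℝ × ℝ) : Prop := |y.1 - z.1| ≤ ε ∧ |y.2 - z.2| ≤ ε

lemma Near.symm {ε : ℝ} {y z : ℝ × ℝ} (h : Near ε y z) : Near ε z y :=
  ⟨by rw [abs_sub_comm]; exact h.1, by rw [abs_sub_comm]; exact h.2⟩

/-- Rounding to the lattice of mesh `ε` centred at `w`. -/
def rnd (ε : ℝ) (w y : ℝ × ℝ) : ℤ × ℤ := (⌊(y.1 - w.1) / ε⌋, ⌊(y.2 - w.2) / ε⌋)

lemma abs_floor_sub_le {ε : ℝ} (hε : 0 < ε) (c y : ℝ) : |c + ε * ⌊(y - c) / ε⌋ - y| ≤ ε := by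
  have h1 := Int.floor_le ((y - c) / ε)
  have h2 := Int.lt_floor_add_one ((y - c) / ε)
  rw [le_div_iff₀ hε] at h1
  rw [div_lt_iff₀ hε] at h2
  rw [abs_le]; constructor <;> nlinarith

lemma floor_near {ε : ℝ} (hε : 0 < ε) {c y y' : ℝ} (h : |y - y'| ≤ ε) :
    ⌊(y' - c) / ε⌋ ≤ ⌊(y - c) / ε⌋ + 1 ∧ ⌊(y - c) / ε⌋ ≤ ⌊(y' - c) / ε⌋ + 1 := by
  rw [abs_le] at h
  constructor
  · rw [← Int.floor_add_one]
    refine Int.floor_le_floor ?_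
    rw [div_add_one hε.ne']; exact div_le_div_of_nonneg_right (by linarith) hε.le
  · rw [← Int.floor_add_one]
    refine Int.floor_le_floor ?_
    rw [div_add_one hε.ne']; exact div_le_div_of_nonneg_right (by linarith) hε.le

lemma conn_rnd {ε : ℝ} (hε : 0 < ε) {w y y' : ℝ × ℝ} {O : Set (ℤ × ℤ)} (h : Near ε y y')
    (hy : ∀ q, Near (2 * ε) (ptw ε w q) y → q ∈ O) (hy' : ∀ q, Near (2 * ε) (ptw ε w q) y' → q ∈ O) :
    Conn Adj4 O (rnd ε w y) (rnd ε w y') := by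
  have a1 := abs_floor_sub_le hε w.1 y.1
  have a2 := abs_floor_sub_le hε w.2 y.2
  have b1 := abs_floor_sub_le hε w.1 y'.1
  have b2 := abs_floor_sub_le hε w.2 y'.2
  have m0 : rnd ε w y ∈ O := hy _ ⟨a1.trans (by linarith), a2.trans (by linarith)⟩
  have m1 : (⌊(y'.1 - w.1) / ε⌋, ⌊(y.2 - w.2) / ε⌋) ∈ O := by
    refine hy _ ⟨?_, a2.trans (by linarith)⟩
    have := abs_sub_le (w.1 + ε * ⌊(y'.1 - w.1) / ε⌋) y'.1 y.1
    have h1 := h.symm.1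
    change |w.1 + ε * ⌊(y'.1 - w.1) / ε⌋ - y.1| ≤ 2 * ε
    linarith
  have m2 : rnd ε w y' ∈ O := hy' (rnd ε w y') ⟨b1.trans (by linarith), b2.trans (by linarith)⟩
  have f1 := floor_near hε (c := w.1) h.1
  have f2 := floor_near hε (c := w.2) h.2
  have s1 : Conn Adj4 O (rnd ε w y) (⌊(y'.1 - w.1) / ε⌋, ⌊(y.2 - w.2) / ε⌋) := by
    by_cases e : ⌊(y.1 - w.1) / ε⌋ = ⌊(y'.1 - w.1) / ε⌋
    · unfold rnd at m0 ⊢; rw [e] at m0 ⊢; exact Conn.refl m0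
    · refine Conn.edge m0 (Or.inr ⟨rfl, ?_⟩) m1
      simp only [rnd]; omega
  by_cases e : ⌊(y.2 - w.2) / ε⌋ = ⌊(y'.2 - w.2) / ε⌋
  · rw [e] at s1; exact s1
  · refine s1.step (Or.inl ⟨rfl, ?_⟩) m2
    simp only [rnd]; omega

lemma card_filter_near_le (U : ℕ) (x : ℝ) {c : ℝ} (hc : 0 ≤ c) :
    (({u ∈ Finset.Icc 1 U | |x - (u : ℕ)| ≤ c} : Finset ℕ).card : ℝ) ≤ 2 * c + 1 := by
  have h1 : (({u ∈ Finset.Icc 1 U | |x - (u : ℕ)| ≤ c} : Finset ℕ)).card ≤ (Finset.Icc ⌈x - c⌉ ⌊x + c⌋).card := by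
    refine Finset.card_le_card_of_injOn (fun u => (u : ℤ)) (fun u hu => ?_) fun a _ b _ h => by simpa using h
    have := (Finset.mem_filter.1 hu).2
    rw [abs_le] at this
    refine Finset.mem_coe.2 (Finset.mem_Icc.2 ⟨Int.ceil_le.2 ?_, Int.le_floor.2 ?_⟩) <;> push_cast <;> linarith
  rw [Int.card_Icc] at h1
  have h2 : (((⌊x + c⌋ + 1 - ⌈x - c⌉).toNat : ℤ) : ℝ) ≤ 2 * c + 1 := by
    rcases le_total 0 (⌊x + c⌋ + 1 - ⌈x - c⌉) with h | h
    · rw [Int.toNat_of_nonneg h]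
      push_cast
      have := Int.floor_le (x + c)
      have := Int.le_ceil (x - c)
      linarith
    · rw [Int.toNat_of_nonpos h]; push_cast; linarith
  refine le_trans ?_ h2
  exact_mod_cast h1

variable {V : Type*} {N : ℕ} {z : V → ℝ × ℝ} {X B R ε θ r : ℝ} {t D : ℤ} {d : ℝ × ℝ → ℝ}

/-- Centre of a block. -/
def ctr (i : Blk N) : ℝ × ℝ := (√(i.1 : ℕ), √(i.2 : ℕ))

/-- Starting points of the exploration of level `u`. -/
def St (d : ℝ × ℝ → ℝ) (ε : ℝ) (z : V → ℝ × ℝ) (u : ℕ) : Set V := {a | |d (z a) - u| ≤ 2 * ε}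

/-- Total field error in the comparison of the exploration with lattice arms. -/
def sErr (X B R ε : ℝ) : ℝ := 4 * B * Kc X ^ 2 * Real.exp (-R ^ 2 / 4) + 8 * B * Kc X ^ 2 * √(2 * ε)

lemma arm_of_mem_revBlk (hε : 0 < ε) (hB : 0 ≤ B) (hR : 0 ≤ R) (hθ : 0 ≤ θ)
    (hz : ∀ a, 2 * ε ≤ (z a).1 ∧ (z a).1 ≤ X - 2 * ε ∧ 2 * ε ≤ (z a).2 ∧ (z a).2 ≤ X - 2 * ε)
    (hd : ∀ y y' c, Near c y y' → |d y - d y'| ≤ 2 * c) (hr : R < r) (ht : R + 2 * ε ≤ ε * t) (hD : ε * (D + 1) ≤ r)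
    {x : Blk N → ℝ} (hx : x ∈ Tame N B) {i : Blk N} {u : ℕ} (hu : 2 * r + 2 * ε < |d (ctr i) - u|)
    (hi : i ∈ revBlk R θ N z (fun a b => Near ε (z a) (z b)) (St d ε z u) x) :
    Arm t D {q | -sErr X B R ε < fld N (ptw ε (ctr i) q) x ∧ ptw ε (ctr i) q ∈ box X} := by
  set O := {q | -sErr X B R ε < fld N (ptw ε (ctr i) q) x ∧ ptw ε (ctr i) q ∈ box X} with hO
  obtain ⟨a, ⟨a0, ha0, hch⟩, hia⟩ := mem_revBlk.1 hi
  have hbox : ∀ a, z a ∈ box X := fun a => by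
    obtain ⟨h1, h2, h3, h4⟩ := hz a
    exact ⟨⟨by linarith, by linarith⟩, by linarith, by linarith⟩
  have hopen : ∀ b, θ < fldl R N (z b) x → ∀ q, Near (2 * ε) (ptw ε (ctr i) q) (z b) → q ∈ O := by
    intro b hb q hq
    have hqb : ptw ε (ctr i) q ∈ box X := by
      obtain ⟨h1, h2, h3, h4⟩ := hz b
      obtain ⟨h5, h6⟩ := hq
      rw [abs_le] at h5 h6
      exact ⟨⟨by linarith, by linarith⟩, by linarith, by linarith⟩
    refine ⟨?_, hqb⟩
    have e1 := (abs_le.1 (abs_cfl_sub_le_of_tame hB hR hx (hbox b))).2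
    have e2 := (abs_le.1 (abs_sub_le_of_tame hB hx hqb (hbox b) hq.1 hq.2)).1
    unfold fldl at hb
    unfold sErr fld
    linarith
  have hfar : ¬ Near r (z a0) (ctr i) := by
    intro h
    have h1 := hd _ _ _ h
    have h2 : |d (z a0) - u| ≤ 2 * ε := ha0
    have h3 := abs_sub_le (d (ctr i)) (d (z a0)) u
    rw [abs_sub_comm (d (ctr i)) (d (z a0))] at h3
    linarith
  have hchain : a = a0 ∨ ∃ b, Conn Adj4 O (rnd ε (ctr i) (z a0)) (rnd ε (ctr i) (z b)) ∧
      Near ε (z b) (z a) ∧ θ < fldl R N (z b) x := by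
    clear hia hi
    induction hch with
    | refl => exact Or.inl rfl
    | @tail b c _ hbc ih =>
      refine Or.inr ⟨b, ?_, hbc.2, hbc.1⟩
      rcases ih with rfl | ⟨b', hc, hn, hb'⟩
      · refine Conn.refl (hopen _ hbc.1 _ ⟨?_, ?_⟩)
        · exact (abs_floor_sub_le hε _ _).trans (by linarith)
        · exact (abs_floor_sub_le hε _ _).trans (by linarith)
      · exact hc.trans (conn_rnd hε hn (hopen _ hb') (hopen _ hbc.1))
  have hia' : Near R (z a) (ctr i) := Near.symm hia
  rcases hchain with rfl | ⟨b, hc, hn, hb⟩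
  · exact absurd ⟨hia'.1.trans hr.le, hia'.2.trans hr.le⟩ hfar
  refine ⟨_, _, ?_, ?_, hc.symm fun _ _ => Adj4.symm⟩
  · have key : ∀ c y y' : ℝ, |y - y'| ≤ ε → |y' - c| ≤ R → |⌊(y - c) / ε⌋| ≤ t := by
      intro c y y' h1 h2
      have h3 := abs_floor_sub_le hε c y
      have h4 : ε * |(⌊(y - c) / ε⌋ : ℝ)| ≤ ε * t := by
        rw [← abs_of_pos hε, ← abs_mul, abs_of_pos hε]
        rw [abs_le] at *
        constructor <;> linarith [h1.1, h1.2, h2.1, h2.2, h3.1, h3.2]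
      exact_mod_cast le_of_mul_le_mul_left h4 hε
    exact max_le (key _ _ _ hn.1 hia'.1) (key _ _ _ hn.2 hia'.2)
  · have key : ∀ c y : ℝ, r < |y - c| → D ≤ |⌊(y - c) / ε⌋| := by
      intro c y h1
      have h3 := abs_floor_sub_le hε c y
      have h4 : ε * D ≤ ε * |(⌊(y - c) / ε⌋ : ℝ)| := by
        rw [← abs_of_pos hε, ← abs_mul, abs_of_pos hε]
        have h5 : |y - c| ≤ |ε * (⌊(y - c) / ε⌋ : ℝ)| + |c + ε * ⌊(y - c) / ε⌋ - y| := by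
          have := abs_sub (ε * (⌊(y - c) / ε⌋ : ℝ)) (c + ε * ⌊(y - c) / ε⌋ - y)
          refine le_trans (le_of_eq ?_) this
          congr 1; ring
        linarith
      exact_mod_cast le_of_mul_le_mul_left h4 hε
    by_contra! hcon
    rw [max_lt_iff] at hcon
    refine hfar ⟨?_, ?_⟩ <;> by_contra! h
    · exact absurd (key _ _ h) (not_le.2 hcon.1)
    · exact absurd (key _ _ h) (not_le.2 hcon.2)

lemma sum_revBlk_le [Fintype V] (hε : 0 < ε) (hB : 0 < B) (hR : 0 ≤ R) (hθ : 0 ≤ θ)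
    (hz : ∀ a, 2 * ε ≤ (z a).1 ∧ (z a).1 ≤ X - 2 * ε ∧ 2 * ε ≤ (z a).2 ∧ (z a).2 ≤ X - 2 * ε)
    (hd : ∀ y y' c, Near c y y' → |d y - d y'| ≤ 2 * c) (hr : R < r) (ht : R + 2 * ε ≤ ε * t) (hD : ε * (D + 1) ≤ r)
    (hN : trunc X ≤ N) (U : ℕ) (i : Blk N) {p : ℝ} (hp0 : 0 ≤ p)
    (hp : (∃ a, Near R (z a) (ctr i)) →
      (gam (Blk N)).real {x | Arm t D (pos (fld N) (ptw ε (ctr i)) x ∩ {q | ptw ε (ctr i) q ∈ box X})} ≤ p) :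
    ∑ u ∈ Finset.Icc 1 U, (gam (Blk N)).real
        {x | i ∈ revBlk R θ N z (fun a b => Near ε (z a) (z b)) (St d ε z u) x} ≤
      (4 * r + 4 * ε + 1) + U * (p + Sc X * sErr X B R ε + 4 / B ^ 2) := by
  classical
  have hs : 0 ≤ sErr X B R ε := by unfold sErr; positivity
  have hSc := Sc_pos X
  have hpp : 0 ≤ p + Sc X * sErr X B R ε + 4 / B ^ 2 := by positivity
  set S := (finite_ptw_box hε (ctr i) X).toFinset with hS
  have hSS : (S : Set (ℤ × ℤ)) = {q | ptw ε (ctr i) q ∈ box X} := Finite.coe_toFinset _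
  have hone : ∀ u : ℕ, 2 * r + 2 * ε < |d (ctr i) - u| → (gam (Blk N)).real
      {x | i ∈ revBlk R θ N z (fun a b => Near ε (z a) (z b)) (St d ε z u) x} ≤
      p + Sc X * sErr X B R ε + 4 / B ^ 2 := by
    intro u hu
    by_cases hex : ∃ a, Near R (z a) (ctr i)
    swap
    · have : {x | i ∈ revBlk R θ N z (fun a b => Near ε (z a) (z b)) (St d ε z u) x} = ∅ := by
        refine eq_empty_of_forall_notMem fun x hx => hex ?_
        obtain ⟨a, _, h⟩ := mem_revBlk.1 hx
        exact ⟨a, Near.symm h⟩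
      rw [this, measureReal_empty]; exact hpp
    set E : Set (ℤ × ℤ) → Prop := fun O => Arm t D (O ∩ S) with hE
    have hES : OnlyOn E S := fun O O' h hO => by
      change Arm t D (O' ∩ S)
      rw [← h]; exact hO
    have hmono : ∀ O O', O ⊆ O' → E O → E O' := by
      rintro O O' h ⟨a, b, ha, hb, hc⟩
      exact ⟨a, b, ha, hb, hc.mono (inter_subset_inter_left _ h)⟩
    have h1 := pattern_perturb_le (N := N) (p := locP E S) hs hB hN (monoP_locP hmono S) (fun _ => 0)
      (z := fun q : S => ptw ε (ctr i) q) (fun q => (finite_ptw_box hε (ctr i) X).mem_toFinset.1 q.2)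
      (E := {x | i ∈ revBlk R θ N z (fun a b => Near ε (z a) (z b)) (St d ε z u) x}) ?_
    · have h2 := hp hex
      rw [← hSS] at h2
      have h3 : (gam (Blk N)).real {x | locP E S fun a => 0 < fld N (ptw ε (ctr i) a) x} ≤ p := by
        simp only [← locP_iff hES]; exact h2
      linarith
    · intro x hx ht'
      have h2 := arm_of_mem_revBlk hε hB.le hR hθ hz hd hr ht hD ht' hu hx
      change E _
      refine hmono _ _ ?_ (show E {q | -sErr X B R ε < fld N (ptw ε (ctr i) q) x ∧ ptw ε (ctr i) q ∈ box X} from ?_)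
      · rintro q ⟨h3, h4⟩
        exact ⟨(Finite.mem_toFinset _).2 h4, by rw [zero_sub]; exact h3⟩
      · change Arm t D (_ ∩ _)
        rw [hSS, inter_eq_left.2]
        · exact h2
        · exact fun q hq => hq.2
  rw [← Finset.sum_filter_add_sum_filter_not _ fun u : ℕ => |d (ctr i) - u| ≤ 2 * r + 2 * ε]
  refine add_le_add ?_ ?_
  · refine (Finset.sum_le_card_nsmul _ _ 1 fun u _ => measureReal_le_one).trans ?_
    rw [nsmul_eq_mul, mul_one]
    refine (card_filter_near_le U (d (ctr i)) (by linarith)).trans (by linarith)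
  · refine (Finset.sum_le_card_nsmul _ _ (p + Sc X * sErr X B R ε + 4 / B ^ 2) fun u hu => ?_).trans ?_
    · exact hone u (not_le.1 (Finset.mem_filter.1 hu).2)
    · rw [nsmul_eq_mul]
      refine mul_le_mul_of_nonneg_right ?_ hpp
      have := Finset.card_filter_le (Finset.Icc 1 U) fun u : ℕ => ¬ |d (ctr i) - u| ≤ 2 * r + 2 * ε
      rw [Nat.card_Icc] at this
      exact_mod_cast this.trans (by omega)

end Reveal

section FiniteCov

lemma gv_lin {ι β V κ : Type*} [Fintype ι] [DecidableEq ι] [Fintype β] [Fintype V] [Fintype κ] (ST : κ → ι → β → ℝ)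
    (c : κ → κ → ℝ) (hST : ∀ b b' i j, ∑ p, ST b i p * ST b' j p = if i = j then c b b' else 0) (C : V → ι → ℝ) :
    GV (gam β) (fun (q : κ × V) x => ∑ i, C q.2 i * lin (ST q.1) x i)
      fun q r => c q.1 r.1 * ∑ i, C q.2 i * C r.2 i := by
  have h := GV.linear (ι := β) fun (q : κ × V) p => ∑ i, C q.2 i * ST q.1 i p
  have e1 : (fun (q : κ × V) (x : β → ℝ) => ∑ p, (∑ i, C q.2 i * ST q.1 i p) * x p) =
      fun (q : κ × V) x => ∑ i, C q.2 i * lin (ST q.1) x i := by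
    ext q x
    simp only [lin, Finset.sum_mul, Finset.mul_sum]
    rw [Finset.sum_comm]
    exact Finset.sum_congr rfl fun i _ => Finset.sum_congr rfl fun p _ => by ring
  have e2 : (fun q r : κ × V => ∑ p, (∑ i, C q.2 i * ST q.1 i p) * ∑ i, C r.2 i * ST r.1 i p) =
      fun q r => c q.1 r.1 * ∑ i, C q.2 i * C r.2 i := by
    ext q r
    calc _ = ∑ i, ∑ j, C q.2 i * C r.2 j * ∑ p, ST q.1 i p * ST r.1 j p := by
          simp_rw [Finset.sum_mul_sum]
          rw [Finset.sum_comm]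
          refine Finset.sum_congr rfl fun i _ => ?_
          rw [Finset.sum_comm]
          refine Finset.sum_congr rfl fun j _ => ?_
          rw [Finset.mul_sum]
          exact Finset.sum_congr rfl fun p _ => by ring
      _ = _ := by
          simp only [hST, mul_ite, mul_zero, Finset.sum_ite_eq, Finset.mem_univ, if_true]
          rw [Finset.mul_sum]
          exact Finset.sum_congr rfl fun i _ => by ring
  rw [e1, e2] at h
  exact h

/-- Coefficients of the pair of correlated copies. -/
def pairMat (ι : Type*) [DecidableEq ι] (ρ : ℝ) (b : Bool) (i : ι) : ι ⊕ ι → ℝ :=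
  Sum.elim (fun j => if i = j then (if b then ρ else 1) else 0)
    fun j => if i = j then (if b then √(1 - ρ ^ 2) else 0) else 0

lemma pairMat_mul {ι : Type*} [Fintype ι] [DecidableEq ι] {ρ : ℝ} (hρ : ρ ^ 2 ≤ 1) (b b' : Bool) (i j : ι) :
    ∑ p, pairMat ι ρ b i p * pairMat ι ρ b' j p = if i = j then (if b = b' then 1 else ρ) else 0 := by
  have h := Real.mul_self_sqrt (sub_nonneg.2 hρ)
  simp only [Fintype.sum_sum_type, pairMat, Sum.elim_inl, Sum.elim_inr, ite_mul, zero_mul, Finset.sum_ite_eq,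
    Finset.mem_univ, if_true]
  by_cases hij : i = j
  · subst hij
    cases b <;> cases b' <;> simp
    rw [h]; ring
  · simp [hij, Ne.symm hij]

/-- Discrete intermediate values. -/
lemma exists_level {h : ℕ → ℝ} {M : ℕ} {u c : ℝ} (hc : 0 ≤ c) (h0 : h 0 ≤ u) (hM : u ≤ h M)
    (hs : ∀ i < M, |h (i + 1) - h i| ≤ c) : ∃ k ≤ M, |h k - u| ≤ c := by
  classical
  have hex : ∃ k, u ≤ h k := ⟨M, hM⟩
  set k := Nat.find hex
  have hk : u ≤ h k := Nat.find_spec hex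
  have hkM : k ≤ M := Nat.find_min' hex hM
  refine ⟨k, hkM, ?_⟩
  rcases Nat.eq_zero_or_pos k with h' | h'
  · rw [h'] at hk ⊢; rw [le_antisymm h0 hk]; simpa
  · have h1 : h (k - 1) < u := not_le.1 (Nat.find_min hex (Nat.sub_lt h' one_pos))
    have h2 := hs (k - 1) (by omega)
    rw [Nat.sub_add_cancel h', abs_le] at h2
    rw [abs_le]; constructor <;> linarith

variable {Ω : Type*} [MeasurableSpace Ω] {P : Measure Ω}

lemma eventually_arm {X' : ℝ × ℝ → Ω → ℝ} (h : BFF P X') {ε : ℝ} (hε : 0 < ε) {t D : ℤ} {p τ X R : ℝ} (hτ : 0 < τ)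
    (hp : ∀ (w : ℝ × ℝ) (S : Set (ℤ × ℤ)), S.Finite → P.real {ω | Arm t D (pos X' (ptw ε w) ω ∩ S)} ≤ p) :
    ∀ᶠ N in atTop, ∀ i : Blk N, (∃ y ∈ box X, Near R y (ctr i)) →
      (gam (Blk N)).real {x | Arm t D (pos (fld N) (ptw ε (ctr i)) x ∩ {q | ptw ε (ctr i) q ∈ box X})} ≤ p + τ := by
  set K := ⌈(X + R) ^ 2⌉₊
  have h1 : ∀ k ∈ Finset.range (K + 1) ×ˢ Finset.range (K + 1), ∀ᶠ N in atTop, (gam (Blk N)).real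
      {x | Arm t D (pos (fld N) (ptw ε (√(k.1 : ℕ), √(k.2 : ℕ))) x ∩
        {q | ptw ε (√(k.1 : ℕ), √(k.2 : ℕ)) q ∈ box X})} < p + τ := by
    intro k _
    set w : ℝ × ℝ := (√(k.1 : ℕ), √(k.2 : ℕ))
    have hf := finite_ptw_box hε w X
    have loc : Local fun O => Arm t D (O ∩ {q | ptw ε w q ∈ box X}) := ⟨_, hf, fun O O' hO hE => by
      change Arm t D (O' ∩ _); rw [← hO]; exact hE⟩
    exact (h.tendsto_real loc (g := ptw ε w) (g' := ptw ε w) fun _ _ => rfl).eventually_lt_const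
      ((hp w _ hf).trans_lt (by linarith))
  filter_upwards [(Finset.eventually_all _).2 h1] with N hN i hi
  obtain ⟨y, hy, hn⟩ := hi
  refine (hN (i.1, i.2) ?_).le
  have key : ∀ k : ℕ, ∀ c : ℝ, 0 ≤ c → c ≤ X → |c - √k| ≤ R → k ∈ Finset.range (K + 1) := by
    intro k c h0 h1 h2
    rw [abs_le] at h2
    have h3 : √(k : ℝ) ≤ X + R := by linarith
    have h4 : (k : ℝ) ≤ (X + R) ^ 2 := by
      rw [← Real.sq_sqrt (Nat.cast_nonneg k)]
      exact pow_le_pow_left₀ (Real.sqrt_nonneg _) h3 2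
    rw [Finset.mem_range, Nat.lt_succ_iff]
    exact_mod_cast h4.trans (Nat.le_ceil _)
  exact Finset.mem_product.2 ⟨key _ _ hy.1.1 hy.1.2 hn.1, key _ _ hy.2.1 hy.2.2 hn.2⟩

variable {Ω' : Type*} [MeasurableSpace Ω'] {P' : Measure Ω'}

set_option maxHeartbeats 800000 in
theorem finite_cov_le {X' : ℝ × ℝ → Ω' → ℝ} (h' : BFF P' X') {V κ : Type} [Fintype V] {z : V → ℝ × ℝ}
    {w : κ → ℕ → V} {M : ℕ} {X B R ε θ r p τ ρ : ℝ} {t D : ℤ} {d : ℝ × ℝ → ℝ} {U m : ℕ} {Y : Bool × V → Ω → ℝ}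
    (hY : GV P Y fun q q' => (if q.1 = q'.1 then 1 else ρ) * Kbf (z q.2) (z q'.2))
    (hε : 0 < ε) (hB : 0 < B) (hR : 0 ≤ R) (hθ : 0 ≤ θ) (hτ : 0 < τ) (hp0 : 0 ≤ p)
    (hz : ∀ a, 2 * ε ≤ (z a).1 ∧ (z a).1 ≤ X - 2 * ε ∧ 2 * ε ≤ (z a).2 ∧ (z a).2 ≤ X - 2 * ε)
    (hd : ∀ y y' c, Near c y y' → |d y - d y'| ≤ 2 * c) (hr : R < r) (ht : R + 2 * ε ≤ ε * t) (hD : ε * (D + 1) ≤ r)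
    (hw : ∀ j, ∀ i < M, Near ε (z (w j i)) (z (w j (i + 1)))) (hw0 : ∀ j, d (z (w j 0)) ≤ 0)
    (hwM : ∀ j, U ≤ d (z (w j M))) (hU : 0 < U)
    (hp : ∀ (w : ℝ × ℝ) (S : Set (ℤ × ℤ)), S.Finite → P'.real {ω | Arm t D (pos X' (ptw ε w) ω ∩ S)} ≤ p)
    (hm : 2 ≤ m) (hρ0 : 0 ≤ ρ) (hρ1 : ρ ≤ 1 - 1 / m) :
    P.real {ω | PathOpen w M (fun a => θ < Y (false, a) ω) ∧ PathOpen w M fun a => θ < Y (true, a) ω} ≤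
      P.real {ω | PathOpen w M fun a => θ < Y (false, a) ω} * P.real {ω | PathOpen w M fun a => θ < Y (true, a) ω} +
      (((4 * r + 4 * ε + 1) / U + (p + τ + Sc X * sErr X B R ε + 4 / B ^ 2)) * m ^ 2 +
        4 * (2 * Sc X * sErr X B R ε + 4 / B ^ 2)) := by
  classical
  have hSc := Sc_pos X
  have hs : 0 ≤ sErr X B R ε := by unfold sErr; positivity
  have hm1 : (2 : ℝ) ≤ m := by exact_mod_cast hm
  have hρ2 : ρ ^ 2 ≤ 1 := by
    have : ρ ≤ 1 := hρ1.trans (by have : (0 : ℝ) ≤ 1 / m := by positivity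
                                  linarith)
    nlinarith
  have hzb : ∀ a, z a ∈ box X := fun a => by
    obtain ⟨h1, h2, h3, h4⟩ := hz a
    exact ⟨⟨by linarith, by linarith⟩, by linarith, by linarith⟩
  set pp := PathOpen w M
  have hG : ∀ N, GV (gam (Blk N ⊕ Blk N)) (fun (q : Bool × V) x => fld N (z q.2) (lin (pairMat (Blk N) ρ q.1) x))
      fun q q' => (if q.1 = q'.1 then 1 else ρ) * ∑ i, cf N (z q.2) i * cf N (z q'.2) i := fun N =>
    gv_lin (pairMat (Blk N) ρ) (fun b b' => if b = b' then 1 else ρ) (pairMat_mul hρ2) fun a => cf N (z a)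
  have hlim : ∀ (Φ : (Bool × V → Prop) → Prop), Tendsto (fun N => (gam (Blk N ⊕ Blk N)).real
      {x | Φ fun q => θ < fld N (z q.2) (lin (pairMat (Blk N) ρ q.1) x)}) atTop
      (𝓝 (P.real {ω | Φ fun q => θ < Y q ω})) := fun Φ =>
    GV.tendsto_patt hG hY (fun q q' => (tendsto_cov _ _).const_mul _) (fun q => by simp [Kbf_self]) Φ fun _ => θ
  have l1 := hlim fun Q => pp (fun a => Q (false, a)) ∧ pp fun a => Q (true, a)
  have l2 := (hlim fun Q => pp fun a => Q (false, a)).mul (hlim fun Q => pp fun a => Q (true, a))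
  refine le_of_tendsto_of_tendsto l1 (l2.add_const _) ?_
  filter_upwards [eventually_ge_atTop (trunc X), eventually_arm h' hε hτ (X := X) (R := R) hp] with N hN harm
  set L := fun b => lin (pairMat (Blk N) ρ b) with hL
  have hLp : ∀ b, MeasurePreserving (L b) (gam (Blk N ⊕ Blk N)) (gam (Blk N)) := fun b =>
    measurePreserving_lin _ fun i j => by rw [pairMat_mul hρ2]; simp
  set A : Set (Blk N → ℝ) := {x | pp fun a => θ < fld N (z a) x} with hA
  set G : Set (Blk N → ℝ) := {x | pp fun a => θ < fldl R N (z a) x} with hGd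
  have mA : MeasurableSet A := measurableSet_pattern (fun a => measurable_fld (z a)) pp fun _ => θ
  have mG : MeasurableSet G := measurableSet_pattern (fun a => measurable_fldl R (z a)) pp fun _ => θ
  set e := 2 * Sc X * sErr X B R ε + 4 / B ^ 2 with he
  have hZ : (gam (Blk N)).real (A \ G ∪ G \ A) ≤ e := by
    have := pattern_symmDiff_le (N := N) (s := sErr X B R ε) hs hB hN (monoP_pathOpen w M) (fun _ => θ) hzb
      (G := fun a => fldl R N (z a)) fun x hx a => (abs_cfl_sub_le_of_tame hB.le hR hx (hzb a)).trans
        (le_add_of_nonneg_right (by positivity))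
    refine (measureReal_mono fun x hx => ?_).trans this
    rcases hx with ⟨h1, h2⟩ | ⟨h1, h2⟩
    · exact fun h => h2 (h.2 h1)
    · exact fun h => h2 (h.1 h1)
  have mZ : MeasurableSet (A \ G ∪ G \ A) := (mA.diff mG).union (mG.diff mA)
  have hpre : ∀ b {s : Set (Blk N → ℝ)}, MeasurableSet s →
      (gam (Blk N ⊕ Blk N)).real (L b ⁻¹' s) = (gam (Blk N)).real s := fun b s hs =>
    (hLp b).measureReal_preimage hs.nullMeasurableSet
  have e1 : (gam (Blk N ⊕ Blk N)).real {x | pp fun a => θ < fld N (z a) (L false x)} = (gam (Blk N)).real A :=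
    hpre false mA
  have e2 : (gam (Blk N ⊕ Blk N)).real {x | pp fun a => θ < fld N (z a) (L true x)} = (gam (Blk N)).real A :=
    hpre true mA
  rw [e1, e2]
  have hdec : ∀ u ∈ Finset.Icc 1 U, StopSet (crossInd R θ N z w M)
      (revBlk R θ N z (fun a b => Near ε (z a) (z b)) (St d ε z u)) := by
    intro u hu
    have hu' := Finset.mem_Icc.1 hu
    refine stopSet_revBlk (fun a b hab => hab.symm) hw fun j => ?_
    refine exists_level (h := fun k => d (z (w j k))) (by linarith) ((hw0 j).trans (Nat.cast_nonneg u))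
      (le_trans (by exact_mod_cast hu'.2) (hwM j)) fun i hi => ?_
    rw [abs_sub_comm]
    exact hd _ _ _ (hw j i hi)
  have hg : BM (crossInd R θ N z w M) := BM.indicator mG
  have hU' : (0 : ℝ) < U := by exact_mod_cast hU
  set δ := (4 * r + 4 * ε + 1) / U + (p + τ + Sc X * sErr X B R ε + 4 / B ^ 2) with hδ
  have hδ0 : 0 ≤ δ := by
    have : 0 ≤ r := hR.trans hr.le
    positivity
  have hns := noise_sens (β := Blk N ⊕ Blk N) (Finset.nonempty_Icc.2 (show 1 ≤ U from hU)) hdec hg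
    (fun x => by
      unfold crossInd
      by_cases hx : x ∈ {x | PathOpen w M fun a => θ < fldl R N (z a) x}
      · rw [indicator_of_mem hx]; simp
      · rw [indicator_of_notMem hx]; simp) (δ := δ) hδ0
    (fun i => by
      refine (sum_revBlk_le hε hB hR hθ hz hd hr ht hD hN U i (p := p + τ) (by linarith) fun ⟨a, ha⟩ =>
        harm i ⟨z a, hzb a, ha⟩).trans (le_of_eq ?_)
      rw [Nat.card_Icc, Nat.add_sub_cancel, hδ]; field_simp)
    hm hρ0 hρ1 (pairMat (Blk N) ρ false) (pairMat (Blk N) ρ true)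
    (fun i j => by rw [pairMat_mul hρ2]; simp) (fun i j => by rw [pairMat_mul hρ2]; simp)
    (fun i j => by rw [pairMat_mul hρ2]; simp)
  have i1 : ∫ x, crossInd R θ N z w M x ∂gam (Blk N) = (gam (Blk N)).real G := by
    change ∫ x, G.indicator _ x ∂_ = _
    rw [integral_indicator_const _ mG]; simp
  have i2 : ∫ x, crossInd R θ N z w M (lin (pairMat (Blk N) ρ false) x) *
      crossInd R θ N z w M (lin (pairMat (Blk N) ρ true) x) ∂gam (Blk N ⊕ Blk N) =
      (gam (Blk N ⊕ Blk N)).real (L false ⁻¹' G ∩ L true ⁻¹' G) := by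
    rw [← integral_indicator_one (((hLp false).measurable mG).inter ((hLp true).measurable mG))]
    congr 1; ext x
    change G.indicator _ (L false x) * G.indicator _ (L true x) = _
    simp only [indicator, mem_inter_iff, mem_preimage]
    split_ifs <;> simp_all
  rw [i1, i2] at hns
  have i3 : (gam (Blk N ⊕ Blk N)).real {x | pp (fun a => θ < fld N (z a) (L false x)) ∧
      pp fun a => θ < fld N (z a) (L true x)} ≤
      (gam (Blk N ⊕ Blk N)).real (L false ⁻¹' G ∩ L true ⁻¹' G) + e + e := by
    have hsub : {x | pp (fun a => θ < fld N (z a) (L false x)) ∧ pp fun a => θ < fld N (z a) (L true x)} ⊆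
        ((L false ⁻¹' G ∩ L true ⁻¹' G) ∪ L false ⁻¹' (A \ G ∪ G \ A)) ∪ L true ⁻¹' (A \ G ∪ G \ A) := by
      rintro x ⟨h1, h2⟩
      have h1' : L false x ∈ A := h1
      have h2' : L true x ∈ A := h2
      by_cases g1 : L false x ∈ G
      · by_cases g2 : L true x ∈ G
        · exact Or.inl (Or.inl ⟨g1, g2⟩)
        · exact Or.inr (Or.inl ⟨h2', g2⟩)
      · exact Or.inl (Or.inr (Or.inl ⟨h1', g1⟩))
    refine (measureReal_mono hsub).trans ((measureReal_union_le _ _).trans (add_le_add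
      ((measureReal_union_le _ _).trans (add_le_add le_rfl ?_)) ?_))
    · rw [hpre false mZ]; exact hZ
    · rw [hpre true mZ]; exact hZ
  have i4 : (gam (Blk N)).real G ≤ (gam (Blk N)).real A + e := by
    refine (measureReal_mono (s₂ := A ∪ (A \ G ∪ G \ A)) fun x hx => ?_).trans
      ((measureReal_union_le _ _).trans (add_le_add le_rfl hZ))
    by_cases hxA : x ∈ A
    · exact Or.inl hxA
    · exact Or.inr (Or.inr ⟨hx, hxA⟩)
  have n1 : 0 ≤ (gam (Blk N)).real G := measureReal_nonneg
  have n2 : 0 ≤ (gam (Blk N)).real A := measureReal_nonneg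
  have u1 : (gam (Blk N)).real G ≤ 1 := measureReal_le_one
  have u2 : (gam (Blk N)).real A ≤ 1 := measureReal_le_one
  have he0 : 0 ≤ e := by positivity
  have i5 : (gam (Blk N)).real G ^ 2 ≤ (gam (Blk N)).real A * (gam (Blk N)).real A + 2 * e := by
    nlinarith
  refine i3.trans ?_
  linarith

end FiniteCov

section Parameters

lemma eventually_poly_mul_exp_le (p : Polynomial ℝ) {c : ℝ} (hc : 0 < c) :
    ∀ᶠ s in atTop, p.eval s * Real.exp (-s) ≤ c := by
  filter_upwards [(p.tendsto_div_exp_atTop).eventually_le_const hc] with s hs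
  rwa [Real.exp_neg, ← div_eq_mul_inv]

lemma Sc_mono {x y : ℝ} (hx : 0 ≤ x) (h : x ≤ y) : Sc x ≤ Sc y := by unfold Sc; gcongr

lemma Kc_mono {x y : ℝ} (hx : 0 ≤ x) (h : x ≤ y) : Kc x ≤ Kc y := by unfold Kc; gcongr

lemma Kc_pos (x : ℝ) : 0 < Kc x := by unfold Kc; positivity

variable {Ω : Type*} [MeasurableSpace Ω] {P : Measure Ω} {X : ℝ × ℝ → Ω → ℝ}

lemma BFF.arm_le (h : BFF P X) {C : ℤ} {κ q : ℝ} (hC : ∀ {D d0 s0 : ℤ} {err : ℝ} (M : Perc D d0 s0 err) (t : ℤ)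
      (I N : ℕ), 0 ≤ err → err ≤ κ → 1 ≤ s0 →
      d0 ≤ t → 3 * s0 ≤ t → (t + 1) * 3 ^ I ≤ s0 * 4 ^ I → C ^ (N + 1) * (2 ^ I * t) ≤ D →
      M.pr (Arm t (C ^ (N + 1) * (2 ^ I * t))) ≤ (1 - q) ^ N + N * err)
    {D d0 s0 t : ℤ} {err ε : ℝ} (M : Perc D d0 s0 err) (hM : ∀ E, M.pr E = P.real {ω | E (pos X (pt ε 0) ω)}) {I N : ℕ}
    (h1 : 0 ≤ err) (h2 : err ≤ κ) (h3 : 1 ≤ s0) (h4 : d0 ≤ t) (h5 : 3 * s0 ≤ t)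
    (h6 : (t + 1) * 3 ^ I ≤ s0 * 4 ^ I) (h7 : C ^ (N + 1) * (2 ^ I * t) = D) (w : ℝ × ℝ) (S : Set (ℤ × ℤ))
    (hS : S.Finite) : P.real {ω | Arm t D (pos X (ptw ε w) ω ∩ S)} ≤ (1 - q) ^ N + N * err := by
  have loc : Local fun O => Arm t D (O ∩ S) := ⟨S, hS, fun O O' hO hE => by
    change Arm t D (O' ∩ _); rw [← hO]; exact hE⟩
  have e := h.real_eq h loc (g := ptw ε w) (g' := pt ε 0) fun q r => by
    simp only [Kbf, pt, ptw]; ring_nf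
  have h8 := hC M t I N h1 h2 h3 h4 h5 h6 h7.le
  rw [e, ← hM fun O => Arm t D (O ∩ S)]
  rw [h7] at h8
  refine (M.mono _ _ ?_).trans h8
  rintro O ⟨a, b, ha, hb, hc⟩
  exact ⟨a, b, ha, hb, Conn.mono inter_subset_left hc⟩

/-- A mesh scale small enough for the unit box condition. -/
lemma exists_base_scale : ∃ δ : ℝ, 0 < δ ∧ δ ≤ 1 / 2 ∧ 48 * Kc 1 ^ 2 * √(2 * δ) < 1 / 8 := by
  have h1 : Tendsto (fun δ : ℝ => 48 * Kc 1 ^ 2 * √(2 * δ)) (𝓝[>] 0) (𝓝 (48 * Kc 1 ^ 2 * √(2 * 0))) :=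
    (Continuous.tendsto (by fun_prop) 0).mono_left nhdsWithin_le_nhds
  have h2 := h1.eventually_lt_const (u := 1 / 8) (by norm_num)
  have h3 : ∀ᶠ δ : ℝ in 𝓝[>] 0, δ ∈ Ioo (0 : ℝ) (1 / 2) := Ioo_mem_nhdsGT (by norm_num)
  obtain ⟨δ, h4, h5⟩ := (h2.and h3).exists
  exact ⟨δ, h5.1, h5.2.le, h4⟩

lemma exp_combine {s K S : ℝ} {D : ℤ} (hs : 32 ≤ s) (hK : 1 ≤ K) (hS : 0 ≤ S) (hD0 : 0 ≤ D)
    (hD : D ≤ K * s ^ 5 * Real.exp (2 * s))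
    (h : 27 * K ^ 2 * s ^ 13 * (8 * S + 4) * Real.exp (-s) ≤ 1) :
    3 * ((2 * D + 1) ^ 2 * (8 * S * Real.exp (3 * s) * Real.exp (-s ^ 2 / 4) + 4 / Real.exp (3 * s) ^ 2)) ≤
      (s ^ 3)⁻¹ := by
  have hs0 : 0 < s := by linarith
  have hD0' : (0 : ℝ) ≤ D := by exact_mod_cast hD0
  have a1 : (1 : ℝ) ≤ K * s ^ 5 * Real.exp (2 * s) := by
    have e1 : 1 ≤ s ^ 5 := one_le_pow₀ (by linarith)
    have e2 : 1 ≤ Real.exp (2 * s) := Real.one_le_exp (by linarith)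
    exact one_le_mul_of_one_le_of_one_le (one_le_mul_of_one_le_of_one_le hK e1) e2
  have a2 : (2 * (D : ℝ) + 1) ^ 2 ≤ (3 * (K * s ^ 5 * Real.exp (2 * s))) ^ 2 :=
    pow_le_pow_left₀ (by linarith) (by linarith) 2
  have a3 : Real.exp (3 * s) * Real.exp (-s ^ 2 / 4) ≤ Real.exp (-(5 * s)) := by
    rw [← Real.exp_add]; exact Real.exp_le_exp.2 (by nlinarith)
  have a4 : 4 / Real.exp (3 * s) ^ 2 ≤ 4 * Real.exp (-(5 * s)) := by
    rw [div_eq_mul_inv, ← Real.exp_nat_mul, ← Real.exp_neg]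
    refine mul_le_mul_of_nonneg_left (Real.exp_le_exp.2 ?_) (by norm_num)
    push_cast; linarith
  have a5 : 8 * S * Real.exp (3 * s) * Real.exp (-s ^ 2 / 4) + 4 / Real.exp (3 * s) ^ 2 ≤
      (8 * S + 4) * Real.exp (-(5 * s)) := by
    rw [mul_assoc (8 * S), add_mul]
    exact add_le_add (mul_le_mul_of_nonneg_left a3 (by positivity)) a4
  have a6 : Real.exp (2 * s) ^ 2 * Real.exp (-(5 * s)) = Real.exp (-s) := by
    rw [← Real.exp_nat_mul, ← Real.exp_add]; congr 1; push_cast; ring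
  calc _ ≤ 3 * ((3 * (K * s ^ 5 * Real.exp (2 * s))) ^ 2 * ((8 * S + 4) * Real.exp (-(5 * s)))) := by
        gcongr
    _ = 27 * K ^ 2 * s ^ 10 * (8 * S + 4) * (Real.exp (2 * s) ^ 2 * Real.exp (-(5 * s))) := by ring
    _ = (27 * K ^ 2 * s ^ 13 * (8 * S + 4) * Real.exp (-s)) * (s ^ 3)⁻¹ := by
        rw [a6]; field_simp
    _ ≤ _ := mul_le_of_le_one_left (by positivity) h

set_option maxHeartbeats 1000000 in
/-- Arm decay for the field at macroscopic scale `s`, with mesh `exp (-2 s)`. -/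
theorem BFF.exists_arm_decay (h : BFF P X) : ∃ η K : ℝ, 0 < η ∧ η ≤ 1 ∧ 0 < K ∧ ∀ᶠ s : ℝ in atTop, ∃ t D : ℤ,
    s + 2 * Real.exp (-(2 * s)) ≤ Real.exp (-(2 * s)) * t ∧ Real.exp (-(2 * s)) * (D + 1) ≤ s ^ 6 ∧
    ∀ (w : ℝ × ℝ) (S : Set (ℤ × ℤ)), S.Finite →
      P.real {ω | Arm t D (pos X (ptw (Real.exp (-(2 * s))) w) ω ∩ S)} ≤ K * s ^ (-η) := by
  obtain ⟨C, κ, q, hC8, hκ, hq0, hq1, hC⟩ := exists_arm_bound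
  obtain ⟨δ, hδ0, hδ, hδ1⟩ := exists_base_scale
  have hC8' : (8 : ℝ) ≤ C := by exact_mod_cast hC8
  have hlC : 0 < Real.log C := Real.log_pos (by linarith)
  have hlq : Real.log (1 - q) < 0 := Real.log_neg (by linarith) (by linarith)
  set η := min 1 (-Real.log (1 - q) / Real.log C) with hη
  have hη0 : 0 < η := lt_min one_pos (div_pos (by linarith) hlC)
  have hη1 : η ≤ 1 := min_le_left _ _
  have hqC : 1 - q ≤ (C : ℝ) ^ (-η) := by
    have h1 : η ≤ -Real.log (1 - q) / Real.log C := min_le_right _ _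
    rw [le_div_iff₀ hlC] at h1
    rw [Real.rpow_def_of_pos (by linarith), ← Real.log_le_iff_le_exp (by linarith)]
    nlinarith
  set K := 8000 * C / δ ^ 3 with hKdef
  have hK1 : 1 ≤ K := by
    have : δ ^ 3 ≤ 1 := pow_le_one₀ hδ0.le (by linarith)
    rw [hKdef, le_div_iff₀ (by positivity)]; nlinarith
  refine ⟨η, 1 / (1 - q) + 1, hη0, hη1, by have := sub_pos.2 hq1; positivity, ?_⟩
  have ev1 := eventually_poly_mul_exp_le (32 * (4 * (2 * (Polynomial.C (2 * K) * Polynomial.X ^ 5) ^ 2 + 2) ^ 2 *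
    (48 ^ 6 * (1 + (Polynomial.C (2 * K) * Polynomial.X ^ 5) ^ 2) ^ 6) ^ 2)) (c := 1 / 4) (by norm_num)
  have ev2 := eventually_poly_mul_exp_le (27 * Polynomial.C K ^ 2 * Polynomial.X ^ 13 * (8 * (4 * (2 * (Polynomial.C (2 * K) * Polynomial.X ^ 5) ^ 2 + 2) ^ 2 *
    (48 ^ 6 * (1 + (Polynomial.C (2 * K) * Polynomial.X ^ 5) ^ 2) ^ 6) ^ 2) + 4)) (c := 1) (by norm_num)
  have ev3 := eventually_poly_mul_exp_le 1 (c := δ / 2) (by positivity)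
  filter_upwards [ev1, ev2, ev3, eventually_ge_atTop 32, eventually_ge_atTop (K + 1),
    eventually_ge_atTop (κ⁻¹)] with s h1 h2 h3 hs32 hsK hsκ
  simp only [Polynomial.eval_mul, Polynomial.eval_add, Polynomial.eval_pow, Polynomial.eval_C, Polynomial.eval_X,
    Polynomial.eval_ofNat, Polynomial.eval_one, one_mul] at h1 h2 h3
  have hs : 0 < s := by linarith
  set ε := Real.exp (-(2 * s)) with hεdef
  have hε : 0 < ε := Real.exp_pos _
  have hsε : √ε = Real.exp (-s) := by
    rw [hεdef, show -(2 * s) = -s + -s by ring, Real.exp_add, Real.sqrt_mul_self (Real.exp_pos _).le]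
  have hεδ : ε ≤ δ / 2 := le_trans (Real.exp_le_exp.2 (by linarith)) h3
  have hε1 : ε ≤ 1 := by linarith
  have hεi : ε * Real.exp (2 * s) = 1 := by rw [hεdef, ← Real.exp_add]; simp
  set s0 := ⌊δ / ε⌋
  have b1 : ε * s0 ≤ δ := by
    have := Int.floor_le (δ / ε)
    rwa [le_div_iff₀ hε, mul_comm] at this
  have b2 : δ / 2 ≤ ε * s0 := by
    have := Int.sub_one_lt_floor (δ / ε)
    have h4 : ε * (δ / ε - 1) < ε * s0 := mul_lt_mul_of_pos_left this hε
    rw [mul_sub, mul_div_cancel₀ _ hε.ne'] at h4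
    linarith
  have b3 : 1 ≤ s0 := by
    have : (0 : ℝ) < s0 := (mul_pos_iff_of_pos_left hε).1 (lt_of_lt_of_le (by positivity) b2)
    have : 0 < s0 := by exact_mod_cast this
    omega
  set t := ⌈3 * s / ε⌉
  have t1 : 3 * s ≤ ε * t := by
    have := Int.le_ceil (3 * s / ε)
    rwa [div_le_iff₀ hε, mul_comm _ ε] at this
  have t2 : ε * t ≤ 4 * s := by
    have := Int.ceil_lt_add_one (3 * s / ε)
    have h4 : ε * t < ε * (3 * s / ε + 1) := mul_lt_mul_of_pos_left this hε
    rw [mul_add, mul_div_cancel₀ _ hε.ne'] at h4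
    linarith
  have t0 : 0 ≤ t := Int.ceil_nonneg (by positivity)
  have t3 : 3 * s0 ≤ t := by
    have : ε * (3 * s0) ≤ ε * t := by linarith
    exact_mod_cast le_of_mul_le_mul_left this hε
  have x1 : 1 ≤ 10 * s / δ := by rw [le_div_iff₀ hδ0]; linarith
  obtain ⟨n, hn1, hn2⟩ := exists_nat_pow_near x1 (show (1 : ℝ) < 4 / 3 by norm_num)
  obtain ⟨N, hN1, hN2⟩ := exists_nat_pow_near (show 1 ≤ s by linarith) (show (1 : ℝ) < C by linarith)
  have hI : (t + 1) * 3 ^ (n + 1) ≤ s0 * 4 ^ (n + 1) := by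
    have h4 : ε * (t + 1) ≤ ε * ((10 * s / δ) * s0) := by
      have : (10 * s / δ) * (δ / 2) = 5 * s := by field_simp; ring
      have := mul_le_mul_of_nonneg_left b2 (show 0 ≤ 10 * s / δ by positivity)
      nlinarith
    have h5 := le_of_mul_le_mul_left h4 hε
    have hs0' : (0 : ℝ) < s0 := by exact_mod_cast (by omega : 0 < s0)
    have h6 : (t + 1 : ℝ) ≤ (4 / 3) ^ (n + 1) * s0 := h5.trans (mul_le_mul_of_nonneg_right hn2.le hs0'.le)
    rw [div_pow, div_mul_eq_mul_div, le_div_iff₀ (by positivity), mul_comm ((4 : ℝ) ^ _)] at h6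
    exact_mod_cast h6
  have h2I : (2 : ℝ) ^ (n + 1) ≤ 2 * (10 * s / δ) ^ 3 := by
    rw [pow_succ, mul_comm]
    gcongr
    calc (2 : ℝ) ^ n ≤ ((4 / 3) ^ 3) ^ n := pow_le_pow_left₀ (by norm_num) (by norm_num) n
      _ = ((4 / 3) ^ n) ^ 3 := by rw [← pow_mul, ← pow_mul, mul_comm]
      _ ≤ _ := pow_le_pow_left₀ (by positivity) hn1 3
  have hCN : (C : ℝ) ^ (N + 1) ≤ C * s := by
    rw [pow_succ, mul_comm]; gcongr
  set D := C ^ (N + 1) * (2 ^ (n + 1) * t) with hD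
  have hD0 : 0 ≤ D := by positivity
  have hDε : ε * D ≤ K * s ^ 5 := by
    have : (D : ℝ) = C ^ (N + 1) * (2 ^ (n + 1) * t) := by rw [hD]; push_cast; ring
    rw [this]
    calc ε * (C ^ (N + 1) * (2 ^ (n + 1) * t)) = C ^ (N + 1) * (2 ^ (n + 1) * (ε * t)) := by ring
      _ ≤ (C * s) * (2 * (10 * s / δ) ^ 3 * (4 * s)) := by gcongr
      _ = _ := by rw [hKdef]; field_simp; ring
  have hD0' : (0 : ℝ) ≤ D := by exact_mod_cast hD0
  have hxx : 2 * (ε * D) ≤ 2 * K * s ^ 5 := by linarith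
  have hSc := Sc_mono (by positivity) hxx
  have hKc := Kc_mono (by positivity) hxx
  set x := 2 * (ε * D)
  set S := Sc x * Kc x ^ 2 with hS
  have hS0 : 0 ≤ S := by have := Sc_pos x; positivity
  have hSy : S ≤ Sc (2 * K * s ^ 5) * Kc (2 * K * s ^ 5) ^ 2 := by
    exact mul_le_mul hSc (pow_le_pow_left₀ (Kc_pos x).le hKc 2) (by positivity) (Sc_pos _).le
  have hs3 : (s ^ 3)⁻¹ ≤ κ := by
    rw [inv_le_comm₀ (by positivity) hκ]
    refine hsκ.trans (le_self_pow₀ (by linarith) (by norm_num))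
  have g1 : 32 * S * Real.exp (-s) ≤ 1 / 4 := by
    refine (mul_le_mul_of_nonneg_right ?_ (Real.exp_pos _).le).trans h1
    refine (mul_le_mul_of_nonneg_left hSy (by norm_num)).trans (le_of_eq ?_)
    unfold Sc Kc; ring
  have g2 : 27 * K ^ 2 * s ^ 13 * (8 * S + 4) * Real.exp (-s) ≤ 1 := by
    refine le_trans ?_ h2
    gcongr
    exact hSy
  have hDe : D ≤ K * s ^ 5 * Real.exp (2 * s) := by
    have := mul_le_mul_of_nonneg_left hDε (Real.exp_pos (2 * s)).le
    rw [← mul_assoc, mul_comm (Real.exp _) ε, hεi] at this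
    linarith
  have hm := h.arm_le hC (h.perc (ε := ε) (B := 4) (B' := Real.exp (3 * s)) (R := s) (D := D) (d0 := t) (s0 := s0)
    (err := (s ^ 3)⁻¹) hε.le (by norm_num) (Real.exp_pos _) hs.le (by omega) hD0 (by linarith)
    (lt_of_le_of_lt (by gcongr) hδ1)
    (by rw [hsε]
        change Sc x * (8 * 4 * Kc x ^ 2 * _) + _ ≤ _
        calc _ = 32 * S * Real.exp (-s) + 1 / 4 := by rw [hS]; ring
          _ ≤ _ := by linarith)
    (by linarith)
    ((exp_combine hs32 hK1 hS0 hD0 hDe g2).trans' (le_of_eq (by rw [hS]; ring)))) (fun _ => rfl)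
    (t := t) (I := n + 1) (N := N) (by positivity) hs3 b3 le_rfl t3 hI rfl
  refine ⟨t, D, by linarith, ?_, fun w S hS => (hm w S hS).trans ?_⟩
  · have : (1 : ℝ) ≤ s ^ 5 := one_le_pow₀ (by linarith)
    calc ε * (D + 1) ≤ K * s ^ 5 + 1 := by linarith
      _ ≤ (K + 1) * s ^ 5 := by linarith
      _ ≤ s * s ^ 5 := by gcongr
      _ = s ^ 6 := by ring
  · have hq : 0 < 1 - q := by linarith
    have p1 : (1 - q) ^ (N + 1) ≤ s ^ (-η) := by
      calc (1 - q) ^ (N + 1) ≤ ((C : ℝ) ^ (-η)) ^ (N + 1) := pow_le_pow_left₀ hq.le hqC _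
        _ = ((C : ℝ) ^ (N + 1)) ^ (-η) := by
          rw [← Real.rpow_natCast, ← Real.rpow_natCast, ← Real.rpow_mul (by linarith), ← Real.rpow_mul (by linarith),
            mul_comm]
        _ ≤ _ := Real.rpow_le_rpow_of_nonpos hs hN2.le (by linarith)
    have p2 : (N : ℝ) ≤ s := by
      refine le_trans ?_ hN1
      have : (N : ℝ) ≤ 2 ^ N := by exact_mod_cast Nat.lt_two_pow_self.le
      exact this.trans (pow_le_pow_left₀ (by norm_num) (by linarith) _)
    have p3 : s⁻¹ ≤ s ^ (-η) := by
      rw [← Real.rpow_neg_one]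
      exact Real.rpow_le_rpow_of_exponent_le (by linarith) (by linarith)
    have p4 : N * (s ^ 3)⁻¹ ≤ s ^ (-η) := by
      refine le_trans ?_ p3
      calc N * (s ^ 3)⁻¹ ≤ s * (s ^ 3)⁻¹ := by gcongr
        _ = s⁻¹ * s⁻¹ := by field_simp
        _ ≤ s⁻¹ * 1 := by gcongr; exact inv_le_one_of_one_le₀ (by linarith)
        _ = _ := mul_one _
    have p5 : (1 - q) ^ N ≤ 1 / (1 - q) * s ^ (-η) := by
      rw [div_mul_eq_mul_div, one_mul, le_div_iff₀ hq, ← pow_succ]; exact p1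
    rw [add_mul, one_mul]
    exact add_le_add p5 p4

end Parameters

section Asymptotics
variable {Ω Ω' : Type*} [MeasurableSpace Ω] {P : Measure Ω} [MeasurableSpace Ω'] {P' : Measure Ω'}
  {X' : ℝ × ℝ → Ω' → ℝ}

lemma Sc_mul_sErr_le {s X : ℝ} (hs : 32 ≤ s) (h : 20 * s ^ 2 * (Sc X * Kc X ^ 2) * Real.exp (-s) ≤ 1) :
    Sc X * sErr X s s (Real.exp (-(2 * s))) ≤ s⁻¹ := by
  have hs0 : 0 < s := by linarith
  have h1 : √(2 * Real.exp (-(2 * s))) ≤ 2 * Real.exp (-s) := by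
    refine Real.sqrt_le_iff.2 ⟨by positivity, ?_⟩
    rw [mul_pow, ← Real.exp_nat_mul, show ((2 : ℕ) : ℝ) * -s = -(2 * s) by push_cast; ring]
    nlinarith [Real.exp_pos (-(2 * s))]
  have h2 : Real.exp (-s ^ 2 / 4) ≤ Real.exp (-s) := Real.exp_le_exp.2 (by nlinarith)
  have hSc := Sc_pos X
  have hKc := Kc_pos X
  calc Sc X * sErr X s s (Real.exp (-(2 * s)))
      ≤ Sc X * (4 * s * Kc X ^ 2 * Real.exp (-s) + 8 * s * Kc X ^ 2 * (2 * Real.exp (-s))) := by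
        unfold sErr; gcongr
    _ = (20 * s ^ 2 * (Sc X * Kc X ^ 2) * Real.exp (-s)) * s⁻¹ := by field_simp; ring
    _ ≤ _ := mul_le_of_le_one_left (by positivity) h

set_option maxHeartbeats 1000000 in
theorem BFF.exists_cov_le (h' : BFF P' X') : ∃ α : ℝ, 0 < α ∧ ∀ C δ : ℝ, 0 < δ → ∃ c : ℝ, 0 < c ∧
    ∀ᶠ s : ℝ in atTop, ∃ ε : ℝ, 0 < ε ∧ ε ≤ 1 ∧ ∀ {V κ : Type} [Fintype V] {z : V → ℝ × ℝ} {w : κ → ℕ → V} {M : ℕ}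
      {θ ρ : ℝ} {d : ℝ × ℝ → ℝ} {Y : Bool × V → Ω → ℝ}
      (_ : GV P Y fun q q' => (if q.1 = q'.1 then 1 else ρ) * Kbf (z q.2) (z q'.2)) (_ : 0 ≤ θ)
      (_ : ∀ a, 2 * ε ≤ (z a).1 ∧ (z a).1 ≤ C * s ^ 12 - 2 * ε ∧ 2 * ε ≤ (z a).2 ∧ (z a).2 ≤ C * s ^ 12 - 2 * ε)
      (_ : ∀ y y' c, Near c y y' → |d y - d y'| ≤ 2 * c) (_ : ∀ j, ∀ i < M, Near ε (z (w j i)) (z (w j (i + 1))))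
      (_ : ∀ j, d (z (w j 0)) ≤ 0) (_ : ∀ j, δ * s ^ 12 ≤ d (z (w j M))) (_ : 0 ≤ ρ)
      (_ : ρ ≤ 1 - (s ^ 12) ^ (-α) / 2),
      P.real {ω | PathOpen w M (fun a => θ < Y (false, a) ω) ∧ PathOpen w M fun a => θ < Y (true, a) ω} ≤
      P.real {ω | PathOpen w M fun a => θ < Y (false, a) ω} * P.real {ω | PathOpen w M fun a => θ < Y (true, a) ω} +
        c * (s ^ 12) ^ (-α) := by
  obtain ⟨η, K, hη0, hη1, hK, hev⟩ := h'.exists_arm_decay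
  refine ⟨η / 36, by positivity, fun C δ hδ => ⟨9 * (18 / δ + K + 6) + 24, by positivity, ?_⟩⟩
  have ev1 := eventually_poly_mul_exp_le (20 * Polynomial.X ^ 2 *
    (4 * (2 * (Polynomial.C C * Polynomial.X ^ 12) ^ 2 + 2) ^ 2 *
    (48 ^ 6 * (1 + (Polynomial.C C * Polynomial.X ^ 12) ^ 2) ^ 6) ^ 2)) (c := 1) (by norm_num)
  filter_upwards [ev1, hev, eventually_ge_atTop 32, eventually_ge_atTop (2 / δ)] with s h1 h2 hs32 hsδ
  simp only [Polynomial.eval_mul, Polynomial.eval_add, Polynomial.eval_pow, Polynomial.eval_C, Polynomial.eval_X,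
    Polynomial.eval_ofNat, Polynomial.eval_one] at h1
  obtain ⟨t, D, ht, hD, hp⟩ := h2
  have hs : 0 < s := by linarith
  have hs1 : 1 ≤ s := by linarith
  have hε1 : Real.exp (-(2 * s)) ≤ 1 := Real.exp_le_one_iff.2 (by linarith)
  refine ⟨Real.exp (-(2 * s)), Real.exp_pos _, hε1, ?_⟩
  intro V κ _ z w M θ ρ d Y hY hθ hz hd hw hw0 hwM hρ0 hρ
  have herr := Sc_mul_sErr_le hs32 h1
  set ε := Real.exp (-(2 * s))
  have hε : 0 < ε := Real.exp_pos _
  set β := (s ^ 12) ^ (η / 36) with hβ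
  have hβ1 : 1 ≤ β := Real.one_le_rpow (one_le_pow₀ hs1) (by positivity)
  have hβi : (s ^ 12) ^ (-(η / 36)) = β⁻¹ := Real.rpow_neg (by positivity) _
  have hβ' : β = s ^ (η / 3) := by
    rw [hβ, ← Real.rpow_natCast, ← Real.rpow_mul hs.le]; congr 1; push_cast; ring
  set m := ⌈2 * β⌉₊
  have hm1 : 2 * β ≤ m := Nat.le_ceil _
  have hm2 : (m : ℝ) ≤ 3 * β := by
    have : (m : ℝ) < 2 * β + 1 := Nat.ceil_lt_add_one (by positivity)
    linarith
  have hm : 2 ≤ m := by exact_mod_cast (show (2 : ℝ) ≤ m by linarith)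
  set U := ⌊δ * s ^ 12⌋₊
  have hs12 : s ≤ s ^ 12 := le_self_pow₀ hs1 (by norm_num)
  have hδs : 2 ≤ δ * s ^ 12 := by
    rw [div_le_iff₀ hδ] at hsδ; nlinarith
  have hU1 : (U : ℝ) ≤ δ * s ^ 12 := Nat.floor_le (by positivity)
  have hU2 : δ * s ^ 12 / 2 ≤ U := by
    have : δ * s ^ 12 < U + 1 := Nat.lt_floor_add_one _
    linarith
  have hU : 0 < U := by exact_mod_cast (show (0 : ℝ) < U by linarith)
  set σ := s ^ (-η)
  have hσ : 0 < σ := Real.rpow_pos_of_pos hs _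
  have hinv : s⁻¹ ≤ σ := by
    rw [← Real.rpow_neg_one]
    exact Real.rpow_le_rpow_of_exponent_le hs1 (by linarith)
  have hi1 : s⁻¹ ≤ 1 := inv_le_one_of_one_le₀ hs1
  have hi0 : 0 < s⁻¹ := inv_pos.2 hs
  have key := finite_cov_le (X := C * s ^ 12) (B := s) (R := s) (r := s ^ 6) (p := K * σ) (τ := σ) (m := m) (U := U)
    (t := t) (D := D) h' hY hε hs hs.le hθ hσ (by positivity) hz hd
    (by nlinarith [pow_le_pow_right₀ hs1 (show 2 ≤ 6 by norm_num)]) ht hD hw hw0 (fun j => hU1.trans (hwM j)) hU hp hm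
    hρ0 (hρ.trans (by
      rw [hβi]
      have : 1 / (m : ℝ) ≤ β⁻¹ / 2 := by
        rw [div_le_iff₀ (by positivity)]
        have := mul_le_mul_of_nonneg_left hm1 (show 0 ≤ β⁻¹ / 2 by positivity)
        field_simp at this ⊢; linarith
      linarith))
  refine key.trans (add_le_add le_rfl ?_)
  have q1 : (4 * s ^ 6 + 4 * ε + 1) / U ≤ 18 / δ * σ := by
    have a1 : 4 * s ^ 6 + 4 * ε + 1 ≤ 9 * s ^ 6 := by
      have : 1 ≤ s ^ 6 := one_le_pow₀ hs1
      linarith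
    calc (4 * s ^ 6 + 4 * ε + 1) / U ≤ 9 * s ^ 6 / (δ * s ^ 12 / 2) := by gcongr
      _ = 18 / δ * (s⁻¹) ^ 6 := by field_simp; ring
      _ ≤ 18 / δ * σ := by
        gcongr
        exact (pow_le_of_le_one hi0.le hi1 (by norm_num)).trans hinv
  have q2 : 4 / s ^ 2 ≤ 4 * σ := by
    rw [div_eq_mul_inv, ← inv_pow]
    gcongr
    exact (pow_le_of_le_one hi0.le hi1 (by norm_num)).trans hinv
  have q3 : Sc (C * s ^ 12) * sErr (C * s ^ 12) s s ε ≤ σ := herr.trans hinv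
  have q4 : σ * β ^ 2 = β⁻¹ := by
    rw [hβ', ← Real.rpow_natCast, ← Real.rpow_mul hs.le, ← Real.rpow_add hs, ← Real.rpow_neg hs.le]
    congr 1; push_cast; ring
  have q5 : σ ≤ β⁻¹ := by rw [← q4]; exact le_mul_of_one_le_right hσ.le (one_le_pow₀ hβ1)
  have q6 : (m : ℝ) ^ 2 ≤ 9 * β ^ 2 := by
    refine (pow_le_pow_left₀ (Nat.cast_nonneg _) hm2 2).trans (le_of_eq (by ring))
  rw [hβi]
  calc _ ≤ (18 / δ * σ + (K * σ + σ + σ + 4 * σ)) * (9 * β ^ 2) + 4 * (2 * σ + 4 * σ) := by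
        rw [mul_assoc 2 (Sc _) (sErr _ _ _ _)]; gcongr
    _ = 9 * (18 / δ + K + 6) * (σ * β ^ 2) + 24 * σ := by ring
    _ ≤ 9 * (18 / δ + K + 6) * β⁻¹ + 24 * β⁻¹ := by rw [q4]; gcongr
    _ = _ := by ring

end Asymptotics

section Approximation
variable {Ω : Type*} [MeasurableSpace Ω] {P : Measure Ω}

lemma tendsto_real_iUnion_iInter [IsProbabilityMeasure P] {E : ℕ → ℕ → Set Ω} (hm : ∀ J M, MeasurableSet (E J M))
    (ha : ∀ J, Antitone (E J)) (hmono : ∀ M, Monotone fun J => E J M) :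
    (∀ J, Tendsto (fun M => P.real (E J M)) atTop (𝓝 (P.real (⋂ M, E J M)))) ∧
      Tendsto (fun J => P.real (⋂ M, E J M)) atTop (𝓝 (P.real (⋃ J, ⋂ M, E J M))) := by
  refine ⟨fun J => ?_, ?_⟩
  · exact (ENNReal.tendsto_toReal (measure_ne_top P _)).comp
      (tendsto_measure_iInter_atTop (fun M => (hm J M).nullMeasurableSet) (ha J) ⟨0, measure_ne_top P _⟩)
  · exact (ENNReal.tendsto_toReal (measure_ne_top P _)).comp
      (tendsto_measure_iUnion_atTop fun J J' h => iInter_mono fun M => hmono M h)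

lemma cov_le_of_approx [IsProbabilityMeasure P] {E F : ℕ → ℕ → Set Ω} (hE : ∀ J M, MeasurableSet (E J M))
    (hF : ∀ J M, MeasurableSet (F J M)) (aE : ∀ J, Antitone (E J)) (aF : ∀ J, Antitone (F J))
    (mE : ∀ M, Monotone fun J => E J M) (mF : ∀ M, Monotone fun J => F J M) {B : ℝ}
    (h : ∀ J, ∀ᶠ M in atTop, P.real (E J M ∩ F J M) ≤ P.real (E J M) * P.real (F J M) + B) :
    P.real ((⋃ J, ⋂ M, E J M) ∩ ⋃ J, ⋂ M, F J M) ≤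
      P.real (⋃ J, ⋂ M, E J M) * P.real (⋃ J, ⋂ M, F J M) + B := by
  obtain ⟨e1, e2⟩ := tendsto_real_iUnion_iInter (P := P) hE aE mE
  obtain ⟨f1, f2⟩ := tendsto_real_iUnion_iInter (P := P) hF aF mF
  obtain ⟨g1, g2⟩ := tendsto_real_iUnion_iInter (P := P) (E := fun J M => E J M ∩ F J M)
    (fun J M => (hE J M).inter (hF J M)) (fun J M M' hM => inter_subset_inter (aE J hM) (aF J hM))
    fun M J J' hJ => inter_subset_inter (mE M hJ) (mF M hJ)
  have hs : (⋃ J, ⋂ M, E J M) ∩ ⋃ J, ⋂ M, F J M = ⋃ J, ⋂ M, (E J M ∩ F J M) := by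
    ext ω
    simp only [mem_inter_iff, mem_iUnion, mem_iInter]
    constructor
    · rintro ⟨⟨J, hJ⟩, J', hJ'⟩
      exact ⟨max J J', fun M => ⟨mE M (le_max_left J J') (hJ M), mF M (le_max_right J J') (hJ' M)⟩⟩
    · rintro ⟨J, hJ⟩
      exact ⟨⟨J, fun M => (hJ M).1⟩, J, fun M => (hJ M).2⟩
  rw [hs]
  exact le_of_tendsto_of_tendsto' g2 ((e2.mul f2).add_const B) fun J =>
    le_of_tendsto_of_tendsto (g1 J) (((e1 J).mul (f1 J)).add_const B) (h J)

variable {E : Type*} [TopologicalSpace E]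

/-- One of the first `J` paths stays above `1 / (J + 1)` at dyadic times of level `M`. -/
def DyadicOpen (g : ℕ → ℝ → E) (J M : ℕ) (u : E → ℝ) : Prop :=
  ∃ j < J, ∀ i : ℕ, i ≤ 2 ^ M → 1 / ((J : ℝ) + 1) < u (g j (i / 2 ^ M))

lemma DyadicOpen.mono {g : ℕ → ℝ → E} {J J' M : ℕ} {u : E → ℝ} (h : DyadicOpen g J M u) (hJ : J ≤ J') :
    DyadicOpen g J' M u := by
  obtain ⟨j, hj, h⟩ := h
  refine ⟨j, hj.trans_le hJ, fun i hi => lt_of_le_of_lt ?_ (h i hi)⟩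
  gcongr

lemma DyadicOpen.anti {g : ℕ → ℝ → E} {J M M' : ℕ} {u : E → ℝ} (h : DyadicOpen g J M' u) (hM : M ≤ M') :
    DyadicOpen g J M u := by
  obtain ⟨j, hj, h⟩ := h
  refine ⟨j, hj, fun i hi => ?_⟩
  obtain ⟨k, rfl⟩ := Nat.exists_eq_add_of_le hM
  have := h (i * 2 ^ k) (by rw [pow_add]; gcongr)
  convert this using 3
  rw [pow_add]; push_cast; field_simp

lemma dyadicOpen_iff {g : ℕ → ℝ → E} (hg : ∀ j, Continuous (g j)) {u : E → ℝ} (hu : Continuous u) :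
    (∃ J, ∀ M, DyadicOpen g J M u) ↔ ∃ j, ∀ r ∈ Icc (0 : ℝ) 1, 0 < u (g j r) := by
  constructor
  · rintro ⟨J, hJ⟩
    have h1 : ∃ j < J, ∀ M, ∀ i : ℕ, i ≤ 2 ^ M → 1 / ((J : ℝ) + 1) < u (g j (i / 2 ^ M)) := by
      by_contra! hc
      choose! M hM using hc
      obtain ⟨j, hj, h⟩ := hJ ((Finset.range J).sup M)
      obtain ⟨i, hi, hlt⟩ := hM j hj
      obtain ⟨k, hk⟩ := Nat.exists_eq_add_of_le (Finset.le_sup (f := M) (Finset.mem_range.2 hj))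
      have := h (i * 2 ^ k) (by rw [hk, pow_add]; gcongr)
      refine absurd this (not_lt.2 ?_)
      convert hlt using 3
      rw [hk]; push_cast; rw [pow_add]; field_simp
    obtain ⟨j, -, h⟩ := h1
    refine ⟨j, fun r hr => ?_⟩
    have h2 : Tendsto (fun M : ℕ => (⌊r * 2 ^ M⌋₊ : ℝ) / 2 ^ M) atTop (𝓝 r) :=
      (tendsto_nat_floor_mul_div_atTop (R := ℝ) hr.1).comp (tendsto_pow_atTop_atTop_of_one_lt (by norm_num : (1 : ℝ) < 2))
    have h3 := ((hu.comp (hg j)).tendsto r).comp h2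
    have h4 : 1 / ((J : ℝ) + 1) ≤ u (g j r) := ge_of_tendsto' h3 fun M => by
      refine (h M ⌊r * 2 ^ M⌋₊ (Nat.floor_le_of_le ?_)).le
      push_cast
      exact mul_le_of_le_one_left (by positivity) hr.2
    exact lt_of_lt_of_le (by positivity) h4
  · rintro ⟨j, hj⟩
    obtain ⟨r, hr, hmin⟩ := isCompact_Icc.exists_isMinOn (nonempty_Icc.2 zero_le_one) (hu.comp (hg j)).continuousOn
    obtain ⟨k, hk⟩ := exists_nat_one_div_lt (hj r hr)
    refine ⟨max (j + 1) k, fun M => ⟨j, by omega, fun i hi => ?_⟩⟩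
    have hi' : (i : ℝ) / 2 ^ M ∈ Icc (0 : ℝ) 1 :=
      ⟨div_nonneg (Nat.cast_nonneg i) (pow_nonneg zero_le_two M), div_le_one_of_le₀ (by exact_mod_cast hi) (pow_nonneg zero_le_two M)⟩
    refine lt_of_le_of_lt ?_ (hk.trans_le (hmin hi'))
    gcongr
    exact le_max_right _ _

end Approximation

section Paths

/-- The continuous paths in `K` from `A` to `B`. -/
def pathSet (A B K : Set Plane) : Set C(unitInterval, Plane) := {γ | γ 0 ∈ A ∧ γ 1 ∈ B ∧ ∀ r, γ r ∈ K}

/-- A sequence of paths that suffices to detect crossings. -/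
lemma exists_path_seq {A B K : Set Plane} (h : (pathSet A B K).Nonempty) : ∃ g : ℕ → ℝ → Plane, (∀ j, Continuous (g j)) ∧
    (∀ j, g j 0 ∈ A) ∧ (∀ j, g j 1 ∈ B) ∧ (∀ j r, g j r ∈ K) ∧ ∀ u : Plane → ℝ, Continuous u →
      ((∃ γ : ℝ → Plane, ContinuousOn γ (Icc 0 1) ∧ γ 0 ∈ A ∧ γ 1 ∈ B ∧ ∀ r ∈ Icc (0 : ℝ) 1, γ r ∈ K ∧ 0 < u (γ r)) ↔
        ∃ j, ∀ r ∈ Icc (0 : ℝ) 1, 0 < u (g j r)) := by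
  have : Nonempty (pathSet A B K) := h.to_subtype
  set Γ : ℕ → pathSet A B K := TopologicalSpace.denseSeq (pathSet A B K)
  refine ⟨fun j r => (Γ j : C(unitInterval, Plane)) (projIcc 0 1 zero_le_one r), fun j => by fun_prop, fun j => ?_, fun j => ?_,
    fun j r => (Γ j).2.2.2 _, fun u hu => ⟨?_, ?_⟩⟩
  · simpa using (Γ j).2.1
  · simpa using (Γ j).2.2.1
  · rintro ⟨γ, hγ, h0, h1, hK⟩
    let γ' : pathSet A B K := ⟨⟨fun r => γ r, continuousOn_iff_continuous_domRestrict.1 hγ⟩, h0, h1,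
      fun r => (hK r r.2).1⟩
    have ho : IsOpen {δ : pathSet A B K | MapsTo (δ : C(unitInterval, Plane)) univ {x | 0 < u x}} :=
      (ContinuousMap.isOpen_setOfPred_mapsTo isCompact_univ (isOpen_lt continuous_const hu)).preimage continuous_subtype_val
    obtain ⟨_, hδ, j, rfl⟩ := (TopologicalSpace.denseRange_denseSeq (pathSet A B K)).inter_open_nonempty _ ho
      ⟨γ', fun r _ => (hK r r.2).2⟩
    exact ⟨j, fun r _ => hδ (mem_univ _)⟩
  · rintro ⟨j, hj⟩
    refine ⟨_, Continuous.continuousOn (by fun_prop), ?_, ?_, fun r hr => ⟨(Γ j).2.2.2 _, hj r hr⟩⟩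
    · simpa using (Γ j).2.1
    · simpa using (Γ j).2.2.1

end Paths

section Bridge
variable {Ω : Type*} [MeasurableSpace Ω] {P : Measure Ω} [IsProbabilityMeasure P] {f : Ω → ℝ → Plane → ℝ}

lemma measurable_eval (hf : IsDynBargmannFock P f) (t : ℝ) (x : Plane) : Measurable fun ω => f ω t x :=
  hf.measurable.comp (measurable_id.prodMk (measurable_const (a := (t, x))))

lemma gv_field (hf : IsDynBargmannFock P f) {A : Type*} [Fintype A] {ts : A → ℝ} (hts : ∀ a, 0 ≤ ts a) (xs : A → Plane) :
    GV P (fun a ω => f ω (ts a) (xs a)) fun a b => Real.exp (-|ts a - ts b|) * Real.exp (-‖xs a - xs b‖ ^ 2 / 2) := by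
  have h := GV.of_gaussian (P := P) (X := fun a ω => f ω (ts a) (xs a)) (fun a => measurable_eval hf _ _) fun c => by
    let e := (Fintype.equivFin A).symm
    obtain ⟨v, hv⟩ := hf.gaussian _ (fun i => c (e i)) (fun i => ts (e i)) (fun i => xs (e i)) fun i => hts _
    refine ⟨v, ?_⟩
    rw [← hv]
    congr 1
    ext ω
    exact (e.sum_comp fun a => c a * f ω (ts a) (xs a)).symm
  simpa only [hf.covariance _ _ (hts _) (hts _)] using h

/-- Coordinates in the plane, shifted by `a`. -/
def coords (a : ℝ) (x : Plane) : ℝ × ℝ := (x 0 + a, x 1 + a)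

lemma Kbf_coords (a : ℝ) (x y : Plane) : Kbf (coords a x) (coords a y) = Real.exp (-‖x - y‖ ^ 2 / 2) := by
  rw [Kbf, ← Real.exp_add, EuclideanSpace.real_norm_sq_eq, Fin.sum_univ_two]
  congr 1
  simp only [coords, PiLp.sub_apply]
  ring

lemma bff_field (hf : IsDynBargmannFock P f) : BFF P fun z ω => f ω 0 !₂[z.1, z.2] := fun A _ z => by
  have h := gv_field hf (fun _ : A => le_refl (0 : ℝ)) fun a => !₂[(z a).1, (z a).2]
  simp only [← Kbf_coords 0] at h
  simpa [coords] using h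

lemma abs_infDist_sub_le {A : Set Plane} {a c : ℝ} {y y' : ℝ × ℝ} (h : Near c y y') :
    |Metric.infDist !₂[y.1 - a, y.2 - a] A - Metric.infDist !₂[y'.1 - a, y'.2 - a] A| ≤ 2 * c := by
  have hc : 0 ≤ c := (abs_nonneg _).trans h.1
  refine ((Metric.lipschitz_infDist_pt A).dist_le_mul _ _).trans ?_
  rw [NNReal.coe_one, one_mul, EuclideanSpace.dist_eq, Fin.sum_univ_two]
  refine Real.sqrt_le_iff.2 ⟨by positivity, ?_⟩
  simp only [Real.dist_eq, Matrix.cons_val_zero, Matrix.cons_val_one, sub_sub_sub_cancel_right]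
  nlinarith [h.1, h.2, abs_nonneg (y.1 - y'.1), abs_nonneg (y.2 - y'.2)]

/-- Discretised path events at correlation at most `r` have covariance at most `b`. -/
def PathCovBound (P : Measure Ω) (ε X L r b : ℝ) : Prop :=
  ∀ {V κ : Type} [Fintype V] {z : V → ℝ × ℝ} {w : κ → ℕ → V} {M : ℕ} {θ ρ : ℝ} {d : ℝ × ℝ → ℝ} {Y : Bool × V → Ω → ℝ}
    (_ : GV P Y fun q q' => (if q.1 = q'.1 then 1 else ρ) * Kbf (z q.2) (z q'.2)) (_ : 0 ≤ θ)
    (_ : ∀ a, 2 * ε ≤ (z a).1 ∧ (z a).1 ≤ X - 2 * ε ∧ 2 * ε ≤ (z a).2 ∧ (z a).2 ≤ X - 2 * ε)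
    (_ : ∀ y y' c, Near c y y' → |d y - d y'| ≤ 2 * c) (_ : ∀ j, ∀ i < M, Near ε (z (w j i)) (z (w j (i + 1))))
    (_ : ∀ j, d (z (w j 0)) ≤ 0) (_ : ∀ j, L ≤ d (z (w j M))) (_ : 0 ≤ ρ) (_ : ρ ≤ r),
    P.real {ω | PathOpen w M (fun a => θ < Y (false, a) ω) ∧ PathOpen w M fun a => θ < Y (true, a) ω} ≤
    P.real {ω | PathOpen w M fun a => θ < Y (false, a) ω} * P.real {ω | PathOpen w M fun a => θ < Y (true, a) ω} + b

lemma near_of_dist_le {a ε : ℝ} {x y : Plane} (h : dist x y ≤ ε) : Near ε (coords a x) (coords a y) := by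
  have (i : Fin 2) : |x i - y i| ≤ ε := by
    refine le_trans ?_ h
    rw [dist_eq_norm]
    exact PiLp.norm_apply_le (x - y) i
  simpa [Near, coords] using ⟨this 0, this 1⟩

lemma eventually_near {g : ℕ → ℝ → Plane} (hg : ∀ j, Continuous (g j)) {ε : ℝ} (hε : 0 < ε) (a : ℝ) (J : ℕ) :
    ∀ᶠ M : ℕ in atTop, ∀ j : Fin J, ∀ i < 2 ^ M,
      Near ε (coords a (g j ((i : ℕ) / 2 ^ M))) (coords a (g j ((i + 1 : ℕ) / 2 ^ M))) := by
  refine eventually_all.2 fun j => ?_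
  obtain ⟨δ, hδ, h⟩ := Metric.uniformContinuousOn_iff.1
    ((isCompact_Icc (a := (0 : ℝ)) (b := 1)).uniformContinuousOn_of_continuous (hg j).continuousOn) ε hε
  filter_upwards [(tendsto_pow_atTop_atTop_of_one_lt (one_lt_two : (1 : ℝ) < 2)).eventually_gt_atTop δ⁻¹] with M hM i hi
  have h2 : (0 : ℝ) < 2 ^ M := by positivity
  have h3 : ((i + 1 : ℕ) : ℝ) ≤ 2 ^ M := by exact_mod_cast hi
  have hI (k : ℕ) (hk : (k : ℝ) ≤ 2 ^ M) : (k : ℝ) / 2 ^ M ∈ Icc (0 : ℝ) 1 := ⟨by positivity, div_le_one_of_le₀ hk h2.le⟩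
  refine near_of_dist_le (h _ (hI _ (by push_cast at h3; linarith)) _ (hI _ h3) ?_).le
  rw [Real.dist_eq, ← sub_div, abs_div, abs_of_pos h2]
  push_cast
  rw [sub_add_cancel_left, abs_neg, abs_one, one_div]
  exact inv_lt_of_inv_lt₀ hδ hM

lemma dyadicOpen_iff_pathOpen {g : ℕ → ℝ → Plane} {J M : ℕ} {u : Plane → ℝ} :
    DyadicOpen g J M u ↔ PathOpen (V := Fin J × Fin (2 ^ M + 1))
      (fun j i => (j, (⟨min i (2 ^ M), by omega⟩ : Fin (2 ^ M + 1)))) (2 ^ M)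
      fun a => 1 / ((J : ℝ) + 1) < u (g a.1 ((a.2 : ℕ) / 2 ^ M)) := by
  constructor
  · rintro ⟨j, hj, h⟩
    exact ⟨⟨j, hj⟩, fun i hi => by simpa [min_eq_left hi] using h i hi⟩
  · rintro ⟨j, h⟩
    exact ⟨j, j.2, fun i hi => by simpa [min_eq_left hi] using h i hi⟩

lemma PathCovBound.dyadic {ε X L r b : ℝ} (H : PathCovBound P ε X L r b) (hf : IsDynBargmannFock P f) (hε : 0 < ε)
    (hε1 : ε ≤ 1) {g : ℕ → ℝ → Plane} (hg : ∀ j, Continuous (g j)) {R : ℝ} (hR : ∀ j r i, |g j r i| ≤ R)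
    (hX : 2 * R + 4 ≤ X) {A : Set Plane} (h0 : ∀ j, g j 0 ∈ A) (h1 : ∀ j, L ≤ Metric.infDist (g j 1) A) {t : ℝ}
    (ht : 0 ≤ t) (hr : Real.exp (-t) ≤ r) (J : ℕ) :
    ∀ᶠ M in atTop, P.real ({ω | DyadicOpen g J M (f ω 0)} ∩ {ω | DyadicOpen g J M (f ω t)}) ≤
      P.real {ω | DyadicOpen g J M (f ω 0)} * P.real {ω | DyadicOpen g J M (f ω t)} + b := by
  filter_upwards [eventually_near hg hε (R + 2) J] with M hM
  let z : Fin J × Fin (2 ^ M + 1) → ℝ × ℝ := fun a => coords (R + 2) (g a.1 ((a.2 : ℕ) / 2 ^ M))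
  have hY : GV P (fun (q : Bool × (Fin J × Fin (2 ^ M + 1))) ω => f ω (if q.1 then t else 0) (g q.2.1 ((q.2.2 : ℕ) / 2 ^ M)))
      fun q q' => (if q.1 = q'.1 then 1 else Real.exp (-t)) * Kbf (z q.2) (z q'.2) := by
    convert gv_field hf (ts := fun q : Bool × (Fin J × Fin (2 ^ M + 1)) => if q.1 then t else 0)
      (fun q => by split_ifs <;> simp [ht]) fun q => g q.2.1 ((q.2.2 : ℕ) / 2 ^ M) using 3 with q q'
    obtain ⟨b, a⟩ := q
    obtain ⟨b', a'⟩ := q'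
    rw [Kbf_coords]
    congr 1
    cases b <;> cases b' <;> simp [abs_of_nonneg ht]
  have key := H hY (θ := 1 / ((J : ℝ) + 1)) (M := 2 ^ M)
    (w := fun j i => (j, (⟨min i (2 ^ M), by omega⟩ : Fin (2 ^ M + 1))))
    (d := fun y => Metric.infDist !₂[y.1 - (R + 2), y.2 - (R + 2)] A) (by positivity)
    (fun a => by
      have b0 := abs_le.1 (hR a.1 ((a.2 : ℕ) / 2 ^ M) 0)
      have b1 := abs_le.1 (hR a.1 ((a.2 : ℕ) / 2 ^ M) 1)
      refine ⟨?_, ?_, ?_, ?_⟩ <;> simp only [z, coords] <;> linarith)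
    (fun y y' c h => abs_infDist_sub_le h)
    (fun j i hi => by simpa [z, min_eq_left hi.le, min_eq_left (Nat.succ_le_of_lt hi)] using hM j i hi)
    (fun j => by
      have : (!₂[g j 0 0, g j 0 1] : Plane) = g j 0 := by ext i; fin_cases i <;> rfl
      simp [z, coords, this, Metric.infDist_zero_of_mem (h0 j)])
    (fun j => by
      have : (!₂[g j 1 0, g j 1 1] : Plane) = g j 1 := by ext i; fin_cases i <;> rfl
      simpa [z, coords, this] using h1 j)
    (Real.exp_pos _).le hr
  simp only [dyadicOpen_iff_pathOpen]
  exact key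

lemma measurableSet_dyadicOpen (hf : IsDynBargmannFock P f) (g : ℕ → ℝ → Plane) (J M : ℕ) (t : ℝ) :
    MeasurableSet {ω | DyadicOpen g J M (f ω t)} := by
  have : {ω | DyadicOpen g J M (f ω t)} = ⋃ j ∈ Iio J, ⋂ i ∈ Iic (2 ^ M), {ω | 1 / ((J : ℝ) + 1) < f ω t (g j ((i : ℕ) / 2 ^ M))} := by
    ext ω; simp [DyadicOpen]
  rw [this]
  exact MeasurableSet.biUnion (to_countable _) fun j _ => MeasurableSet.biInter (to_countable _) fun i _ =>
    measurableSet_lt measurable_const (measurable_eval hf _ _)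

/-- The crossing event of `K` from `A` to `B`. -/
def CrossFrom (A B K : Set Plane) (u : Plane → ℝ) : Prop :=
  ∃ γ : ℝ → Plane, ContinuousOn γ (Icc 0 1) ∧ γ 0 ∈ A ∧ γ 1 ∈ B ∧ ∀ r ∈ Icc (0 : ℝ) 1, γ r ∈ K ∧ 0 < u (γ r)

lemma PathCovBound.crossFrom {ε X L r b : ℝ} (H : PathCovBound P ε X L r b) (hf : IsDynBargmannFock P f) (hε : 0 < ε)
    (hε1 : ε ≤ 1) {A B K : Set Plane} {R : ℝ} (hR : ∀ x ∈ K, ∀ i, |x i| ≤ R) (hX : 2 * R + 4 ≤ X)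
    (hL : ∀ x ∈ B, L ≤ Metric.infDist x A) {t : ℝ} (ht : 0 ≤ t) (hr : Real.exp (-t) ≤ r) (hb : 0 ≤ b) :
    P.real ({ω | CrossFrom A B K (f ω 0)} ∩ {ω | CrossFrom A B K (f ω t)}) ≤
      P.real {ω | CrossFrom A B K (f ω 0)} * P.real {ω | CrossFrom A B K (f ω t)} + b := by
  by_cases hne : (pathSet A B K).Nonempty
  · obtain ⟨g, hg, hA, hB, hK, hiff⟩ := exists_path_seq hne
    have hcont (s : ℝ) (hs : 0 ≤ s) : ∀ᵐ ω ∂P, Continuous (f ω s) := by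
      filter_upwards [hf.continuous] with ω hω
      exact continuousOn_univ.1 (hω.comp (f := fun x : Plane => (s, x)) (by fun_prop) fun x _ => ⟨hs, mem_univ _⟩)
    have hae (s : ℝ) (hs : 0 ≤ s) :
        ({ω | CrossFrom A B K (f ω s)} : Set Ω) =ᵐ[P] ⋃ J, ⋂ M, {ω | DyadicOpen g J M (f ω s)} := by
      filter_upwards [hcont s hs] with ω hω
      have h : ω ∈ ⋃ J, ⋂ M, {ω | DyadicOpen g J M (f ω s)} ↔ ∃ J, ∀ M, DyadicOpen g J M (f ω s) := by simp
      exact propext (((hiff _ hω).trans (dyadicOpen_iff hg hω).symm).trans h.symm)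
    rw [measureReal_congr ((hae 0 le_rfl).inter (hae t ht)), measureReal_congr (hae 0 le_rfl), measureReal_congr (hae t ht)]
    exact cov_le_of_approx (fun J M => measurableSet_dyadicOpen hf g J M 0) (fun J M => measurableSet_dyadicOpen hf g J M t)
      (fun J M M' h ω hω => DyadicOpen.anti hω h) (fun J M M' h ω hω => DyadicOpen.anti hω h)
      (fun M J J' h ω hω => DyadicOpen.mono hω h) (fun M J J' h ω hω => DyadicOpen.mono hω h)
      (H.dyadic hf hε hε1 hg (fun j r => hR _ (hK j r)) hX hA (fun j => hL _ (hB j)) ht hr)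
  · have (u : Plane → ℝ) : ¬ CrossFrom A B K u := fun ⟨γ, hγ, h0, h1, hK⟩ => hne
      ⟨⟨fun r => γ r, continuousOn_iff_continuous_domRestrict.1 hγ⟩, h0, h1, fun r => (hK r r.2).1⟩
    simp [this, hb]

end Bridge

section Main
variable {Ω : Type*} [MeasurableSpace Ω] {P : Measure Ω} [IsProbabilityMeasure P] {f : Ω → ℝ → Plane → ℝ}

lemma exp_neg_le_of_le {x t : ℝ} (hx : x ≤ 1) (ht : x ≤ t) (hx0 : 0 ≤ x) : Real.exp (-t) ≤ 1 - x / 2 := by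
  refine (Real.exp_le_exp.2 (neg_le_neg ht)).trans ?_
  rw [Real.exp_neg, inv_le_iff_one_le_mul₀ (Real.exp_pos x)]
  nlinarith [Real.add_one_le_exp x]

lemma exists_pos_le_dist (Q : Quad) : ∃ δ : ℝ, 0 < δ ∧ Q.eta.Nonempty ∧ ∀ x ∈ Q.eta', ∀ y ∈ Q.eta, δ ≤ dist x y := by
  obtain ⟨γ, hγ, -, -, -, -, ⟨a, b, hab, h⟩, -⟩ := Q.boundary
  have hc : IsCompact Q.eta := h ▸ isCompact_Icc.image hγ
  obtain ⟨r, hr, hlt⟩ := Metric.exists_pos_forall_lt_edist hc Q.eta'_closed Q.disjoint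
  refine ⟨r, hr, h ▸ (nonempty_Icc.2 hab).image γ, fun x hx y hy => ?_⟩
  have := (hlt y hy x hx).le
  rw [edist_comm, edist_nndist] at this
  exact_mod_cast this

lemma crossedScaled_iff (Q : Quad) (s : ℝ) (u : Plane → ℝ) :
    CrossedScaled Q s 0 u ↔ CrossFrom (s • Q.eta) (s • Q.eta') (s • Q.carrier) u := by
  simp only [CrossedScaled, CrossFrom, neg_zero]

lemma covIndicator_le_one (A B : Set Ω) : covIndicator P A B ≤ 1 := by
  have h1 : P.real (A ∩ B) ≤ 1 := measureReal_le_one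
  have h2 : 0 ≤ P.real A * P.real B := by positivity
  change P.real (A ∩ B) - P.real A * P.real B ≤ 1
  linarith

lemma exists_covIndicator_crossed_le (hf : IsDynBargmannFock P f) : ∃ α > (0 : ℝ), ∀ Q : Quad, ∃ c > (0 : ℝ), ∀ n : ℕ,
    1 ≤ n → ∀ t : ℝ, (n : ℝ) ^ (-α) ≤ t →
      covIndicator P {ω | CrossedScaled Q (n : ℝ) 0 (f ω 0)} {ω | CrossedScaled Q (n : ℝ) 0 (f ω t)} ≤
        c * (n : ℝ) ^ (-α) := by
  obtain ⟨α, hα, h⟩ := (bff_field hf).exists_cov_le (Ω := Ω) (P := P)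
  refine ⟨α, hα, fun Q => ?_⟩
  obtain ⟨δ, hδ, hne, hdist⟩ := exists_pos_le_dist Q
  obtain ⟨R, hR, hQ⟩ := Q.compact.isBounded.exists_pos_norm_le
  obtain ⟨c, hc, hev⟩ := h (2 * R + 4) δ hδ
  have htend : Tendsto (fun n : ℕ => (n : ℝ) ^ (1 / 12 : ℝ)) atTop atTop :=
    (tendsto_rpow_atTop (by norm_num)).comp tendsto_natCast_atTop_atTop
  obtain ⟨N, hN⟩ := eventually_atTop.1 (htend.eventually hev)
  refine ⟨max c ((N : ℝ) ^ α), lt_max_of_lt_left hc, fun n hn t ht => ?_⟩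
  have hn0 : (0 : ℝ) < n := by exact_mod_cast hn
  have hn1 : (1 : ℝ) ≤ n := by exact_mod_cast hn
  have hp : 0 < (n : ℝ) ^ (-α) := Real.rpow_pos_of_pos hn0 _
  obtain hnN | hnN := lt_or_ge n N
  · refine (covIndicator_le_one _ _).trans ?_
    have : (n : ℝ) ^ α ≤ max c ((N : ℝ) ^ α) := le_max_of_le_right (by gcongr)
    calc (1 : ℝ) = (n : ℝ) ^ α * (n : ℝ) ^ (-α) := by rw [← Real.rpow_add hn0, add_neg_cancel, Real.rpow_zero]
      _ ≤ _ := by gcongr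
  have hs : ((n : ℝ) ^ (1 / 12 : ℝ)) ^ 12 = n := by
    rw [← Real.rpow_natCast, ← Real.rpow_mul hn0.le]; norm_num
  obtain ⟨ε, hε, hε1, H⟩ := hN n hnN
  have H' : PathCovBound P ε ((2 * R + 4) * n) (δ * n) (1 - (n : ℝ) ^ (-α) / 2) (c * (n : ℝ) ^ (-α)) := by
    intro V κ _ z w M θ ρ d Y a1 a2 a3 a4 a5 a6 a7 a8 a9
    have := H a1 a2 (by rwa [hs]) a4 a5 a6 (by rwa [hs]) a8 (by rwa [hs])
    rwa [hs] at this
  have key := H'.crossFrom hf hε hε1 (A := (n : ℝ) • Q.eta) (B := (n : ℝ) • Q.eta') (K := (n : ℝ) • Q.carrier) (R := n * R)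
    (by
      rintro _ ⟨x, hx, rfl⟩ i
      refine (PiLp.norm_apply_le ((n : ℝ) • x) i).trans ?_
      rw [norm_smul, Real.norm_natCast]
      gcongr
      exact hQ x hx)
    (by nlinarith)
    (by
      rintro _ ⟨x, hx, rfl⟩
      refine (Metric.le_infDist hne.smul_set).2 ?_
      rintro _ ⟨y, hy, rfl⟩
      change δ * n ≤ dist ((n : ℝ) • x) ((n : ℝ) • y)
      rw [dist_smul₀, Real.norm_natCast, mul_comm]
      gcongr
      exact hdist x hx y hy)
    (hp.le.trans ht) (exp_neg_le_of_le (Real.rpow_le_one_of_one_le_of_nonpos hn1 (by linarith)) ht hp.le) (by positivity)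
  simp only [crossedScaled_iff]
  have hle : c * (n : ℝ) ^ (-α) ≤ max c ((N : ℝ) ^ α) * (n : ℝ) ^ (-α) := by gcongr; exact le_max_left _ _
  change P.real _ - P.real _ * P.real _ ≤ _
  linarith

end Main

end BF

/-- **Noise sensitivity of Bargmann–Fock percolation.** There exists `α > 0` such that for
every quad `Q` there is `c = c(Q) > 0` with: for every `n ≥ 1` and every `t ≥ n^{-α}`,
`Cov(1_{f(0,·) ∈ Cross_0(nQ)}, 1_{f(t,·) ∈ Cross_0(nQ)}) ≤ c n^{-α}`. -/
theorem bargmannFock_noise_sensitive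
    {Ω : Type*} [MeasurableSpace Ω] (P : Measure Ω) [IsProbabilityMeasure P]
    (f : Ω → ℝ → Plane → ℝ) (hf : IsDynBargmannFock P f) :
    ∃ α > (0 : ℝ), ∀ Q : Quad, ∃ c > (0 : ℝ), ∀ n : ℕ, 1 ≤ n → ∀ t : ℝ,
      (n : ℝ) ^ (-α) ≤ t →
      covIndicator P {ω | CrossedScaled Q (n : ℝ) 0 (f ω 0)}
          {ω | CrossedScaled Q (n : ℝ) 0 (f ω t)}
        ≤ c * (n : ℝ) ^ (-α) := by
  exact BF.exists_covIndicator_crossed_le hf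

end
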